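/- Fix an integer k ≥ 2 and assume 0 < y < ∞. Then the random variables tr(ρ_n^k) − Σ_{j=0}^{k−1} (p·(p/n)^j/(j+1))·C(k,j)·C(k−1,j) converge in distribution, as n → ∞, to the Gaussian law N(μ_{x^k}, σ_{x^k}²), where μ_{x^k} = (1/4)[(1−√y)^{2k} + (1+√y)^{2k}] − (1/2) Σ_{j=0}^k C(k,j)² y^{k−j} − (2/y) Σ_{j=0}^k C(k,j)(y−1)^j C(2k−j, k−2) + Σ_{j=0}^k C(k,j)(y−1)^j C(2k−j−1, k−2), and σ_{x^k}² = 2 Σ_{j1=0}^{k−1} Σ_{j2=0}^{k} C(k,j1) C(k,j2) (y−1)^{j1+j2} Σ_{l=1}^{k−j1} l·C(2k−1−(j1+l), k−1)·C(2k−1−j2+l, k−1) − (2/y) Σ_{j1=0}^{k} Σ_{j2=0}^{k} C(k,j1) C(k,j2) (y−1)^{j1+j2} C(2k−j1, k−1) C(2k−j2, k−1). Here C(m,r) denotes the binomial coefficient. -/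

import Mathlib

open MeasureTheory Finset

/-- The (finite) sample space of `p`-tuples of permutations of `{1,…,n}` carries the
discrete σ-algebra. -/
instance permVecMeasurableSpace (n p : ℕ) :
    MeasurableSpace (Fin p → Equiv.Perm (Fin n)) := ⊤

/-- The uniform probability measure on `p`-tuples of permutations of `{1,…,n}`: the joint
law of `p` independent uniform random permutations `σ₁,…,σ_p`, i.e. the law of the
columnwise ranks of an `n×p` data matrix with independent entries having continuous
distributions. -/
noncomputable def permVecUniform (n p : ℕ) : Measure (Fin p → Equiv.Perm (Fin n)) :=
  (PMF.uniformOfFintype (Fin p → Equiv.Perm (Fin n))).toMeasure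

/-- Spearman's rank correlation matrix
`ρₙ = (12/(n(n²−1))) Σ_{k=1}^n (r_k − (n+1)/2·1_p)(r_k − (n+1)/2·1_p)ᵀ ∈ ℝ^{p×p}`, built
from the rank matrix `r_{kj} = σⱼ(k)`; the rank `σⱼ(k) ∈ {1,…,n}` is realized as
`(ω j k) + 1` with `ω j k : Fin n`. -/
noncomputable def spearmanRho (n p : ℕ) (ω : Fin p → Equiv.Perm (Fin n)) :
    Matrix (Fin p) (Fin p) ℝ :=
  (12 / ((n : ℝ) * ((n : ℝ) ^ 2 - 1))) •
    ∑ k : Fin n, Matrix.vecMulVec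
      (fun j => ((ω j k : ℕ) : ℝ) + 1 - ((n : ℝ) + 1) / 2)
      (fun j => ((ω j k : ℕ) : ℝ) + 1 - ((n : ℝ) + 1) / 2)

open MeasureTheory Finset

namespace Spear
open Polynomial

/-! ### Power series algebra: the Marchenko–Pastur generating functions -/

/-- coefficients of the series `q` solving `q = u (1+q)(1+tq)`. -/
noncomputable def qc : ℕ → ℝ[X]
  | 0 => 0
  | n + 1 => (if n = 0 then 1 else 0) + (1 + X) * qc n
      + X * ∑ i : Fin (n + 1), qc i.1 * qc (n - i.1)
  decreasing_by all_goals omega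

noncomputable abbrev qs : PowerSeries ℝ[X] := PowerSeries.mk qc
/-- the variable `u` -/
noncomputable abbrev us : PowerSeries ℝ[X] := PowerSeries.X
/-- the constant series `t` -/
noncomputable abbrev ts : PowerSeries ℝ[X] := PowerSeries.C X

lemma qs_eq : qs = us * ((1 + qs) * (1 + ts * qs)) := by
  ext1 n
  rcases n with _ | n
  · simp [qc]
  · rw [PowerSeries.coeff_succ_X_mul]
    have : (1 + qs) * (1 + ts * qs) = 1 + qs + ts * qs + ts * (qs * qs) := by ring
    rw [this]
    simp only [map_add, PowerSeries.coeff_C_mul, PowerSeries.coeff_mk, PowerSeries.coeff_one]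
    rw [PowerSeries.coeff_mul]
    simp only [PowerSeries.coeff_mk]
    rw [qc, Finset.Nat.sum_antidiagonal_eq_sum_range_succ (fun i j => qc i * qc j),
      Finset.sum_range]
    ring

/-- derivative in `t`, coefficientwise -/
noncomputable def dT (f : PowerSeries ℝ[X]) : PowerSeries ℝ[X] :=
  PowerSeries.mk fun n => derivative (PowerSeries.coeff n f)

/-- the Euler operator `u d/du` -/
noncomputable def dU {R : Type*} [CommRing R] (f : PowerSeries R) : PowerSeries R :=
  PowerSeries.mk fun n => (n : R) * PowerSeries.coeff n f

@[simp] lemma coeff_dT (f : PowerSeries ℝ[X]) (n : ℕ) :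
    PowerSeries.coeff n (dT f) = derivative (PowerSeries.coeff n f) := by simp [dT]
@[simp] lemma coeff_dU {R : Type*} [CommRing R] (f : PowerSeries R) (n : ℕ) :
    PowerSeries.coeff n (dU f) = (n : R) * PowerSeries.coeff n f := by simp [dU]

lemma dT_add (f g : PowerSeries ℝ[X]) : dT (f + g) = dT f + dT g := by ext1 n; simp
lemma dT_sub (f g : PowerSeries ℝ[X]) : dT (f - g) = dT f - dT g := by ext1 n; simp
lemma dT_mul (f g : PowerSeries ℝ[X]) : dT (f * g) = dT f * g + f * dT g := by
  ext1 n
  simp [PowerSeries.coeff_mul, derivative_sum, derivative_mul, Finset.sum_add_distrib]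
lemma dT_zero : dT 0 = 0 := by ext1 n; simp
lemma dT_one : dT 1 = 0 := by
  ext1 n; simp only [coeff_dT, PowerSeries.coeff_one]; split_ifs <;> simp
lemma dT_us : dT us = 0 := by
  ext1 n; simp only [coeff_dT, PowerSeries.coeff_X]; split_ifs <;> simp
lemma dT_ts : dT ts = 1 := by
  ext1 n; simp only [coeff_dT, PowerSeries.coeff_C, PowerSeries.coeff_one]; split_ifs <;> simp

section
variable {R : Type*} [CommRing R]
lemma dU_add (f g : PowerSeries R) : dU (f + g) = dU f + dU g := by ext1 n; simp [mul_add]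
lemma dU_sub (f g : PowerSeries R) : dU (f - g) = dU f - dU g := by ext1 n; simp [mul_sub]
lemma dU_mul (f g : PowerSeries R) : dU (f * g) = dU f * g + f * dU g := by
  ext1 n
  simp only [PowerSeries.coeff_mul, coeff_dU, map_add, Finset.mul_sum, ← Finset.sum_add_distrib]
  refine Finset.sum_congr rfl fun x hx => ?_
  rw [← Finset.HasAntidiagonal.mem_antidiagonal.mp hx]; push_cast; ring
lemma dU_C (c : R) : dU (PowerSeries.C c) = 0 := by
  ext1 n; simp only [coeff_dU, PowerSeries.coeff_C]; split_ifs with h <;> simp [h]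
lemma dU_one : dU (1 : PowerSeries R) = 0 := by simpa using dU_C (1 : R)
lemma dU_X : dU (PowerSeries.X : PowerSeries R) = PowerSeries.X := by
  ext1 n; simp only [coeff_dU, PowerSeries.coeff_X]; split_ifs with h <;> simp [h]
end

lemma dT_dU (f : PowerSeries ℝ[X]) : dT (dU f) = dU (dT f) := by
  ext1 n; simp [derivative_mul]

noncomputable def Is : PowerSeries ℝ[X] := PowerSeries.invOfUnit (1 - ts * qs ^ 2) 1
noncomputable def Js : PowerSeries ℝ[X] := PowerSeries.invOfUnit (1 + ts * qs) 1

lemma constq : PowerSeries.constantCoeff qs = 0 := by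
  rw [← PowerSeries.coeff_zero_eq_constantCoeff_apply]; simp [qc]

lemma hI : (1 - ts * qs ^ 2) * Is = 1 := by
  apply PowerSeries.mul_invOfUnit; simp [qc]
lemma hJ : (1 + ts * qs) * Js = 1 := by
  apply PowerSeries.mul_invOfUnit; simp [qc]

lemma uh_eq : us * (1 + qs) = qs * Js := by
  have h := qs_eq
  linear_combination (-us * (1 + qs)) * hJ - Js * h

lemma dT_q : dT qs = qs ^ 2 * (1 + qs) * Is := by
  have h := congrArg dT qs_eq
  simp only [dT_mul, dT_add, dT_one, dT_us, dT_ts] at h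
  have h2 : (1 - ts * qs ^ 2) * dT qs = qs ^ 2 * (1 + qs) := by
    have e := qs_eq
    set D := dT qs
    linear_combination ((1 + qs) * (1 + ts * qs)) * h
       - (D * (1 + 2 * ts * qs + ts) + (1 + qs) * qs) * e
  linear_combination Is * h2 - dT qs * hI

lemma dU_q : dU qs = qs * (1 + qs) * (1 + ts * qs) * Is := by
  have h := congrArg dU qs_eq
  simp only [dU_mul, dU_add, dU_one, dU_X, dU_C] at h
  have h2 : (1 - ts * qs ^ 2) * dU qs = qs * (1 + qs) * (1 + ts * qs) := by
    have e := qs_eq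
    set D := dU qs
    linear_combination ((1 + qs) * (1 + ts * qs)) * h
       - (D * (1 + 2 * ts * qs + ts) + (1 + qs) * (1 + ts * qs)) * e
  linear_combination Is * h2 - dU qs * hI

lemma dT_I : dT Is = Is ^ 2 * (qs ^ 2 + 2 * ts * qs * dT qs) := by
  have h := congrArg dT hI
  simp only [dT_mul, dT_sub, dT_one, dT_ts, pow_two] at h
  linear_combination Is * h - dT Is * hI

lemma dU_I : dU Is = Is ^ 2 * (2 * ts * qs * dU qs) := by
  have h := congrArg dU hI
  simp only [dU_mul, dU_sub, dU_one, dU_C, pow_two] at h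
  linear_combination Is * h - dU Is * hI

lemma dU_J : dU Js = - Js ^ 2 * (ts * dU qs) := by
  have h := congrArg dU hJ
  simp only [dU_mul, dU_add, dU_one, dU_C] at h
  linear_combination Js * h - dU Js * hJ

/-- moments, `h` and mean series -/
noncomputable def ms : PowerSeries ℝ[X] := 1 + ts * qs
noncomputable def hs : PowerSeries ℝ[X] := 1 + qs
noncomputable def B0 : PowerSeries ℝ[X] := (1 + qs) * (1 + ts * qs) * Is
noncomputable def es : PowerSeries ℝ[X] := ts * qs ^ 2 * B0 * (Is - 2)

lemma hs_ms : hs = 1 + us * (ms * hs) := by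
  unfold hs ms; linear_combination qs_eq

lemma dT_ms : dT ms = dU (us * ms) * hs := by
  have h1 := uh_eq
  have e := qs_eq
  unfold ms hs
  simp only [dT_add, dT_mul, dT_one, dT_ts, dU_mul, dU_add, dU_one, dU_C, dU_X]
  rw [dT_q, dU_q]
  have h3 := hI
  have h4 := hJ
  linear_combination (1 + ts * qs * (1+qs) * Is) * e 

/-- the series of `Σ_{i+l=n} Γ_{il}` -/
noncomputable def Gs : PowerSeries ℝ[X] :=
  PowerSeries.mk fun n => ((n : ℝ[X]) + 1) * PowerSeries.coeff n ms - PowerSeries.coeff n (ms ^ 2)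

lemma us_Gs : us * Gs = dU (us * ms) - us * ms ^ 2 := by
  ext1 n
  rcases n with _ | n
  · simp only [map_sub, coeff_dU]; simp
  · simp only [map_sub, coeff_dU, PowerSeries.coeff_succ_X_mul, Gs, PowerSeries.coeff_mk]
    push_cast; ring

lemma u2h2G : us ^ 2 * hs ^ 2 * Gs = ts * qs ^ 4 * Is := by
  have h := us_Gs
  have h1 := dT_ms
  have h2 : dT ms = qs + ts * dT qs := by
    unfold ms; simp only [dT_add, dT_mul, dT_one, dT_ts]; ring
  have h3 := uh_eq
  rw [dT_q] at h2
  have e := qs_eq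
  have h4 := hI
  have h5 := hJ
  unfold hs at *
  unfold ms at *
  have : us ^ 2 * (1 + qs) ^ 2 * Gs = us * (1+qs) * dT (1 + ts * qs)
      - (us * ((1 + qs) * (1 + ts * qs))) ^ 2 := by
    rw [h1]; linear_combination us * (1+qs)^2 * h
  rw [this, ← e, h2, h3]
  linear_combination qs ^ 2 * (Is * h5 - Js * h4 ) + qs^2 * h4

lemma es_ode_field {K : Type*} [Field K] (q t I J : K) (hI : (1 - t * q ^ 2) * I = 1)
    (hJ : (1 + t * q) * J = 1) (Tq Uq TI UI TJ UJ TTq : K)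
    (h1 : Tq = q ^ 2 * (1 + q) * I) (h2 : Uq = q * (1 + q) * (1 + t * q) * I)
    (h3 : TI = I ^ 2 * (q ^ 2 + 2 * t * q * Tq)) (h4 : UI = I ^ 2 * (2 * t * q * Uq))
    (h5 : UJ = - J ^ 2 * (t * Uq))
    (h6 : TTq = 2 * q * Tq * (1 + q) * I + q ^ 2 * Tq * I + q ^ 2 * (1 + q) * TI) :
    2 * ((q ^ 2 + t * (2 * q * Tq)) * ((1 + q) * (1 + t * q) * I) * (I - 2)
      + t * q ^ 2 * ((Tq * (1 + t * q) + (1 + q) * (q + t * Tq)) * I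
          + (1 + q) * (1 + t * q) * TI) * (I - 2)
      + t * q ^ 2 * ((1 + q) * (1 + t * q) * I) * TI)
    = 2 * (t * (4 * q ^ 3 * Uq) * I + t * q ^ 4 * UI) - (Tq + Tq + t * TTq)
      + 2 * ((Uq * J + q * UJ) * (t * q ^ 2 * ((1 + q) * (1 + t * q) * I) * (I - 2))
        + q * J * (t * (2 * q * Uq) * ((1 + q) * (1 + t * q) * I) * (I - 2)
          + t * q ^ 2 * ((Uq * (1 + t * q) + (1 + q) * (t * Uq)) * I
            + (1 + q) * (1 + t * q) * UI) * (I - 2)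
          + t * q ^ 2 * ((1 + q) * (1 + t * q) * I) * UI)) := by
  have hI0 : (1 - t * q ^ 2) ≠ 0 := left_ne_zero_of_mul_eq_one hI
  have hJ0 : (1 + t * q) ≠ 0 := left_ne_zero_of_mul_eq_one hJ
  have eI : I = 1 / (1 - t * q ^ 2) := by field_simp; linear_combination hI
  have eJ : J = 1 / (1 + t * q) := by field_simp; linear_combination hJ
  subst h6 h5 h4 h3 h2 h1
  obtain ⟨D, hD⟩ : ∃ D, D = 1 - t * q ^ 2 := ⟨_, rfl⟩
  obtain ⟨E, hE⟩ : ∃ E, E = 1 + t * q := ⟨_, rfl⟩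
  rw [← hD] at hI0 eI
  rw [← hE] at hJ0 eJ
  rw [eI, eJ]
  field_simp
  subst hD hE
  ring

lemma es_ode : 2 * dT es = 2 * dU (us ^ 2 * hs ^ 2 * Gs) - dT (dT ms) + 2 * dU (us * hs * es) := by
  rw [u2h2G]
  have hu : us * hs = qs * Js := uh_eq
  rw [hu]
  unfold es B0 ms
  have hTT : dT (dT qs) = 2 * qs * dT qs * (1 + qs) * Is + qs ^ 2 * dT qs * Is
      + qs ^ 2 * (1 + qs) * dT Is := by
    conv_lhs => rw [dT_q]
    simp only [dT_mul, dT_add, dT_one, pow_two]; ring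
  have c2T : dT (2 : PowerSeries ℝ[X]) = 0 := by
    rw [← one_add_one_eq_two, dT_add, dT_one, add_zero]
  have c2U : dU (2 : PowerSeries ℝ[X]) = 0 := by
    rw [← one_add_one_eq_two, dU_add, dU_one, add_zero]
  apply IsFractionRing.injective (PowerSeries ℝ[X]) (FractionRing (PowerSeries ℝ[X]))
  have key := es_ode_field (K := FractionRing (PowerSeries ℝ[X]))
    (algebraMap _ _ qs) (algebraMap _ _ ts) (algebraMap _ _ Is) (algebraMap _ _ Js)
    (by have := congrArg (algebraMap _ (FractionRing (PowerSeries ℝ[X]))) hI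
        simp only [map_mul, map_add, map_sub, map_neg, map_pow, map_ofNat, map_one] at this
        exact this)
    (by have := congrArg (algebraMap _ (FractionRing (PowerSeries ℝ[X]))) hJ
        simp only [map_mul, map_add, map_sub, map_neg, map_pow, map_ofNat, map_one] at this
        exact this)
    (algebraMap _ _ (dT qs)) (algebraMap _ _ (dU qs)) (algebraMap _ _ (dT Is))
    (algebraMap _ _ (dU Is)) 0 (algebraMap _ _ (dU Js)) (algebraMap _ _ (dT (dT qs)))
    (by have := congrArg (algebraMap _ (FractionRing (PowerSeries ℝ[X]))) dT_q
        simp only [map_mul, map_add, map_sub, map_neg, map_pow, map_ofNat, map_one] at this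
        exact this)
    (by have := congrArg (algebraMap _ (FractionRing (PowerSeries ℝ[X]))) dU_q
        simp only [map_mul, map_add, map_sub, map_neg, map_pow, map_ofNat, map_one] at this
        exact this)
    (by have := congrArg (algebraMap _ (FractionRing (PowerSeries ℝ[X]))) dT_I
        simp only [map_mul, map_add, map_sub, map_neg, map_pow, map_ofNat, map_one] at this
        exact this)
    (by have := congrArg (algebraMap _ (FractionRing (PowerSeries ℝ[X]))) dU_I
        simp only [map_mul, map_add, map_sub, map_neg, map_pow, map_ofNat, map_one] at this
        exact this)
    (by have := congrArg (algebraMap _ (FractionRing (PowerSeries ℝ[X]))) dU_J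
        simp only [map_mul, map_add, map_sub, map_neg, map_pow, map_ofNat, map_one] at this
        exact this)
    (by have := congrArg (algebraMap _ (FractionRing (PowerSeries ℝ[X]))) hTT
        simp only [map_mul, map_add, map_sub, map_neg, map_pow, map_ofNat, map_one] at this
        exact this)
  simp only [dT_zero, dT_mul, dT_add, dT_sub, dT_one, dT_ts, dU_mul, dU_add, dU_sub, dU_one, dU_C, pow_succ,
    pow_zero, one_mul, c2T, c2U, map_add, map_sub, map_mul, map_one, map_zero, map_ofNat]
  linear_combination key

end Spear

open MeasureTheory Finset

namespace Spear
open Polynomial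

/-! ### Polynomial facts extracted from the generating functions -/

noncomputable def mp (a : ℕ) : ℝ[X] := PowerSeries.coeff a ms
noncomputable def hp (a : ℕ) : ℝ[X] := PowerSeries.coeff a hs
noncomputable def ep (a : ℕ) : ℝ[X] := PowerSeries.coeff a es
/-- the linearisation kernel -/
noncomputable def KK (a i : ℕ) : ℝ[X] := if i < a then (a : ℝ[X]) * hp (a - 1 - i) else 0
noncomputable def Gam (i l : ℕ) : ℝ[X] := mp (i + l) - mp i * mp l

lemma coeff_uh (F : PowerSeries ℝ[X]) (k a : ℕ) (ha : a ≤ k) :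
    PowerSeries.coeff a (us * hs * F)
      = ∑ i ∈ range k, (if i < a then hp (a - 1 - i) else 0) * PowerSeries.coeff i F := by
  rcases a with _ | a
  · simp
  · rw [mul_assoc, PowerSeries.coeff_succ_X_mul, mul_comm, PowerSeries.coeff_mul,
      Finset.Nat.sum_antidiagonal_eq_sum_range_succ
        (fun i j => PowerSeries.coeff i F * PowerSeries.coeff j hs)]
    have : range (a + 1) ⊆ range k := by
      intro x hx; simp only [mem_range] at *; omega
    rw [← Finset.sum_subset this]
    · refine Finset.sum_congr rfl fun i hi => ?_
      simp only [mem_range] at hi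
      rw [if_pos hi, hp, mul_comm]; congr 2
    · intro x _ hx
      simp only [mem_range] at hx
      rw [if_neg hx, zero_mul]

lemma coeff_dU_uh (F : PowerSeries ℝ[X]) (k a : ℕ) (ha : a ≤ k) :
    PowerSeries.coeff a (dU (us * hs * F))
      = ∑ i ∈ range k, KK a i * PowerSeries.coeff i F := by
  rw [coeff_dU, coeff_uh F k a ha, Finset.mul_sum]
  refine Finset.sum_congr rfl fun i _ => ?_
  unfold KK; split_ifs <;> ring

lemma mp_zero : mp 0 = 1 := by simp [mp, ms, qc]
lemma hp_zero : hp 0 = 1 := by simp [hp, hs, qc]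
lemma ep_zero : ep 0 = 0 := by simp [ep, es, B0, qc]

/-! #### tridiagonal orthogonality -/

noncomputable def AA (i r : ℕ) : ℝ[X] := PowerSeries.coeff i (ms * qs ^ r)
noncomputable def QQ (i r : ℕ) : ℝ[X] := PowerSeries.coeff i (qs ^ r)
noncomputable def bb (i r : ℕ) : ℝ[X] := PowerSeries.coeff i (qs ^ r * B0)

lemma coeff_mul_qpow (F : PowerSeries ℝ[X]) (i r : ℕ) (h : i < r) :
    PowerSeries.coeff i (F * qs ^ r) = 0 := by
  have : (PowerSeries.X : PowerSeries ℝ[X]) ^ r ∣ F * qs ^ r := by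
    apply Dvd.dvd.mul_left
    apply pow_dvd_pow_of_dvd
    exact Dvd.intro _ qs_eq.symm
  exact (PowerSeries.X_pow_dvd_iff.mp this) i h

lemma AA_eq_zero (i r : ℕ) (h : i < r) : AA i r = 0 := coeff_mul_qpow _ _ _ h
lemma bb_eq_zero (i r : ℕ) (h : i < r) : bb i r = 0 := by
  rw [bb, mul_comm]; exact coeff_mul_qpow _ _ _ h

lemma AA_zero_right (i : ℕ) : AA i 0 = mp i := by simp [AA, mp]

lemma AA_succ (i r : ℕ) :
    AA (i + 1) (r + 1) = AA i r + (1 + X) * AA i (r + 1) + X * AA i (r + 2) := by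
  have : ms * qs ^ (r + 1) = us * (ms * qs ^ r + PowerSeries.C (1 + X) * (ms * qs ^ (r + 1))
      + PowerSeries.C X * (ms * qs ^ (r + 2))) := by
    rw [map_add, map_one]
    linear_combination ms * qs ^ r * qs_eq
  rw [AA, this, PowerSeries.coeff_succ_X_mul, map_add, map_add, PowerSeries.coeff_C_mul,
    PowerSeries.coeff_C_mul]
  rfl

lemma AA_succ_zero (i : ℕ) : AA (i + 1) 0 = X * AA i 0 + X * AA i 1 := by
  have : ms * qs ^ 0 = 1 + us * (PowerSeries.C X * (ms * qs ^ 0)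
      + PowerSeries.C X * (ms * qs ^ 1)) := by
    unfold ms
    linear_combination ts * qs_eq
  rw [AA, this, map_add, PowerSeries.coeff_succ_X_mul]
  simp only [map_add, PowerSeries.coeff_C_mul, AA]
  simp [PowerSeries.coeff_one]

lemma AA_shift (i l R : ℕ) :
    ∑ r ∈ range (R + 1), (X : ℝ[X]) ^ r * (AA (i + 1) r * AA l r - AA i r * AA (l + 1) r)
      = X ^ (R + 1) * (AA i (R + 1) * AA l R - AA i R * AA l (R + 1)) := by
  induction R with
  | zero => simp only [zero_add, sum_range_one, AA_succ_zero]; ring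
  | succ R ih => rw [Finset.sum_range_succ, ih, AA_succ, AA_succ]; ring

lemma AA_orth (i : ℕ) : ∀ l R : ℕ, i + l ≤ R →
    ∑ r ∈ range (R + 1), (X : ℝ[X]) ^ r * (AA i r * AA l r) = mp (i + l) := by
  induction i with
  | zero =>
    intro l R h
    rw [Finset.sum_range_succ', Finset.sum_eq_zero]
    · rw [AA_zero_right, AA_zero_right, mp_zero]; simp
    · intro r _; rw [AA_eq_zero 0 (r + 1) (by omega)]; simp
  | succ i ih =>
    intro l R h
    have h1 := AA_shift i l R
    rw [AA_eq_zero i (R + 1) (by omega), AA_eq_zero l (R+1) (by omega)] at h1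
    simp only [mul_sub, Finset.sum_sub_distrib] at h1
    rw [ih (l + 1) R (by omega)] at h1
    rw [show i + 1 + l = i + (l + 1) by ring]
    linear_combination h1

lemma Gam_eq (i l R : ℕ) (h : i + l ≤ R + 1) :
    Gam i l = ∑ r ∈ range (R + 1), (X : ℝ[X]) ^ (r + 1) * (AA i (r + 1) * AA l (r + 1)) := by
  have := AA_orth i l (R + 1) h
  rw [Finset.sum_range_succ'] at this
  rw [Gam, ← this, AA_zero_right, AA_zero_right]; ring

lemma dU_pow_q (r : ℕ) : dU (qs ^ r) = (r : PowerSeries ℝ[X]) * (qs ^ r * B0) := by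
  induction r with
  | zero => simp [dU_one]
  | succ r ih => rw [pow_succ, dU_mul, ih, dU_q, B0]; push_cast; ring

lemma dT_pow_q (r : ℕ) : dT (qs ^ r) = (r : PowerSeries ℝ[X]) * (qs ^ (r + 1) * (1 + qs) * Is) := by
  induction r with
  | zero => simp [dT_one]
  | succ r ih => rw [pow_succ, dT_mul, ih, dT_q]; push_cast; ring

lemma r_bb (i r : ℕ) : (r : ℝ[X]) * bb i r = i * QQ i r := by
  have h := congrArg (PowerSeries.coeff i) (dU_pow_q r)
  rw [coeff_dU, ← map_natCast (PowerSeries.C (R := ℝ[X])), PowerSeries.coeff_C_mul] at h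
  rw [bb, QQ, h]

/-- `q^{r+1} = u h σ q^r` -/
lemma QQ_succ (k a r : ℕ) (ha : a ≤ k) :
    (a : ℝ[X]) * QQ a (r + 1) = ∑ i ∈ range k, KK a i * AA i r := by
  have h : qs ^ (r + 1) = us * hs * (ms * qs ^ r) := by
    unfold hs ms; linear_combination qs ^ r * qs_eq
  have := coeff_dU_uh (ms * qs ^ r) k a ha
  rw [← h, coeff_dU] at this
  rw [QQ, this]; rfl

lemma bb_ode_field {K : Type*} [Field K] (q t I J w P : K) (hI : (1 - t * q ^ 2) * I = 1)
    (hJ : (1 + t * q) * J = 1) :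
    w * (P * q * (1 + q) * I) * ((1 + q) * (1 + t * q) * I) +
      P * (q ^ 2 * (1 + q) * I * (1 + t * q) * I + (1 + q) * (q + t * (q ^ 2 * (1 + q) * I)) * I +
        (1 + q) * (1 + t * q) * (I ^ 2 * (q ^ 2 + 2 * t * q * (q ^ 2 * (1 + q) * I))))
    = (q * (1 + q) * (1 + t * q) * I * J + q * (-J ^ 2 * (t * (q * (1 + q) * (1 + t * q) * I))))
        * (P * ((1 + q) * (1 + t * q) * I)) +
      q * J * (w * (P * ((1 + q) * (1 + t * q) * I)) * ((1 + q) * (1 + t * q) * I) +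
        P * (q * (1 + q) * (1 + t * q) * I * (1 + t * q) * I +
          (1 + q) * (t * (q * (1 + q) * (1 + t * q) * I)) * I +
          (1 + q) * (1 + t * q) * (I ^ 2 * (2 * t * q * (q * (1 + q) * (1 + t * q) * I))))) := by
  have hI0 : (1 - t * q ^ 2) ≠ 0 := left_ne_zero_of_mul_eq_one hI
  have hJ0 : (1 + t * q) ≠ 0 := left_ne_zero_of_mul_eq_one hJ
  have eI : I = 1 / (1 - t * q ^ 2) := by field_simp; linear_combination hI
  have eJ : J = 1 / (1 + t * q) := by field_simp; linear_combination hJ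
  obtain ⟨D, hD⟩ : ∃ D, D = 1 - t * q ^ 2 := ⟨_, rfl⟩
  obtain ⟨E, hE⟩ : ∃ E, E = 1 + t * q := ⟨_, rfl⟩
  rw [← hD] at hI0 eI
  rw [← hE] at hJ0 eJ
  rw [eI, eJ]
  field_simp
  subst hD hE
  ring

lemma dT_bb (k a r : ℕ) (ha : a ≤ k) (hr : 1 ≤ r) :
    derivative (bb a r) = ∑ i ∈ range k, KK a i * bb i r := by
  rw [bb, ← coeff_dT]
  have h : dT (qs ^ r * B0) = dU (us * hs * (qs ^ r * B0)) := by
    have hd1 : dU (qs ^ r) = (r : PowerSeries ℝ[X]) * (qs ^ r * B0) := dU_pow_q r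
    have hd2 := dT_pow_q r
    have hu : us * hs = qs * Js := uh_eq
    rw [hu]
    have e1 : dT B0 = dT qs * (1 + ts * qs) * Is + (1 + qs) * (qs + ts * dT qs) * Is
        + (1 + qs) * (1 + ts * qs) * dT Is := by
      unfold B0; simp only [dT_mul, dT_add, dT_one, dT_ts]; ring
    have e2 : dU B0 = dU qs * (1 + ts * qs) * Is + (1 + qs) * (ts * dU qs) * Is
        + (1 + qs) * (1 + ts * qs) * dU Is := by
      unfold B0; simp only [dU_mul, dU_add, dU_one, dU_C]; ring
    rw [dT_mul, dU_mul, dU_mul, dU_mul, hd1, hd2, e1, e2, dU_J, dT_I, dU_I, dT_q, dU_q, B0]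
    apply IsFractionRing.injective (PowerSeries ℝ[X]) (FractionRing (PowerSeries ℝ[X]))
    have key := bb_ode_field (K := FractionRing (PowerSeries ℝ[X]))
      (algebraMap _ _ qs) (algebraMap _ _ ts) (algebraMap _ _ Is) (algebraMap _ _ Js)
      (r : FractionRing (PowerSeries ℝ[X])) (algebraMap _ _ (qs ^ r))
      (by have := congrArg (algebraMap _ (FractionRing (PowerSeries ℝ[X]))) hI
          simp only [map_mul, map_sub, map_pow, map_one] at this
          exact this)
      (by have := congrArg (algebraMap _ (FractionRing (PowerSeries ℝ[X]))) hJ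
          simp only [map_mul, map_add, map_one] at this
          exact this)
    rw [pow_succ]
    simp only [map_add, map_sub, map_neg, map_mul, map_pow, map_one, map_natCast, map_ofNat] at key ⊢
    exact key
  rw [h, coeff_dU_uh _ k a ha]; rfl

end Spear

open MeasureTheory Finset

namespace Spear
open Polynomial

lemma coeff_X_sq_mul {R : Type*} [CommRing R] (G F : PowerSeries R) (M : ℕ → ℕ → R)
    (hF : ∀ n, PowerSeries.coeff n F = ∑ x ∈ antidiagonal n, M x.1 x.2) (k a : ℕ) (ha : a ≤ k) :
    PowerSeries.coeff a (PowerSeries.X ^ 2 * G * F) = ∑ i ∈ range k, ∑ l ∈ range k,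
      (if i + l + 2 ≤ a then PowerSeries.coeff (a - 2 - i - l) G else 0) * M i l := by
  rw [mul_assoc]
  by_cases h2 : 2 ≤ a
  · obtain ⟨b, rfl⟩ : ∃ b, a = b + 2 := ⟨a - 2, by omega⟩
    rw [show b + 2 = b + 2 from rfl, PowerSeries.coeff_X_pow_mul, mul_comm, PowerSeries.coeff_mul,
      Finset.Nat.sum_antidiagonal_eq_sum_range_succ
        (fun i j => PowerSeries.coeff i F * PowerSeries.coeff j G)]
    simp_rw [hF, Finset.sum_mul]
    rw [Finset.sum_sigma', ← Finset.sum_product']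
    rw [← Finset.sum_filter_add_sum_filter_not (range k ×ˢ range k) (fun x => x.1 + x.2 ≤ b)]
    have hz : ∑ x ∈ range k ×ˢ range k with ¬x.1 + x.2 ≤ b,
        (if x.1 + x.2 + 2 ≤ b + 2 then (PowerSeries.coeff (b + 2 - 2 - x.1 - x.2)) G else 0)
          * M x.1 x.2 = 0 := by
      apply Finset.sum_eq_zero
      rintro ⟨i, l⟩ h
      simp only [mem_filter, mem_product, mem_range] at h
      rw [if_neg (by omega), zero_mul]
    rw [hz, add_zero]
    · refine Finset.sum_bij' (fun x _ => x.2) (fun x _ => ⟨x.1 + x.2, x⟩) ?_ ?_ ?_ ?_ ?_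
      · rintro ⟨n, i, l⟩ h
        simp only [mem_sigma, mem_range, HasAntidiagonal.mem_antidiagonal, mem_filter,
          mem_product] at h ⊢
        omega
      · rintro ⟨i, l⟩ h
        simp only [mem_sigma, mem_range, HasAntidiagonal.mem_antidiagonal, mem_filter,
          mem_product] at h ⊢
        exact ⟨by omega, trivial⟩
      · rintro ⟨n, i, l⟩ h
        simp only [mem_sigma, mem_range, HasAntidiagonal.mem_antidiagonal] at h ⊢
        obtain ⟨_, rfl⟩ := h; rfl
      · rintro ⟨i, l⟩ h; rfl
      · rintro ⟨n, i, l⟩ h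
        simp only [mem_sigma, mem_range, HasAntidiagonal.mem_antidiagonal] at h ⊢
        obtain ⟨h1, rfl⟩ := h
        rw [if_pos (by omega), mul_comm]; congr 3; omega
  · rw [PowerSeries.coeff_X_pow_mul', if_neg h2]
    symm
    refine Finset.sum_eq_zero fun i _ => Finset.sum_eq_zero fun l _ => ?_
    rw [if_neg (by omega), zero_mul]

/-- the second order kernel (twice the coefficient of the quadratic term) -/
noncomputable def H2 (a i l : ℕ) : ℝ[X] :=
  if i + l + 2 ≤ a then (a : ℝ[X]) * PowerSeries.coeff (a - 2 - i - l) (hs ^ 2) else 0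

lemma ep_ode (k a : ℕ) (ha : a ≤ k) :
    2 * derivative (ep a) = 2 * ∑ i ∈ range k, ∑ l ∈ range k, H2 a i l * Gam i l
      - derivative (derivative (mp a)) + 2 * ∑ i ∈ range k, KK a i * ep i := by
  have h := congrArg (PowerSeries.coeff a) es_ode
  have e2 : (2 : PowerSeries ℝ[X]) = PowerSeries.C 2 := (map_ofNat PowerSeries.C 2).symm
  rw [map_add, map_sub, e2, PowerSeries.coeff_C_mul, PowerSeries.coeff_C_mul,
    PowerSeries.coeff_C_mul, coeff_dU_uh _ k a ha, coeff_dU,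
    coeff_X_sq_mul (hs ^ 2) Gs Gam _ k a ha] at h
  · simp only [coeff_dT] at h
    unfold mp ep
    rw [h, Finset.mul_sum]
    congr 3
    refine Finset.sum_congr rfl fun i _ => ?_
    rw [Finset.mul_sum]
    refine Finset.sum_congr rfl fun l _ => ?_
    unfold H2; split_ifs <;> ring
  · intro n
    simp only [Gs, PowerSeries.coeff_mk, Gam, Finset.sum_sub_distrib]
    rw [pow_two, PowerSeries.coeff_mul]
    congr 1
    rw [Finset.sum_congr rfl (g := fun _ => PowerSeries.coeff n ms)]
    · simp
    · intro x hx; rw [mp, HasAntidiagonal.mem_antidiagonal.mp hx]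

/-- limiting covariances -/
noncomputable def VV (k a b : ℕ) : ℝ[X] :=
  ∑ r ∈ range (2 * k + 1), 2 * ((r + 2 : ℕ) : ℝ[X]) * X ^ (r + 2) * (bb a (r + 2) * bb b (r + 2))

lemma VV_ode (k a b : ℕ) (ha : a ≤ k) (hb : b ≤ k) :
    derivative (VV k a b) = ∑ i ∈ range k, KK a i * VV k i b + ∑ i ∈ range k, KK b i * VV k a i
      + 2 * ∑ i ∈ range k, ∑ l ∈ range k, KK a i * KK b l * Gam i l := by
  have h1 : ∀ i ∈ range k, ∀ l ∈ range k, KK a i * KK b l * Gam i l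
      = ∑ r ∈ range (2 * k + 1), X ^ (r + 1) * ((KK a i * AA i (r + 1)) * (KK b l * AA l (r + 1))) := by
    intro i hi l hl
    simp only [mem_range] at hi hl
    rw [Gam_eq i l (2 * k) (by omega), Finset.mul_sum]
    exact Finset.sum_congr rfl fun r _ => by ring
  rw [Finset.sum_congr rfl fun i hi => Finset.sum_congr rfl (h1 i hi)]
  have h2 : ∑ i ∈ range k, ∑ l ∈ range k, ∑ r ∈ range (2 * k + 1), X ^ (r + 1) *
      ((KK a i * AA i (r + 1)) * (KK b l * AA l (r + 1)))
      = ∑ r ∈ range (2 * k + 1), X ^ (r + 1) * ((((r + 2 : ℕ) : ℝ[X]) * bb a (r + 2)) *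
        (((r + 2 : ℕ) : ℝ[X]) * bb b (r + 2))) := by
    rw [Finset.sum_congr rfl fun i _ => Finset.sum_comm, Finset.sum_comm]
    refine Finset.sum_congr rfl fun r _ => ?_
    rw [r_bb, r_bb, QQ_succ k a _ ha, QQ_succ k b _ hb, Finset.sum_mul_sum, Finset.mul_sum]
    exact Finset.sum_congr rfl fun i _ => by rw [Finset.mul_sum]
  rw [h2]
  have h3 : ∑ i ∈ range k, KK a i * VV k i b = ∑ r ∈ range (2 * k + 1),
      2 * ((r + 2 : ℕ) : ℝ[X]) * X ^ (r + 2) * (derivative (bb a (r + 2)) * bb b (r + 2)) := by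
    simp only [VV, Finset.mul_sum]
    rw [Finset.sum_comm]
    refine Finset.sum_congr rfl fun r _ => ?_
    rw [dT_bb k a _ ha (by omega), Finset.sum_mul, Finset.mul_sum]
    exact Finset.sum_congr rfl fun i _ => by ring
  have h4 : ∑ i ∈ range k, KK b i * VV k a i = ∑ r ∈ range (2 * k + 1),
      2 * ((r + 2 : ℕ) : ℝ[X]) * X ^ (r + 2) * (bb a (r + 2) * derivative (bb b (r + 2))) := by
    simp only [VV, Finset.mul_sum]
    rw [Finset.sum_comm]
    refine Finset.sum_congr rfl fun r _ => ?_
    rw [dT_bb k b _ hb (by omega), Finset.mul_sum, Finset.mul_sum]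
    exact Finset.sum_congr rfl fun i _ => by ring
  rw [h3, h4, VV, derivative_sum, Finset.mul_sum, ← Finset.sum_add_distrib,
    ← Finset.sum_add_distrib]
  refine Finset.sum_congr rfl fun r _ => ?_
  simp only [derivative_mul, derivative_X_pow, derivative_natCast, derivative_ofNat]
  rw [show r + 2 - 1 = r + 1 by omega]
  push_cast
  simp only [map_add, map_natCast, map_ofNat]
  ring

lemma exists_antideriv (Q : ℝ[X]) : ∃ P : ℝ[X], derivative P = Q := by
  induction Q using Polynomial.induction_on' with
  | add p q hp hq =>
    obtain ⟨P, rfl⟩ := hp; obtain ⟨R, rfl⟩ := hq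
    exact ⟨P + R, by simp⟩
  | monomial n a =>
    refine ⟨monomial (n + 1) (a / (n + 1)), ?_⟩
    rw [derivative_monomial]
    have : (n : ℝ) + 1 ≠ 0 := by positivity
    simp only [Nat.add_sub_cancel, Nat.cast_add, Nat.cast_one]
    rw [div_mul_cancel₀ _ this]

lemma exists_antideriv' (Q : ℝ[X]) (y v : ℝ) : ∃ P : ℝ[X], derivative P = Q ∧ P.eval y = v := by
  obtain ⟨P, hP⟩ := exists_antideriv Q
  exact ⟨P + C (v - P.eval y), by simp [hP], by simp⟩

lemma exists_cc (k : ℕ) (y : ℝ) : ∃ c : ℕ → ℝ[X],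
    (∀ i ≤ k, derivative (c i) = - ∑ a ∈ range (k + 1), c a * KK a i) ∧
    (∀ i ≤ k, (c i).eval y = if i = k then 1 else 0) := by
  have key : ∀ d ≤ k + 1, ∃ c : ℕ → ℝ[X],
    (∀ i ≤ k, k < i + d → derivative (c i) = - ∑ a ∈ range (k + 1), c a * KK a i) ∧
    (∀ i ≤ k, k < i + d → (c i).eval y = if i = k then 1 else 0) := by
    intro d
    induction d with
    | zero => intro _; exact ⟨fun _ => 0, fun i hi h => by omega, fun i hi h => by omega⟩
    | succ d ih =>
      intro hd
      obtain ⟨c, h1, h2⟩ := ih (by omega)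
      obtain ⟨P, hP, hPy⟩ := exists_antideriv' (- ∑ a ∈ range (k + 1), c a * KK a (k - d)) y
        (if k - d = k then 1 else 0)
      have hsum : ∀ i ≤ k, k - d ≤ i → ∑ a ∈ range (k + 1),
          Function.update c (k - d) P a * KK a i = ∑ a ∈ range (k + 1), c a * KK a i := by
        intro i hi hdi
        refine Finset.sum_congr rfl fun a _ => ?_
        by_cases h : a = k - d
        · subst h; simp [KK, show ¬ i < k - d by omega]
        · rw [Function.update_of_ne h]
      refine ⟨Function.update c (k - d) P, ?_, ?_⟩
      · intro i hi hlt
        rw [hsum i hi (by omega)]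
        by_cases h : i = k - d
        · subst h; rw [Function.update_self, hP]
        · rw [Function.update_of_ne h]; exact h1 i hi (by omega)
      · intro i hi hlt
        by_cases h : i = k - d
        · subst h; rw [Function.update_self, hPy]
        · rw [Function.update_of_ne h]; exact h2 i hi (by omega)
  obtain ⟨c, h1, h2⟩ := key (k + 1) le_rfl
  exact ⟨c, fun i hi => h1 i hi (by omega), fun i hi => h2 i hi (by omega)⟩

noncomputable def WW (k : ℕ) (c : ℕ → ℝ[X]) : ℝ[X] :=
  ∑ a ∈ range (k + 1), ∑ b ∈ range (k + 1), c a * c b * VV k a b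

lemma KK_eq_zero (k a : ℕ) (ha : a ≤ k) : KK a k = 0 := by simp [KK, ha]

lemma WW_alg {R : Type*} [CommRing R] (k : ℕ) (c d : ℕ → R) (K V G : ℕ → ℕ → R)
    (hd : ∀ i < k, d i = - ∑ a ∈ range (k + 1), c a * K a i) (hk : d k = 0) :
    ∑ a ∈ range (k + 1), ∑ b ∈ range (k + 1),
      ((d a * c b + c a * d b) * V a b + c a * c b *
      (∑ i ∈ range k, K a i * V i b + ∑ i ∈ range k, K b i * V a i
      + 2 * ∑ i ∈ range k, ∑ l ∈ range k, K a i * K b l * G i l))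
    = 2 * ∑ i ∈ range k, ∑ l ∈ range k, d i * d l * G i l := by
  have e2 : ∑ a ∈ range (k + 1), ∑ b ∈ range (k + 1), c a * c b * ∑ i ∈ range k, K a i * V i b
      = - ∑ a ∈ range (k + 1), ∑ b ∈ range (k + 1), d a * c b * V a b := by
    rw [Finset.sum_comm, Finset.sum_comm (s := range (k + 1)) (f := fun a b => d a * c b * V a b),
      ← Finset.sum_neg_distrib]
    refine Finset.sum_congr rfl fun b _ => ?_
    rw [Finset.sum_range_succ (fun a => d a * c b * V a b), hk, zero_mul, zero_mul, add_zero,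
      ← Finset.sum_neg_distrib]
    simp only [Finset.mul_sum]
    rw [Finset.sum_comm]
    refine Finset.sum_congr rfl fun i hi => ?_
    rw [hd i (mem_range.mp hi), neg_mul, neg_mul, neg_neg, Finset.sum_mul, Finset.sum_mul]
    exact Finset.sum_congr rfl fun _ _ => by ring
  have e3 : ∑ a ∈ range (k + 1), ∑ b ∈ range (k + 1), c a * c b * ∑ i ∈ range k, K b i * V a i
      = - ∑ a ∈ range (k + 1), ∑ b ∈ range (k + 1), c a * d b * V a b := by
    rw [← Finset.sum_neg_distrib]
    refine Finset.sum_congr rfl fun a _ => ?_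
    rw [Finset.sum_range_succ (fun b => c a * d b * V a b), hk, mul_zero, zero_mul, add_zero,
      ← Finset.sum_neg_distrib]
    simp only [Finset.mul_sum]
    rw [Finset.sum_comm]
    refine Finset.sum_congr rfl fun i hi => ?_
    rw [hd i (mem_range.mp hi), mul_neg, neg_mul, neg_neg, Finset.mul_sum, Finset.sum_mul]
    exact Finset.sum_congr rfl fun _ _ => by ring
  have e4 : ∑ a ∈ range (k + 1), ∑ b ∈ range (k + 1), c a * c b *
      (∑ i ∈ range k, ∑ l ∈ range k, K a i * K b l * G i l)
      = ∑ i ∈ range k, ∑ l ∈ range k, d i * d l * G i l := by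
    have h : ∀ i ∈ range k, ∑ l ∈ range k, d i * d l * G i l
        = ∑ a ∈ range (k + 1), ∑ b ∈ range (k + 1), ∑ l ∈ range k,
          c a * c b * (K a i * K b l * G i l) := by
      intro i hi
      have h' : ∀ l ∈ range k, d i * d l * G i l = ∑ a ∈ range (k + 1), ∑ b ∈ range (k + 1),
          c a * c b * (K a i * K b l * G i l) := by
        intro l hl
        rw [hd i (mem_range.mp hi), hd l (mem_range.mp hl), neg_mul_neg, Finset.sum_mul_sum,
          Finset.sum_mul]
        refine Finset.sum_congr rfl fun a _ => ?_
        rw [Finset.sum_mul]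
        exact Finset.sum_congr rfl fun _ _ => by ring
      rw [Finset.sum_congr rfl h', Finset.sum_comm]
      exact Finset.sum_congr rfl fun _ _ => Finset.sum_comm
    rw [Finset.sum_congr rfl h]
    conv_rhs => rw [Finset.sum_comm]
    refine Finset.sum_congr rfl fun a _ => ?_
    conv_rhs => rw [Finset.sum_comm]
    refine Finset.sum_congr rfl fun b _ => ?_
    rw [Finset.mul_sum]
    exact Finset.sum_congr rfl fun i _ => by rw [Finset.mul_sum]
  rw [← e4, Finset.mul_sum]
  have e5 : ∀ a b, (d a * c b + c a * d b) * V a b + c a * c b *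
      (∑ i ∈ range k, K a i * V i b + ∑ i ∈ range k, K b i * V a i
      + 2 * ∑ i ∈ range k, ∑ l ∈ range k, K a i * K b l * G i l)
      = d a * c b * V a b + c a * d b * V a b + c a * c b * ∑ i ∈ range k, K a i * V i b
        + c a * c b * ∑ i ∈ range k, K b i * V a i
        + 2 * (c a * c b * (∑ i ∈ range k, ∑ l ∈ range k, K a i * K b l * G i l)) := by
    intro a b; ring
  simp only [e5, Finset.sum_add_distrib]
  rw [e2, e3, ← Finset.mul_sum]
  simp only [← Finset.mul_sum]
  ring

lemma WW_ode (k : ℕ) (c : ℕ → ℝ[X])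
    (hc : ∀ i ≤ k, derivative (c i) = - ∑ a ∈ range (k + 1), c a * KK a i) :
    derivative (WW k c) = 2 * ∑ i ∈ range k, ∑ l ∈ range k,
      derivative (c i) * derivative (c l) * Gam i l := by
  have hck : derivative (c k) = 0 := by
    rw [hc k le_rfl, Finset.sum_eq_zero, neg_zero]
    intro a ha; rw [KK_eq_zero k a (by simpa [Nat.lt_succ_iff] using ha), mul_zero]
  rw [← WW_alg k c (fun i => derivative (c i)) KK (VV k) Gam (fun i hi => hc i hi.le) hck]
  rw [WW, derivative_sum]
  refine Finset.sum_congr rfl fun a ha => ?_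
  rw [derivative_sum]
  refine Finset.sum_congr rfl fun b hb => ?_
  simp only [mem_range] at ha hb
  rw [derivative_mul, derivative_mul, VV_ode k a b (by omega) (by omega)]

lemma VV_eval_zero (k a b : ℕ) : (VV k a b).eval 0 = 0 := by
  rw [VV, eval_finset_sum]
  exact Finset.sum_eq_zero fun r _ => by simp

lemma WW_eval_zero (k : ℕ) (c : ℕ → ℝ[X]) : (WW k c).eval 0 = 0 := by
  simp only [WW, eval_finset_sum, eval_mul, VV_eval_zero, mul_zero, Finset.sum_const_zero]

lemma WW_eval_y (k : ℕ) (y : ℝ) (c : ℕ → ℝ[X])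
    (hc : ∀ i ≤ k, (c i).eval y = if i = k then 1 else 0) :
    (WW k c).eval y = (VV k k k).eval y := by
  simp only [WW, eval_finset_sum, eval_mul]
  rw [Finset.sum_eq_single k, Finset.sum_eq_single k]
  · rw [hc k le_rfl]; simp
  · intro b hb hbk; simp only [mem_range] at hb; rw [hc b (by omega), if_neg hbk]; simp
  · simp
  · intro b hb hbk
    simp only [mem_range] at hb
    refine Finset.sum_eq_zero fun b' _ => ?_
    rw [hc b (by omega), if_neg hbk]; simp
  · simp

lemma ep_eval_zero (a : ℕ) : (ep a).eval 0 = 0 := by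
  rw [ep, es, mul_assoc, mul_assoc, PowerSeries.coeff_C_mul]; simp

lemma mp_eval_zero (a : ℕ) (ha : 1 ≤ a) : (mp a).eval 0 = 0 := by
  rw [mp, ms, map_add, PowerSeries.coeff_C_mul, PowerSeries.coeff_one, if_neg (by omega)]; simp

end Spear

open MeasureTheory Finset

namespace Spear
open Polynomial

/-! ### Explicit formulas -/

lemma bb_zero_zero : bb 0 0 = 1 := by
  simp [bb, B0, Is, qc, PowerSeries.constantCoeff_invOfUnit]

lemma bb_succ_succ (k l : ℕ) :
    bb (k + 1) (l + 1) = bb k l + (1 + X) * bb k (l + 1) + X * bb k (l + 2) := by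
  have : qs ^ (l + 1) * B0 = us * (qs ^ l * B0 + PowerSeries.C (1 + X) * (qs ^ (l + 1) * B0)
      + PowerSeries.C X * (qs ^ (l + 2) * B0)) := by
    rw [map_add, map_one]
    linear_combination B0 * qs ^ l * qs_eq
  rw [bb, this, PowerSeries.coeff_succ_X_mul, map_add, map_add, PowerSeries.coeff_C_mul,
    PowerSeries.coeff_C_mul]
  rfl

lemma bb_succ_zero (k : ℕ) : bb (k + 1) 0 = (1 + X) * bb k 0 + 2 * X * bb k 1 := by
  have : qs ^ 0 * B0 = 1 + us * (PowerSeries.C (1 + X) * (qs ^ 0 * B0)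
      + PowerSeries.C (2 * X) * (qs ^ 1 * B0)) := by
    rw [map_add, map_one, map_mul, map_ofNat]
    unfold B0
    linear_combination hI + (Is * ((1 + ts) + 2 * ts * qs)) * qs_eq
  rw [bb, this, map_add, PowerSeries.coeff_succ_X_mul, map_add, PowerSeries.coeff_C_mul,
    PowerSeries.coeff_C_mul, PowerSeries.coeff_one, if_neg (by omega), zero_add]
  rfl

lemma coeff_bb (k : ℕ) : ∀ l j : ℕ, (bb k l).coeff j = (k.choose j : ℝ) * (k.choose (j + l) : ℝ) := by
  induction k with
  | zero =>
    intro l j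
    rcases l with _ | l
    · rw [bb_zero_zero]
      rcases j with _ | j
      · simp
      · simp [Polynomial.coeff_one]
    · rw [bb_eq_zero 0 (l + 1) (by omega)]
      simp [← add_assoc]
  | succ k ih =>
    intro l j
    rcases l with _ | l
    · rw [bb_succ_zero, add_mul, one_mul, mul_assoc, show (2 : ℝ[X]) = C 2 from (map_ofNat C 2).symm]
      rcases j with _ | j
      · simp [ih]
      · simp only [coeff_add, coeff_X_mul, coeff_C_mul, ih]
        simp only [add_zero, Nat.choose_succ_succ]
        push_cast; ring
    · rw [bb_succ_succ, add_mul, one_mul]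
      rcases j with _ | j
      · simp only [coeff_add, ih, mul_coeff_zero, coeff_X_zero, zero_mul, zero_add, add_zero,
          Nat.choose_zero_right, Nat.choose_succ_succ]
        push_cast; ring
      · simp only [coeff_add, coeff_X_mul, ih]
        simp only [show j + 1 + (l + 1) = (j + l + 1) + 1 by ring, show j + 1 + l = j + l + 1 by ring,
          show j + (l + 1) = j + l + 1 by ring, show j + (l + 2) = j + l + 1 + 1 by ring,
          Nat.choose_succ_succ]
        push_cast; ring

noncomputable def bE (k l : ℕ) (y : ℝ) : ℝ :=
  ∑ j ∈ range (k + 1), (k.choose j : ℝ) * (k.choose (j + l) : ℝ) * y ^ j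

lemma eval_bb (k l : ℕ) (y : ℝ) : (bb k l).eval y = bE k l y := by
  have hd : (bb k l).natDegree < k + 1 := by
    rw [Nat.lt_succ_iff, natDegree_le_iff_coeff_eq_zero]
    intro j hj
    rw [coeff_bb, Nat.choose_eq_zero_of_lt hj]; simp
  rw [eval_eq_sum_range' hd, bE]
  exact Finset.sum_congr rfl fun j _ => by rw [coeff_bb]

lemma k_mp (k : ℕ) (hk : 1 ≤ k) : (k : ℝ[X]) * mp k = X * bb k 1 := by
  have h := r_bb k 1
  rw [Nat.cast_one, one_mul] at h
  rw [h, mp, ms, map_add, PowerSeries.coeff_C_mul, PowerSeries.coeff_one, if_neg (by omega), zero_add,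
    QQ, pow_one]
  ring

lemma mp_eq (k : ℕ) (hk : 1 ≤ k) : mp k = ∑ j ∈ range k,
    C ((k.choose j : ℝ) * ((k - 1).choose j : ℝ) / ((j : ℝ) + 1)) * X ^ (j + 1) := by
  have hk0 : (k : ℝ) ≠ 0 := by positivity
  have hk1 : (k : ℝ[X]) ≠ 0 := by exact_mod_cast (by omega : k ≠ 0)
  apply mul_left_cancel₀ hk1
  rw [k_mp k hk]
  ext i
  rw [← C_eq_natCast, coeff_C_mul, finset_sum_coeff]
  rcases i with _ | i
  · simp
  · rw [coeff_X_mul, coeff_bb]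
    simp only [coeff_C_mul, coeff_X_pow]
    by_cases hi : i < k
    · rw [Finset.sum_eq_single i]
      · obtain ⟨m, rfl⟩ : ∃ m, k = m + 1 := ⟨k - 1, by omega⟩
        have := Nat.add_one_mul_choose_eq m i
        have h2 : ((m : ℝ) + 1) * (m.choose i) = ((m + 1).choose (i + 1)) * ((i : ℝ) + 1) := by
          exact_mod_cast this
        simp only [Nat.add_sub_cancel]
        have : (i : ℝ) + 1 ≠ 0 := by positivity
        push_cast
        simp only [if_true, mul_one]
        field_simp
        linear_combination (-((m+1).choose i : ℝ)) * h2
      · intro b _ hb; rw [if_neg (by omega)]; simp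
      · simp [hi]
    · rw [Nat.choose_eq_zero_of_lt (show k < i + 1 by omega), Finset.sum_eq_zero]
      · simp
      · intro b hb; simp only [mem_range] at hb; rw [if_neg (by omega)]; simp

lemma eval_mp (k : ℕ) (hk : 1 ≤ k) (y : ℝ) : (mp k).eval y = ∑ j ∈ range k,
    (k.choose j : ℝ) * ((k - 1).choose j : ℝ) / ((j : ℝ) + 1) * y ^ (j + 1) := by
  rw [mp_eq k hk]; simp [eval_finset_sum]

lemma eval_dmp (k : ℕ) (hk : 1 ≤ k) (y : ℝ) : (derivative (mp k)).eval y = ∑ j ∈ range k,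
    (k.choose j : ℝ) * ((k - 1).choose j : ℝ) * y ^ j := by
  rw [mp_eq k hk, derivative_sum, eval_finset_sum]
  refine Finset.sum_congr rfl fun j _ => ?_
  have : (j : ℝ) + 1 ≠ 0 := by positivity
  simp only [derivative_mul, derivative_C, derivative_X_pow, eval_mul, eval_add, eval_C, eval_pow,
    eval_X, Nat.add_sub_cancel, zero_mul, zero_add]
  push_cast
  field_simp

/-- binomial sums as coefficients -/
lemma coeff_prod_expand (M k r : ℕ) (y : ℝ) :
    ∑ j ∈ range (k + 1), (k.choose j : ℝ) * (y - 1) ^ j * ((M + (k - j)).choose r : ℝ)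
      = ∑ x ∈ antidiagonal r, (M.choose x.1 : ℝ) * ((k.choose x.2 : ℝ) * y ^ (k - x.2)) := by
  have h : ((1 + X) ^ M * (X + C y) ^ k : ℝ[X]) = ∑ j ∈ range (k + 1),
      C ((k.choose j : ℝ) * (y - 1) ^ j) * (1 + X) ^ (M + (k - j)) := by
    rw [show (X + C y : ℝ[X]) = C (y - 1) + (1 + X) by rw [C_sub, C_1]; ring,
      add_pow (C (y - 1)), Finset.mul_sum]
    refine Finset.sum_congr rfl fun j _ => ?_
    rw [pow_add, C_mul, C_pow, C_eq_natCast]; ring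
  have h2 := congrArg (fun P => coeff P r) h
  simp only [finset_sum_coeff, coeff_C_mul] at h2
  simp only [add_comm (1 : ℝ[X]) X, coeff_X_add_one_pow, coeff_mul, coeff_X_add_C_pow] at h2
  rw [← h2]
  exact Finset.sum_congr rfl fun x _ => by ring

lemma coeff_low (k l : ℕ) (hl : l ≤ k) (y : ℝ) :
    ∑ j ∈ range (k + 1), (k.choose j : ℝ) * (y - 1) ^ j * ((2 * k - j).choose (k - l) : ℝ)
      = y ^ l * bE k l y := by
  have h := coeff_prod_expand k k (k - l) y
  rw [Finset.sum_congr rfl (g := fun j => (k.choose j : ℝ) * (y - 1) ^ j *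
    ((k + (k - j)).choose (k - l) : ℝ))]
  · rw [h, Finset.Nat.sum_antidiagonal_eq_sum_range_succ
      (fun i j => (k.choose i : ℝ) * ((k.choose j : ℝ) * y ^ (k - j))), bE, Finset.mul_sum]
    have hs : range ((k - l) + 1) ⊆ range (k + 1) := range_subset_range.mpr (by omega)
    rw [← Finset.sum_subset hs]
    · refine Finset.sum_congr rfl fun a ha => ?_
      simp only [mem_range] at ha
      rw [show k - (k - l - a) = l + a by omega, pow_add,
        ← Nat.choose_symm (show a + l ≤ k by omega), show k - (a + l) = k - l - a by omega]
      ring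
    · intro a _ ha
      simp only [mem_range] at ha
      rw [Nat.choose_eq_zero_of_lt (show k < a + l by omega)]; simp
  · intro j hj
    simp only [mem_range] at hj
    rw [show 2 * k - j = k + (k - j) by omega]

lemma coeff_high (k l : ℕ) (y : ℝ) :
    ∑ j ∈ range (k + 1), (k.choose j : ℝ) * (y - 1) ^ j * ((2 * k - j).choose (k + l) : ℝ)
      = bE k l y := by
  have h := coeff_prod_expand k k (k + l) y
  rw [Finset.sum_congr rfl (g := fun j => (k.choose j : ℝ) * (y - 1) ^ j *
    ((k + (k - j)).choose (k + l) : ℝ))]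
  · rw [h, ← Finset.Nat.sum_antidiagonal_swap]
    simp only [Prod.fst_swap, Prod.snd_swap]
    rw [Finset.Nat.sum_antidiagonal_eq_sum_range_succ
      (fun i j => (k.choose j : ℝ) * ((k.choose i : ℝ) * y ^ (k - i))), bE]
    have hs : range (k + 1) ⊆ range (k + l + 1) := range_subset_range.mpr (by omega)
    rw [← Finset.sum_subset hs]
    · rw [← Finset.sum_range_reflect]
      refine Finset.sum_congr rfl fun a ha => ?_
      simp only [mem_range] at ha
      rw [show k + 1 - 1 - a = k - a by omega, show k - (k - a) = a by omega,
        show k + l - (k - a) = a + l by omega, Nat.choose_symm (by omega)]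
      ring
    · intro a _ ha
      simp only [mem_range] at ha
      rw [Nat.choose_eq_zero_of_lt (show k < a by omega)]; simp
  · intro j hj
    simp only [mem_range] at hj
    rw [show 2 * k - j = k + (k - j) by omega]

lemma hockey (M : ℕ) : ∀ a c : ℕ,
    ∑ l ∈ range M, l.choose a * (M - 1 - l).choose c = M.choose (a + c + 1) := by
  induction M with
  | zero => intro a c; simp
  | succ M ih =>
    intro a c
    rw [Finset.sum_range_succ]
    rcases c with _ | c
    · have := ih a 0
      simp only [Nat.choose_zero_right, mul_one] at this ⊢
      rw [this, add_zero, Nat.choose_succ_succ]; ring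
    · have h1 : ∀ l ∈ range M, l.choose a * (M + 1 - 1 - l).choose (c + 1)
          = l.choose a * (M - 1 - l).choose c + l.choose a * (M - 1 - l).choose (c + 1) := by
        intro l hl
        simp only [mem_range] at hl
        rw [show M + 1 - 1 - l = (M - 1 - l) + 1 by omega, Nat.choose_succ_succ]; ring
      rw [Finset.sum_congr rfl h1, Finset.sum_add_distrib, ih, ih]
      simp only [Nat.add_sub_cancel, Nat.sub_self, Nat.choose_zero_succ, mul_zero, add_zero]
      rw [show a + (c + 1) + 1 = (a + c + 1) + 1 by ring, Nat.choose_succ_succ]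

/-! #### mean -/

lemma pow_series_geom (a : ℝ) : (1 - PowerSeries.C a * PowerSeries.X) *
    (PowerSeries.mk fun k => a ^ k) = 1 := by
  ext n
  rw [sub_mul, one_mul, mul_assoc, map_sub, PowerSeries.coeff_C_mul]
  rcases n with _ | n
  · simp
  · rw [PowerSeries.coeff_succ_X_mul, PowerSeries.coeff_mk, PowerSeries.coeff_mk,
      PowerSeries.coeff_one, if_neg (by omega)]; ring

lemma ep_first (k : ℕ) (y : ℝ) (hy : 0 ≤ y) :
    (PowerSeries.coeff k (ts * qs ^ 2 * B0 * Is)).eval y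
      = (1 / 4) * ((1 - Real.sqrt y) ^ (2 * k) + (1 + Real.sqrt y) ^ (2 * k))
        - (1 / 2) * bE k 0 y := by
  set φ := PowerSeries.map (evalRingHom y)
  set s := Real.sqrt y
  have hs : s ^ 2 = y := Real.sq_sqrt hy
  have hφ : ∀ F, (PowerSeries.coeff k F).eval y = PowerSeries.coeff k (φ F) := by
    intro F; simp [φ]
  have ht : φ ts = PowerSeries.C (s ^ 2) := by simp [φ, hs]
  have hu : φ us = PowerSeries.X := by simp [φ]
  have eq := congrArg φ qs_eq
  have eI := congrArg φ hI
  simp only [map_mul, map_add, map_sub, map_one, map_pow, ht, hu] at eq eI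
  have g1 := pow_series_geom ((1 + s) ^ 2)
  have g2 := pow_series_geom ((1 - s) ^ 2)
  have key : φ (ts * qs ^ 2 * B0 * Is) = PowerSeries.C (1 / 4) *
      ((PowerSeries.mk fun k => ((1 - s) ^ 2) ^ k) + (PowerSeries.mk fun k => ((1 + s) ^ 2) ^ k))
      - PowerSeries.C (1 / 2) * φ B0 := by
    have c4 : (PowerSeries.C (1 / 4 : ℝ)) * 4 = 1 := by
      rw [← map_ofNat (PowerSeries.C (R := ℝ)) 4, ← map_mul]; norm_num
    have c2 : (PowerSeries.C (1 / 2 : ℝ)) = 2 * PowerSeries.C (1 / 4 : ℝ) := by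
      rw [← map_ofNat (PowerSeries.C (R := ℝ)) 2, ← map_mul]; norm_num
    unfold B0
    simp only [map_mul, map_add, map_sub, map_one, map_pow, ht, c2] at *
    generalize (PowerSeries.mk fun k => ((1 + s) ^ 2) ^ k) = F at *
    generalize (PowerSeries.mk fun k => ((1 - s) ^ 2) ^ k) = G at *
    generalize PowerSeries.C s = z at *
    generalize PowerSeries.C (1 / 4 : ℝ) = w at *
    generalize φ qs = q at *
    generalize φ Is = I at *
    generalize (PowerSeries.X : PowerSeries ℝ) = u at *
    have f1 : F * (1 - z * q) ^ 2 = (1 + q) * (1 + z ^ 2 * q) := by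
      linear_combination ((1 + q) * (1 + z ^ 2 * q)) * g1 - F * (1 + z) ^ 2 * eq
    have f2 : G * (1 + z * q) ^ 2 = (1 + q) * (1 + z ^ 2 * q) := by
      linear_combination ((1 + q) * (1 + z ^ 2 * q)) * g2 - G * (1 - z) ^ 2 * eq
    have f3 : F = I ^ 2 * (1 + z * q) ^ 2 * ((1 + q) * (1 + z ^ 2 * q)) := by
      linear_combination I ^ 2 * (1 + z * q) ^ 2 * f1 - F * ((1 - z ^ 2 * q ^ 2) * I + 1) * eI
    have f4 : G = I ^ 2 * (1 - z * q) ^ 2 * ((1 + q) * (1 + z ^ 2 * q)) := by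
      linear_combination I ^ 2 * (1 - z * q) ^ 2 * f2 - G * ((1 - z ^ 2 * q ^ 2) * I + 1) * eI
    rw [f3, f4]
    linear_combination (-z ^ 2 * q ^ 2 * ((1 + q) * (1 + z ^ 2 * q)) * I ^ 2) * c4
      - 2 * w * ((1 + q) * (1 + z ^ 2 * q)) * I * eI
  rw [hφ, key, map_sub, PowerSeries.coeff_C_mul, PowerSeries.coeff_C_mul, map_add,
    PowerSeries.coeff_mk, PowerSeries.coeff_mk, ← pow_mul, ← pow_mul, ← hφ, ← eval_bb, bb]
  simp

lemma ep_eval (k : ℕ) (y : ℝ) (hy : 0 ≤ y) :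
    (ep k).eval y = (1 / 4) * ((1 - Real.sqrt y) ^ (2 * k) + (1 + Real.sqrt y) ^ (2 * k))
        - (1 / 2) * bE k 0 y - 2 * y * bE k 2 y := by
  rw [← ep_first k y hy, ← eval_bb, ep, es, mul_sub, map_sub, eval_sub]
  congr 1
  rw [show ts * qs ^ 2 * B0 * 2 = PowerSeries.C (2 * X) * (qs ^ 2 * B0) by
    rw [map_mul, map_ofNat]; ring, PowerSeries.coeff_C_mul, bb]
  simp

lemma mean_formula (k : ℕ) (hk : 2 ≤ k) (y : ℝ) (hy : 0 < y) :
    (1 / 4) * ((1 - Real.sqrt y) ^ (2 * k) + (1 + Real.sqrt y) ^ (2 * k))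
            - (1 / 2) * ∑ j ∈ Finset.range (k + 1),
                (Nat.choose k j : ℝ) ^ 2 * y ^ (k - j)
            - (2 / y) * ∑ j ∈ Finset.range (k + 1),
                (Nat.choose k j : ℝ) * (y - 1) ^ j * (Nat.choose (2 * k - j) (k - 2) : ℝ)
            + ∑ j ∈ Finset.range (k + 1),
                (Nat.choose k j : ℝ) * (y - 1) ^ j
                  * (Nat.choose (2 * k - j - 1) (k - 2) : ℝ)
    = (ep k).eval y + (y * (derivative (mp k)).eval y - (mp k).eval y) := by
  have h0 : ∑ j ∈ Finset.range (k + 1), (Nat.choose k j : ℝ) ^ 2 * y ^ (k - j) = bE k 0 y := by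
    rw [bE, ← Finset.sum_range_reflect]
    refine Finset.sum_congr rfl fun j hj => ?_
    simp only [mem_range] at hj
    rw [show k + 1 - 1 - j = k - j by omega, Nat.choose_symm (by omega), show k - (k - j) = j by omega,
      add_zero]
    ring
  have h1 : ∑ j ∈ Finset.range (k + 1), (Nat.choose k j : ℝ) * (y - 1) ^ j
      * (Nat.choose (2 * k - j - 1) (k - 2) : ℝ)
      = y * (derivative (mp k)).eval y - (mp k).eval y := by
    have h := coeff_prod_expand (k - 1) k (k - 2) y
    rw [Finset.sum_congr rfl (g := fun j => (k.choose j : ℝ) * (y - 1) ^ j *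
      ((k - 1 + (k - j)).choose (k - 2) : ℝ))]
    · rw [h, Finset.Nat.sum_antidiagonal_eq_sum_range_succ
        (fun i j => ((k - 1).choose i : ℝ) * ((k.choose j : ℝ) * y ^ (k - j))),
        eval_dmp k (by omega), eval_mp k (by omega), Finset.mul_sum, ← Finset.sum_sub_distrib]
      obtain ⟨m, rfl⟩ : ∃ m, k = m + 2 := ⟨k - 2, by omega⟩
      rw [show (m + 2 - 2).succ = m + 1 by omega, show m + 2 = m + 1 + 1 by omega,
        Finset.sum_range_succ' _ (m + 1)]
      simp only [Nat.add_sub_cancel]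
      simp only [pow_zero, zero_add, mul_one, Nat.choose_zero_right, Nat.cast_zero, Nat.cast_one]
      rw [pow_one, div_one, one_mul, sub_self, add_zero]
      refine Finset.sum_congr rfl fun i hi => ?_
      simp only [mem_range] at hi
      rw [show m + 1 + 1 - 2 - i = (m + 1 + 1) - (i + 2) by omega, Nat.choose_symm (by omega),
        show m + 1 + 1 - (m + 1 + 1 - (i + 2)) = i + 2 by omega]
      have a1 : (((m + 1 + 1).choose (i + 2) : ℕ) : ℝ) * ((i : ℝ) + 2)
          = (m + 1 + 1).choose (i + 1) * ((m : ℝ) + 1 - i) := by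
        have := Nat.choose_succ_right_eq (m + 1 + 1) (i + 1)
        have h' : ((m + 1 + 1 - (i + 1) : ℕ) : ℝ) = (m : ℝ) + 1 - i := by
          rw [Nat.cast_sub (by omega)]; push_cast; ring
        rw [← h']; exact_mod_cast this
      have a2 : (((m + 1).choose (i + 1) : ℕ) : ℝ) * ((i : ℝ) + 1)
          = (m + 1).choose i * ((m : ℝ) + 1 - i) := by
        have := Nat.choose_succ_right_eq (m + 1) i
        have h' : ((m + 1 - i : ℕ) : ℝ) = (m : ℝ) + 1 - i := by
          rw [Nat.cast_sub (by omega)]; push_cast; ring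
        rw [← h']; exact_mod_cast this
      have : (i : ℝ) + 1 + 1 ≠ 0 := by positivity
      push_cast
      field_simp
      linear_combination (y ^ (i+2) * (m + 1).choose i) * a1 - (y ^ (i+2) * (m + 1 + 1).choose (i + 1)) * a2
    · intro j hj
      simp only [mem_range] at hj
      rw [show 2 * k - j - 1 = k - 1 + (k - j) by omega]
  rw [h0, h1, coeff_low k 2 hk, ep_eval k y hy.le]
  field_simp

/-! #### variance -/

lemma VV_eval (k : ℕ) (y : ℝ) :
    (VV k k k).eval y = 2 * ∑ l ∈ Icc 2 k, (l : ℝ) * y ^ l * bE k l y ^ 2 := by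
  rw [VV, eval_finset_sum, Finset.mul_sum]
  have hs : ∑ l ∈ Icc 2 k, 2 * ((l : ℝ) * y ^ l * bE k l y ^ 2)
      = ∑ l ∈ Ico 2 (2 * k + 1 + 2), 2 * ((l : ℝ) * y ^ l * bE k l y ^ 2) := by
    apply Finset.sum_subset
    · intro l hl; simp only [mem_Icc, mem_Ico] at *; omega
    · intro l hl hl2
      simp only [mem_Icc, mem_Ico] at *
      rw [← eval_bb, bb_eq_zero k l (by omega)]; simp
  rw [hs, Finset.sum_Ico_eq_sum_range, show 2 * k + 1 + 2 - 2 = 2 * k + 1 by omega]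
  refine Finset.sum_congr rfl fun r _ => ?_
  simp only [eval_mul, eval_pow, eval_X, eval_natCast, eval_ofNat, eval_bb]
  rw [add_comm 2 r]; ring

lemma var_formula (k : ℕ) (hk : 2 ≤ k) (y : ℝ) (hy : 0 < y) :
    2 * ∑ j1 ∈ Finset.range k, ∑ j2 ∈ Finset.range (k + 1),
                (Nat.choose k j1 : ℝ) * (Nat.choose k j2 : ℝ) * (y - 1) ^ (j1 + j2)
                  * ∑ l ∈ Finset.Icc 1 (k - j1),
                      (l : ℝ) * (Nat.choose (2 * k - 1 - (j1 + l)) (k - 1) : ℝ)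
                        * (Nat.choose (2 * k - 1 - j2 + l) (k - 1) : ℝ)
              - (2 / y) * ∑ j1 ∈ Finset.range (k + 1), ∑ j2 ∈ Finset.range (k + 1),
                  (Nat.choose k j1 : ℝ) * (Nat.choose k j2 : ℝ) * (y - 1) ^ (j1 + j2)
                    * (Nat.choose (2 * k - j1) (k - 1) : ℝ)
                    * (Nat.choose (2 * k - j2) (k - 1) : ℝ)
    = (VV k k k).eval y := by
  set A : ℕ → ℝ := fun l => ∑ j ∈ range (k + 1), (k.choose j : ℝ) * (y - 1) ^ j *
    ((2 * k - 1 - (j + l)).choose (k - 1) : ℝ) with hA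
  set A' : ℕ → ℝ := fun l => ∑ j ∈ range (k + 1), (k.choose j : ℝ) * (y - 1) ^ j *
    ((2 * k - 1 - j + l).choose (k - 1) : ℝ) with hA'
  have h1 : ∑ j1 ∈ Finset.range (k + 1), ∑ j2 ∈ Finset.range (k + 1),
      (Nat.choose k j1 : ℝ) * (Nat.choose k j2 : ℝ) * (y - 1) ^ (j1 + j2)
        * (Nat.choose (2 * k - j1) (k - 1) : ℝ) * (Nat.choose (2 * k - j2) (k - 1) : ℝ)
      = (y * bE k 1 y) ^ 2 := by
    have := coeff_low k 1 (by omega) y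
    rw [pow_one] at this
    rw [← this, pow_two, Finset.sum_mul_sum]
    exact Finset.sum_congr rfl fun i _ => Finset.sum_congr rfl fun j _ => by ring
  have hz : ∀ j l, k < j + l → (2 * k - 1 - (j + l)).choose (k - 1) = 0 := fun j l h =>
    Nat.choose_eq_zero_of_lt (by omega)
  have h2 : ∑ j1 ∈ Finset.range k, ∑ j2 ∈ Finset.range (k + 1),
                (Nat.choose k j1 : ℝ) * (Nat.choose k j2 : ℝ) * (y - 1) ^ (j1 + j2)
                  * ∑ l ∈ Finset.Icc 1 (k - j1),
                      (l : ℝ) * (Nat.choose (2 * k - 1 - (j1 + l)) (k - 1) : ℝ)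
                        * (Nat.choose (2 * k - 1 - j2 + l) (k - 1) : ℝ)
      = ∑ l ∈ Icc 1 k, (l : ℝ) * A l * A' l := by
    have e1 : ∀ j1 j2, ∑ l ∈ Finset.Icc 1 (k - j1),
        (l : ℝ) * (Nat.choose (2 * k - 1 - (j1 + l)) (k - 1) : ℝ)
          * (Nat.choose (2 * k - 1 - j2 + l) (k - 1) : ℝ)
        = ∑ l ∈ Finset.Icc 1 k, (l : ℝ) * (Nat.choose (2 * k - 1 - (j1 + l)) (k - 1) : ℝ)
          * (Nat.choose (2 * k - 1 - j2 + l) (k - 1) : ℝ) := by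
      intro j1 j2
      apply Finset.sum_subset
      · intro l hl; simp only [mem_Icc] at *; omega
      · intro l hl hl2
        simp only [mem_Icc] at *
        rw [hz j1 l (by omega)]; simp
    simp only [e1]
    have e2 : ∀ l ∈ Icc 1 k, (l : ℝ) * A l * A' l = ∑ j1 ∈ Finset.range k, ∑ j2 ∈ Finset.range (k + 1),
        (Nat.choose k j1 : ℝ) * (Nat.choose k j2 : ℝ) * (y - 1) ^ (j1 + j2)
        * ((l : ℝ) * (Nat.choose (2 * k - 1 - (j1 + l)) (k - 1) : ℝ)
          * (Nat.choose (2 * k - 1 - j2 + l) (k - 1) : ℝ)) := by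
      intro l hl
      simp only [mem_Icc] at hl
      rw [hA, hA']
      simp only
      rw [Finset.sum_range_succ _ k, hz k l (by omega), Nat.cast_zero, mul_zero, add_zero, mul_assoc,
        Finset.sum_mul_sum, Finset.mul_sum]
      refine Finset.sum_congr rfl fun i _ => ?_
      rw [Finset.mul_sum]
      exact Finset.sum_congr rfl fun j _ => by rw [pow_add]; ring
    rw [Finset.sum_congr rfl e2]
    conv_rhs => rw [Finset.sum_comm]
    refine Finset.sum_congr rfl fun j1 _ => ?_
    conv_rhs => rw [Finset.sum_comm]
    refine Finset.sum_congr rfl fun j2 _ => ?_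
    rw [Finset.mul_sum]
  -- hockey stick
  have h3 : ∀ a, 1 ≤ a → ∑ l ∈ Icc 1 k, (l.choose a : ℝ) * A l = bE k a y := by
    intro a ha
    rw [← coeff_high k a y]
    simp only [hA, Finset.mul_sum]
    rw [Finset.sum_comm]
    refine Finset.sum_congr rfl fun j hj => ?_
    simp only [mem_range] at hj
    have hh := hockey (2 * k - j) a (k - 1)
    rw [show a + (k - 1) + 1 = k + a by omega] at hh
    rw [← hh]
    push_cast
    rw [Finset.mul_sum]
    have hsub : Icc 1 k ⊆ range (2 * k) := by
      intro l hl; simp only [mem_Icc, mem_range] at *; omega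
    have hsub2 : range (2 * k - j) ⊆ range (2 * k) := range_subset_range.mpr (by omega)
    rw [Finset.sum_subset hsub2, Finset.sum_subset hsub]
    · refine Finset.sum_congr rfl fun l _ => ?_
      rw [show 2 * k - 1 - (j + l) = 2 * k - j - 1 - l by omega]; ring
    · intro l hl hl2
      simp only [mem_Icc, mem_range] at *
      rcases Nat.eq_zero_or_pos l with rfl | h
      · rw [Nat.choose_eq_zero_of_lt ha]; simp
      · rw [hz j l (by omega)]; simp
    · intro l hl hl2
      simp only [mem_range] at *
      rw [Nat.choose_eq_zero_of_lt (show 2 * k - j - 1 - l < k - 1 by omega)]; simp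
  have h4 : ∀ l ∈ Icc 1 k, A' l = ∑ b ∈ range k, ((l - 1).choose b : ℝ) * (y ^ (b + 1) * bE k (b + 1) y) := by
    intro l hl
    simp only [mem_Icc] at hl
    simp only [hA']
    have e : ∀ j ∈ range (k + 1), (k.choose j : ℝ) * (y - 1) ^ j * ((2 * k - 1 - j + l).choose (k - 1) : ℝ)
        = ∑ b ∈ range k, ((l - 1).choose b : ℝ) * ((k.choose j : ℝ) * (y - 1) ^ j *
          ((2 * k - j).choose (k - (b + 1)) : ℝ)) := by
      intro j hj
      simp only [mem_range] at hj
      rw [show 2 * k - 1 - j + l = (l - 1) + (2 * k - j) by omega, Nat.add_choose_eq,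
        Finset.Nat.sum_antidiagonal_eq_sum_range_succ
          (fun i m => (l - 1).choose i * (2 * k - j).choose m), show (k - 1).succ = k by omega]
      push_cast
      rw [Finset.mul_sum]
      refine Finset.sum_congr rfl fun b _ => ?_
      rw [show k - (b + 1) = k - 1 - b by omega]; ring
    rw [Finset.sum_congr rfl e, Finset.sum_comm]
    refine Finset.sum_congr rfl fun b hb => ?_
    simp only [mem_range] at hb
    rw [← Finset.mul_sum, coeff_low k (b + 1) (by omega)]
  have h5 : ∑ l ∈ Icc 1 k, (l : ℝ) * A l * A' l
      = ∑ b ∈ range k, ((b : ℝ) + 1) * y ^ (b + 1) * bE k (b + 1) y ^ 2 := by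
    have e : ∀ l ∈ Icc 1 k, (l : ℝ) * A l * A' l = ∑ b ∈ range k,
        ((b : ℝ) + 1) * (y ^ (b + 1) * bE k (b + 1) y) * ((l.choose (b + 1) : ℝ) * A l) := by
      intro l hl
      rw [h4 l hl, Finset.mul_sum]
      refine Finset.sum_congr rfl fun b _ => ?_
      simp only [mem_Icc] at hl
      have := Nat.add_one_mul_choose_eq (l - 1) b
      rw [show l - 1 + 1 = l by omega] at this
      have h' : (l : ℝ) * ((l - 1).choose b : ℝ) = (l.choose (b + 1) : ℝ) * ((b : ℝ) + 1) := by
        exact_mod_cast this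
      linear_combination (A l * (y ^ (b + 1) * bE k (b + 1) y)) * h'
    rw [Finset.sum_congr rfl e, Finset.sum_comm]
    refine Finset.sum_congr rfl fun b _ => ?_
    rw [← Finset.mul_sum, h3 (b + 1) (by omega)]; ring
  rw [h1, h2, h5, VV_eval]
  obtain ⟨m, rfl⟩ : ∃ m, k = m + 1 := ⟨k - 1, by omega⟩
  rw [Finset.sum_range_succ']
  have : ∑ l ∈ Icc 2 (m + 1), (l : ℝ) * y ^ l * bE (m + 1) l y ^ 2
      = ∑ b ∈ range m, (((b + 1 : ℕ) : ℝ) + 1) * y ^ (b + 1 + 1) * bE (m + 1) (b + 1 + 1) y ^ 2 := by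
    rw [show Icc 2 (m + 1) = Ico 2 (m + 2) from rfl, Finset.sum_Ico_eq_sum_range,
      show m + 2 - 2 = m by omega]
    refine Finset.sum_congr rfl fun b _ => ?_
    rw [show 2 + b = b + 1 + 1 by ring]; push_cast; ring
  rw [this]
  field_simp
  simp
  ring

end Spear

open MeasureTheory Finset
namespace Spear
open Matrix

abbrev Mat (n : ℕ) := Matrix (Fin n) (Fin n) ℝ
abbrev Pm (n : ℕ) := Equiv.Perm (Fin n)

/-! ### averages over permutations -/
section av
variable {n : ℕ} {E : Type*} [AddCommGroup E] [Module ℝ E]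

noncomputable def av (f : Pm n → E) : E := ((Fintype.card (Pm n) : ℝ)⁻¹) • ∑ σ, f σ

lemma card_pos' : 0 < ((Fintype.card (Pm n) : ℝ)) := by
  exact_mod_cast Fintype.card_pos

lemma av_add (f g : Pm n → E) : av (fun σ => f σ + g σ) = av f + av g := by
  simp [av, Finset.sum_add_distrib]
lemma av_sub (f g : Pm n → E) : av (fun σ => f σ - g σ) = av f - av g := by
  simp [av, Finset.sum_sub_distrib, smul_sub]
lemma av_smul (c : ℝ) (f : Pm n → E) : av (fun σ => c • f σ) = c • av f := by
  simp only [av, ← Finset.smul_sum, smul_comm c]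
lemma av_const (c : E) : av (fun _ : Pm n => c) = c := by
  simp only [av, Finset.sum_const, Finset.card_univ]
  rw [← Nat.cast_smul_eq_nsmul ℝ, smul_smul, inv_mul_cancel₀ card_pos'.ne', one_smul]
lemma av_sum {ι : Type*} (s : Finset ι) (f : ι → Pm n → E) :
    av (fun σ => ∑ i ∈ s, f i σ) = ∑ i ∈ s, av (f i) := by
  simp only [av]; rw [Finset.sum_comm, Finset.smul_sum]
lemma av_mulRight (τ : Pm n) (f : Pm n → E) : av (fun σ => f (σ * τ)) = av f := by
  simp only [av]; congr 1
  exact Equiv.sum_comp (Equiv.mulRight τ) f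
lemma av_comm {m : ℕ} (f : Pm n → Pm m → E) :
    av (fun σ => av (fun τ => f σ τ)) = av (fun τ => av (fun σ => f σ τ)) := by
  simp only [av, ← Finset.smul_sum]; rw [Finset.sum_comm, smul_comm]
end av

section avR
variable {n : ℕ}
lemma av_mul (c : ℝ) (f : Pm n → ℝ) : av (fun σ => c * f σ) = c * av f := av_smul c f
lemma av_mul' (c : ℝ) (f : Pm n → ℝ) : av (fun σ => f σ * c) = av f * c := by
  simp only [mul_comm _ c, av_mul]
lemma av_mono {f g : Pm n → ℝ} (h : ∀ σ, f σ ≤ g σ) : av f ≤ av g := by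
  simp only [av, smul_eq_mul]
  exact mul_le_mul_of_nonneg_left (Finset.sum_le_sum fun σ _ => h σ) (inv_nonneg.2 card_pos'.le)
lemma av_nonneg {f : Pm n → ℝ} (h : ∀ σ, 0 ≤ f σ) : 0 ≤ av f := by
  have := av_mono h; rwa [av_const] at this
lemma abs_av_le (f : Pm n → ℝ) : |av f| ≤ av (fun σ => |f σ|) := by
  rw [abs_le]; constructor
  · have := av_mono (fun σ => neg_abs_le (f σ))
    have h2 := av_mul (-1) (fun σ => |f σ|)
    simp only [neg_mul, one_mul] at h2; rw [h2] at this; linarith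
  · exact av_mono fun σ => le_abs_self _
lemma norm_av_le (f : Pm n → ℂ) : ‖av f‖ ≤ av (fun σ => ‖f σ‖) := by
  simp only [av, norm_smul, smul_eq_mul, norm_inv, Real.norm_natCast]
  exact mul_le_mul_of_nonneg_left (norm_sum_le _ _) (inv_nonneg.2 card_pos'.le)
/-- Jensen for powers. -/
lemma av_pow_le (f : Pm n → ℝ) (h : ∀ σ, 0 ≤ f σ) (q : ℕ) : (av f) ^ q ≤ av (fun σ => f σ ^ q) := by
  simp only [av, smul_eq_mul, Finset.mul_sum]
  refine Real.pow_arith_mean_le_arith_mean_pow Finset.univ _ f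
    (fun _ _ => inv_nonneg.2 card_pos'.le) ?_ (fun σ _ => h σ) q
  simp only [Finset.sum_const, Finset.card_univ, nsmul_eq_mul]
  exact mul_inv_cancel₀ card_pos'.ne'
lemma av_sq_le (f : Pm n → ℝ) : (av f) ^ 2 ≤ av (fun σ => f σ ^ 2) := by
  have h := av_nonneg (n := n) (f := fun σ => (f σ - av f) ^ 2) (fun σ => sq_nonneg _)
  have : (fun σ => (f σ - av f) ^ 2) = fun σ => (f σ ^ 2 - (2 * av f) * f σ) + (av f)^2 := by
    funext σ; ring
  rw [this, av_add, av_sub, av_mul, av_const] at h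
  nlinarith
end avR

/-! ### the rank vector -/
noncomputable def vv (n : ℕ) (σ : Pm n) : Fin n → ℝ := fun a =>
  Real.sqrt (12 / ((n : ℝ) * ((n : ℝ) ^ 2 - 1))) * (((σ a : ℕ) : ℝ) + 1 - ((n : ℝ) + 1) / 2)

lemma vv_mul {n : ℕ} (σ τ : Pm n) (a : Fin n) : vv n (σ * τ) a = vv n σ (τ a) := rfl

lemma cst_nonneg {n : ℕ} (hn : 2 ≤ n) : 0 ≤ 12 / ((n : ℝ) * ((n : ℝ) ^ 2 - 1)) := by
  have : (2 : ℝ) ≤ n := by exact_mod_cast hn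
  apply div_nonneg (by norm_num)
  apply mul_nonneg (by linarith); nlinarith

lemma sum_id_range (n : ℕ) : ∑ i ∈ range n, (i : ℝ) = n * (n - 1) / 2 := by
  induction n with
  | zero => simp
  | succ n ih => rw [Finset.sum_range_succ, ih]; push_cast; ring
lemma sum_sq_range (n : ℕ) : ∑ i ∈ range n, (i : ℝ) ^ 2 = n * (n - 1) * (2 * n - 1) / 6 := by
  induction n with
  | zero => simp
  | succ n ih => rw [Finset.sum_range_succ, ih]; push_cast; ring

lemma sum_perm {n : ℕ} (σ : Pm n) (f : ℕ → ℝ) : ∑ a, f (σ a : ℕ) = ∑ i ∈ range n, f i := by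
  rw [Equiv.sum_comp σ (fun a : Fin n => f (a : ℕ)), Fin.sum_univ_eq_sum_range]

lemma vv_sum {n : ℕ} (σ : Pm n) : ∑ a, vv n σ a = 0 := by
  simp only [vv, ← Finset.mul_sum]
  rw [sum_perm σ (fun i => (i : ℝ) + 1 - ((n : ℝ) + 1) / 2)]
  simp only [Finset.sum_sub_distrib, Finset.sum_add_distrib, sum_id_range, Finset.sum_const,
    Finset.card_range, nsmul_eq_mul]
  rw [show (n : ℝ) * (n - 1) / 2 + n * 1 - n * ((n + 1) / 2) = 0 by ring, mul_zero]

lemma vv_sum_sq {n : ℕ} (hn : 2 ≤ n) (σ : Pm n) : ∑ a, vv n σ a ^ 2 = 1 := by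
  have h2 : (2 : ℝ) ≤ n := by exact_mod_cast hn
  simp only [vv, mul_pow, ← Finset.mul_sum, Real.sq_sqrt (cst_nonneg hn)]
  rw [sum_perm σ (fun i => ((i : ℝ) + 1 - ((n : ℝ) + 1) / 2) ^ 2)]
  have : ∀ i ∈ range n, ((i : ℝ) + 1 - ((n : ℝ) + 1) / 2) ^ 2
      = (i : ℝ) ^ 2 + (1 - n) * i + ((1 - n) / 2) ^ 2 := by intro i _; ring
  rw [Finset.sum_congr rfl this]
  simp only [Finset.sum_add_distrib, ← Finset.mul_sum, sum_id_range, sum_sq_range,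
    Finset.sum_const, Finset.card_range, nsmul_eq_mul]
  have h3 : (n : ℝ) ≠ 0 := by linarith
  have h4 : (n : ℝ) ^ 2 - 1 ≠ 0 := by nlinarith
  field_simp
  ring

lemma vv_sq_le {n : ℕ} (hn : 2 ≤ n) (σ : Pm n) (a : Fin n) : vv n σ a ^ 2 ≤ 3 / n := by
  have h2 : (2 : ℝ) ≤ n := by exact_mod_cast hn
  simp only [vv, mul_pow, Real.sq_sqrt (cst_nonneg hn)]
  have h1 : ((σ a : ℕ) : ℝ) + 1 ≤ n := by exact_mod_cast (σ a).2
  have h0 : (0 : ℝ) ≤ ((σ a : ℕ) : ℝ) := by positivity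
  have h3 : (((σ a : ℕ) : ℝ) + 1 - ((n : ℝ) + 1) / 2) ^ 2 ≤ (((n : ℝ) - 1) / 2) ^ 2 := by
    apply sq_le_sq'
    · linarith
    · linarith
  calc _ ≤ 12 / ((n : ℝ) * ((n : ℝ) ^ 2 - 1)) * (((n : ℝ) - 1) / 2) ^ 2 :=
        mul_le_mul_of_nonneg_left h3 (cst_nonneg hn)
    _ = 3 * (n - 1) / (n * (n + 1)) := by
        have h3 : (n : ℝ) ≠ 0 := by linarith
        have h4 : (n : ℝ) - 1 ≠ 0 := by linarith
        have h5 : (n : ℝ) + 1 ≠ 0 := by linarith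
        rw [show (n : ℝ) ^ 2 - 1 = (n - 1) * (n + 1) by ring]
        field_simp; ring
    _ ≤ _ := by
        rw [div_le_div_iff₀ (by positivity) (by positivity)]
        nlinarith

/-! ### moments of the rank vector -/
lemma mom_perm {n : ℕ} (τ : Pm n) (F : (Fin n → ℝ) → ℝ) :
    av (fun σ => F (fun a => vv n σ (τ a))) = av (fun σ => F (vv n σ)) :=
  av_mulRight τ (fun σ => F (vv n σ))

lemma av_vv_sq {n : ℕ} (hn : 2 ≤ n) (a : Fin n) : av (fun σ => vv n σ a ^ 2) = 1 / n := by
  have h : ∀ b, av (fun σ => vv n σ b ^ 2) = av (fun σ => vv n σ a ^ 2) := fun b => by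
    have := mom_perm (Equiv.swap a b) (fun v => v a ^ 2)
    simpa using this
  have h1 : av (fun σ => ∑ b, vv n σ b ^ 2) = 1 := by
    simp only [vv_sum_sq hn, av_const]
  rw [av_sum, Finset.sum_congr rfl (fun b _ => h b)] at h1
  simp only [Finset.sum_const, Finset.card_univ, Fintype.card_fin, nsmul_eq_mul] at h1
  have : (n : ℝ) ≠ 0 := by positivity
  field_simp; linarith

lemma av_vv_mul {n : ℕ} (hn : 2 ≤ n) {a b : Fin n} (hab : a ≠ b) :
    av (fun σ => vv n σ a * vv n σ b) = - (1 / (n * (n - 1))) := by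
  have h : ∀ c ∈ univ.erase a, av (fun σ => vv n σ a * vv n σ c)
      = av (fun σ => vv n σ a * vv n σ b) := fun c hc => by
    have hca : c ≠ a := (Finset.mem_erase.1 hc).1
    have := mom_perm (Equiv.swap b c) (fun v => v a * v b)
    simp only [Equiv.swap_apply_left, Equiv.swap_apply_of_ne_of_ne hab hca.symm] at this
    exact this
  have h1 : av (fun σ => ∑ c, vv n σ a * vv n σ c) = 0 := by
    simp only [← Finset.mul_sum, vv_sum, mul_zero, av_const]
  rw [av_sum, ← Finset.add_sum_erase _ _ (Finset.mem_univ a), Finset.sum_congr rfl h] at h1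
  simp only [← sq, av_vv_sq hn] at h1
  simp only [Finset.sum_const, Finset.card_erase_of_mem (Finset.mem_univ a), Finset.card_univ,
    Fintype.card_fin, nsmul_eq_mul] at h1
  have h2 : (2 : ℝ) ≤ n := by exact_mod_cast hn
  rw [Nat.cast_sub (by omega)] at h1
  have h3 : (n : ℝ) ≠ 0 := by linarith
  have h4 : (n : ℝ) - 1 ≠ 0 := by linarith
  push_cast at h1
  field_simp at h1 ⊢
  linarith

end Spear

open MeasureTheory Finset
namespace Spear
open Matrix

noncomputable def qf {n : ℕ} (A : Mat n) (v : Fin n → ℝ) : ℝ := v ⬝ᵥ (A *ᵥ v)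

lemma qf_eq {n : ℕ} (A : Mat n) (v : Fin n → ℝ) : qf A v = ∑ a, ∑ b, A a b * (v a * v b) := by
  simp only [qf, dotProduct, mulVec, Finset.mul_sum]
  refine Finset.sum_congr rfl fun a _ => Finset.sum_congr rfl fun b _ => by ring

/-- symmetric with zero row sums -/
def Sym0 {n : ℕ} (A : Mat n) : Prop := Aᵀ = A ∧ ∀ a, ∑ b, A a b = 0

lemma Sym0.symm {n : ℕ} {A : Mat n} (h : Sym0 A) (a b : Fin n) : A a b = A b a := by
  conv_lhs => rw [← h.1]
  rfl
lemma Sym0.col {n : ℕ} {A : Mat n} (h : Sym0 A) (b : Fin n) : ∑ a, A a b = 0 := by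
  simp only [h.symm _ b, h.2]

lemma av_vv2 {n : ℕ} (hn : 2 ≤ n) (a b : Fin n) :
    av (fun σ => vv n σ a * vv n σ b)
      = (if a = b then 1 / ((n : ℝ) - 1) else 0) - 1 / (n * (n - 1)) := by
  have h2 : (2 : ℝ) ≤ n := by exact_mod_cast hn
  have h3 : (n : ℝ) ≠ 0 := by linarith
  have h4 : (n : ℝ) - 1 ≠ 0 := by linarith
  split_ifs with h
  · subst h
    simp only [← sq, av_vv_sq hn]
    field_simp
  · rw [av_vv_mul hn h]; ring

lemma av_qf {n : ℕ} (hn : 2 ≤ n) {A : Mat n} (hA : ∀ a, ∑ b, A a b = 0) :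
    av (fun σ => qf A (vv n σ)) = A.trace / (n - 1) := by
  simp only [qf_eq, av_sum, av_mul, av_vv2 hn, mul_sub, Finset.sum_sub_distrib, ← Finset.sum_mul,
    hA]
  simp [Matrix.trace, Finset.sum_div, div_eq_mul_inv, Finset.sum_mul]

lemma perm_ext {n m : ℕ} (x y : Fin m ↪ Fin n) : ∃ τ : Pm n, ∀ i, τ (x i) = y i := by
  have h := (Equiv.Perm.isMultiplyPretransitive (Fin n) m).exists_smul_eq x y
  obtain ⟨g, hg⟩ := h
  exact ⟨g, fun i => by rw [← hg]; rfl⟩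

lemma perm_ext4 {n : ℕ} {a b c d a' b' c' d' : Fin n} (h : [a, b, c, d].Nodup)
    (h' : [a', b', c', d'].Nodup) : ∃ τ : Pm n, τ a = a' ∧ τ b = b' ∧ τ c = c' ∧ τ d = d' := by
  obtain ⟨τ, hτ⟩ := perm_ext (m := 4) ⟨([a, b, c, d]).get, List.nodup_iff_injective_get.1 h⟩
    ⟨([a', b', c', d']).get, List.nodup_iff_injective_get.1 h'⟩
  exact ⟨τ, hτ 0, hτ 1, hτ 2, hτ 3⟩

lemma perm_ext3 {n : ℕ} {a b c a' b' c' : Fin n} (h : [a, b, c].Nodup)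
    (h' : [a', b', c'].Nodup) : ∃ τ : Pm n, τ a = a' ∧ τ b = b' ∧ τ c = c' := by
  obtain ⟨τ, hτ⟩ := perm_ext (m := 3) ⟨([a, b, c]).get, List.nodup_iff_injective_get.1 h⟩
    ⟨([a', b', c']).get, List.nodup_iff_injective_get.1 h'⟩
  exact ⟨τ, hτ 0, hτ 1, hτ 2⟩

lemma perm_ext2 {n : ℕ} {a b a' b' : Fin n} (h : a ≠ b)
    (h' : a' ≠ b') : ∃ τ : Pm n, τ a = a' ∧ τ b = b' := by
  obtain ⟨τ, hτ⟩ := perm_ext (m := 2) ⟨([a, b]).get, List.nodup_iff_injective_get.1 (by simpa using h)⟩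
    ⟨([a', b']).get, List.nodup_iff_injective_get.1 (by simpa using h')⟩
  exact ⟨τ, hτ 0, hτ 1⟩

/-- the five fourth-order moments -/
lemma moments4 {n : ℕ} (hn : 4 ≤ n) : ∃ M4 M31 M22 M211 M1111 : ℝ,
    (∀ a, av (fun σ => vv n σ a ^ 4) = M4) ∧
    (∀ a b, a ≠ b → av (fun σ => vv n σ a ^ 3 * vv n σ b) = M31) ∧
    (∀ a b, a ≠ b → av (fun σ => vv n σ a ^ 2 * vv n σ b ^ 2) = M22) ∧
    (∀ a b c, a ≠ b → a ≠ c → b ≠ c →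
      av (fun σ => vv n σ a ^ 2 * (vv n σ b * vv n σ c)) = M211) ∧
    (∀ a b c d, [a, b, c, d].Nodup →
      av (fun σ => vv n σ a * vv n σ b * (vv n σ c * vv n σ d)) = M1111) := by
  let i0 : Fin n := ⟨0, by omega⟩
  let i1 : Fin n := ⟨1, by omega⟩
  let i2 : Fin n := ⟨2, by omega⟩
  let i3 : Fin n := ⟨3, by omega⟩
  have h01 : i0 ≠ i1 := by simp [i0, i1]
  refine ⟨av (fun σ => vv n σ i0 ^ 4), av (fun σ => vv n σ i0 ^ 3 * vv n σ i1),
    av (fun σ => vv n σ i0 ^ 2 * vv n σ i1 ^ 2),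
    av (fun σ => vv n σ i0 ^ 2 * (vv n σ i1 * vv n σ i2)),
    av (fun σ => vv n σ i0 * vv n σ i1 * (vv n σ i2 * vv n σ i3)), ?_, ?_, ?_, ?_, ?_⟩
  · intro a
    have := mom_perm (Equiv.swap i0 a) (fun v => v i0 ^ 4)
    simpa using this
  · intro a b hab
    obtain ⟨τ, h1, h2⟩ := perm_ext2 h01 hab
    have := mom_perm τ (fun v => v i0 ^ 3 * v i1)
    simpa only [h1, h2] using this
  · intro a b hab
    obtain ⟨τ, h1, h2⟩ := perm_ext2 h01 hab
    have := mom_perm τ (fun v => v i0 ^ 2 * v i1 ^ 2)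
    simpa only [h1, h2] using this
  · intro a b c hab hac hbc
    obtain ⟨τ, h1, h2, h3⟩ := perm_ext3 (a := i0) (b := i1) (c := i2) (a' := a) (b' := b) (c' := c)
      (by simp [i0, i1, i2]) (by simp [hab, hac, hbc])
    have := mom_perm τ (fun v => v i0 ^ 2 * (v i1 * v i2))
    simpa only [h1, h2, h3] using this
  · intro a b c d h
    obtain ⟨τ, h1, h2, h3, h4⟩ := perm_ext4 (a := i0) (b := i1) (c := i2) (d := i3)
      (by simp [i0, i1, i2, i3]) h
    have := mom_perm τ (fun v => v i0 * v i1 * (v i2 * v i3))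
    simpa only [h1, h2, h3, h4] using this

lemma card_ne {n : ℕ} (s : Finset (Fin n)) : ((sᶜ : Finset (Fin n)).card : ℝ) = n - s.card := by
  rw [Finset.card_compl, Fintype.card_fin, Nat.cast_sub]
  simpa using Finset.card_le_univ s

/-- relations between the moments -/
lemma moments4' {n : ℕ} (hn : 4 ≤ n) : ∃ M4 M31 M22 M211 M1111 : ℝ,
    (∀ a, av (fun σ => vv n σ a ^ 4) = M4) ∧
    (∀ a b, a ≠ b → av (fun σ => vv n σ a ^ 3 * vv n σ b) = M31) ∧
    (∀ a b, a ≠ b → av (fun σ => vv n σ a ^ 2 * vv n σ b ^ 2) = M22) ∧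
    (∀ a b c, a ≠ b → a ≠ c → b ≠ c →
      av (fun σ => vv n σ a ^ 2 * (vv n σ b * vv n σ c)) = M211) ∧
    (∀ a b c d, [a, b, c, d].Nodup →
      av (fun σ => vv n σ a * vv n σ b * (vv n σ c * vv n σ d)) = M1111) ∧
    |M4| ≤ 3 / (n:ℝ) ^ 2 ∧ |M31| ≤ 3 / (n:ℝ)^2 ∧ |M22| ≤ 4 / (n:ℝ)^2 ∧ |M211| ≤ 7 / (n:ℝ)^2 ∧
      |M1111| ≤ 21 / (n:ℝ)^2 := by
  obtain ⟨M4, M31, M22, M211, M1111, h4, h31, h22, h211, h1111⟩ := moments4 hn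
  refine ⟨M4, M31, M22, M211, M1111, h4, h31, h22, h211, h1111, ?_⟩
  have hn4 : (4 : ℝ) ≤ n := by exact_mod_cast hn
  let i0 : Fin n := ⟨0, by omega⟩
  let i1 : Fin n := ⟨1, by omega⟩
  let i2 : Fin n := ⟨2, by omega⟩
  have h01 : i0 ≠ i1 := by simp [i0, i1]
  have h02 : i0 ≠ i2 := by simp [i0, i2]
  have h12 : i1 ≠ i2 := by simp [i1, i2]
  have r31 : M4 + (n - 1) * M31 = 0 := by
    have h1 : av (fun σ => ∑ c, vv n σ i0 ^ 3 * vv n σ c) = 0 := by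
      simp only [← Finset.mul_sum, vv_sum, mul_zero, av_const]
    rw [av_sum, ← Finset.sum_add_sum_compl {i0}, Finset.sum_congr (s₁ := {i0}ᶜ) rfl
      (fun c hc => h31 i0 c (by simpa [eq_comm] using hc))] at h1
    simp only [Finset.sum_const, nsmul_eq_mul, card_ne, Finset.sum_singleton, ← pow_succ, h4] at h1
    simpa using h1
  have r22 : M4 + (n - 1) * M22 = 1 / n := by
    have h1 : av (fun σ => ∑ c, vv n σ i0 ^ 2 * vv n σ c ^ 2) = 1 / n := by
      simp only [← Finset.mul_sum, vv_sum_sq (show 2 ≤ n by omega), mul_one]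
      exact av_vv_sq (by omega) i0
    rw [av_sum, ← Finset.sum_add_sum_compl {i0}, Finset.sum_congr (s₁ := {i0}ᶜ) rfl
      (fun c hc => h22 i0 c (by simpa [eq_comm] using hc))] at h1
    simp only [Finset.sum_const, nsmul_eq_mul, card_ne, Finset.sum_singleton, ← pow_add, h4] at h1
    simpa using h1
  have r211 : M31 + M22 + (n - 2) * M211 = 0 := by
    have h1 : av (fun σ => ∑ c, vv n σ i0 ^ 2 * (vv n σ i1 * vv n σ c)) = 0 := by
      simp only [← Finset.mul_sum, vv_sum, mul_zero, av_const]
    rw [av_sum, ← Finset.sum_add_sum_compl {i0, i1}, Finset.sum_congr (s₁ := {i0, i1}ᶜ) rfl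
      (fun c hc => h211 i0 i1 c h01 (by simp at hc; tauto) (by simp at hc; tauto))] at h1
    rw [Finset.sum_pair h01] at h1
    have e1 : (fun σ => vv n σ i0 ^ 2 * (vv n σ i1 * vv n σ i0)) =
      fun σ => vv n σ i0 ^ 3 * vv n σ i1 := by funext σ; ring
    have e2 : (fun σ => vv n σ i0 ^ 2 * (vv n σ i1 * vv n σ i1)) =
      fun σ => vv n σ i0 ^ 2 * vv n σ i1 ^ 2 := by funext σ; ring
    rw [e1, e2, h31 _ _ h01, h22 _ _ h01] at h1
    simp only [Finset.sum_const, nsmul_eq_mul, card_ne, Finset.card_pair h01] at h1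
    simpa using h1
  have r1111 : 3 * M211 + (n - 3) * M1111 = 0 := by
    have h1 : av (fun σ => ∑ c, vv n σ i0 * vv n σ i1 * (vv n σ i2 * vv n σ c)) = 0 := by
      simp only [← Finset.mul_sum, vv_sum, mul_zero, av_const]
    rw [av_sum, ← Finset.sum_add_sum_compl {i0, i1, i2}, Finset.sum_congr (s₁ := {i0, i1, i2}ᶜ) rfl
      (fun c hc => h1111 i0 i1 i2 c (by
        simp only [mem_compl, mem_insert, mem_singleton, not_or] at hc
        simp [h01, h02, h12]
        tauto))] at h1
    have hc3 : ({i0, i1, i2} : Finset (Fin n)).card = 3 := by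
      rw [Finset.card_eq_three]; exact ⟨i0, i1, i2, h01, h02, h12, rfl⟩
    rw [Finset.sum_insert (by simp [h01, h02]), Finset.sum_pair h12] at h1
    have e1 : (fun σ => vv n σ i0 * vv n σ i1 * (vv n σ i2 * vv n σ i0)) =
      fun σ => vv n σ i0 ^ 2 * (vv n σ i1 * vv n σ i2) := by funext σ; ring
    have e2 : (fun σ => vv n σ i0 * vv n σ i1 * (vv n σ i2 * vv n σ i1)) =
      fun σ => vv n σ i1 ^ 2 * (vv n σ i0 * vv n σ i2) := by funext σ; ring
    have e3 : (fun σ => vv n σ i0 * vv n σ i1 * (vv n σ i2 * vv n σ i2)) =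
      fun σ => vv n σ i2 ^ 2 * (vv n σ i0 * vv n σ i1) := by funext σ; ring
    rw [e1, e2, e3, h211 _ _ _ h01 h02 h12, h211 _ _ _ h01.symm h12 h02,
      h211 _ _ _ h02.symm h12.symm h01] at h1
    simp only [Finset.sum_const, nsmul_eq_mul, card_ne, hc3] at h1
    push_cast at h1
    linarith
  have b4 : 0 ≤ M4 := by rw [← h4 i0]; exact av_nonneg fun σ => by positivity
  have b4' : M4 ≤ 3 / (n:ℝ) ^ 2 := by
    rw [← h4 i0]
    have : av (fun σ => vv n σ i0 ^ 4) ≤ av (fun σ => 3 / n * vv n σ i0 ^ 2) := av_mono fun σ => by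
      have := vv_sq_le (show 2 ≤ n by omega) σ i0
      nlinarith [sq_nonneg (vv n σ i0)]
    rw [av_mul, av_vv_sq (by omega)] at this
    refine this.trans (le_of_eq ?_); ring
  have b22 : 0 ≤ M22 := by rw [← h22 i0 i1 h01]; exact av_nonneg fun σ => by positivity
  have e31 : M31 = - M4 / (n - 1) := by
    rw [eq_div_iff (by linarith)]; linarith
  have b31 : |M31| ≤ 3 / (n:ℝ)^2 := by
    rw [e31, abs_div, abs_neg, abs_of_nonneg b4, abs_of_nonneg (by linarith : (0:ℝ) ≤ n - 1)]
    exact (div_le_self b4 (by linarith)).trans b4'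
  have b22' : |M22| ≤ 4 / (n:ℝ)^2 := by
    rw [abs_of_nonneg b22, le_div_iff₀ (by positivity)]
    have h5 : (n - 1) * M22 ≤ 1 / n := by linarith
    rw [le_div_iff₀ (by positivity)] at h5
    nlinarith [mul_nonneg b22 (by linarith : (0:ℝ) ≤ n), mul_nonneg (mul_nonneg b22 (by linarith : (0:ℝ) ≤ n)) (by linarith : (0:ℝ) ≤ n - 4)]
  have b211 : |M211| ≤ 7 / (n:ℝ)^2 := by
    have e : M211 = - (M31 + M22) / (n - 2) := by
      rw [eq_div_iff (by linarith)]; linarith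
    rw [e, abs_div, abs_neg, abs_of_nonneg (by linarith : (0:ℝ) ≤ n - 2)]
    refine (div_le_self (abs_nonneg _) (by linarith)).trans ((abs_add_le _ _).trans ?_)
    refine (add_le_add b31 b22').trans (le_of_eq (by ring))
  refine ⟨by rwa [abs_of_nonneg b4], b31, b22', b211, ?_⟩
  have e : M1111 = - (3 * M211) / (n - 3) := by
    rw [eq_div_iff (by linarith)]; linarith
  rw [e, abs_div, abs_neg, abs_of_nonneg (by linarith : (0:ℝ) ≤ n - 3)]
  refine (div_le_self (abs_nonneg _) (by linarith)).trans ?_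
  rw [abs_mul, abs_of_nonneg (by norm_num : (0:ℝ) ≤ 3)]
  calc 3 * |M211| ≤ 3 * (7 / (n:ℝ)^2) := by gcongr
    _ = _ := by ring

/-- pattern decomposition of the fourth moment tensor -/
lemma tensor4 {n : ℕ} (hn : 4 ≤ n) : ∃ (α κ : ℝ) (f1 f2 f3 f4 : Fin n → Fin n → Fin n → ℝ),
    |κ| ≤ 300 / (n:ℝ)^2 ∧ |α| ≤ 100 / (n:ℝ)^2 ∧ ∀ a b c d,
    av (fun σ => vv n σ a * vv n σ b * (vv n σ c * vv n σ d)) =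
      α * ((if a = b ∧ c = d then 1 else 0) + (if a = c ∧ b = d then 1 else 0)
        + (if a = d ∧ b = c then 1 else 0))
      + κ * (if a = b ∧ a = c ∧ a = d then 1 else 0)
      + (f1 b c d + f2 a c d + f3 a b d + f4 a b c) := by
  obtain ⟨M4, M31, M22, M211, M1111, h4, h31, h22, h211, h1111, b4, b31, b22, b211, b1111⟩ :=
    moments4' hn
  set c1 := M211 - M1111 with hc1
  set c3 := M31 - 3 * M211 + 2 * M1111 with hc3
  refine ⟨M22 - 2 * M211 + M1111, M4 - 3 * M22 - 4 * M31 + 12 * M211 - 6 * M1111,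
    fun b c d => c3 * (if b = c ∧ b = d then 1 else 0),
    fun a c d => c1 * (if c = d then 1 else 0) + c3 * (if a = c ∧ a = d then 1 else 0),
    fun a b d => c1 * ((if a = d then 1 else 0) + (if b = d then 1 else 0))
      + c3 * (if a = b ∧ a = d then 1 else 0),
    fun a b c => M1111 + c1 * ((if a = b then 1 else 0) + (if a = c then 1 else 0)
      + (if b = c then 1 else 0)) + c3 * (if a = b ∧ a = c then 1 else 0), ?_, ?_, ?_⟩
  · have e : (300 : ℝ) / n ^ 2 = 100 * (3 / n^2) := by ring
    have e2 : (4 : ℝ) / n ^ 2 = 4/3 * (3 / n^2) := by ring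
    have e3 : (7 : ℝ) / n ^ 2 = 7/3 * (3 / n^2) := by ring
    have e4 : (21 : ℝ) / n ^ 2 = 7 * (3 / n^2) := by ring
    have : (0:ℝ) ≤ 3 / n^2 := by positivity
    rw [e]; rw [e2] at b22; rw [e3] at b211; rw [e4] at b1111
    rw [abs_le] at *
    constructor <;> linarith [b4.1, b31.1, b22.1, b211.1, b1111.1, b4.2, b31.2, b22.2, b211.2, b1111.2]
  · have e : (100 : ℝ) / n ^ 2 = 100/3 * (3 / n^2) := by ring
    have e2 : (4 : ℝ) / n ^ 2 = 4/3 * (3 / n^2) := by ring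
    have e3 : (7 : ℝ) / n ^ 2 = 7/3 * (3 / n^2) := by ring
    have e4 : (21 : ℝ) / n ^ 2 = 7 * (3 / n^2) := by ring
    have : (0:ℝ) ≤ 3 / n^2 := by positivity
    rw [e]; rw [e2] at b22; rw [e3] at b211; rw [e4] at b1111
    rw [abs_le] at *
    constructor <;> linarith [b4.1, b31.1, b22.1, b211.1, b1111.1, b4.2, b31.2, b22.2, b211.2, b1111.2]
  · intro a b c d
    have key : ∀ {F : Pm n → ℝ} {G : Pm n → ℝ} {M : ℝ}, av G = M → (∀ σ, F σ = G σ) → av F = M := by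
      intro F G M h hh; rw [← h]; congr 1; funext σ; exact hh σ
    by_cases hab : a = b
    · subst hab
      by_cases hac : a = c
      · subst hac
        by_cases had : a = d
        · subst had
          rw [key (h4 a) (fun σ => by ring)]; simp; ring
        · rw [key (h31 a d had) (fun σ => by ring)]; simp [had]; ring
      · by_cases had : a = d
        · subst had
          rw [key (h31 a c hac) (fun σ => by ring)]; simp [hac, Ne.symm hac]; ring
        · by_cases hcd : c = d
          · subst hcd
            rw [key (h22 a c hac) (fun σ => by ring)]; simp [hac]; ring
          · rw [key (h211 a c d hac had hcd) (fun σ => by ring)]; simp [hac, had, hcd]; ring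
    · by_cases hac : a = c
      · subst hac
        by_cases had : a = d
        · subst had
          rw [key (h31 a b hab) (fun σ => by ring)]; simp [hab, Ne.symm hab]; ring
        · by_cases hbd : b = d
          · subst hbd
            rw [key (h22 a b hab) (fun σ => by ring)]; simp [hab, Ne.symm hab]; ring
          · rw [key (h211 a b d hab had hbd) (fun σ => by ring)]
            simp [hab, Ne.symm hab, had, hbd]; ring
      · by_cases had : a = d
        · subst had
          by_cases hbc : b = c
          · subst hbc
            rw [key (h22 a b hab) (fun σ => by ring)]; simp [hab, Ne.symm hab]; ring
          · rw [key (h211 a b c hab hac hbc) (fun σ => by ring)]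
            simp [hab, Ne.symm hab, hac, Ne.symm hac, hbc]; ring
        · by_cases hbc : b = c
          · subst hbc
            by_cases hbd : b = d
            · subst hbd
              rw [key (h31 b a (Ne.symm hab)) (fun σ => by ring)]; simp [hab]; ring
            · rw [key (h211 b a d (Ne.symm hab) hbd had) (fun σ => by ring)]
              simp [hab, had, hbd]; ring
          · by_cases hbd : b = d
            · subst hbd
              rw [key (h211 b a c (Ne.symm hab) hbc hac) (fun σ => by ring)]
              simp [hab, hac, hbc, Ne.symm hbc]; ring
            · by_cases hcd : c = d
              · subst hcd
                rw [key (h211 c a b (Ne.symm hac) (Ne.symm hbc) hab) (fun σ => by ring)]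
                simp [hab, hac, hbc]
                ring
              · rw [h1111 a b c d (by simp [hab, hac, had, hbc, hbd, hcd])]
                simp [hab, hac, had, hbc, hbd, hcd]

/-- fourth order contraction -/
lemma av_qf_qf {n : ℕ} (hn : 4 ≤ n) : ∃ (α κ : ℝ),
    |κ| ≤ 300 / (n:ℝ)^2 ∧ |α| ≤ 100 / (n:ℝ)^2 ∧ ∀ A B : Mat n, Sym0 A → Sym0 B →
    av (fun σ => qf A (vv n σ) * qf B (vv n σ)) =
      α * (A.trace * B.trace + 2 * (A * B).trace) + κ * ∑ a, A a a * B a a := by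
  obtain ⟨α, κ, f1, f2, f3, f4, hκ, hα, hT⟩ := tensor4 hn
  refine ⟨α, κ, hκ, hα, fun A B hA hB => ?_⟩
  have e0 : ∀ v : Fin n → ℝ, qf A v * qf B v
      = ∑ a, ∑ b, ∑ c, ∑ d, A a b * B c d * (v a * v b * (v c * v d)) := by
    intro v
    rw [qf_eq, qf_eq, Finset.sum_mul]
    refine Finset.sum_congr rfl fun a _ => ?_
    rw [Finset.sum_mul]
    refine Finset.sum_congr rfl fun b _ => ?_
    rw [Finset.mul_sum]
    refine Finset.sum_congr rfl fun c _ => ?_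
    rw [Finset.mul_sum]
    refine Finset.sum_congr rfl fun d _ => ?_
    ring
  simp only [e0, av_sum, av_mul, hT]
  have z4 : ∑ a, ∑ b, ∑ c, ∑ d, A a b * B c d * f4 a b c = 0 := by
    refine Finset.sum_eq_zero fun a _ => Finset.sum_eq_zero fun b _ => Finset.sum_eq_zero fun c _ => ?_
    rw [← Finset.sum_mul, ← Finset.mul_sum, hB.2]; simp
  have z3 : ∑ a, ∑ b, ∑ c, ∑ d, A a b * B c d * f3 a b d = 0 := by
    refine Finset.sum_eq_zero fun a _ => Finset.sum_eq_zero fun b _ => ?_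
    rw [Finset.sum_comm]
    refine Finset.sum_eq_zero fun c _ => ?_
    rw [← Finset.sum_mul, ← Finset.mul_sum, hB.col]; simp
  have z2 : ∑ a, ∑ b, ∑ c, ∑ d, A a b * B c d * f2 a c d = 0 := by
    refine Finset.sum_eq_zero fun a _ => ?_
    rw [Finset.sum_comm]
    refine Finset.sum_eq_zero fun c _ => ?_
    rw [Finset.sum_comm]
    refine Finset.sum_eq_zero fun d _ => ?_
    rw [← Finset.sum_mul, ← Finset.sum_mul, hA.2]; simp
  have z1 : ∑ a, ∑ b, ∑ c, ∑ d, A a b * B c d * f1 b c d = 0 := by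
    rw [Finset.sum_comm]
    refine Finset.sum_eq_zero fun b _ => ?_
    rw [Finset.sum_comm]
    refine Finset.sum_eq_zero fun c _ => ?_
    rw [Finset.sum_comm]
    refine Finset.sum_eq_zero fun d _ => ?_
    rw [← Finset.sum_mul, ← Finset.sum_mul, hA.col]; simp
  have p1 : ∑ a, ∑ b, ∑ c, ∑ d, A a b * B c d * (if a = b ∧ c = d then (1:ℝ) else 0)
      = A.trace * B.trace := by
    simp [ite_and, Matrix.trace, Finset.sum_mul_sum]
  have p2 : ∑ a, ∑ b, ∑ c, ∑ d, A a b * B c d * (if a = c ∧ b = d then (1:ℝ) else 0)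
      = (A * B).trace := by
    simp only [ite_and, Matrix.trace, mul_apply, diag_apply, mul_ite, mul_one, mul_zero]
    refine Finset.sum_congr rfl fun a _ => Finset.sum_congr rfl fun b _ => ?_
    rw [Finset.sum_eq_single a]
    · simp [hB.symm a b]
    · intro c _ hc; simp [Ne.symm hc]
    · simp
  have p3 : ∑ a, ∑ b, ∑ c, ∑ d, A a b * B c d * (if a = d ∧ b = c then (1:ℝ) else 0)
      = (A * B).trace := by
    simp only [ite_and, Matrix.trace, mul_apply, diag_apply, mul_ite, mul_one, mul_zero]
    refine Finset.sum_congr rfl fun a _ => Finset.sum_congr rfl fun b _ => ?_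
    rw [Finset.sum_eq_single b]
    · simp
    · intro c _ hc; simp [Ne.symm hc]
    · simp
  have p4 : ∑ a, ∑ b, ∑ c, ∑ d, A a b * B c d * (if a = b ∧ a = c ∧ a = d then (1:ℝ) else 0)
      = ∑ a, A a a * B a a := by
    simp [ite_and]
  have key : ∀ a b c d, A a b * B c d * (α * ((if a = b ∧ c = d then 1 else 0)
        + (if a = c ∧ b = d then 1 else 0) + (if a = d ∧ b = c then 1 else 0))
      + κ * (if a = b ∧ a = c ∧ a = d then 1 else 0)
      + (f1 b c d + f2 a c d + f3 a b d + f4 a b c)) =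
      α * (A a b * B c d * (if a = b ∧ c = d then 1 else 0))
      + α * (A a b * B c d * (if a = c ∧ b = d then 1 else 0))
      + α * (A a b * B c d * (if a = d ∧ b = c then 1 else 0))
      + κ * (A a b * B c d * (if a = b ∧ a = c ∧ a = d then 1 else 0))
      + A a b * B c d * f1 b c d + A a b * B c d * f2 a c d
      + A a b * B c d * f3 a b d + A a b * B c d * f4 a b c := by
    intro a b c d; ring
  simp only [key, Finset.sum_add_distrib, ← Finset.mul_sum, z1, z2, z3, z4, p1, p2, p3, p4]
  ring

end Spear

open MeasureTheory Finset
namespace Spear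
open Matrix

/-- Dirichlet form inequality -/
lemma dirichlet {n : ℕ} (h : Pm n → ℝ) (τ : Pm n) (hτ : τ * τ = 1) :
    - av (fun σ => h σ ^ 3 * (h (σ * τ) - h σ)) ≤ 3 / 2 * av (fun σ => h σ ^ 2 * (h (σ * τ) - h σ) ^ 2) := by
  have sw : ∀ F : ℝ → ℝ → ℝ, av (fun σ => F (h (σ * τ)) (h σ)) = av (fun σ => F (h σ) (h (σ * τ))) := by
    intro F
    have := av_mulRight τ (fun σ => F (h σ) (h (σ * τ)))
    simpa only [mul_assoc, hτ, mul_one] using this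
  have h1 := sw (fun x y => x ^ 3 * (y - x))
  have h2 := sw (fun x y => x ^ 2 * (y - x) ^ 2)
  have h3 : 0 ≤ av (fun σ => (3 / 2 * (h σ ^ 2 * (h (σ * τ) - h σ) ^ 2)
      + 3 / 2 * (h (σ * τ) ^ 2 * (h σ - h (σ * τ)) ^ 2))
      + (h σ ^ 3 * (h (σ * τ) - h σ) + h (σ * τ) ^ 3 * (h σ - h (σ * τ)))) := by
    refine av_nonneg fun σ => ?_
    set x := h σ
    set y := h (σ * τ)
    nlinarith [mul_nonneg (sq_nonneg (x - y)) (sq_nonneg (x - y))]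
  rw [av_add, av_add, av_add, av_mul, av_mul, h1, h2] at h3
  linarith

lemma dirichlet_sum {n : ℕ} (h : Pm n → ℝ) :
    - av (fun σ => h σ ^ 3 * ∑ a, ∑ b, (h (σ * Equiv.swap a b) - h σ)) ≤
      3 / 2 * av (fun σ => h σ ^ 2 * ∑ a, ∑ b, (h (σ * Equiv.swap a b) - h σ) ^ 2) := by
  simp only [Finset.mul_sum, av_sum, ← Finset.sum_neg_distrib]
  refine Finset.sum_le_sum fun a _ => Finset.sum_le_sum fun b _ => ?_
  exact dirichlet h (Equiv.swap a b) (by simp)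

section swapcalc
variable {n : ℕ}

lemma swap_vec (v : Fin n → ℝ) (a b : Fin n) :
    (fun c => v (Equiv.swap a b c)) = v + (v b - v a) • (Pi.single a 1 - Pi.single b 1) := by
  funext c
  by_cases ha : c = a
  · subst ha
    by_cases hb : c = b
    · subst hb; simp
    · simp [hb]
  · by_cases hb : c = b
    · subst hb; simp [ha]
    · simp [Equiv.swap_apply_of_ne_of_ne ha hb, ha, hb]

lemma qf_swap {A : Mat n} (hA : Sym0 A) (v : Fin n → ℝ) (a b : Fin n) :
    qf A (fun c => v (Equiv.swap a b c)) - qf A v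
      = 2 * (v b - v a) * ((A *ᵥ v) a - (A *ᵥ v) b)
        + (v b - v a) ^ 2 * (A a a + A b b - 2 * A a b) := by
  rw [swap_vec]
  have hs : ∀ u w : Fin n → ℝ, u ⬝ᵥ (A *ᵥ w) = w ⬝ᵥ (A *ᵥ u) := by
    intro u w
    rw [dotProduct_mulVec, ← mulVec_transpose, hA.1, dotProduct_comm]
  simp only [qf, mulVec_add, dotProduct_add, add_dotProduct, mulVec_smul, dotProduct_smul,
    smul_dotProduct, smul_eq_mul]
  rw [hs v (Pi.single a 1 - Pi.single b 1)]
  simp only [mulVec_sub, dotProduct_sub, sub_dotProduct, single_dotProduct, one_mul,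
    mulVec_single_one, col_apply]
  rw [hA.symm b a]
  ring

lemma sum_swap_qf {A : Mat n} (hA : Sym0 A) (v : Fin n → ℝ) (hv0 : ∑ a, v a = 0)
    (hv1 : ∑ a, v a ^ 2 = 1) :
    ∑ a, ∑ b, (qf A (fun c => v (Equiv.swap a b c)) - qf A v)
      = -4 * (n - 1) * qf A v + 2 * n * (∑ a, v a ^ 2 * A a a) + 2 * A.trace := by
  simp only [qf_swap hA]
  have hAv : ∑ a, (A *ᵥ v) a = 0 := by
    simp only [mulVec, dotProduct]
    rw [Finset.sum_comm]
    exact Finset.sum_eq_zero fun b _ => by rw [← Finset.sum_mul, hA.col, zero_mul]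
  have q1 : ∑ a, v a * (A *ᵥ v) a = qf A v := rfl
  have q2 : ∑ a, ∑ b, A a b * (v a * v b) = qf A v := (qf_eq A v).symm
  have key : ∀ a b, 2 * (v b - v a) * ((A *ᵥ v) a - (A *ᵥ v) b)
        + (v b - v a) ^ 2 * (A a a + A b b - 2 * A a b)
      = 2 * (v b * (A *ᵥ v) a) - 2 * (v b * (A *ᵥ v) b) - 2 * (v a * (A *ᵥ v) a)
        + 2 * (v a * (A *ᵥ v) b)
        + v b ^ 2 * A a a + v b ^ 2 * A b b + v a ^ 2 * A a a + v a ^ 2 * A b b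
        - 2 * (v b ^ 2 * A a b) - 2 * (v a ^ 2 * A a b)
        - 2 * (v b * (v a * A a a)) - 2 * (v a * (v b * A b b))
        + 4 * (A a b * (v a * v b)) := by intro a b; ring
  have r1 : ∑ a, ∑ b, v b * (A *ᵥ v) a = 0 := by simp [← Finset.sum_mul, hv0]
  have r2 : ∑ a, ∑ b, v a * (A *ᵥ v) b = 0 := by simp [← Finset.mul_sum, hAv]
  have r3 : ∑ a, ∑ b, v b ^ 2 * A a b = 0 := by
    rw [Finset.sum_comm]; simp [← Finset.mul_sum, hA.col]
  have r4 : ∑ a, ∑ b, v a ^ 2 * A a b = 0 := by simp [← Finset.mul_sum, hA.2]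
  have r5 : ∑ a, ∑ b, v b * (v a * A a a) = 0 := by simp [← Finset.sum_mul, hv0]
  have r6 : ∑ a, ∑ b, v a * (v b * A b b) = 0 := by
    rw [Finset.sum_comm]; simp [← Finset.sum_mul, hv0]
  have r7 : ∑ a, ∑ b, v b ^ 2 * A a a = A.trace := by simp [← Finset.sum_mul, hv1, Matrix.trace]
  have r8 : ∑ a, ∑ b, v a ^ 2 * A b b = A.trace := by
    rw [Finset.sum_comm]; simp [← Finset.sum_mul, hv1, Matrix.trace]
  have r9 : ∑ a : Fin n, ∑ b, v b * (A *ᵥ v) b = n * qf A v := by simp [q1]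
  have r10 : ∑ a, ∑ b : Fin n, v a * (A *ᵥ v) a = n * qf A v := by
    simp [← Finset.mul_sum, q1]
  have r11 : ∑ a : Fin n, ∑ b, v b ^ 2 * A b b = n * ∑ a, v a ^ 2 * A a a := by simp
  have r12 : ∑ a, ∑ b : Fin n, v a ^ 2 * A a a = n * ∑ a, v a ^ 2 * A a a := by
    simp [← Finset.mul_sum]
  have E : ∑ a, ∑ b, (2 * (v b - v a) * ((A *ᵥ v) a - (A *ᵥ v) b)
        + (v b - v a) ^ 2 * (A a a + A b b - 2 * A a b))
      = 2 * ∑ a, ∑ b, (v b * (A *ᵥ v) a) - 2 * ∑ a : Fin n, ∑ b, (v b * (A *ᵥ v) b)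
        - 2 * ∑ a, ∑ b : Fin n, (v a * (A *ᵥ v) a)
        + 2 * ∑ a, ∑ b, (v a * (A *ᵥ v) b)
        + ∑ a, ∑ b, v b ^ 2 * A a a + ∑ a : Fin n, ∑ b, v b ^ 2 * A b b
        + ∑ a, ∑ b : Fin n, v a ^ 2 * A a a + ∑ a, ∑ b, v a ^ 2 * A b b
        - 2 * ∑ a, ∑ b, (v b ^ 2 * A a b) - 2 * ∑ a, ∑ b, (v a ^ 2 * A a b)
        - 2 * ∑ a, ∑ b, (v b * (v a * A a a)) - 2 * ∑ a, ∑ b, (v a * (v b * A b b))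
        + 4 * ∑ a, ∑ b, (A a b * (v a * v b)) := by
    simp only [key, Finset.sum_add_distrib, Finset.sum_sub_distrib, Finset.mul_sum]
  rw [E, r1, r2, r3, r4, r5, r6, r7, r8, r9, r10, r11, r12, q2]
  ring

lemma diag_swap (d : Fin n → ℝ) (v : Fin n → ℝ) (a b : Fin n) :
    ∑ c, (v (Equiv.swap a b c)) ^ 2 * d c - ∑ c, v c ^ 2 * d c = (v b ^ 2 - v a ^ 2) * (d a - d b) := by
  have := congrFun (swap_vec (fun c => v c ^ 2) a b)
  simp only [this]
  simp [add_mul, Finset.sum_add_distrib, sub_mul, mul_sub, Finset.sum_sub_distrib, mul_assoc,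
    ← Finset.mul_sum, Pi.single_apply]

lemma sum_diag_swap (d : Fin n → ℝ) (v : Fin n → ℝ) (hv1 : ∑ a, v a ^ 2 = 1) :
    ∑ a, ∑ b, (∑ c, (v (Equiv.swap a b c)) ^ 2 * d c - ∑ c, v c ^ 2 * d c)
      = 2 * ∑ a, d a - 2 * n * ∑ a, v a ^ 2 * d a := by
  simp only [diag_swap]
  have key : ∀ a b, (v b ^ 2 - v a ^ 2) * (d a - d b)
      = v b ^ 2 * d a - v b ^ 2 * d b - v a ^ 2 * d a + v a ^ 2 * d b := by intro a b; ring
  have r7 : ∑ a, ∑ b, v b ^ 2 * d a = ∑ a, d a := by simp [← Finset.sum_mul, hv1]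
  have r8 : ∑ a, ∑ b, v a ^ 2 * d b = ∑ a, d a := by
    rw [Finset.sum_comm]; simp [← Finset.sum_mul, hv1]
  simp only [key, Finset.sum_add_distrib, Finset.sum_sub_distrib, r7, r8]
  simp only [Finset.sum_const, Finset.card_univ, Fintype.card_fin, nsmul_eq_mul, ← Finset.mul_sum]
  ring

lemma tr_sq {A : Mat n} (hA : Sym0 A) : (A * A).trace = ∑ a, ∑ b, A a b ^ 2 := by
  simp only [Matrix.trace, mul_apply, diag_apply]
  refine Finset.sum_congr rfl fun a _ => Finset.sum_congr rfl fun b _ => by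
    rw [hA.symm b a]; ring

lemma qf_sq {A : Mat n} (hA : Sym0 A) (v : Fin n → ℝ) : qf (A * A) v = ∑ a, (A *ᵥ v) a ^ 2 := by
  simp only [qf]
  rw [← mulVec_mulVec, dotProduct_mulVec, ← mulVec_transpose, hA.1]
  simp [dotProduct, sq]

lemma diag_sq_le {A : Mat n} (hA : Sym0 A) : ∑ a, A a a ^ 2 ≤ (A * A).trace := by
  rw [tr_sq hA]
  refine Finset.sum_le_sum fun a _ => ?_
  exact Finset.single_le_sum (f := fun b => A a b ^ 2) (fun b _ => sq_nonneg _) (Finset.mem_univ a)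

lemma gam_f_le {A : Mat n} (hA : Sym0 A) (hn : 4 ≤ n) (v : Fin n → ℝ) (hv : ∀ a, v a ^ 2 ≤ 3 / n) :
    ∑ a, ∑ b, (qf A (fun c => v (Equiv.swap a b c)) - qf A v) ^ 2
      ≤ 384 * qf (A * A) v + 5184 * ((A * A).trace / n) := by
  have hn4 : (4 : ℝ) ≤ n := by exact_mod_cast hn
  simp only [qf_swap hA]
  have hd : ∀ a b, (v b - v a) ^ 2 ≤ 12 / n := by
    intro a b
    have h1 := hv a
    have h2 := hv b
    have : (12 : ℝ) / n = 4 * (3 / n) := by ring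
    rw [this]
    nlinarith [sq_nonneg (v a + v b)]
  have h12 : (0:ℝ) ≤ 12 / n := by positivity
  have key : ∀ a b, (2 * (v b - v a) * ((A *ᵥ v) a - (A *ᵥ v) b)
        + (v b - v a) ^ 2 * (A a a + A b b - 2 * A a b)) ^ 2 ≤
      12 / n * 16 * ((A *ᵥ v) a ^ 2 + (A *ᵥ v) b ^ 2)
      + (12 / n) ^ 2 * (6 * A a a ^ 2 + 6 * A b b ^ 2 + 24 * A a b ^ 2) := by
    intro a b
    set d := v b - v a
    set x := (A *ᵥ v) a
    set y := (A *ᵥ v) b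
    set q := A a a + A b b - 2 * A a b with hq
    have e1 : (2 * d * (x - y) + d ^ 2 * q) ^ 2 ≤ 8 * d ^ 2 * (x - y) ^ 2 + 2 * (d ^ 2) ^ 2 * q ^ 2 := by
      nlinarith [sq_nonneg (2 * d * (x - y) - d ^ 2 * q)]
    have e2 : (x - y) ^ 2 ≤ 2 * (x ^ 2 + y ^ 2) := by nlinarith [sq_nonneg (x + y)]
    have e3 : q ^ 2 ≤ 3 * A a a ^ 2 + 3 * A b b ^ 2 + 12 * A a b ^ 2 := by
      rw [hq]
      nlinarith [sq_nonneg (A a a - A b b), sq_nonneg (A a a + 2 * A a b), sq_nonneg (A b b + 2 * A a b)]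
    have e4 : 8 * d ^ 2 * (x - y) ^ 2 ≤ 8 * (12 / n) * (2 * (x ^ 2 + y ^ 2)) := by
      apply mul_le_mul _ e2 (sq_nonneg _) (by positivity)
      have := hd a b
      linarith
    have e5 : 2 * (d ^ 2) ^ 2 * q ^ 2 ≤ 2 * (12 / n) ^ 2 * (3 * A a a ^ 2 + 3 * A b b ^ 2 + 12 * A a b ^ 2) := by
      apply mul_le_mul _ e3 (sq_nonneg _) (by positivity)
      have := pow_le_pow_left₀ (sq_nonneg d) (hd a b) 2
      linarith
    calc _ ≤ _ := e1
      _ ≤ _ := add_le_add e4 e5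
      _ = _ := by ring
  refine (Finset.sum_le_sum fun a _ => Finset.sum_le_sum fun b _ => key a b).trans ?_
  simp only [Finset.sum_add_distrib, ← Finset.mul_sum, Finset.sum_const, Finset.card_univ,
    Fintype.card_fin, nsmul_eq_mul, ← qf_sq hA, ← tr_sq hA]
  have hds := diag_sq_le hA
  have ht : 0 ≤ (A * A).trace := by rw [tr_sq hA]; positivity
  have h0 : (n : ℝ) ≠ 0 := by linarith
  have e1 : 12 / (n:ℝ) * 16 * (n * qf (A * A) v + n * qf (A * A) v) = 384 * qf (A * A) v := by
    field_simp; ring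
  rw [e1]
  have e2 : (12 / (n:ℝ)) ^ 2 * (n * (6 * ∑ a, A a a ^ 2) + n * (6 * ∑ a, A a a ^ 2)
      + 24 * (A * A).trace) ≤ 5184 * ((A * A).trace / n) := by
    calc _ ≤ (12 / (n:ℝ)) ^ 2 * (n * (6 * (A * A).trace) + n * (6 * (A * A).trace)
          + n * (6 * (A * A).trace)) := by
          apply mul_le_mul_of_nonneg_left _ (sq_nonneg _)
          have w1 : (n:ℝ) * (6 * ∑ a, A a a ^ 2) ≤ n * (6 * (A * A).trace) := by gcongr
          have w2 : 24 * (A * A).trace ≤ n * (6 * (A * A).trace) := by nlinarith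
          linarith
      _ ≤ _ := by
          have : (12 / (n:ℝ)) ^ 2 * (n * (6 * (A * A).trace) + n * (6 * (A * A).trace)
            + n * (6 * (A * A).trace)) = 2592 * ((A * A).trace / n) := by field_simp; ring
          rw [this]
          have : 0 ≤ (A * A).trace / n := by positivity
          linarith
  refine le_trans (le_of_eq ?_) (add_le_add_right e2 (384 * qf (A * A) v))
  ring

lemma gam_g_le {A : Mat n} (hA : Sym0 A) (hn : 4 ≤ n) (v : Fin n → ℝ) (hv : ∀ a, v a ^ 2 ≤ 3 / n) :
    ∑ a, ∑ b, (∑ c, (v (Equiv.swap a b c)) ^ 2 * A c c - ∑ c, v c ^ 2 * A c c) ^ 2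
      ≤ 36 * ((A * A).trace / n) := by
  have hn4 : (4 : ℝ) ≤ n := by exact_mod_cast hn
  simp only [diag_swap (fun c => A c c)]
  have key : ∀ a b, ((v b ^ 2 - v a ^ 2) * (A a a - A b b)) ^ 2 ≤
      (3 / n) ^ 2 * (2 * A a a ^ 2 + 2 * A b b ^ 2) := by
    intro a b
    rw [mul_pow]
    apply mul_le_mul _ _ (sq_nonneg _) (by positivity)
    · have h1 := hv a
      have h2 := hv b
      apply sq_le_sq' <;> nlinarith [sq_nonneg (v a), sq_nonneg (v b)]
    · nlinarith [sq_nonneg (A a a + A b b)]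
  refine (Finset.sum_le_sum fun a _ => Finset.sum_le_sum fun b _ => key a b).trans ?_
  simp only [Finset.sum_add_distrib, ← Finset.mul_sum, Finset.sum_const, Finset.card_univ,
    Fintype.card_fin, nsmul_eq_mul]
  have hds := diag_sq_le hA
  have h0 : (n : ℝ) ≠ 0 := by linarith
  have e1 : (3 / (n:ℝ)) ^ 2 * (n * (2 * ∑ a, A a a ^ 2) + n * (2 * ∑ a, A a a ^ 2))
    = 36 * ((∑ a, A a a ^ 2) / n) := by field_simp; ring
  have e3 : 36 * ((∑ a, A a a ^ 2) / n) ≤ 36 * ((A * A).trace / n) := by gcongr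
  rw [← e1] at e3
  refine le_trans (le_of_eq ?_) e3
  ring
end swapcalc

lemma fourth_moment {n : ℕ} (hn : 4 ≤ n) {A : Mat n} (hA : Sym0 A) :
    av (fun σ => (qf A (vv n σ) - A.trace / (n - 1)) ^ 4) ≤
      10 ^ 9 / (n:ℝ) ^ 2 * (av (fun σ => qf (A * A) (vv n σ) ^ 2) + ((A * A).trace / n) ^ 2) := by
  have hn4 : (4 : ℝ) ≤ n := by exact_mod_cast hn
  have hn2 : 2 ≤ n := by omega
  set μ := A.trace / ((n:ℝ) - 1) with hμ
  set f : Pm n → ℝ := fun σ => qf A (vv n σ) - μ with hf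
  set γ := A.trace / (n:ℝ) with hγ
  set g : Pm n → ℝ := fun σ => ∑ c, (vv n σ c) ^ 2 * A c c - γ with hg
  have h1 : (n : ℝ) - 1 ≠ 0 := by linarith
  have h0 : (n : ℝ) ≠ 0 := by linarith
  have sf : ∀ σ, ∑ a, ∑ b, (f (σ * Equiv.swap a b) - f σ) = -4 * (n - 1) * f σ + 2 * n * g σ := by
    intro σ
    have := sum_swap_qf hA (vv n σ) (vv_sum σ) (vv_sum_sq hn2 σ)
    simp only [hf, hg, sub_sub_sub_cancel_right]
    refine this.trans ?_
    rw [hμ, hγ]; field_simp; ring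
  have sg : ∀ σ, ∑ a, ∑ b, (g (σ * Equiv.swap a b) - g σ) = -2 * n * g σ := by
    intro σ
    have := sum_diag_swap (fun c => A c c) (vv n σ) (vv_sum_sq hn2 σ)
    simp only [hg, sub_sub_sub_cancel_right]
    refine this.trans ?_
    rw [hγ]; simp only [Matrix.trace, diag_apply]; field_simp; ring
  set Gf : Pm n → ℝ := fun σ => ∑ a, ∑ b, (f (σ * Equiv.swap a b) - f σ) ^ 2 with hGf
  set Gg : Pm n → ℝ := fun σ => ∑ a, ∑ b, (g (σ * Equiv.swap a b) - g σ) ^ 2 with hGg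
  set T := (A * A).trace / (n:ℝ) with hT
  have hT0 : 0 ≤ T := by rw [hT, tr_sq hA]; positivity
  have bf : ∀ σ, Gf σ ≤ 384 * qf (A * A) (vv n σ) + 5184 * T := by
    intro σ
    have := gam_f_le hA hn (vv n σ) (fun a => vv_sq_le hn2 σ a)
    simp only [hGf, hf, sub_sub_sub_cancel_right]
    exact this
  have bg : ∀ σ, Gg σ ≤ 36 * T := by
    intro σ
    have := gam_g_le hA hn (vv n σ) (fun a => vv_sq_le hn2 σ a)
    simp only [hGg, hg, sub_sub_sub_cancel_right]
    exact this
  have Gf0 : ∀ σ, 0 ≤ Gf σ := fun σ => by positivity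
  have Gg0 : ∀ σ, 0 ≤ Gg σ := fun σ => by positivity
  have df := dirichlet_sum f
  have dg := dirichlet_sum g
  simp only [sf] at df
  simp only [sg] at dg
  change _ ≤ 3 / 2 * av (fun σ => f σ ^ 2 * Gf σ) at df
  change _ ≤ 3 / 2 * av (fun σ => g σ ^ 2 * Gg σ) at dg
  -- g
  have g4 : av (fun σ => g σ ^ 4) ≤ (36 * T) ^ 2 / (n:ℝ) ^ 2 := by
    have e1 : av (fun σ => g σ ^ 3 * (-2 * n * g σ)) = -2 * n * av (fun σ => g σ ^ 4) := by
      rw [← av_mul]; congr 1; funext σ; ring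
    rw [e1] at dg
    have e2 : av (fun σ => g σ ^ 2 * Gg σ) ≤ av (fun σ => 2 / 3 * n * g σ ^ 4 + (36 * T) ^ 2 * (2/3 / n)) := by
      refine av_mono fun σ => ?_
      have : g σ ^ 2 * Gg σ ≤ g σ ^ 2 * (36 * T) := mul_le_mul_of_nonneg_left (bg σ) (sq_nonneg _)
      refine this.trans ?_
      have h5 : 0 ≤ 2 / 3 * (n:ℝ)⁻¹ * (n * g σ ^ 2 - 3 / 4 * (36 * T)) ^ 2 := by positivity
      have h6 : 2 / 3 * (n:ℝ)⁻¹ * (n * g σ ^ 2 - 3 / 4 * (36 * T)) ^ 2 =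
        2 / 3 * n * g σ ^ 4 - g σ ^ 2 * (36 * T) + 3 / 8 * (36 * T) ^ 2 * (n : ℝ)⁻¹ := by
          field_simp; ring
      have h7 : 0 ≤ (36 * T) ^ 2 * (n:ℝ)⁻¹ := by positivity
      have h8 : (36 * T) ^ 2 * (2/3 / (n:ℝ)) = 2 / 3 * ((36 * T) ^ 2 * (n:ℝ)⁻¹) := by field_simp
      rw [h8]
      linarith
    rw [av_add, av_mul, av_const] at e2
    have e3 : n * av (fun σ => g σ ^ 4) ≤ (36 * T) ^ 2 / n := by
      have : (36 * T) ^ 2 * (2/3 / (n:ℝ)) = 2 / 3 * ((36 * T) ^ 2 / n) := by field_simp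
      rw [this] at e2
      linarith
    rw [le_div_iff₀ (by positivity)] at e3 ⊢
    linarith
  have f4 : av (fun σ => f σ ^ 4) ≤ av (fun σ => g σ ^ 4) + 2 / (n:ℝ) ^ 2 * av (fun σ => Gf σ ^ 2) := by
    have e1 : av (fun σ => f σ ^ 3 * (-4 * (n - 1) * f σ + 2 * n * g σ))
        = -4 * (n - 1) * av (fun σ => f σ ^ 4) + 2 * n * av (fun σ => f σ ^ 3 * g σ) := by
      rw [← av_mul, ← av_mul, ← av_add]; congr 1; funext σ; ring
    rw [e1] at df
    set N := (n:ℝ) - 1 with hN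
    have hnN : (n:ℝ) ≤ 4 / 3 * N := by rw [hN]; linarith
    have hN0 : 0 < N := by rw [hN]; linarith
    have e2 : av (fun σ => f σ ^ 3 * g σ) ≤ av (fun σ => 3 / 4 * f σ ^ 4 + 1 / 4 * g σ ^ 4) := by
      refine av_mono fun σ => ?_
      nlinarith [sq_nonneg (f σ ^ 2 - f σ * g σ), sq_nonneg (f σ ^ 2 - g σ ^ 2)]
    rw [av_add, av_mul, av_mul] at e2
    have e3 : av (fun σ => f σ ^ 2 * Gf σ) ≤ av (fun σ => 2 / 3 * N * f σ ^ 4 + 3 / 8 * N⁻¹ * Gf σ ^ 2) := by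
      refine av_mono fun σ => ?_
      have h5 : 0 ≤ 2 / 3 * N⁻¹ * (N * f σ ^ 2 - 3 / 4 * Gf σ) ^ 2 := by positivity
      have h6 : 2 / 3 * N⁻¹ * (N * f σ ^ 2 - 3 / 4 * Gf σ) ^ 2 =
        2 / 3 * N * f σ ^ 4 - f σ ^ 2 * Gf σ + 3 / 8 * N⁻¹ * Gf σ ^ 2 := by
          field_simp; ring
      linarith
    rw [av_add, av_mul, av_mul] at e3
    have pf : 0 ≤ av (fun σ => f σ ^ 4) := av_nonneg fun σ => by positivity
    have pg : 0 ≤ av (fun σ => g σ ^ 4) := av_nonneg fun σ => by positivity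
    have pG : 0 ≤ av (fun σ => Gf σ ^ 2) := av_nonneg fun σ => by positivity
    set F4 := av (fun σ => f σ ^ 4)
    set G4 := av (fun σ => g σ ^ 4)
    set G2 := av (fun σ => Gf σ ^ 2)
    have e4 : 2 * n * av (fun σ => f σ ^ 3 * g σ) ≤ 2 * (4 / 3 * N) * (3 / 4 * F4 + 1 / 4 * G4) := by
      calc _ ≤ 2 * n * (3 / 4 * F4 + 1 / 4 * G4) := by gcongr
        _ ≤ _ := by gcongr
    have e5 : N * F4 ≤ N * G4 + N⁻¹ * G2 := by
      have : 0 ≤ N⁻¹ * G2 := by positivity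
      have := mul_nonneg hN0.le pg
      nlinarith
    have e6 : F4 ≤ G4 + N⁻¹ ^ 2 * G2 := by
      have := mul_le_mul_of_nonneg_left e5 (inv_nonneg.2 hN0.le)
      have h9 : N⁻¹ * (N * F4) = F4 := by field_simp
      have h10 : N⁻¹ * (N * G4 + N⁻¹ * G2) = G4 + N⁻¹ ^ 2 * G2 := by field_simp
      rwa [h9, h10] at this
    have e7 : N⁻¹ ^ 2 ≤ 2 / (n:ℝ)^2 := by
      rw [inv_pow, inv_eq_one_div, div_le_div_iff₀ (by positivity) (by positivity)]
      nlinarith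
    nlinarith
  have G2 : av (fun σ => Gf σ ^ 2) ≤ 2 * 384 ^ 2 * av (fun σ => qf (A * A) (vv n σ) ^ 2)
      + 2 * 5184 ^ 2 * T ^ 2 := by
    rw [← av_mul, ← av_const (n := n) (2 * 5184 ^ 2 * T ^ 2), ← av_add]
    refine av_mono fun σ => ?_
    have := pow_le_pow_left₀ (Gf0 σ) (bf σ) 2
    nlinarith [sq_nonneg (384 * qf (A * A) (vv n σ) - 5184 * T)]
  have pq : 0 ≤ av (fun σ => qf (A * A) (vv n σ) ^ 2) := av_nonneg fun σ => by positivity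
  set Q := av (fun σ => qf (A * A) (vv n σ) ^ 2)
  have hn2' : (0:ℝ) ≤ 1 / (n:ℝ) ^ 2 := by positivity
  calc av (fun σ => f σ ^ 4) ≤ _ := f4
    _ ≤ (36 * T) ^ 2 / (n:ℝ) ^ 2 + 2 / (n:ℝ) ^ 2 * (2 * 384 ^ 2 * Q + 2 * 5184 ^ 2 * T ^ 2) := by
        gcongr
    _ = 1 / (n:ℝ) ^ 2 * (4 * 384 ^ 2 * Q + (36 ^ 2 + 4 * 5184 ^ 2) * T ^ 2) := by ring
    _ ≤ 1 / (n:ℝ) ^ 2 * (10 ^ 9 * (Q + T ^ 2)) := by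
        gcongr
        nlinarith [sq_nonneg T]
    _ = _ := by ring

end Spear

open MeasureTheory Finset
namespace Spear
open Matrix

noncomputable def upd {n : ℕ} (S : Mat n) (σ : Pm n) : Mat n := S + vecMulVec (vv n σ) (vv n σ)

section chain
variable {n : ℕ} {E : Type*} [AddCommGroup E] [Module ℝ E]

noncomputable def LL (F : Mat n → E) : Mat n → E := fun S => av fun σ => F (upd S σ)

noncomputable def Ex : ℕ → (Mat n → E) → E
  | 0, F => F 0
  | j + 1, F => Ex j (LL F)

lemma Ex_zero (F : Mat n → E) : Ex 0 F = F 0 := rfl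
lemma Ex_succ (j : ℕ) (F : Mat n → E) : Ex (j + 1) F = Ex j (LL F) := rfl
lemma Ex_succ' (j : ℕ) (F : Mat n → E) :
    Ex (j + 1) F = Ex j (fun S => av fun σ => F (upd S σ)) := rfl

lemma Ex_add (j : ℕ) (F G : Mat n → E) : Ex j (fun S => F S + G S) = Ex j F + Ex j G := by
  induction j generalizing F G with
  | zero => rfl
  | succ j ih =>
    simp only [Ex_succ, ← ih]; congr 1; funext S; exact av_add _ _
lemma Ex_smul (j : ℕ) (c : ℝ) (F : Mat n → E) : Ex j (fun S => c • F S) = c • Ex j F := by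
  induction j generalizing F with
  | zero => rfl
  | succ j ih =>
    simp only [Ex_succ, ← ih]; congr 1; funext S; exact av_smul _ _
lemma Ex_const (j : ℕ) (c : E) : Ex (n := n) j (fun _ => c) = c := by
  induction j with
  | zero => rfl
  | succ j ih =>
    rw [Ex_succ]; refine Eq.trans ?_ ih; congr 1; funext S; exact av_const _
lemma Ex_sub (j : ℕ) (F G : Mat n → E) : Ex j (fun S => F S - G S) = Ex j F - Ex j G := by
  have := Ex_add j F (fun S => (-1 : ℝ) • G S)
  rw [Ex_smul] at this
  simpa [sub_eq_add_neg] using this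
lemma Ex_sum {ι : Type*} (j : ℕ) (s : Finset ι) (F : ι → Mat n → E) :
    Ex j (fun S => ∑ i ∈ s, F i S) = ∑ i ∈ s, Ex j (F i) := by
  classical
  induction s using Finset.induction_on with
  | empty => simp [Ex_const]
  | insert a s ha ih => simp only [Finset.sum_insert ha, Ex_add, ih]

lemma Ex_conj (j : ℕ) (τ : Pm n) (F : Mat n → E) :
    Ex j (fun S => F (S.submatrix τ τ)) = Ex j F := by
  induction j generalizing F with
  | zero => simp [Ex_zero]
  | succ j ih =>
    rw [Ex_succ, Ex_succ, ← ih (LL F)]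
    congr 1; funext S
    simp only [LL]
    exact av_mulRight τ (fun σ => F (upd (S.submatrix τ τ) σ))
end chain

def Good {n : ℕ} (S : Mat n) : Prop := S.PosSemidef ∧ ∀ a, ∑ b, S a b = 0

lemma good_zero {n : ℕ} : Good (0 : Mat n) := ⟨PosSemidef.zero, by simp⟩
lemma good_upd {n : ℕ} {S : Mat n} (h : Good S) (σ : Pm n) : Good (upd S σ) := by
  constructor
  · refine h.1.add ?_
    have := posSemidef_vecMulVec_self_star (R := ℝ) (vv n σ)
    simpa using this
  · intro a
    simp only [upd, Matrix.add_apply, vecMulVec_apply, Finset.sum_add_distrib, h.2, ← Finset.mul_sum,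
      vv_sum, mul_zero, add_zero]

lemma Good.symm {n : ℕ} {S : Mat n} (h : Good S) : Sᵀ = S := by
  have := h.1.1
  rwa [IsHermitian, conjTranspose_eq_transpose_of_trivial] at this
lemma Good.sym0 {n : ℕ} {S : Mat n} (h : Good S) : Sym0 S := ⟨h.symm, h.2⟩

lemma Good.mulVec_one {n : ℕ} {S : Mat n} (h : Good S) : S *ᵥ (fun _ => 1) = 0 := by
  funext a; simp [mulVec, dotProduct, h.2]

lemma Good.sym0_pow {n : ℕ} {S : Mat n} (h : Good S) {a : ℕ} (ha : 1 ≤ a) : Sym0 (S ^ a) := by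
  constructor
  · rw [transpose_pow, h.symm]
  · obtain ⟨b, rfl⟩ : ∃ b, a = b + 1 := ⟨a - 1, by omega⟩
    intro i
    have : S ^ (b + 1) *ᵥ (fun _ => 1) = 0 := by
      rw [pow_succ, ← mulVec_mulVec, h.mulVec_one, mulVec_zero]
    have := congrFun this i
    simpa [mulVec, dotProduct] using this

section chainR
variable {n : ℕ}
lemma Ex_mul (j : ℕ) (c : ℝ) (F : Mat n → ℝ) : Ex j (fun S => c * F S) = c * Ex j F := Ex_smul j c F
lemma Ex_mono (j : ℕ) {F G : Mat n → ℝ} (h : ∀ S, Good S → F S ≤ G S) : Ex j F ≤ Ex j G := by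
  induction j generalizing F G with
  | zero => exact h 0 good_zero
  | succ j ih => exact ih fun S hS => av_mono fun σ => h _ (good_upd hS σ)
lemma Ex_congr {E : Type*} [AddCommGroup E] [Module ℝ E] (j : ℕ) {F G : Mat n → E}
    (h : ∀ S, Good S → F S = G S) : Ex j F = Ex j G := by
  induction j generalizing F G with
  | zero => exact h 0 good_zero
  | succ j ih =>
    refine ih fun S hS => ?_
    simp only [LL]; congr 1; funext σ; exact h _ (good_upd hS σ)
lemma Ex_nonneg (j : ℕ) {F : Mat n → ℝ} (h : ∀ S, Good S → 0 ≤ F S) : 0 ≤ Ex j F := by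
  have := Ex_mono j h; rwa [Ex_const] at this
lemma abs_Ex_le (j : ℕ) (F : Mat n → ℝ) : |Ex j F| ≤ Ex j (fun S => |F S|) := by
  rw [abs_le]; constructor
  · have := Ex_mono j (fun S (_ : Good S) => neg_abs_le (F S))
    have h2 := Ex_mul j (-1) (fun S => |F S|)
    simp only [neg_mul, one_mul] at h2; rw [h2] at this; linarith
  · exact Ex_mono j fun S _ => le_abs_self _
lemma norm_Ex_le (j : ℕ) (F : Mat n → ℂ) : ‖Ex j F‖ ≤ Ex j (fun S => ‖F S‖) := by
  induction j generalizing F with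
  | zero => exact le_rfl
  | succ j ih => exact (ih _).trans (Ex_mono j fun S _ => norm_av_le _)

/-! ### Efron–Stein -/
lemma av_var (f : Pm n → ℝ) (c : ℝ) :
    av (fun σ => (f σ - c) ^ 2) = av (fun σ => f σ ^ 2) - 2 * c * av f + c ^ 2 := by
  have : (fun σ => (f σ - c) ^ 2) = fun σ => (f σ ^ 2 - (2 * c) * f σ) + c^2 := by
    funext σ; ring
  rw [this, av_add, av_sub, av_mul, av_const]

noncomputable def Var1 (F : Mat n → ℝ) (S : Mat n) : ℝ :=
  av (fun σ => F (upd S σ) ^ 2) - (av fun σ => F (upd S σ)) ^ 2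

lemma Var1_le (F : Mat n → ℝ) (S : Mat n) (c : ℝ) :
    Var1 F S ≤ av (fun σ => (F (upd S σ) - c) ^ 2) := by
  rw [av_var, Var1]
  nlinarith [sq_nonneg (av (fun σ => F (upd S σ)) - c)]

lemma upd_comm (S : Mat n) (σ τ : Pm n) : upd (upd S σ) τ = upd (upd S τ) σ := by
  simp only [upd]; exact add_right_comm _ _ _

lemma Var1_LL (F : Mat n → ℝ) (S : Mat n) : Var1 (LL F) S ≤ LL (Var1 F) S := by
  set G : Pm n → Pm n → ℝ := fun σ τ => F (upd (upd S σ) τ) with hG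
  have e1 : Var1 (LL F) S = av (fun σ => (av (fun τ => G σ τ - av (fun σ' => G σ' τ))) ^ 2) := by
    simp only [av_sub]
    rw [av_var, av_comm (fun τ σ' => G σ' τ)]
    simp only [Var1, LL]
    ring
  have e2 : LL (Var1 F) S = av (fun σ => av (fun τ => (G σ τ - av (fun σ' => G σ' τ)) ^ 2)) := by
    rw [av_comm]
    simp only [av_var, LL, Var1]
    congr 1; funext τ
    simp only [hG, upd_comm S _ τ]
    ring
  rw [e1, e2]
  exact av_mono fun σ => av_sq_le _

lemma efron_stein (j : ℕ) (F : Mat n → ℝ) :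
    Ex (j + 1) (fun S => F S ^ 2) - (Ex (j + 1) F) ^ 2 ≤ (j + 1) * Ex j (Var1 F) := by
  induction j generalizing F with
  | zero => simp [Ex_succ, Ex_zero, Var1, LL]
  | succ j ih =>
    have h1 := ih (LL F)
    have h2 : Ex j (Var1 (LL F)) ≤ Ex (j + 1) (Var1 F) := Ex_mono j fun S _ => Var1_LL F S
    have h3 : Ex (j + 1 + 1) (fun S => F S ^ 2)
        = Ex (j + 1) (Var1 F) + Ex (j + 1) (fun S => LL F S ^ 2) := by
      rw [← Ex_add, Ex_succ (j + 1)]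
      congr 1; funext S; simp [LL, Var1]
    rw [h3, Ex_succ (j + 1) F]
    have : ((j:ℝ) + 1) * Ex j (Var1 (LL F)) ≤ (j + 1) * Ex (j + 1) (Var1 F) := by gcongr
    push_cast
    linarith
end chainR

end Spear

open MeasureTheory Finset
namespace Spear

/-! ### Truncated `ℓ¹` norms of power series -/
noncomputable def tn (K : ℕ) (F : PowerSeries ℝ) : ℝ := ∑ i ∈ range K, |PowerSeries.coeff i F|

lemma tn_nonneg (K : ℕ) (F : PowerSeries ℝ) : 0 ≤ tn K F := Finset.sum_nonneg fun _ _ => abs_nonneg _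
lemma tn_mono {K K' : ℕ} (h : K ≤ K') (F : PowerSeries ℝ) : tn K F ≤ tn K' F :=
  Finset.sum_le_sum_of_subset_of_nonneg (Finset.range_mono h) fun _ _ _ => abs_nonneg _
lemma tn_add (K : ℕ) (F G : PowerSeries ℝ) : tn K (F + G) ≤ tn K F + tn K G := by
  simp only [tn, ← Finset.sum_add_distrib, map_add]
  exact Finset.sum_le_sum fun i _ => abs_add_le _ _
lemma tn_sub (K : ℕ) (F G : PowerSeries ℝ) : tn K (F - G) ≤ tn K F + tn K G := by
  simp only [tn, ← Finset.sum_add_distrib, map_sub]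
  exact Finset.sum_le_sum fun i _ => abs_sub _ _
lemma tn_one (K : ℕ) : tn K 1 ≤ 1 := by
  rcases K with _ | K
  · simp [tn]
  · rw [tn, Finset.sum_range_succ']
    simp [PowerSeries.coeff_one]
lemma tn_X_mul (K : ℕ) (F : PowerSeries ℝ) : tn (K + 1) (PowerSeries.X * F) = tn K F := by
  rw [tn, Finset.sum_range_succ']
  simp [tn, PowerSeries.coeff_succ_X_mul]
lemma tn_mul (K : ℕ) (F G : PowerSeries ℝ) : tn K (F * G) ≤ tn K F * tn K G := by
  calc tn K (F * G) ≤ ∑ i ∈ range K, ∑ x ∈ antidiagonal i,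
        |PowerSeries.coeff x.1 F| * |PowerSeries.coeff x.2 G| := by
        refine Finset.sum_le_sum fun i _ => ?_
        rw [PowerSeries.coeff_mul]
        refine (Finset.abs_sum_le_sum_abs _ _).trans (le_of_eq ?_)
        simp only [abs_mul]
    _ = ∑ y ∈ (range K).sigma fun i => antidiagonal i,
        |PowerSeries.coeff y.2.1 F| * |PowerSeries.coeff y.2.2 G| := by
        rw [Finset.sum_sigma]
    _ = ∑ x ∈ ((range K).sigma fun i => antidiagonal i).image (fun y => y.2),
        |PowerSeries.coeff x.1 F| * |PowerSeries.coeff x.2 G| := by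
        rw [Finset.sum_image]
        rintro ⟨i, x⟩ hx ⟨j, y⟩ hy hxy
        simp only [Finset.coe_sigma, Set.mem_sigma_iff, Finset.mem_coe, HasAntidiagonal.mem_antidiagonal] at hx hy hxy
        subst hxy
        obtain ⟨_, rfl⟩ := hx
        obtain ⟨_, rfl⟩ := hy
        rfl
    _ ≤ ∑ x ∈ range K ×ˢ range K, |PowerSeries.coeff x.1 F| * |PowerSeries.coeff x.2 G| := by
        refine Finset.sum_le_sum_of_subset_of_nonneg ?_ fun _ _ _ => by positivity
        intro x hx
        simp only [Finset.mem_image, Finset.mem_sigma, Finset.mem_range, HasAntidiagonal.mem_antidiagonal] at hx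
        obtain ⟨⟨i, x'⟩, ⟨h1, h2⟩, rfl⟩ := hx
        simp only [Finset.mem_product, Finset.mem_range] at *
        omega
    _ = _ := by rw [tn, tn, Finset.sum_mul_sum, Finset.sum_product]
lemma tn_dU (K : ℕ) (F : PowerSeries ℝ) : tn (K + 1) (dU F) ≤ K * tn (K + 1) F := by
  rw [tn, tn, Finset.mul_sum]
  refine Finset.sum_le_sum fun i hi => ?_
  rw [coeff_dU, abs_mul, Nat.abs_cast]
  have : i ≤ K := by simpa [Nat.lt_succ_iff] using hi
  gcongr
lemma coeff_le_tn {i K : ℕ} (h : i < K) (F : PowerSeries ℝ) : |PowerSeries.coeff i F| ≤ tn K F :=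
  Finset.single_le_sum (f := fun i => |PowerSeries.coeff i F|) (fun _ _ => abs_nonneg _)
    (Finset.mem_range.2 h)

/-- `1/(1-uX)` -/
noncomputable def HX (F : PowerSeries ℝ) : PowerSeries ℝ := (1 - PowerSeries.X * F)⁻¹
lemma HX_spec (F : PowerSeries ℝ) : (1 - PowerSeries.X * F) * HX F = 1 :=
  PowerSeries.mul_inv_cancel _ (by simp)
lemma HX_eq (F : PowerSeries ℝ) : HX F = 1 + PowerSeries.X * (F * HX F) := by
  linear_combination HX_spec F
lemma HX_unique (F h : PowerSeries ℝ) (hh : h = 1 + PowerSeries.X * (F * h)) : h = HX F := by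
  linear_combination HX F * hh - (h) * HX_spec F

lemma tn_HX (K : ℕ) (F : PowerSeries ℝ) : tn (K + 1) (HX F) ≤ (1 + tn K F) ^ K := by
  induction K with
  | zero => rw [HX_eq]; simp [tn]
  | succ K ih =>
    rw [HX_eq]
    refine (tn_add _ _ _).trans ?_
    rw [tn_X_mul]
    have h1 := tn_mul (K + 1) F (HX F)
    have h2 : tn (K+1) (HX F) ≤ (1 + tn (K+1) F) ^ K := ih.trans (by
      have := tn_mono (Nat.le_succ K) F
      have := tn_nonneg K F
      gcongr)
    have h3 := tn_one (K + 1 + 1)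
    have h4 := tn_nonneg (K+1) F
    have h5 : 1 ≤ (1 + tn (K+1) F) ^ K := one_le_pow₀ (by linarith)
    have h6 := mul_le_mul_of_nonneg_left h2 h4
    rw [pow_succ]; nlinarith

/-- the increment functional -/
noncomputable def DD (F : PowerSeries ℝ) : PowerSeries ℝ := dU (PowerSeries.X * F) * HX F

noncomputable def EEs (F M : PowerSeries ℝ) : PowerSeries ℝ := PowerSeries.X * ((F - M) * HX M)
noncomputable def GGs (F M : PowerSeries ℝ) : PowerSeries ℝ := (1 - PowerSeries.X * M) * HX F

lemma DD_exp1 (F M : PowerSeries ℝ) : DD F - DD M = dU (EEs F M) * GGs F M := by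
  have hM := HX_spec M
  have hF := HX_spec F
  have e1 : PowerSeries.X * F = PowerSeries.X * M + EEs F M * (1 - PowerSeries.X * M) := by
    unfold EEs; linear_combination (-PowerSeries.X * (F - M)) * hM
  have e2 := congrArg dU e1
  rw [dU_add, dU_mul (EEs F M), dU_sub, dU_one] at e2
  unfold DD GGs
  rw [e2]
  have e3 : (1 - EEs F M) * HX F = HX M := by
    unfold EEs
    linear_combination (-HX F) * hM + HX M * hF
  linear_combination dU (PowerSeries.X * M) * e3

lemma GGs_eq (F M : PowerSeries ℝ) : GGs F M = 1 + EEs F M * GGs F M := by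
  have hM := HX_spec M
  have hF := HX_spec F
  unfold GGs EEs
  linear_combination hF + (-PowerSeries.X * (F - M) * HX F) * hM

lemma DD_exp3 (F M : PowerSeries ℝ) : DD F - DD M - dU (EEs F M) - (PowerSeries.C (1/2 : ℝ)) * dU (EEs F M ^ 2)
    = dU (EEs F M) * (EEs F M * (EEs F M * GGs F M)) := by
  have e := GGs_eq F M
  have h : (PowerSeries.C (1/2 : ℝ)) * 2 = (1 : PowerSeries ℝ) := by
    have : (2 : PowerSeries ℝ) = PowerSeries.C 2 := (map_ofNat (PowerSeries.C (R := ℝ)) 2).symm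
    rw [this, ← map_mul]; norm_num
  rw [DD_exp1, pow_two, dU_mul]
  linear_combination (dU (EEs F M) + dU (EEs F M) * EEs F M) * e - dU (EEs F M) * EEs F M * h

lemma tn_EEs (K : ℕ) (F M : PowerSeries ℝ) : tn (K+1) (EEs F M) ≤ tn K (F - M) * tn K (HX M) := by
  unfold EEs; rw [tn_X_mul]; exact tn_mul _ _ _
lemma tn_GGs (K : ℕ) (F M : PowerSeries ℝ) : tn (K+1) (GGs F M) ≤ (1 + tn K M) * (1 + tn K F) ^ K := by
  unfold GGs
  refine (tn_mul _ _ _).trans ?_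
  have h1 := tn_HX K F
  have h2 : tn (K+1) (1 - PowerSeries.X * M) ≤ 1 + tn K M := by
    refine (tn_sub _ _ _).trans ?_
    rw [tn_X_mul]; linarith [tn_one (K+1)]
  have := tn_nonneg K M
  exact mul_le_mul h2 h1 (tn_nonneg _ _) (by linarith)

lemma DD_bound1 (K : ℕ) (F M : PowerSeries ℝ) :
    |PowerSeries.coeff K (DD F) - PowerSeries.coeff K (DD M)|
      ≤ K * (tn K (F - M) * tn K (HX M)) * ((1 + tn K M) * (1 + tn K F) ^ K) := by
  rw [← map_sub, DD_exp1]
  refine (coeff_le_tn (Nat.lt_succ_self K) _).trans ((tn_mul _ _ _).trans ?_)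
  have h1 := (tn_dU K (EEs F M)).trans (mul_le_mul_of_nonneg_left (tn_EEs K F M) (Nat.cast_nonneg K))
  exact mul_le_mul h1 (tn_GGs K F M) (tn_nonneg _ _) ((tn_nonneg _ _).trans h1)

lemma DD_bound3 (K : ℕ) (F M : PowerSeries ℝ) :
    |PowerSeries.coeff K (DD F) - PowerSeries.coeff K (DD M) - PowerSeries.coeff K (dU (EEs F M))
      - 1/2 * PowerSeries.coeff K (dU (EEs F M ^ 2))|
      ≤ K * (tn K (F - M) * tn K (HX M)) ^ 3 * ((1 + tn K M) * (1 + tn K F) ^ K) := by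
  have h0 : PowerSeries.coeff K (DD F) - PowerSeries.coeff K (DD M) - PowerSeries.coeff K (dU (EEs F M))
      - 1/2 * PowerSeries.coeff K (dU (EEs F M ^ 2)) =
      PowerSeries.coeff K (dU (EEs F M) * (EEs F M * (EEs F M * GGs F M))) := by
    rw [← DD_exp3]; simp only [map_sub, PowerSeries.coeff_C_mul]
  rw [h0]
  have hE := tn_EEs K F M
  set e := tn K (F - M) * tn K (HX M)
  have he : 0 ≤ e := (tn_nonneg _ _).trans hE
  set g := (1 + tn K M) * (1 + tn K F) ^ K
  have hG : tn (K+1) (GGs F M) ≤ g := tn_GGs K F M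
  have hg : 0 ≤ g := (tn_nonneg _ _).trans hG
  have h1 := (tn_dU K (EEs F M)).trans (mul_le_mul_of_nonneg_left hE (Nat.cast_nonneg K))
  have h2 : tn (K+1) (EEs F M * GGs F M) ≤ e * g :=
    (tn_mul _ _ _).trans (mul_le_mul hE hG (tn_nonneg _ _) he)
  have h3 : tn (K+1) (EEs F M * (EEs F M * GGs F M)) ≤ e * (e * g) :=
    (tn_mul _ _ _).trans (mul_le_mul hE h2 (tn_nonneg _ _) he)
  refine (coeff_le_tn (Nat.lt_succ_self K) _).trans ((tn_mul _ _ _).trans ?_)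
  refine (mul_le_mul h1 h3 (tn_nonneg _ _) (by positivity)).trans (le_of_eq ?_)
  ring

/-! ### specialisation to the base point `m(t)` -/
noncomputable def phi (t : ℝ) : PowerSeries (Polynomial ℝ) →+* PowerSeries ℝ :=
  PowerSeries.map (Polynomial.evalRingHom t)
lemma coeff_phi (t : ℝ) (F : PowerSeries (Polynomial ℝ)) (a : ℕ) :
    PowerSeries.coeff a (phi t F) = (PowerSeries.coeff a F).eval t := by simp [phi]
noncomputable def mser (t : ℝ) : PowerSeries ℝ := phi t ms
lemma coeff_mser (t : ℝ) (a : ℕ) : PowerSeries.coeff a (mser t) = (mp a).eval t := coeff_phi _ _ _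
lemma phi_X (t : ℝ) : phi t PowerSeries.X = PowerSeries.X := by simp [phi]
lemma HX_mser (t : ℝ) : HX (mser t) = phi t hs := by
  refine (HX_unique _ _ ?_).symm
  have := congrArg (phi t) hs_ms
  rw [map_add, map_mul, map_mul, phi_X, map_one] at this
  exact this
lemma phi_dU (t : ℝ) (F : PowerSeries (Polynomial ℝ)) : phi t (dU F) = dU (phi t F) := by
  ext a; simp [coeff_phi]
lemma DD_mser (t : ℝ) (a : ℕ) : PowerSeries.coeff a (DD (mser t)) = (Polynomial.derivative (mp a)).eval t := by
  have := congrArg (fun F => PowerSeries.coeff a (phi t F)) dT_ms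
  simp only [map_mul, phi_dU, phi_X, ← HX_mser] at this
  rw [coeff_phi, coeff_dT] at this
  exact this.symm
/-- constants lifted to `ℝ[X]` -/
noncomputable def lift (F : PowerSeries ℝ) : PowerSeries (Polynomial ℝ) := PowerSeries.map Polynomial.C F
lemma phi_lift (t : ℝ) (F : PowerSeries ℝ) : phi t (lift F) = F := by ext a; simp [phi, lift]

lemma coeff_lin (t : ℝ) (F : PowerSeries ℝ) (k a : ℕ) (ha : a ≤ k) :
    PowerSeries.coeff a (dU (EEs F (mser t)))
      = ∑ i ∈ range k, (KK a i).eval t * (PowerSeries.coeff i F - (mp i).eval t) := by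
  have h := congrArg (Polynomial.eval t) (coeff_dU_uh (lift (F - mser t)) k a ha)
  rw [← coeff_phi, phi_dU, map_mul, map_mul, phi_X, ← HX_mser, phi_lift] at h
  have e : EEs F (mser t) = PowerSeries.X * HX (mser t) * (F - mser t) := by unfold EEs; ring
  rw [e, h, Polynomial.eval_finsetSum]
  refine Finset.sum_congr rfl fun i _ => ?_
  simp [lift, coeff_mser]
lemma coeff_quad (t : ℝ) (F : PowerSeries ℝ) (k a : ℕ) (ha : a ≤ k) :
    PowerSeries.coeff a (dU (EEs F (mser t) ^ 2))
      = ∑ i ∈ range k, ∑ l ∈ range k, (H2 a i l).eval t *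
        ((PowerSeries.coeff i F - (mp i).eval t) * (PowerSeries.coeff l F - (mp l).eval t)) := by
  have e : EEs F (mser t) ^ 2 = PowerSeries.X ^ 2 * HX (mser t) ^ 2 * (F - mser t) ^ 2 := by
    unfold EEs; ring
  rw [coeff_dU, e, coeff_X_sq_mul (HX (mser t) ^ 2) ((F - mser t) ^ 2)
    (fun i l => (PowerSeries.coeff i F - (mp i).eval t) * (PowerSeries.coeff l F - (mp l).eval t)) _ k a ha,
    Finset.mul_sum]
  · refine Finset.sum_congr rfl fun i _ => ?_
    rw [Finset.mul_sum]
    refine Finset.sum_congr rfl fun l _ => ?_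
    unfold H2
    rw [HX_mser, ← map_pow]
    split_ifs
    · rw [coeff_phi, Polynomial.eval_mul, Polynomial.eval_natCast]; ring
    · simp
  · intro n
    rw [pow_two, PowerSeries.coeff_mul]
    simp only [map_sub, coeff_mser]
end Spear

open MeasureTheory Finset
namespace Spear
open Matrix

lemma spec_rep {n : ℕ} {S : Mat n} (h : S.PosSemidef) (v : Fin n → ℝ) :
    ∃ w lam : Fin n → ℝ, (∀ i, 0 ≤ w i) ∧ (∀ i, 0 ≤ lam i) ∧
      ∀ a, qf (S ^ a) v = ∑ i, w i * lam i ^ a := by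
  have hH := h.1
  set U : Mat n := (hH.eigenvectorUnitary : Mat n) with hU
  have hUU : Uᵀ * U = 1 := by
    have := (Matrix.mem_unitaryGroup_iff').1 hH.eigenvectorUnitary.2
    rwa [star_eq_conjTranspose, conjTranspose_eq_transpose_of_trivial] at this
  have hUU' : U * Uᵀ = 1 := mul_eq_one_comm.1 hUU
  have hS : S = U * diagonal hH.eigenvalues * Uᵀ := by
    have := hH.spectral_theorem
    rw [Unitary.conjStarAlgAut_apply] at this
    simpa [star_eq_conjTranspose, conjTranspose_eq_transpose_of_trivial] using this
  have hp : ∀ a, S ^ a = U * diagonal (fun i => hH.eigenvalues i ^ a) * Uᵀ := by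
    intro a
    induction a with
    | zero => simp [hUU']
    | succ a ih =>
      rw [pow_succ, ih]
      nth_rewrite 2 [hS]
      rw [show U * diagonal (fun i => hH.eigenvalues i ^ a) * Uᵀ * (U * diagonal hH.eigenvalues * Uᵀ)
        = U * diagonal (fun i => hH.eigenvalues i ^ a) * (Uᵀ * U) * diagonal hH.eigenvalues * Uᵀ by
        simp only [Matrix.mul_assoc], hUU, Matrix.mul_one, Matrix.mul_assoc U, diagonal_mul_diagonal]
      simp [pow_succ]
  refine ⟨fun i => (Uᵀ *ᵥ v) i ^ 2, hH.eigenvalues, fun i => sq_nonneg _, h.eigenvalues_nonneg, ?_⟩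
  intro a
  rw [hp a, qf, ← mulVec_mulVec, ← mulVec_mulVec, dotProduct_mulVec, ← mulVec_transpose]
  simp only [dotProduct, mulVec_diagonal]
  exact Finset.sum_congr rfl fun i _ => by ring

noncomputable def xx {n : ℕ} (S : Mat n) (σ : Pm n) (a : ℕ) : ℝ := qf (S ^ a) (vv n σ)
noncomputable def ss {n : ℕ} (S : Mat n) (a : ℕ) : ℝ := av fun σ => xx S σ a

section
variable {n : ℕ}
lemma xx_zero (hn : 2 ≤ n) (S : Mat n) (σ : Pm n) : xx S σ 0 = 1 := by
  simp only [xx, pow_zero, qf, one_mulVec, dotProduct, ← vv_sum_sq hn σ]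
  exact Finset.sum_congr rfl fun i _ => by ring
lemma ss_zero (hn : 2 ≤ n) (S : Mat n) : ss S 0 = 1 := by
  simp only [ss, xx_zero hn, av_const]

lemma xx_rep (hn : 2 ≤ n) {S : Mat n} (h : Good S) (σ : Pm n) :
    ∃ w lam : Fin n → ℝ, (∀ i, 0 ≤ w i) ∧ (∀ i, 0 ≤ lam i) ∧ ∑ i, w i = 1 ∧
      ∀ a, xx S σ a = ∑ i, w i * lam i ^ a := by
  obtain ⟨w, l, h1, h2, h3⟩ := spec_rep h.1 (vv n σ)
  refine ⟨w, l, h1, h2, ?_, h3⟩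
  have := h3 0
  rw [show qf (S ^ 0) (vv n σ) = 1 from xx_zero hn S σ] at this
  simpa using this.symm

lemma xx_nonneg (hn : 2 ≤ n) {S : Mat n} (h : Good S) (σ : Pm n) (a : ℕ) : 0 ≤ xx S σ a := by
  obtain ⟨w, l, h1, h2, _, h3⟩ := xx_rep hn h σ
  rw [h3]; exact Finset.sum_nonneg fun i _ => mul_nonneg (h1 i) (pow_nonneg (h2 i) _)
lemma ss_nonneg (hn : 2 ≤ n) {S : Mat n} (h : Good S) (a : ℕ) : 0 ≤ ss S a :=
  av_nonneg fun σ => xx_nonneg hn h σ a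

lemma xx_pow_le (hn : 2 ≤ n) {S : Mat n} (h : Good S) (σ : Pm n) (a q : ℕ) :
    xx S σ a ^ q ≤ xx S σ (a * q) := by
  obtain ⟨w, l, h1, h2, h4, h3⟩ := xx_rep hn h σ
  rw [h3, h3]
  refine (Real.pow_arith_mean_le_arith_mean_pow Finset.univ w (fun i => l i ^ a) (fun i _ => h1 i) h4
    (fun i _ => pow_nonneg (h2 i) _) q).trans (le_of_eq ?_)
  simp only [pow_mul]
lemma xx_le_one_add (hn : 2 ≤ n) {S : Mat n} (h : Good S) (σ : Pm n) {a m : ℕ} (ham : a ≤ m) :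
    xx S σ a ≤ 1 + xx S σ m := by
  obtain ⟨w, l, h1, h2, h4, h3⟩ := xx_rep hn h σ
  rw [h3, h3, ← h4, ← Finset.sum_add_distrib]
  refine Finset.sum_le_sum fun i _ => ?_
  have : l i ^ a ≤ 1 + l i ^ m := by
    rcases le_total (l i) 1 with hl | hl
    · have := pow_le_one₀ (n := a) (h2 i) hl
      have := pow_nonneg (h2 i) m
      linarith
    · have := pow_le_pow_right₀ hl ham; linarith
  nlinarith [h1 i]
lemma xx_mul_le (hn : 2 ≤ n) {S : Mat n} (h : Good S) (σ : Pm n) (a b : ℕ) :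
    xx S σ a * xx S σ b ≤ xx S σ (a + b) := by
  obtain ⟨w, l, h1, h2, h4, h3⟩ := xx_rep hn h σ
  have key : 0 ≤ ∑ i, ∑ j, w i * w j * ((l i ^ a - l j ^ a) * (l i ^ b - l j ^ b)) := by
    refine Finset.sum_nonneg fun i _ => Finset.sum_nonneg fun j _ => ?_
    refine mul_nonneg (mul_nonneg (h1 i) (h1 j)) ?_
    rcases le_total (l i) (l j) with hl | hl
    · have e1 := pow_le_pow_left₀ (h2 i) hl a
      have e2 := pow_le_pow_left₀ (h2 i) hl b
      nlinarith
    · have e1 := pow_le_pow_left₀ (h2 j) hl a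
      have e2 := pow_le_pow_left₀ (h2 j) hl b
      nlinarith
  have e : ∑ i, ∑ j, w i * w j * ((l i ^ a - l j ^ a) * (l i ^ b - l j ^ b))
      = 2 * (∑ i, w i * l i ^ (a + b)) * (∑ i, w i)
        - 2 * ((∑ i, w i * l i ^ a) * (∑ i, w i * l i ^ b)) := by
    have s1 : (∑ i, w i * l i ^ (a + b)) * (∑ i, w i) = ∑ i, ∑ j, w i * w j * l i ^ (a+b) := by
      rw [Finset.sum_mul_sum]
      exact Finset.sum_congr rfl fun i _ => Finset.sum_congr rfl fun j _ => by ring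
    have s2 : (∑ i, w i * l i ^ (a + b)) * (∑ i, w i) = ∑ i, ∑ j, w i * w j * l j ^ (a+b) := by
      rw [mul_comm, Finset.sum_mul_sum]
      exact Finset.sum_congr rfl fun i _ => Finset.sum_congr rfl fun j _ => by ring
    have s3 : (∑ i, w i * l i ^ a) * (∑ i, w i * l i ^ b) = ∑ i, ∑ j, w i * w j * (l i ^ a * l j ^ b) := by
      rw [Finset.sum_mul_sum]
      exact Finset.sum_congr rfl fun i _ => Finset.sum_congr rfl fun j _ => by ring
    have s4 : (∑ i, w i * l i ^ a) * (∑ i, w i * l i ^ b) = ∑ i, ∑ j, w i * w j * (l j ^ a * l i ^ b) := by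
      rw [mul_comm, Finset.sum_mul_sum]
      exact Finset.sum_congr rfl fun i _ => Finset.sum_congr rfl fun j _ => by ring
    rw [show ∀ A B : ℝ, 2 * A * B - 2 * ((∑ i, w i * l i ^ a) * (∑ i, w i * l i ^ b))
      = A * B + A * B - (∑ i, w i * l i ^ a) * (∑ i, w i * l i ^ b)
        - (∑ i, w i * l i ^ a) * (∑ i, w i * l i ^ b) from fun A B => by ring]
    nth_rewrite 1 [s1]
    nth_rewrite 1 [s2]
    nth_rewrite 1 [s3]
    rw [s4]
    simp only [← Finset.sum_add_distrib, ← Finset.sum_sub_distrib]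
    exact Finset.sum_congr rfl fun i _ => Finset.sum_congr rfl fun j _ => by ring
  rw [e, h4] at key
  rw [h3, h3, h3]; linarith
lemma ss_pow_le (hn : 2 ≤ n) {S : Mat n} (h : Good S) (a q : ℕ) : ss S a ^ q ≤ ss S (a * q) :=
  (av_pow_le _ (fun σ => xx_nonneg hn h σ a) q).trans (av_mono fun σ => xx_pow_le hn h σ a q)
lemma ss_le_one_add (hn : 2 ≤ n) {S : Mat n} (h : Good S) {a m : ℕ} (ham : a ≤ m) :
    ss S a ≤ 1 + ss S m := by
  refine (av_mono fun σ => xx_le_one_add hn h σ ham).trans (le_of_eq ?_)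
  rw [av_add, av_const]; rfl
lemma ss_eq (hn : 2 ≤ n) {S : Mat n} (h : Good S) {a : ℕ} (ha : 1 ≤ a) :
    ss S a = (S ^ a).trace / ((n : ℝ) - 1) := av_qf hn (h.sym0_pow ha).2

/-! ### increments -/
noncomputable def xser (S : Mat n) (σ : Pm n) : PowerSeries ℝ := PowerSeries.mk (xx S σ)
noncomputable def sser (S : Mat n) : PowerSeries ℝ := PowerSeries.mk (ss S)

lemma upd_pow_mulVec (S : Mat n) (σ : Pm n) (i : ℕ) :
    (upd S σ) ^ i *ᵥ vv n σ = ∑ d ∈ range (i + 1),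
      PowerSeries.coeff d (HX (xser S σ)) • (S ^ (i - d) *ᵥ vv n σ) := by
  induction i with
  | zero =>
    have : PowerSeries.coeff 0 (HX (xser S σ)) = 1 := by rw [HX_eq]; simp
    simp only [zero_add, Finset.sum_range_one, this]; simp
  | succ i ih =>
    rw [pow_succ', ← mulVec_mulVec, ih, Finset.sum_range_succ _ (i+1)]
    have hη : PowerSeries.coeff (i+1) (HX (xser S σ)) = ∑ d ∈ range (i+1),
        PowerSeries.coeff d (HX (xser S σ)) * xx S σ (i - d) := by
      nth_rewrite 1 [HX_eq]
      rw [map_add, PowerSeries.coeff_succ_X_mul, mul_comm, PowerSeries.coeff_mul,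
        Finset.Nat.sum_antidiagonal_eq_sum_range_succ_mk]
      simp [PowerSeries.coeff_one, xser]
    rw [hη, mulVec_sum, Finset.sum_smul, Nat.sub_self, ← Finset.sum_add_distrib]
    refine Finset.sum_congr rfl fun d hd => ?_
    have hd' : d ≤ i := by simpa [Nat.lt_succ_iff] using hd
    rw [mulVec_smul, mulVec_mulVec, upd, add_mul, add_mulVec, ← pow_succ', smul_add, mul_smul,
      Nat.succ_sub hd']
    congr 2
    rw [← mulVec_mulVec]
    simp only [xx, qf, pow_zero, one_mulVec, vecMulVec_mulVec]
    funext b; simp [mul_comm]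

lemma trace_incr (S : Mat n) (σ : Pm n) (k : ℕ) :
    ((upd S σ) ^ k).trace - (S ^ k).trace = PowerSeries.coeff k (DD (xser S σ)) := by
  set v := vv n σ
  set H := HX (xser S σ) with hH
  have h1 : ∀ k, ((upd S σ) ^ k).trace - (S ^ k).trace
      = ∑ i ∈ range k, ∑ d ∈ range (i+1), PowerSeries.coeff d H * xx S σ (k - 1 - d) := by
    intro k
    have tele : ∀ k, (upd S σ) ^ k - S ^ k = ∑ i ∈ range k, (upd S σ) ^ i * vecMulVec v v * S ^ (k - 1 - i) := by
      intro k
      induction k with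
      | zero => simp
      | succ k ih =>
        rw [Finset.sum_range_succ]
        have : ∑ i ∈ range k, (upd S σ) ^ i * vecMulVec v v * S ^ (k + 1 - 1 - i)
            = (∑ i ∈ range k, (upd S σ) ^ i * vecMulVec v v * S ^ (k - 1 - i)) * S := by
          rw [Finset.sum_mul]
          refine Finset.sum_congr rfl fun i hi => ?_
          have : i < k := by simpa using hi
          rw [show k + 1 - 1 - i = (k - 1 - i) + 1 by omega, pow_succ]
          simp only [Matrix.mul_assoc]
        rw [this, ← ih, pow_succ, pow_succ]
        simp only [Nat.add_sub_cancel, Nat.sub_self, pow_zero, Matrix.mul_one]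
        have e : vecMulVec v v = upd S σ - S := by simp [upd, v]
        rw [e]; noncomm_ring
    rw [← trace_sub, tele, trace_sum]
    refine Finset.sum_congr rfl fun i hi => ?_
    have hi' : i < k := by simpa using hi
    have e1 : ((upd S σ) ^ i * vecMulVec v v * S ^ (k - 1 - i)).trace
        = v ⬝ᵥ (S ^ (k-1-i) *ᵥ ((upd S σ) ^ i *ᵥ v)) := by
      rw [mul_vecMulVec, vecMulVec_mul, trace_vecMulVec, dotProduct_comm, ← dotProduct_mulVec]
    rw [e1, upd_pow_mulVec, mulVec_sum, dotProduct_sum]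
    refine Finset.sum_congr rfl fun d hd => ?_
    have hd' : d ≤ i := by simpa [Nat.lt_succ_iff] using hd
    rw [mulVec_smul, dotProduct_smul, mulVec_mulVec, ← pow_add, smul_eq_mul]
    rw [show k - 1 - i + (i - d) = k - 1 - d by omega]; rfl
  rw [h1]
  have h2 : PowerSeries.coeff k (DD (xser S σ)) =
      ∑ d ∈ range k, ((k - d : ℕ) : ℝ) * (PowerSeries.coeff d H * xx S σ (k - 1 - d)) := by
    rw [DD, mul_comm, PowerSeries.coeff_mul, Finset.Nat.sum_antidiagonal_eq_sum_range_succ_mk,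
      Finset.sum_range_succ]
    simp only [coeff_dU, Nat.sub_self, Nat.cast_zero, zero_mul, mul_zero, add_zero]
    refine Finset.sum_congr rfl fun d hd => ?_
    have hd' : d < k := by simpa using hd
    obtain ⟨e, he⟩ : ∃ e, k - d = e + 1 := ⟨k - d - 1, by omega⟩
    rw [he, PowerSeries.coeff_succ_X_mul, show PowerSeries.coeff e (xser S σ) = xx S σ e from PowerSeries.coeff_mk _ _, hH, show k - 1 - d = e by omega]
    push_cast; ring
  rw [h2]
  have h3 : ∀ i ∈ range k, ∑ d ∈ range (i+1), PowerSeries.coeff d H * xx S σ (k - 1 - d)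
      = ∑ d ∈ range k, if d ≤ i then PowerSeries.coeff d H * xx S σ (k - 1 - d) else 0 := by
    intro i hi
    rw [← Finset.sum_filter]
    congr 1; ext d
    have : i < k := by simpa using hi
    simp only [Finset.mem_range, Finset.mem_filter]; omega
  rw [Finset.sum_congr rfl h3, Finset.sum_comm]
  refine Finset.sum_congr rfl fun d hd => ?_
  rw [← Finset.sum_filter, Finset.sum_const, nsmul_eq_mul]
  congr 2
  have : (range k).filter (fun i => d ≤ i) = Finset.Ico d k := by ext i; simp; omega
  rw [this, Nat.card_Ico]
end
end Spear

open MeasureTheory Finset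
namespace Spear
open Matrix

/-! ### rate calculus -/
noncomputable def EE (n j : ℕ) (X : Mat n → Pm n → ℝ) : ℝ := Ex j (fun S => av (X S))
noncomputable def ww (n : ℕ) : ℝ := (Real.sqrt ((n : ℝ) - 1))⁻¹
abbrev Fam := ∀ n : ℕ, ℕ → Mat n → Pm n → ℝ
def Rt (B : ℝ) (r : ℕ) (X : Fam) : Prop :=
  ∃ C : ℝ, 0 ≤ C ∧ ∀ n : ℕ, 4 ≤ n → ∀ j : ℕ, (j : ℝ) ≤ B * n → EE n j (X n j) ≤ C * ww n ^ r

lemma N_pos {n : ℕ} (hn : 4 ≤ n) : (3 : ℝ) ≤ (n : ℝ) - 1 := by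
  have : (4 : ℝ) ≤ n := by exact_mod_cast hn
  linarith
lemma ww_pos {n : ℕ} (hn : 4 ≤ n) : 0 < ww n := by
  have := N_pos hn
  unfold ww; positivity
lemma ww_le_one {n : ℕ} (hn : 4 ≤ n) : ww n ≤ 1 := by
  have := N_pos hn
  unfold ww
  exact inv_le_one_of_one_le₀ (Real.one_le_sqrt.2 (by linarith))
lemma ww_sq {n : ℕ} (hn : 4 ≤ n) : ww n ^ 2 = ((n : ℝ) - 1)⁻¹ := by
  have := N_pos hn
  unfold ww; rw [inv_pow, Real.sq_sqrt (by linarith)]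

section
variable {n : ℕ}
lemma EE_mono (j : ℕ) {X Y : Mat n → Pm n → ℝ} (h : ∀ S, Good S → ∀ σ, X S σ ≤ Y S σ) :
    EE n j X ≤ EE n j Y := Ex_mono j fun S hS => av_mono (h S hS)
lemma EE_add (j : ℕ) (X Y : Mat n → Pm n → ℝ) :
    EE n j (fun S σ => X S σ + Y S σ) = EE n j X + EE n j Y := by
  simp only [EE, av_add, Ex_add]
lemma EE_mul (j : ℕ) (c : ℝ) (X : Mat n → Pm n → ℝ) :
    EE n j (fun S σ => c * X S σ) = c * EE n j X := by
  simp only [EE, av_mul, Ex_mul]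
lemma EE_const (j : ℕ) (c : ℝ) : EE n j (fun _ _ => c) = c := by
  simp only [EE, av_const, Ex_const]
lemma EE_S (j : ℕ) (F : Mat n → ℝ) : EE n j (fun S _ => F S) = Ex j F := by
  simp only [EE, av_const]
end

lemma Rt.mono {B : ℝ} {r : ℕ} {X Y : Fam} (hY : Rt B r Y)
    (h : ∀ n : ℕ, 4 ≤ n → ∀ j : ℕ, (j : ℝ) ≤ B * n → ∀ S : Mat n, Good S → ∀ σ, X n j S σ ≤ Y n j S σ) :
    Rt B r X := by
  obtain ⟨C, hC, hY⟩ := hY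
  exact ⟨C, hC, fun n hn j hj => (EE_mono j (h n hn j hj)).trans (hY n hn j hj)⟩
lemma Rt.add {B : ℝ} {r : ℕ} {X Y : Fam} (hX : Rt B r X) (hY : Rt B r Y) :
    Rt B r (fun n j S σ => X n j S σ + Y n j S σ) := by
  obtain ⟨C, hC, hX⟩ := hX
  obtain ⟨C', hC', hY⟩ := hY
  refine ⟨C + C', by positivity, fun n hn j hj => ?_⟩
  rw [EE_add, add_mul]; exact add_le_add (hX n hn j hj) (hY n hn j hj)
lemma Rt.cmul {B : ℝ} {r : ℕ} {X : Fam} (hX : Rt B r X) {c : ℝ} (hc : 0 ≤ c) :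
    Rt B r (fun n j S σ => c * X n j S σ) := by
  obtain ⟨C, hC, hX⟩ := hX
  refine ⟨c * C, by positivity, fun n hn j hj => ?_⟩
  rw [EE_mul, mul_assoc]; exact mul_le_mul_of_nonneg_left (hX n hn j hj) hc
lemma Rt.wmul {B : ℝ} {r : ℕ} {X : Fam} (hX : Rt B r X) (s : ℕ) :
    Rt B (r + s) (fun n j S σ => ww n ^ s * X n j S σ) := by
  obtain ⟨C, hC, hX⟩ := hX
  refine ⟨C, hC, fun n hn j hj => ?_⟩
  rw [EE_mul, pow_add]
  have := mul_le_mul_of_nonneg_left (hX n hn j hj) (pow_nonneg (ww_pos hn).le s)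
  linarith
lemma Rt.zero (B : ℝ) (r : ℕ) : Rt B r (fun _ _ _ _ => 0) :=
  ⟨0, le_rfl, fun n hn j hj => by rw [EE_const]; simp⟩
lemma Rt.one (B : ℝ) : Rt B 0 (fun _ _ _ _ => 1) :=
  ⟨1, zero_le_one, fun n hn j hj => by rw [EE_const]; simp⟩
lemma Rt.sum {B : ℝ} {r : ℕ} {ι : Type*} (s : Finset ι) {X : ι → Fam} (hX : ∀ i ∈ s, Rt B r (X i)) :
    Rt B r (fun n j S σ => ∑ i ∈ s, X i n j S σ) := by
  classical
  induction s using Finset.induction_on with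
  | empty => simpa using Rt.zero B r
  | insert a s ha ih =>
    simp only [Finset.sum_insert ha]
    exact (hX a (Finset.mem_insert_self a s)).add (ih fun i hi => hX i (Finset.mem_insert_of_mem hi))
lemma Rt.weaken {B : ℝ} {r r' : ℕ} {X : Fam} (hX : Rt B r X) (h : r' ≤ r) : Rt B r' X := by
  obtain ⟨C, hC, hX⟩ := hX
  refine ⟨C, hC, fun n hn j hj => (hX n hn j hj).trans ?_⟩
  exact mul_le_mul_of_nonneg_left (pow_le_pow_of_le_one (ww_pos hn).le (ww_le_one hn) h) hC
lemma Rt.young {B : ℝ} {a b : ℕ} {X Y : Fam} (hX : Rt B (2 * a) (fun n j S σ => X n j S σ ^ 2))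
    (hY : Rt B (2 * b) (fun n j S σ => Y n j S σ ^ 2)) :
    Rt B (a + b) (fun n j S σ => X n j S σ * Y n j S σ) := by
  obtain ⟨C, hC, hX⟩ := hX
  obtain ⟨C', hC', hY⟩ := hY
  refine ⟨C + C', by positivity, fun n hn j hj => ?_⟩
  have hw := ww_pos hn
  set w := ww n
  have hx := hX n hn j hj
  have hy := hY n hn j hj
  have h1 : EE n j (fun S σ => X n j S σ * Y n j S σ) ≤
      (w ^ (a + b) / w ^ (2 * a)) * EE n j (fun S σ => X n j S σ ^ 2)
        + (w ^ (a + b) / w ^ (2 * b)) * EE n j (fun S σ => Y n j S σ ^ 2) := by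
    rw [← EE_mul, ← EE_mul, ← EE_add]
    refine EE_mono j fun S _ σ => ?_
    set x := X n j S σ
    set y := Y n j S σ
    have e1 : x * y = w ^ (a+b) * ((x / w ^ a) * (y / w ^ b)) := by
      rw [pow_add]; field_simp
    have e2 : w ^ (a+b) / w ^ (2*a) * x ^ 2 + w ^ (a+b) / w ^ (2*b) * y ^ 2
        = w ^ (a+b) * ((x / w ^ a) ^ 2 + (y / w ^ b) ^ 2) := by
      rw [div_pow, div_pow, ← pow_mul, ← pow_mul, mul_comm a 2, mul_comm b 2]; ring
    rw [e1, e2]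
    refine mul_le_mul_of_nonneg_left ?_ (by positivity)
    nlinarith [sq_nonneg (x / w ^ a - y / w ^ b), sq_nonneg (x / w ^ a), sq_nonneg (y / w ^ b)]
  refine h1.trans ?_
  have h2 := mul_le_mul_of_nonneg_left hx (show 0 ≤ w ^ (a + b) / w ^ (2 * a) by positivity)
  have h3 := mul_le_mul_of_nonneg_left hy (show 0 ≤ w ^ (a + b) / w ^ (2 * b) by positivity)
  have h4 : w ^ (a + b) / w ^ (2 * a) * (C * w ^ (2 * a)) = C * w ^ (a+b) := by
    field_simp
  have h5 : w ^ (a + b) / w ^ (2 * b) * (C' * w ^ (2 * b)) = C' * w ^ (a+b) := by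
    field_simp
  rw [add_mul]; linarith

/-! ### moment bounds -/
lemma coeff_HX_nonneg {n : ℕ} (hn : 2 ≤ n) {S : Mat n} (h : Good S) (σ : Pm n) (i : ℕ) :
    0 ≤ PowerSeries.coeff i (HX (xser S σ)) := by
  induction i using Nat.strong_induction_on with
  | _ i ih =>
    rw [HX_eq]
    rcases i with _ | i
    · simp
    · rw [map_add, PowerSeries.coeff_succ_X_mul, PowerSeries.coeff_mul]
      refine add_nonneg (by rw [PowerSeries.coeff_one]; split_ifs <;> norm_num) ?_
      refine Finset.sum_nonneg fun x hx => mul_nonneg ?_ (ih _ ?_)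
      · simpa [xser] using xx_nonneg hn h σ _
      · have := Finset.HasAntidiagonal.mem_antidiagonal.1 hx; omega

lemma xx_eta_le (i : ℕ) : ∃ C : ℝ, 0 ≤ C ∧ ∀ i' ≤ i, ∀ n : ℕ, 2 ≤ n → ∀ S : Mat n, Good S → ∀ σ c,
    xx S σ c * PowerSeries.coeff i' (HX (xser S σ)) ≤ C * (1 + xx S σ (c + i')) := by
  induction i with
  | zero =>
    refine ⟨1, zero_le_one, ?_⟩
    intro i' hi n hn S hS σ c
    obtain rfl : i' = 0 := by omega
    have : PowerSeries.coeff 0 (HX (xser S σ)) = 1 := by rw [HX_eq]; simp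
    rw [this]; simp
  | succ i ih =>
    obtain ⟨C, hC, ih⟩ := ih
    refine ⟨C + (i + 1) * (2 * C), by positivity, ?_⟩
    intro i' hi n hn S hS σ c
    have hx := xx_nonneg hn hS σ (c + i')
    rcases Nat.lt_or_ge i' (i+1) with h | h
    · refine (ih i' (by omega) n hn S hS σ c).trans ?_
      refine mul_le_mul_of_nonneg_right ?_ (by linarith)
      have : (0:ℝ) ≤ (i + 1) * (2 * C) := by positivity
      linarith
    · obtain rfl : i' = i + 1 := by omega
      rw [HX_eq, map_add, PowerSeries.coeff_succ_X_mul, PowerSeries.coeff_mul,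
        Finset.Nat.sum_antidiagonal_eq_sum_range_succ_mk, PowerSeries.coeff_one, if_neg (by omega), zero_add,
        Finset.mul_sum]
      have : ∀ d ∈ range (i+1), xx S σ c * (PowerSeries.coeff d (xser S σ) * PowerSeries.coeff (i - d) (HX (xser S σ)))
          ≤ 2 * C * (1 + xx S σ (c + (i+1))) := by
        intro d hd
        have hd' : d ≤ i := by simpa [Nat.lt_succ_iff] using hd
        have e : PowerSeries.coeff d (xser S σ) = xx S σ d := PowerSeries.coeff_mk _ _
        rw [e, ← mul_assoc]
        have h1 := mul_le_mul_of_nonneg_right (xx_mul_le hn hS σ c d) (coeff_HX_nonneg hn hS σ (i - d))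
        have h2 := ih (i - d) (by omega) n hn S hS σ (c + d)
        rw [show c + d + (i - d) = c + i by omega] at h2
        have h3 := xx_le_one_add hn hS σ (show c + i ≤ c + (i+1) by omega)
        nlinarith
      refine (Finset.sum_le_sum this).trans ?_
      rw [Finset.sum_const, Finset.card_range, nsmul_eq_mul]
      push_cast
      have : 0 ≤ C * (1 + xx S σ (c + (i+1))) := by positivity
      linarith

lemma coeff_DD_le (k : ℕ) : ∃ C : ℝ, 0 ≤ C ∧ ∀ n : ℕ, 2 ≤ n → ∀ S : Mat n, Good S → ∀ σ,
    PowerSeries.coeff k (DD (xser S σ)) ≤ C * (1 + xx S σ (k - 1)) := by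
  obtain ⟨C, hC, h⟩ := xx_eta_le k
  refine ⟨(k + 1) * (k * C), by positivity, fun n hn S hS σ => ?_⟩
  rw [DD, mul_comm, PowerSeries.coeff_mul, Finset.Nat.sum_antidiagonal_eq_sum_range_succ_mk]
  have hx := xx_nonneg hn hS σ (k - 1)
  have : ∀ d ∈ range k.succ, PowerSeries.coeff d (HX (xser S σ)) *
      PowerSeries.coeff (k - d) (dU (PowerSeries.X * xser S σ)) ≤ k * C * (1 + xx S σ (k-1)) := by
    intro d hd
    have hd' : d ≤ k := by simpa [Nat.lt_succ_iff] using hd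
    rw [coeff_dU]
    rcases Nat.eq_zero_or_pos (k - d) with h0 | h0
    · rw [h0]; simp; positivity
    · obtain ⟨e, he⟩ : ∃ e, k - d = e + 1 := ⟨k - d - 1, by omega⟩
      rw [he, PowerSeries.coeff_succ_X_mul,
        show PowerSeries.coeff e (xser S σ) = xx S σ e from PowerSeries.coeff_mk _ _]
      have h1 := h d hd' n hn S hS σ e
      rw [show e + d = k - 1 by omega] at h1
      have h2 := mul_nonneg (xx_nonneg hn hS σ e) (coeff_HX_nonneg hn hS σ d)
      have h3 : ((e + 1 : ℕ) : ℝ) ≤ k := by exact_mod_cast (by omega : e + 1 ≤ k)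
      calc _ = ((e+1 : ℕ) : ℝ) * (xx S σ e * PowerSeries.coeff d (HX (xser S σ))) := by ring
        _ ≤ k * (C * (1 + xx S σ (k-1))) := by gcongr
        _ = _ := by ring
  refine (Finset.sum_le_sum this).trans ?_
  rw [Finset.sum_const, Finset.card_range, nsmul_eq_mul]
  push_cast; linarith

lemma ss_upd {n : ℕ} (hn : 2 ≤ n) {S : Mat n} (hS : Good S) (σ : Pm n) {k : ℕ} (hk : 1 ≤ k) :
    ss (upd S σ) k = ss S k + PowerSeries.coeff k (DD (xser S σ)) / ((n : ℝ) - 1) := by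
  rw [ss_eq hn (good_upd hS σ) hk, ss_eq hn hS hk, ← trace_incr]; ring

lemma ss_zero_mat {n k : ℕ} (hk : 1 ≤ k) : ss (0 : Mat n) k = 0 := by
  simp only [ss, xx, zero_pow (by omega : k ≠ 0), qf, zero_mulVec, dotProduct_zero, av_const]

lemma mom_ss (B : ℝ) (k : ℕ) : ∃ C : ℝ, 0 ≤ C ∧ ∀ n : ℕ, 4 ≤ n → ∀ j : ℕ, (j : ℝ) ≤ B * n →
    Ex (n := n) j (fun S => ss S k) ≤ C := by
  induction k with
  | zero =>
    refine ⟨1, zero_le_one, fun n hn j _ => ?_⟩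
    simp only [ss_zero (by omega : 2 ≤ n), Ex_const, le_refl]
  | succ k ih =>
    obtain ⟨C, hC, ih⟩ := ih
    obtain ⟨D, hD, hDD⟩ := coeff_DD_le (k + 1)
    have key : ∀ n : ℕ, 4 ≤ n → ∀ j : ℕ, (j : ℝ) ≤ B * n →
        Ex (n := n) j (fun S => ss S (k+1)) ≤ j * (D * (1 + C) / ((n:ℝ) - 1)) := by
      intro n hn j
      have hN := N_pos hn
      induction j with
      | zero => intro _; rw [Ex_zero, ss_zero_mat (by omega)]; simp
      | succ j ihj =>
        intro hj
        have hj' : (j : ℝ) ≤ B * n := by push_cast at hj; linarith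
        have h1 := ihj hj'
        rw [Ex_succ']
        have h2 : Ex j (fun S : Mat n => av fun σ => ss (upd S σ) (k+1)) ≤
            Ex j (fun S : Mat n => ss S (k+1) + (D / ((n:ℝ) - 1)) * (1 + ss S k)) := by
          refine Ex_mono j fun S hS => ?_
          have : av (fun σ => ss S (k+1) + (D / ((n:ℝ) - 1)) * (1 + xx S σ k))
              = ss S (k+1) + (D / ((n:ℝ) - 1)) * (1 + ss S k) := by
            rw [av_add, av_const, av_mul, av_add, av_const]; rfl
          rw [← this]
          refine av_mono fun σ => ?_
          rw [ss_upd (by omega) hS σ (by omega)]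
          have := hDD n (by omega) S hS σ
          rw [Nat.add_sub_cancel] at this
          rw [div_mul_eq_mul_div]
          gcongr
        refine h2.trans ?_
        rw [Ex_add, Ex_mul, Ex_add, Ex_const]
        have h3 := ih n hn j hj'
        have h4 : D / ((n:ℝ) - 1) * (1 + Ex (n := n) j (fun S => ss S k)) ≤ D / ((n:ℝ) - 1) * (1 + C) := by
          gcongr
        push_cast
        have h5 : D / ((n:ℝ) - 1) * (1 + C) = D * (1 + C) / ((n:ℝ) - 1) := by ring
        rw [h5] at h4
        linarith
    refine ⟨2 * |B| * (D * (1 + C)), by positivity, fun n hn j hj => (key n hn j hj).trans ?_⟩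
    have hN := N_pos hn
    have h1 : (j : ℝ) / ((n:ℝ) - 1) ≤ 2 * |B| := by
      rw [div_le_iff₀ (by linarith)]
      have h5 : B * n ≤ |B| * n := mul_le_mul_of_nonneg_right (le_abs_self B) (Nat.cast_nonneg n)
      nlinarith [abs_nonneg B]
    calc (j:ℝ) * (D * (1 + C) / ((n:ℝ) - 1)) = (j / ((n:ℝ) - 1)) * (D * (1 + C)) := by ring
      _ ≤ _ := by gcongr

lemma Rt_ss (B : ℝ) (k : ℕ) : Rt B 0 (fun _ _ S _ => ss S k) := by
  obtain ⟨C, hC, h⟩ := mom_ss B k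
  exact ⟨C, hC, fun n hn j hj => by rw [EE_S]; simpa using h n hn j hj⟩
lemma Rt_xx (B : ℝ) (k : ℕ) : Rt B 0 (fun _ _ S σ => xx S σ k) := by
  obtain ⟨C, hC, h⟩ := mom_ss B k
  exact ⟨C, hC, fun n hn j hj => by rw [pow_zero, mul_one]; exact h n hn j hj⟩

noncomputable def Lf {n : ℕ} (K : ℕ) (S : Mat n) (σ : Pm n) : ℝ := 1 + xx S σ K + ss S K
noncomputable def Dl {n : ℕ} (K : ℕ) (S : Mat n) (σ : Pm n) : ℝ := ∑ i ∈ range K, |xx S σ i - ss S i|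

section
variable {n : ℕ}
lemma Lf_ge_one (hn : 2 ≤ n) {S : Mat n} (hS : Good S) (σ : Pm n) (K : ℕ) : 1 ≤ Lf K S σ := by
  unfold Lf; linarith [xx_nonneg hn hS σ K, ss_nonneg hn hS K]
lemma xx_le_Lf (hn : 2 ≤ n) {S : Mat n} (hS : Good S) (σ : Pm n) {i K : ℕ} (h : i ≤ K) :
    xx S σ i ≤ Lf K S σ := by
  unfold Lf; linarith [xx_le_one_add hn hS σ h, ss_nonneg hn hS K]
lemma ss_le_Lf (hn : 2 ≤ n) {S : Mat n} (hS : Good S) (σ : Pm n) {i K : ℕ} (h : i ≤ K) :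
    ss S i ≤ Lf K S σ := by
  unfold Lf; linarith [ss_le_one_add hn hS h, xx_nonneg hn hS σ K]
lemma Dl_nonneg (K : ℕ) (S : Mat n) (σ : Pm n) : 0 ≤ Dl K S σ := Finset.sum_nonneg fun _ _ => abs_nonneg _
lemma Dl_le_Lf (hn : 2 ≤ n) {S : Mat n} (hS : Good S) (σ : Pm n) (K : ℕ) :
    Dl K S σ ≤ K * Lf K S σ := by
  have : ∀ i ∈ range K, |xx S σ i - ss S i| ≤ Lf K S σ := by
    intro i hi
    have hi : i ≤ K := (Finset.mem_range.1 hi).le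
    rw [abs_le]
    constructor
    · linarith [ss_le_Lf hn hS σ hi, xx_nonneg hn hS σ i]
    · linarith [xx_le_Lf hn hS σ hi, ss_nonneg hn hS i]
  refine (Finset.sum_le_sum this).trans ?_
  simp
end

lemma pow_add3_le {a b : ℝ} (ha : 0 ≤ a) (hb : 0 ≤ b) (q : ℕ) :
    (1 + a + b) ^ q ≤ 3 ^ q * (1 + a ^ q + b ^ q) := by
  have h1 : 1 + a + b ≤ 3 * max 1 (max a b) := by
    have := le_max_left 1 (max a b)
    have := (le_max_left a b).trans (le_max_right 1 (max a b))
    have := (le_max_right a b).trans (le_max_right 1 (max a b))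
    linarith
  have h2 : (max 1 (max a b)) ^ q ≤ 1 + a ^ q + b ^ q := by
    have := pow_nonneg ha q
    have := pow_nonneg hb q
    rcases max_choice 1 (max a b) with h | h
    · rw [h]; simp; linarith
    · rw [h]; rcases max_choice a b with h | h <;> rw [h] <;> linarith
  calc (1 + a + b) ^ q ≤ (3 * max 1 (max a b)) ^ q := pow_le_pow_left₀ (by positivity) h1 q
    _ = 3 ^ q * (max 1 (max a b)) ^ q := mul_pow _ _ _
    _ ≤ _ := by gcongr

lemma Rt_L (B : ℝ) (K q : ℕ) : Rt B 0 (fun _ _ S σ => Lf K S σ ^ q) := by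
  refine (((Rt.one B).add (Rt_xx B (K * q))).add (Rt_ss B (K * q)) |>.cmul (c := 3 ^ q) (by positivity)).mono ?_
  intro n hn j _ S hS σ
  refine (pow_add3_le (xx_nonneg (by omega) hS σ K) (ss_nonneg (by omega) hS K) q).trans ?_
  have := xx_pow_le (by omega) hS σ K q
  have := ss_pow_le (by omega) hS K q
  gcongr

lemma Rt_delta4 (B : ℝ) (i : ℕ) : Rt B 4 (fun _ _ S σ => (xx S σ i - ss S i) ^ 4) := by
  rcases Nat.eq_zero_or_pos i with rfl | hi
  · refine (Rt.zero B 4).mono ?_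
    intro n hn j _ S hS σ
    rw [xx_zero (by omega), ss_zero (by omega)]; simp
  obtain ⟨C, hC, h⟩ := mom_ss B (i * 4)
  refine ⟨2 * 10 ^ 9 * C, by positivity, fun n hn j hj => ?_⟩
  have hN := N_pos hn
  have h1 : EE n j (fun S σ => (xx S σ i - ss S i) ^ 4) ≤
      Ex j (fun S : Mat n => (2 * 10 ^ 9 * ww n ^ 4) * ss S (i*4)) := by
    refine Ex_mono j fun S hS => ?_
    have f := fourth_moment hn (hS.sym0_pow hi)
    rw [← ss_eq (by omega) hS hi] at f
    refine f.trans ?_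
    have e1 : S ^ i * S ^ i = S ^ (i * 2) := by rw [← pow_add, mul_two]
    have a1 : av (fun σ => qf (S ^ i * S ^ i) (vv n σ) ^ 2) ≤ ss S (i * 4) := by
      refine av_mono fun σ => ?_
      rw [e1]
      have := xx_pow_le (by omega) hS σ (i*2) 2
      rwa [mul_assoc] at this
    have a2 : ((S ^ i * S ^ i).trace / n) ^ 2 ≤ ss S (i * 4) := by
      rw [e1]
      have h0 := ss_nonneg (by omega) hS (i*2)
      have h2 := ss_pow_le (by omega) hS (i*2) 2
      rw [mul_assoc] at h2
      refine le_trans ?_ h2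
      have h3 := ss_eq (by omega) hS (show 1 ≤ i * 2 by omega)
      have h4 : (S ^ (i*2)).trace = ss S (i*2) * ((n:ℝ) - 1) := by
        rw [h3]; field_simp
      have h5 : (S ^ (i*2)).trace / n ≤ ss S (i*2) := by
        rw [h4, div_le_iff₀ (by linarith)]; nlinarith
      refine pow_le_pow_left₀ ?_ h5 2
      rw [h4]; apply div_nonneg _ (by linarith)
      exact mul_nonneg h0 (by linarith)
    have h6 : (10:ℝ) ^ 9 / n ^ 2 ≤ 10 ^ 9 * ww n ^ 4 := by
      rw [show ww n ^ 4 = (ww n ^ 2) ^ 2 by ring, ww_sq hn, inv_pow, ← div_eq_mul_inv]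
      gcongr
      linarith
    have h7 := ss_nonneg (by omega) hS (i*4)
    have hw := ww_pos hn
    calc _ ≤ 10 ^ 9 * ww n ^ 4 * (ss S (i*4) + ss S (i*4)) :=
          mul_le_mul h6 (add_le_add a1 a2) (by
            apply add_nonneg (av_nonneg fun σ => sq_nonneg _) (sq_nonneg _)) (by positivity)
      _ = _ := by ring
  refine h1.trans ?_
  rw [Ex_mul]
  have h2 := h n hn j hj
  have hw := ww_pos hn
  have := mul_le_mul_of_nonneg_left h2 (show 0 ≤ 2 * 10 ^ 9 * ww n ^ 4 by positivity)
  linarith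

lemma sum_pow_four_le {ι : Type*} (s : Finset ι) (f : ι → ℝ) :
    (∑ i ∈ s, |f i|) ^ 4 ≤ (s.card : ℝ) ^ 3 * ∑ i ∈ s, f i ^ 4 := by
  have h1 := sq_sum_le_card_mul_sum_sq (s := s) (f := fun i => |f i|)
  have h2 := sq_sum_le_card_mul_sum_sq (s := s) (f := fun i => |f i| ^ 2)
  have h0 : 0 ≤ ∑ i ∈ s, |f i| ^ 2 := Finset.sum_nonneg fun _ _ => sq_nonneg _
  calc (∑ i ∈ s, |f i|) ^ 4 = ((∑ i ∈ s, |f i|) ^ 2) ^ 2 := by ring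
    _ ≤ (s.card * ∑ i ∈ s, |f i| ^ 2) ^ 2 := pow_le_pow_left₀ (sq_nonneg _) h1 2
    _ = s.card ^ 2 * (∑ i ∈ s, |f i| ^ 2) ^ 2 := by ring
    _ ≤ s.card ^ 2 * (s.card * ∑ i ∈ s, (|f i| ^ 2) ^ 2) := by gcongr
    _ = _ := by
      rw [← mul_assoc, ← pow_succ]
      congr 1
      refine Finset.sum_congr rfl fun i _ => ?_
      rw [sq_abs]; ring

lemma Rt_Dl (B : ℝ) (K : ℕ) : Rt B 4 (fun _ _ S σ => Dl K S σ ^ 4) := by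
  refine ((Rt.sum (range K) fun i _ => Rt_delta4 B i).cmul (c := (K:ℝ)^3) (by positivity)).mono ?_
  intro n hn j _ S hS σ
  have := sum_pow_four_le (range K) (fun i => xx S σ i - ss S i)
  rw [Finset.card_range] at this; exact this
end Spear

open MeasureTheory Finset
namespace Spear
open Matrix

/-! ### polynomial bounds -/
lemma poly_bdd (p : Polynomial ℝ) (T : ℝ) : ∃ C : ℝ, 0 ≤ C ∧ ∀ t, 0 ≤ t → t ≤ T → |p.eval t| ≤ C := by
  obtain ⟨C, hC⟩ := (isCompact_Icc (a := (0:ℝ)) (b := T)).exists_bound_of_continuousOn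
    (f := fun t => p.eval t) p.continuous.continuousOn
  exact ⟨max C 0, le_max_right _ _, fun t h0 h1 => (hC t ⟨h0, h1⟩).trans (le_max_left _ _)⟩

lemma poly_taylor2 (p : Polynomial ℝ) (T : ℝ) (hT : 0 ≤ T) : ∃ C : ℝ, 0 ≤ C ∧ ∀ t h, 0 ≤ t → 0 ≤ h → t + h ≤ T →
    |p.eval (t + h) - p.eval t - p.derivative.eval t * h - p.derivative.derivative.eval t / 2 * h ^ 2|
      ≤ C * h ^ 3 := by
  induction p using Polynomial.induction_on with
  | C a => exact ⟨0, le_rfl, fun t h _ _ _ => by simp⟩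
  | add p q hp hq =>
    obtain ⟨C, hC, hp⟩ := hp
    obtain ⟨D, hD, hq⟩ := hq
    refine ⟨C + D, by positivity, fun t h ht hh hth => ?_⟩
    have := (abs_add_le _ _).trans (add_le_add (hp t h ht hh hth) (hq t h ht hh hth))
    rw [← add_mul] at this
    refine le_trans (le_of_eq ?_) this
    congr 1
    simp only [Polynomial.eval_add, Polynomial.derivative_add]; ring
  | monomial m a hp =>
    obtain ⟨C, hC, hp⟩ := hp
    set p : Polynomial ℝ := Polynomial.C a * Polynomial.X ^ m
    have e : Polynomial.C a * Polynomial.X ^ (m+1) = Polynomial.X * p := by simp only [p]; ring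
    rw [e]
    obtain ⟨D, hD, hb⟩ := poly_bdd p.derivative.derivative T
    refine ⟨T * C + D, by positivity, fun t h ht hh hth => ?_⟩
    have h1 := hp t h ht hh hth
    set R := p.eval (t + h) - p.eval t - p.derivative.eval t * h - p.derivative.derivative.eval t / 2 * h ^ 2 with hR
    have e2 : (Polynomial.X * p).eval (t + h) - (Polynomial.X * p).eval t - (Polynomial.X * p).derivative.eval t * h
        - (Polynomial.X * p).derivative.derivative.eval t / 2 * h ^ 2
        = (t + h) * R + p.derivative.derivative.eval t / 2 * h ^ 3 := by
      simp only [Polynomial.eval_mul, Polynomial.eval_X, Polynomial.derivative_mul, Polynomial.derivative_X,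
        Polynomial.derivative_add, one_mul, Polynomial.eval_add, hR]
      ring
    rw [e2]
    have h2 := hb t ht (by linarith)
    have hh3 : 0 ≤ h ^ 3 := by positivity
    calc _ ≤ |(t + h) * R| + |p.derivative.derivative.eval t / 2 * h ^ 3| := abs_add_le _ _
      _ = (t + h) * |R| + |p.derivative.derivative.eval t| / 2 * h ^ 3 := by
        rw [abs_mul, abs_mul, abs_div, abs_of_nonneg (by linarith : 0 ≤ t + h), abs_of_nonneg hh3]; norm_num
      _ ≤ T * (C * h ^ 3) + D * h ^ 3 := by
        have a1 : (t + h) * |R| ≤ T * (C * h^3) := mul_le_mul hth h1 (abs_nonneg _) hT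
        have a2 : |p.derivative.derivative.eval t| / 2 * h ^ 3 ≤ D * h ^ 3 := by
          refine mul_le_mul_of_nonneg_right ?_ hh3
          linarith [abs_nonneg (p.derivative.derivative.eval t)]
        linarith
      _ = _ := by ring

lemma poly_taylor1 (p : Polynomial ℝ) (T : ℝ) (hT : 0 ≤ T) : ∃ C : ℝ, 0 ≤ C ∧ ∀ t h, 0 ≤ t → 0 ≤ h → h ≤ 1 → t + h ≤ T →
    |p.eval (t + h) - p.eval t - p.derivative.eval t * h| ≤ C * h ^ 2 := by
  obtain ⟨C, hC, h1⟩ := poly_taylor2 p T hT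
  obtain ⟨D, hD, hb⟩ := poly_bdd p.derivative.derivative T
  refine ⟨C + D, by positivity, fun t h ht hh hh1 hth => ?_⟩
  have a1 := h1 t h ht hh hth
  have a2 := hb t ht (by linarith)
  have a3 : C * h ^ 3 ≤ C * h ^ 2 := mul_le_mul_of_nonneg_left (pow_le_pow_of_le_one hh hh1 (by norm_num)) hC
  rw [abs_le] at *
  constructor <;> nlinarith [sq_nonneg h]

lemma poly_taylor0 (p : Polynomial ℝ) (T : ℝ) (hT : 0 ≤ T) : ∃ C : ℝ, 0 ≤ C ∧ ∀ t h, 0 ≤ t → 0 ≤ h → h ≤ 1 → t + h ≤ T →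
    |p.eval (t + h) - p.eval t| ≤ C * h := by
  obtain ⟨C, hC, h1⟩ := poly_taylor1 p T hT
  obtain ⟨D, hD, hb⟩ := poly_bdd p.derivative T
  refine ⟨C + D, by positivity, fun t h ht hh hh1 hth => ?_⟩
  have a1 := h1 t h ht hh hh1 hth
  have a2 := hb t ht (by linarith)
  have a3 : C * h ^ 2 ≤ C * h := mul_le_mul_of_nonneg_left (by nlinarith) hC
  rw [abs_le] at *
  constructor <;> nlinarith

/-! ### expansion bounds in terms of `Lf`, `Dl` -/
section
variable {n : ℕ}
lemma coeff_xser (S : Mat n) (σ : Pm n) (i : ℕ) : PowerSeries.coeff i (xser S σ) = xx S σ i :=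
  PowerSeries.coeff_mk _ _
lemma coeff_sser (S : Mat n) (i : ℕ) : PowerSeries.coeff i (sser S) = ss S i :=
  PowerSeries.coeff_mk _ _
lemma tn_xser (hn : 2 ≤ n) {S : Mat n} (hS : Good S) (σ : Pm n) (K : ℕ) :
    1 + tn K (xser S σ) ≤ (K + 1) * Lf K S σ := by
  have : tn K (xser S σ) ≤ ∑ i ∈ range K, Lf K S σ := by
    refine Finset.sum_le_sum fun i hi => ?_
    rw [coeff_xser, abs_of_nonneg (xx_nonneg hn hS σ i)]
    exact xx_le_Lf hn hS σ (Finset.mem_range.1 hi).le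
  have h2 := Lf_ge_one hn hS σ K
  simp at this; linarith
lemma tn_sser (hn : 2 ≤ n) {S : Mat n} (hS : Good S) (σ : Pm n) (K : ℕ) :
    1 + tn K (sser S) ≤ (K + 1) * Lf K S σ := by
  have : tn K (sser S) ≤ ∑ i ∈ range K, Lf K S σ := by
    refine Finset.sum_le_sum fun i hi => ?_
    rw [coeff_sser, abs_of_nonneg (ss_nonneg hn hS i)]
    exact ss_le_Lf hn hS σ (Finset.mem_range.1 hi).le
  have h2 := Lf_ge_one hn hS σ K
  simp at this; linarith
lemma tn_diff (S : Mat n) (σ : Pm n) (K : ℕ) : tn K (xser S σ - sser S) = Dl K S σ := by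
  simp only [tn, Dl, map_sub, coeff_xser, coeff_sser]

lemma DD_diff (hn : 2 ≤ n) {S : Mat n} (hS : Good S) (σ : Pm n) (k : ℕ) :
    |PowerSeries.coeff k (DD (xser S σ)) - PowerSeries.coeff k (DD (sser S))|
      ≤ (k * (k + 1) ^ (2 * k + 1)) * (Lf k S σ ^ (2 * k + 1) * Dl k S σ) := by
  refine (DD_bound1 k _ _).trans ?_
  rw [tn_diff]
  have h1 := tn_xser hn hS σ k
  have h2 := tn_sser hn hS σ k
  have h3 : tn k (HX (sser S)) ≤ ((k + 1) * Lf k S σ) ^ k :=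
    ((tn_mono (Nat.le_succ k) _).trans (tn_HX k _)).trans
      (pow_le_pow_left₀ (by linarith [tn_nonneg k (sser S)]) h2 k)
  have h4 := Dl_nonneg k S σ
  have h5 := Lf_ge_one hn hS σ k
  have h6 := tn_nonneg k (sser S)
  have h7 := tn_nonneg k (xser S σ)
  calc _ ≤ k * (Dl k S σ * ((k + 1) * Lf k S σ) ^ k) * (((k + 1) * Lf k S σ) * ((k + 1) * Lf k S σ) ^ k) := by
        gcongr
    _ = _ := by rw [show 2 * k + 1 = k + 1 + k by ring]; simp only [mul_pow, pow_add]; ring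
end

noncomputable def epsn {n : ℕ} (K : ℕ) (t : ℝ) (S : Mat n) (σ : Pm n) : ℝ :=
  ∑ i ∈ range K, |xx S σ i - (mp i).eval t|

lemma DD_expand (k : ℕ) (T : ℝ) : ∃ C : ℝ, 0 ≤ C ∧ ∀ n : ℕ, 2 ≤ n → ∀ S : Mat n, Good S → ∀ σ t, 0 ≤ t → t ≤ T →
    ∀ a ≤ k, |PowerSeries.coeff a (DD (xser S σ)) - (mp a).derivative.eval t
      - ∑ i ∈ range k, (KK a i).eval t * (xx S σ i - (mp i).eval t)
      - 1/2 * ∑ i ∈ range k, ∑ l ∈ range k, (H2 a i l).eval t *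
        ((xx S σ i - (mp i).eval t) * (xx S σ l - (mp l).eval t))|
      ≤ C * (Lf k S σ ^ k * epsn k t S σ ^ 3) := by
  have hb : ∃ C : ℝ, 0 ≤ C ∧ ∀ t, 0 ≤ t → t ≤ T → tn k (mser t) ≤ C := by
    choose c hc0 hc using fun i => poly_bdd (mp i) T
    refine ⟨∑ i ∈ range k, c i, Finset.sum_nonneg fun i _ => hc0 i, fun t h0 h1 => ?_⟩
    refine Finset.sum_le_sum fun i _ => ?_
    rw [coeff_mser]; exact hc i t h0 h1
  obtain ⟨C, hC, hb⟩ := hb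
  refine ⟨k * ((1 + C) ^ k) ^ 3 * ((1 + C) * (k + 1) ^ k), by positivity, ?_⟩
  intro n hn S hS σ t h0 hT a ha
  have h := DD_bound3 a (xser S σ) (mser t)
  rw [coeff_lin t _ k a ha, coeff_quad t _ k a ha, DD_mser] at h
  simp only [coeff_xser] at h
  refine h.trans ?_
  have e1 : tn k (xser S σ - mser t) = epsn k t S σ := by
    simp only [tn, epsn, map_sub, coeff_xser, coeff_mser]
  have h1 : tn a (xser S σ - mser t) ≤ epsn k t S σ := by rw [← e1]; exact tn_mono ha _
  have h2 : tn a (mser t) ≤ C := (tn_mono ha _).trans (hb t h0 hT)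
  have h3 : tn a (HX (mser t)) ≤ (1 + C) ^ k := by
    refine ((tn_mono (ha.trans (Nat.le_succ k)) _).trans (tn_HX k _)).trans ?_
    have := tn_nonneg k (mser t)
    have := hb t h0 hT
    gcongr
  have h5 := Lf_ge_one hn hS σ k
  have h4 : (1 + tn a (xser S σ)) ^ a ≤ ((k + 1) * Lf k S σ) ^ k := by
    have g1 : 1 + tn a (xser S σ) ≤ (k + 1) * Lf k S σ := by
      linarith [tn_xser hn hS σ k, tn_mono ha (xser S σ)]
    have g2 := tn_nonneg a (xser S σ)
    calc _ ≤ (1 + tn a (xser S σ)) ^ k := pow_le_pow_right₀ (by linarith) ha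
      _ ≤ _ := pow_le_pow_left₀ (by linarith) g1 k
  have ha' : (a : ℝ) ≤ k := by exact_mod_cast ha
  have h6 := tn_nonneg a (xser S σ - mser t)
  have h7 := tn_nonneg a (HX (mser t))
  have h8 := tn_nonneg a (mser t)
  have h9 := tn_nonneg a (xser S σ)
  have h10 : 0 ≤ epsn k t S σ := h6.trans h1
  calc _ ≤ (k:ℝ) * (epsn k t S σ * (1 + C) ^ k) ^ 3 * ((1 + C) * ((k + 1) * Lf k S σ) ^ k) := by
        gcongr
    _ = _ := by simp only [mul_pow]; ring

/-! ### variance -/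
lemma jw_le {B : ℝ} {n : ℕ} (hn : 4 ≤ n) {j : ℕ} (hj : (j : ℝ) ≤ B * n) : (j : ℝ) / ((n:ℝ) - 1) ≤ 2 * |B| := by
  have hN := N_pos hn
  rw [div_le_iff₀ (by linarith)]
  have h5 : B * n ≤ |B| * n := mul_le_mul_of_nonneg_right (le_abs_self B) (Nat.cast_nonneg n)
  nlinarith [abs_nonneg B]

lemma Rt_LD2 (B : ℝ) (K q : ℕ) : Rt B 2 (fun _ _ S σ => Lf K S σ ^ q * Dl K S σ ^ 2) := by
  have h := Rt.young (B := B) (a := 0) (b := 2) (X := fun _ _ S σ => Lf K S σ ^ q) (Y := fun _ _ S σ => Dl K S σ ^ 2)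
    (by simp only [← pow_mul]; exact Rt_L B K _) (by simp only [← pow_mul]; exact Rt_Dl B K)
  exact h

lemma var_ss (B : ℝ) (k : ℕ) (hk : 1 ≤ k) : ∃ C : ℝ, 0 ≤ C ∧ ∀ n : ℕ, 4 ≤ n → ∀ j : ℕ, (j : ℝ) ≤ B * n →
    Ex (n := n) j (fun S => ss S k ^ 2) - (Ex (n := n) j (fun S => ss S k)) ^ 2 ≤ C * ww n ^ 4 := by
  obtain ⟨C, hC, h⟩ := Rt_LD2 B k ((2 * k + 1) * 2)
  set D : ℝ := (k * (k + 1) ^ (2 * k + 1)) ^ 2 with hD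
  refine ⟨2 * |B| * (D * C), by positivity, fun n hn j hj => ?_⟩
  have hw := ww_pos hn
  have hN := N_pos hn
  rcases j with _ | j
  · simp only [Ex_zero, ss_zero_mat hk]
    have : 0 ≤ 2 * |B| * (D * C) * ww n ^ 4 := by positivity
    simpa using this
  refine (efron_stein j _).trans ?_
  have hj' : (j : ℝ) ≤ B * n := by push_cast at hj; linarith
  have h1 : Ex j (Var1 (fun S : Mat n => ss S k)) ≤ (ww n ^ 4 * D) * EE n j (fun S σ => Lf k S σ ^ ((2 * k + 1) * 2) * Dl k S σ ^ 2) := by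
    rw [← EE_mul]
    refine Ex_mono j fun S hS => ?_
    refine (Var1_le _ S (ss S k + PowerSeries.coeff k (DD (sser S)) / ((n:ℝ) - 1))).trans ?_
    refine av_mono fun σ => ?_
    rw [ss_upd (by omega) hS σ hk]
    have e : (ss S k + PowerSeries.coeff k (DD (xser S σ)) / ((n:ℝ) - 1) -
        (ss S k + PowerSeries.coeff k (DD (sser S)) / ((n:ℝ) - 1))) ^ 2
        = ww n ^ 4 * |PowerSeries.coeff k (DD (xser S σ)) - PowerSeries.coeff k (DD (sser S))| ^ 2 := by
      rw [show ww n ^ 4 = (ww n ^ 2) ^ 2 by ring, ww_sq hn, sq_abs]; field_simp; ring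
    rw [e]; beta_reduce; rw [mul_assoc (ww n ^ 4) D]
    refine mul_le_mul_of_nonneg_left ?_ (by positivity)
    refine (pow_le_pow_left₀ (abs_nonneg _) (DD_diff (by omega) hS σ k) 2).trans (le_of_eq ?_)
    rw [hD, pow_mul]; ring
  have h2 := h n hn j hj'
  have h3 := jw_le hn hj
  have h4 : Ex j (Var1 (fun S : Mat n => ss S k)) ≤ (ww n ^ 4 * D) * (C * ww n ^ 2) :=
    h1.trans (mul_le_mul_of_nonneg_left h2 (by positivity))
  calc ((j:ℝ) + 1) * Ex j (Var1 (fun S : Mat n => ss S k)) ≤ (j + 1) * ((ww n ^ 4 * D) * (C * ww n ^ 2)) := by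
        gcongr
    _ = ((j + 1 : ℕ) / ((n:ℝ) - 1)) * (D * C) * ww n ^ 4 := by
        rw [ww_sq hn]; push_cast; field_simp
    _ ≤ _ := by gcongr
end Spear

open MeasureTheory Finset
namespace Spear
open Matrix

noncomputable def tt (n j : ℕ) : ℝ := (j : ℝ) / ((n : ℝ) - 1)
noncomputable def zz (n j : ℕ) (S : Mat n) (a : ℕ) : ℝ := ss S a - (mp a).eval (tt n j)
noncomputable def Zf (K n j : ℕ) (S : Mat n) : ℝ := ∑ i ∈ range K, |zz n j S i|

lemma tt_nonneg {n : ℕ} (hn : 4 ≤ n) (j : ℕ) : 0 ≤ tt n j := by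
  have := N_pos hn
  unfold tt; exact div_nonneg (Nat.cast_nonneg _) (by linarith)
lemma tt_succ {n : ℕ} (hn : 4 ≤ n) (j : ℕ) : tt n (j + 1) = tt n j + ww n ^ 2 := by
  rw [ww_sq hn]; unfold tt; push_cast; rw [add_div, one_div]
lemma ww_sq_le {n : ℕ} (hn : 4 ≤ n) : ww n ^ 2 ≤ 1 := pow_le_one₀ (ww_pos hn).le (ww_le_one hn)

lemma Zf_nonneg (K n j : ℕ) (S : Mat n) : 0 ≤ Zf K n j S := Finset.sum_nonneg fun _ _ => abs_nonneg _

lemma mps_bdd (K : ℕ) (T : ℝ) : ∃ C : ℝ, 0 ≤ C ∧ ∀ i ≤ K, ∀ t, 0 ≤ t → t ≤ T → |(mp i).eval t| ≤ C := by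
  choose c hc0 hc using fun i => poly_bdd (mp i) T
  refine ⟨∑ i ∈ range (K + 1), c i, Finset.sum_nonneg fun i _ => hc0 i, fun i hi t h0 h1 => (hc i t h0 h1).trans ?_⟩
  exact Finset.single_le_sum (f := c) (fun i _ => hc0 i) (Finset.mem_range.2 (by omega))

lemma polys_bdd {ι : Type*} [Fintype ι] (p : ι → Polynomial ℝ) (T : ℝ) :
    ∃ C : ℝ, 0 ≤ C ∧ ∀ i, ∀ t, 0 ≤ t → t ≤ T → |(p i).eval t| ≤ C := by
  classical
  choose c hc0 hc using fun i => poly_bdd (p i) T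
  refine ⟨∑ i, c i, Finset.sum_nonneg fun i _ => hc0 i, fun i t h0 h1 => (hc i t h0 h1).trans ?_⟩
  exact Finset.single_le_sum (f := c) (fun i _ => hc0 i) (Finset.mem_univ _)

lemma Zf_le_Lf (K : ℕ) (B : ℝ) : ∃ C : ℝ, 0 ≤ C ∧ ∀ n : ℕ, 4 ≤ n → ∀ j : ℕ, (j : ℝ) ≤ B * n → ∀ S : Mat n, Good S → ∀ σ,
    Zf K n j S ≤ C * Lf K S σ := by
  obtain ⟨C, hC, h⟩ := mps_bdd K (2 * |B|)
  refine ⟨K * (1 + C), by positivity, fun n hn j hj S hS σ => ?_⟩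
  have h1 := Lf_ge_one (by omega) hS σ K
  have : Zf K n j S ≤ ∑ i ∈ range K, (1 + C) * Lf K S σ := by
    refine Finset.sum_le_sum fun i hi => ?_
    have hi' := (Finset.mem_range.1 hi).le
    have a1 := h i hi' (tt n j) (tt_nonneg hn j) (jw_le hn hj)
    have a2 := ss_le_Lf (by omega) hS σ hi'
    have a3 := ss_nonneg (by omega) hS i
    have a4 : |zz n j S i| ≤ |ss S i| + |(mp i).eval (tt n j)| := abs_sub _ _
    rw [abs_of_nonneg a3] at a4
    nlinarith
  simp at this; linarith

lemma epsn_le {n : ℕ} (K j : ℕ) (S : Mat n) (σ : Pm n) : epsn K (tt n j) S σ ≤ Dl K S σ + Zf K n j S := by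
  rw [epsn, Dl, Zf, ← Finset.sum_add_distrib]
  refine Finset.sum_le_sum fun i _ => ?_
  have : xx S σ i - (mp i).eval (tt n j) = (xx S σ i - ss S i) + zz n j S i := by unfold zz; ring
  rw [this]; exact abs_add_le _ _

lemma epsn_nonneg {n : ℕ} (K : ℕ) (t : ℝ) (S : Mat n) (σ : Pm n) : 0 ≤ epsn K t S σ :=
  Finset.sum_nonneg fun _ _ => abs_nonneg _

lemma epsn_le_Lf (K : ℕ) (T : ℝ) : ∃ C : ℝ, 0 ≤ C ∧ ∀ n : ℕ, 2 ≤ n → ∀ S : Mat n, Good S → ∀ σ t, 0 ≤ t → t ≤ T →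
    epsn K t S σ ≤ C * Lf K S σ := by
  obtain ⟨C, hC, h⟩ := mps_bdd K T
  refine ⟨K * (1 + C), by positivity, fun n hn S hS σ t h0 hT => ?_⟩
  have h1 := Lf_ge_one (by omega) hS σ K
  have : epsn K t S σ ≤ ∑ i ∈ range K, (1 + C) * Lf K S σ := by
    refine Finset.sum_le_sum fun i hi => ?_
    have hi' := (Finset.mem_range.1 hi).le
    have a1 := h i hi' t h0 hT
    have a2 := xx_le_Lf (by omega) hS σ hi'
    have a3 := xx_nonneg (by omega) hS σ i
    have a4 : |xx S σ i - (mp i).eval t| ≤ |xx S σ i| + |(mp i).eval t| := abs_sub _ _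
    rw [abs_of_nonneg a3] at a4
    nlinarith
  simp at this; linarith

lemma quad_le {n : ℕ} (K : ℕ) (t : ℝ) (S : Mat n) (σ : Pm n) (c : ℕ → ℕ → ℝ) (D : ℝ)
    (hc : ∀ i < K, ∀ l < K, |c i l| ≤ D) :
    |∑ i ∈ range K, ∑ l ∈ range K, c i l * ((xx S σ i - (mp i).eval t) * (xx S σ l - (mp l).eval t))|
      ≤ D * epsn K t S σ ^ 2 := by
  rw [epsn, sq, Finset.sum_mul_sum, Finset.mul_sum]
  refine (Finset.abs_sum_le_sum_abs _ _).trans (Finset.sum_le_sum fun i hi => ?_)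
  rw [Finset.mul_sum]
  refine (Finset.abs_sum_le_sum_abs _ _).trans (Finset.sum_le_sum fun l hl => ?_)
  rw [abs_mul, abs_mul]
  exact mul_le_mul_of_nonneg_right (hc i (Finset.mem_range.1 hi) l (Finset.mem_range.1 hl)) (by positivity)

lemma DD_expand1 (k : ℕ) (T : ℝ) : ∃ C : ℝ, 0 ≤ C ∧ ∀ n : ℕ, 2 ≤ n → ∀ S : Mat n, Good S → ∀ σ t, 0 ≤ t → t ≤ T →
    ∀ a ≤ k, |PowerSeries.coeff a (DD (xser S σ)) - (mp a).derivative.eval t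
      - ∑ i ∈ range k, (KK a i).eval t * (xx S σ i - (mp i).eval t)|
      ≤ C * (Lf k S σ ^ (k + 1) * epsn k t S σ ^ 2) := by
  obtain ⟨C, hC, h⟩ := DD_expand k T
  obtain ⟨D, hD, hH⟩ := polys_bdd (fun x : Fin (k+1) × Fin k × Fin k => H2 x.1 x.2.1 x.2.2) T
  obtain ⟨E, hE, he⟩ := epsn_le_Lf k T
  refine ⟨C * E + D, by positivity, fun n hn S hS σ t h0 hT a ha => ?_⟩
  have h1 := h n hn S hS σ t h0 hT a ha
  have h2 := quad_le k t S σ (fun i l => (H2 a i l).eval t) D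
    (fun i hi l hl => hH (⟨a, by omega⟩, ⟨i, hi⟩, ⟨l, hl⟩) t h0 hT)
  have h3 := he n hn S hS σ t h0 hT
  have h4 := Lf_ge_one hn hS σ k
  have h5 := epsn_nonneg k t S σ
  set e := epsn k t S σ
  set L := Lf k S σ
  have h6 : L ^ k * e ^ 3 ≤ E * (L ^ (k+1) * e ^ 2) := by
    have : L ^ k * e ^ 3 = L ^ k * e ^ 2 * e := by ring
    rw [this]
    calc _ ≤ L ^ k * e ^ 2 * (E * L) := by gcongr
      _ = _ := by ring
  have h7 : e ^ 2 ≤ L ^ (k+1) * e ^ 2 := le_mul_of_one_le_left (by positivity) (one_le_pow₀ h4)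
  have h8 := mul_le_mul_of_nonneg_left h6 hC
  have h9 := mul_le_mul_of_nonneg_left h7 hD
  have h10 : 0 ≤ D * e ^ 2 := by positivity
  rw [abs_le] at h1 h2 ⊢
  constructor <;> linarith [h1.1, h1.2, h2.1, h2.2]

lemma Rt_Z2_of (B : ℝ) (K : ℕ) (h : ∀ i < K, Rt B 4 (fun n j S _ => zz n j S i ^ 2)) :
    Rt B 4 (fun n j S _ => Zf K n j S ^ 2) := by
  have h1 := (Rt.sum (range K) (fun i hi => h i (Finset.mem_range.1 hi))).cmul (c := (K : ℝ)) (Nat.cast_nonneg _)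
  refine h1.mono fun n hn j hj S hS σ => ?_
  have := sq_sum_le_card_mul_sum_sq (s := range K) (f := fun i => |zz n j S i|)
  simpa [Zf, sq_abs] using this

lemma Rt_LZ2_of (B : ℝ) (K q : ℕ) (h : Rt B 4 (fun n j S _ => Zf K n j S ^ 2)) :
    Rt B 3 (fun n j S σ => Lf K S σ ^ q * Zf K n j S ^ 2) := by
  obtain ⟨C, hC, hZ⟩ := Zf_le_Lf K B
  have h2 : ∀ q, Rt B 2 (fun n j S σ => Lf K S σ ^ q * Zf K n j S ^ 2) := by
    intro q
    have := (Rt.young (B := B) (a := 0) (b := 2) (X := fun _ _ S σ => Lf K S σ ^ (q + 1)) (Y := fun n j S _ => Zf K n j S)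
      (by simp only [← pow_mul]; exact Rt_L B K _) h).cmul hC
    refine this.mono fun n hn j hj S hS σ => ?_
    have a1 := hZ n hn j hj S hS σ
    have a2 := Zf_nonneg K n j S
    have a3 := Lf_ge_one (by omega) hS σ K
    calc Lf K S σ ^ q * Zf K n j S ^ 2 = Lf K S σ ^ q * Zf K n j S * Zf K n j S := by ring
      _ ≤ Lf K S σ ^ q * Zf K n j S * (C * Lf K S σ) := by gcongr
      _ = _ := by ring
  have := (Rt.young (B := B) (a := 1) (b := 2) (X := fun n j S σ => Lf K S σ ^ q * Zf K n j S) (Y := fun n j S _ => Zf K n j S)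
      (by simp only [mul_pow, ← pow_mul]; exact h2 _) h)
  refine this.mono fun n hn j hj S hS σ => le_of_eq ?_
  ring

lemma Rt_abs_of (B : ℝ) (i : ℕ) (h : Rt B 4 (fun n j S _ => zz n j S i ^ 2)) :
    Rt B 2 (fun n j S _ => |zz n j S i|) := by
  have := Rt.young (B := B) (a := 0) (b := 2) (X := fun _ _ _ _ => 1) (Y := fun n j S _ => |zz n j S i|)
    (by simpa using Rt.one B) (by simpa only [sq_abs] using h)
  simpa using this

lemma bias_step (B : ℝ) (k : ℕ) (hk : 1 ≤ k) (h : ∀ i < k, Rt B 4 (fun n j S _ => zz n j S i ^ 2)) :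
    ∃ C : ℝ, 0 ≤ C ∧ ∀ n : ℕ, 4 ≤ n → ∀ j : ℕ, (j : ℝ) ≤ B * n →
      |Ex (n := n) j (fun S => ss S k) - (mp k).eval (tt n j)| ≤ C * ww n ^ 2 := by
  set T := 2 * |B| + 1 with hT
  have hT0 : 0 ≤ T := by positivity
  obtain ⟨C1, hC1, hexp⟩ := DD_expand1 k T
  obtain ⟨C2, hC2, htay⟩ := poly_taylor1 (mp k) T hT0
  obtain ⟨C3, hC3, hK⟩ := polys_bdd (fun i : Fin k => KK k i) T
  have hZ := Rt_Z2_of B k h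
  obtain ⟨C4, hC4, hQ⟩ := (Rt_LD2 B k (k+1)).add ((Rt_LZ2_of B k (k+1) hZ).weaken (show 2 ≤ 3 by norm_num))
  obtain ⟨C5, hC5, hz⟩ := Rt.sum (range k) (fun i hi => Rt_abs_of B i (h i (Finset.mem_range.1 hi)))
  set G : ℝ := C3 * C5 + 2 * C1 * C4 + C2 with hG
  have hG0 : 0 ≤ G := by positivity
  have step : ∀ n : ℕ, 4 ≤ n → ∀ j : ℕ, (j : ℝ) ≤ B * n →
      |Ex (n := n) (j+1) (fun S => ss S k) - (mp k).eval (tt n (j+1))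
        - (Ex (n := n) j (fun S => ss S k) - (mp k).eval (tt n j))| ≤ G * ww n ^ 4 := by
    intro n hn j hj
    have hN := N_pos hn
    have hw := ww_pos hn
    have ht0 := tt_nonneg hn j
    have htT : tt n j + ww n ^ 2 ≤ T := by
      have : tt n j ≤ 2 * |B| := jw_le hn hj
      have := ww_sq_le hn
      linarith
    have htT' : tt n j ≤ T := by have := sq_nonneg (ww n); linarith
    have e1 : Ex (n := n) (j+1) (fun S => ss S k) = Ex (n := n) j (fun S => ss S k)
        + ww n ^ 2 * EE n j (fun S σ => PowerSeries.coeff k (DD (xser S σ))) := by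
      rw [Ex_succ', ← EE_mul, ← EE_S j (fun S : Mat n => ss S k), ← EE_add]
      refine Ex_congr j fun S hS => ?_
      congr 1; funext σ
      rw [ss_upd (by omega) hS σ hk, ww_sq hn]; ring
    have e2 : |EE n j (fun S σ => PowerSeries.coeff k (DD (xser S σ))) - (mp k).derivative.eval (tt n j)|
        ≤ (C3 * C5 + 2 * C1 * C4) * ww n ^ 2 := by
      have e3 : EE n j (fun S σ => PowerSeries.coeff k (DD (xser S σ))) - (mp k).derivative.eval (tt n j)
          = Ex j (fun S : Mat n => av fun σ => PowerSeries.coeff k (DD (xser S σ)) - (mp k).derivative.eval (tt n j)) := by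
        rw [EE]
        conv_rhs => enter [2, S]; rw [av_sub, av_const]
        rw [Ex_sub, Ex_const]
      rw [e3]
      refine (abs_Ex_le _ _).trans ?_
      have e4 : EE n j (fun S σ => C3 * (∑ i ∈ range k, |zz n j S i|) + (2 * C1) *
          (Lf k S σ ^ (k+1) * Dl k S σ ^ 2 + Lf k S σ ^ (k+1) * Zf k n j S ^ 2)) ≤ (C3 * C5 + 2 * C1 * C4) * ww n ^ 2 := by
        rw [EE_add, EE_mul, EE_mul]
        have := mul_le_mul_of_nonneg_left (hz n hn j hj) hC3
        have := mul_le_mul_of_nonneg_left (hQ n hn j hj) (show 0 ≤ 2 * C1 by positivity)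
        linarith
      refine le_trans (Ex_mono j fun S hS => ?_) e4
      beta_reduce
      have e5 : av (fun σ => PowerSeries.coeff k (DD (xser S σ)) - (mp k).derivative.eval (tt n j))
          = ∑ i ∈ range k, (KK k i).eval (tt n j) * zz n j S i + av (fun σ => PowerSeries.coeff k (DD (xser S σ)) - (mp k).derivative.eval (tt n j)
            - ∑ i ∈ range k, (KK k i).eval (tt n j) * (xx S σ i - (mp i).eval (tt n j))) := by
        rw [av_sub (fun σ => PowerSeries.coeff k (DD (xser S σ)) - (mp k).derivative.eval (tt n j)), av_sum]
        have : ∀ i, av (fun σ => (KK k i).eval (tt n j) * (xx S σ i - (mp i).eval (tt n j)))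
            = (KK k i).eval (tt n j) * zz n j S i := by
          intro i; rw [av_mul, av_sub, av_const]; rfl
        simp only [this]; ring
      rw [e5, av_add, av_const]
      refine (abs_add_le _ _).trans (add_le_add ?_ ?_)
      · rw [Finset.mul_sum]
        refine (Finset.abs_sum_le_sum_abs _ _).trans (Finset.sum_le_sum fun i hi => ?_)
        rw [abs_mul]
        exact mul_le_mul_of_nonneg_right (hK ⟨i, Finset.mem_range.1 hi⟩ _ ht0 htT') (abs_nonneg _)
      · refine (abs_av_le _).trans (av_mono fun σ => ?_)
        refine (hexp n (by omega) S hS σ _ ht0 htT' k le_rfl).trans ?_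
        have a1 := epsn_le k j S σ
        have a2 := epsn_nonneg k (tt n j) S σ
        have a3 : epsn k (tt n j) S σ ^ 2 ≤ 2 * (Dl k S σ ^ 2 + Zf k n j S ^ 2) := by
          nlinarith [sq_nonneg (Dl k S σ - Zf k n j S)]
        have a4 := Lf_ge_one (by omega) hS σ k
        calc _ ≤ C1 * (Lf k S σ ^ (k+1) * (2 * (Dl k S σ ^ 2 + Zf k n j S ^ 2))) := by gcongr
          _ = _ := by ring
    have e6 := htay (tt n j) (ww n ^ 2) ht0 (by positivity) (ww_sq_le hn) htT
    rw [e1, tt_succ hn]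
    have e7 : Ex (n := n) j (fun S => ss S k) + ww n ^ 2 * EE n j (fun S σ => PowerSeries.coeff k (DD (xser S σ)))
        - (mp k).eval (tt n j + ww n ^ 2) - (Ex (n := n) j (fun S => ss S k) - (mp k).eval (tt n j))
        = ww n ^ 2 * (EE n j (fun S σ => PowerSeries.coeff k (DD (xser S σ))) - (mp k).derivative.eval (tt n j))
          - ((mp k).eval (tt n j + ww n ^ 2) - (mp k).eval (tt n j) - (mp k).derivative.eval (tt n j) * ww n ^ 2) := by ring
    rw [e7]
    refine (abs_sub _ _).trans ?_
    rw [abs_mul, abs_of_nonneg (by positivity : (0:ℝ) ≤ ww n ^ 2)]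
    have e8 := mul_le_mul_of_nonneg_left e2 (by positivity : (0:ℝ) ≤ ww n ^ 2)
    calc _ ≤ ww n ^ 2 * ((C3 * C5 + 2 * C1 * C4) * ww n ^ 2) + C2 * (ww n ^ 2) ^ 2 := add_le_add e8 e6
      _ = _ := by rw [hG]; ring
  refine ⟨2 * |B| * G, by positivity, fun n hn j hj => ?_⟩
  have hN := N_pos hn
  have key : ∀ j : ℕ, (j : ℝ) ≤ B * n → |Ex (n := n) j (fun S => ss S k) - (mp k).eval (tt n j)| ≤ j * (G * ww n ^ 4) := by
    intro j
    induction j with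
    | zero =>
      intro _
      rw [Ex_zero, ss_zero_mat hk]; simp [tt, mp_eval_zero k hk]
    | succ j ih =>
      intro hj
      have hj' : (j : ℝ) ≤ B * n := by push_cast at hj; linarith
      have a1 := ih hj'
      have a2 := step n hn j hj'
      push_cast
      rw [abs_le] at a1 a2 ⊢
      constructor <;> linarith [a1.1, a1.2, a2.1, a2.2]
  refine (key j hj).trans ?_
  have := jw_le hn hj
  have hw := ww_pos hn
  calc (j:ℝ) * (G * ww n ^ 4) = (j / ((n:ℝ) - 1)) * G * ww n ^ 2 := by
        rw [show ww n ^ 4 = ww n ^ 2 * ww n ^ 2 by ring, ww_sq hn]; ring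
    _ ≤ _ := by gcongr

lemma Rt_zz (B : ℝ) (k : ℕ) : Rt B 4 (fun n j S _ => zz n j S k ^ 2) := by
  induction k using Nat.strong_induction_on with
  | _ k ih =>
    rcases Nat.eq_zero_or_pos k with rfl | hk
    · refine (Rt.zero B 4).mono fun n hn j _ S _ _ => ?_
      simp [zz, ss_zero (by omega : 2 ≤ n), mp_zero]
    obtain ⟨C, hC, h1⟩ := var_ss B k hk
    obtain ⟨D, hD, h2⟩ := bias_step B k hk ih
    refine ⟨C + D ^ 2, by positivity, fun n hn j hj => ?_⟩
    have a1 := h1 n hn j hj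
    have a2 := h2 n hn j hj
    have a3 : EE n j (fun S _ => zz n j S k ^ 2) = Ex (n := n) j (fun S => ss S k ^ 2)
        - 2 * (mp k).eval (tt n j) * Ex (n := n) j (fun S => ss S k) + (mp k).eval (tt n j) ^ 2 := by
      rw [EE_S]
      have : (fun S : Mat n => zz n j S k ^ 2) = fun S => (ss S k ^ 2 - (2 * (mp k).eval (tt n j)) * ss S k)
          + (mp k).eval (tt n j) ^ 2 := by funext S; unfold zz; ring
      rw [this, Ex_add, Ex_sub, Ex_mul, Ex_const]
    rw [a3]
    have a4 := pow_le_pow_left₀ (abs_nonneg _) a2 2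
    rw [sq_abs] at a4
    nlinarith

lemma Rt_Z2 (B : ℝ) (K : ℕ) : Rt B 4 (fun n j S _ => Zf K n j S ^ 2) := Rt_Z2_of B K fun i _ => Rt_zz B i
lemma Rt_LZ2 (B : ℝ) (K q : ℕ) : Rt B 3 (fun n j S σ => Lf K S σ ^ q * Zf K n j S ^ 2) := Rt_LZ2_of B K q (Rt_Z2 B K)
lemma Rt_LD3 (B : ℝ) (K q : ℕ) : Rt B 3 (fun _ _ S σ => Lf K S σ ^ q * Dl K S σ ^ 3) := by
  have := Rt.young (B := B) (a := 1) (b := 2) (X := fun _ _ S σ => Lf K S σ ^ q * Dl K S σ) (Y := fun _ _ S σ => Dl K S σ ^ 2)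
    (by simp only [mul_pow, ← pow_mul]; exact Rt_LD2 B K _) (by simp only [← pow_mul]; exact Rt_Dl B K)
  refine this.mono fun n hn j hj S hS σ => le_of_eq ?_
  ring
end Spear

open MeasureTheory Finset
namespace Spear
open Matrix

noncomputable def Qq {n : ℕ} (c : ℕ) (S : Mat n) (σ : Pm n) : ℝ := ∑ a, ((S ^ c *ᵥ vv n σ) a) ^ 4

lemma Qq_nonneg {n : ℕ} (c : ℕ) (S : Mat n) (σ : Pm n) : 0 ≤ Qq c S σ :=
  Finset.sum_nonneg fun _ _ => by positivity

lemma sum_sq_u {n : ℕ} {S : Mat n} (hS : Good S) (σ : Pm n) (c : ℕ) :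
    ∑ a, ((S ^ c *ᵥ vv n σ) a) ^ 2 = xx S σ (2 * c) := by
  have h : (S ^ c)ᵀ = S ^ c := by rw [transpose_pow, hS.symm]
  rw [xx, two_mul, pow_add, qf, ← mulVec_mulVec, dotProduct_mulVec, ← mulVec_transpose, h]
  simp [dotProduct, sq]

lemma Qq_le {n : ℕ} {S : Mat n} (hS : Good S) (σ : Pm n) (c : ℕ) :
    Qq c S σ ≤ xx S σ (2 * c) ^ 2 := by
  rw [← sum_sq_u hS, Qq]
  have := Finset.sum_sq_le_sq_sum_of_nonneg (s := Finset.univ) (f := fun a => ((S ^ c *ᵥ vv n σ) a) ^ 2)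
    (fun _ _ => sq_nonneg _)
  simpa only [← pow_mul] using this

lemma av_lin4 {n : ℕ} (hn : 4 ≤ n) (r : Fin n → ℝ) (hr : ∑ b, r b = 0) :
    av (fun σ => (r ⬝ᵥ vv n σ) ^ 4) ≤ 600 / (n:ℝ)^2 * (∑ b, r b ^ 2) ^ 2 := by
  obtain ⟨α, κ, hκ, hα, h⟩ := av_qf_qf hn
  have hA : Sym0 (vecMulVec r r) := by
    constructor
    · ext a b; simp [vecMulVec_apply, mul_comm]
    · intro a; simp only [vecMulVec_apply, ← Finset.mul_sum, hr, mul_zero]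
  have h1 := h _ _ hA hA
  have e1 : ∀ v : Fin n → ℝ, qf (vecMulVec r r) v = (r ⬝ᵥ v) ^ 2 := by
    intro v
    simp only [qf_eq, vecMulVec_apply, dotProduct, sq, Finset.sum_mul_sum]
    exact Finset.sum_congr rfl fun a _ => Finset.sum_congr rfl fun b _ => by ring
  have e2 : (vecMulVec r r).trace = ∑ b, r b ^ 2 := by
    simp [Matrix.trace, vecMulVec_apply, sq]
  have e3 : (vecMulVec r r * vecMulVec r r).trace = (∑ b, r b ^ 2) ^ 2 := by
    simp only [Matrix.trace, diag_apply, mul_apply, vecMulVec_apply, sq, Finset.sum_mul_sum]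
    exact Finset.sum_congr rfl fun a _ => Finset.sum_congr rfl fun b _ => by ring
  have e4 : ∑ a, vecMulVec r r a a * vecMulVec r r a a ≤ (∑ b, r b ^ 2) ^ 2 := by
    have := Finset.sum_sq_le_sq_sum_of_nonneg (s := Finset.univ) (f := fun a => r a ^ 2) (fun _ _ => sq_nonneg _)
    refine le_trans (le_of_eq ?_) this
    exact Finset.sum_congr rfl fun a _ => by simp only [vecMulVec_apply]; ring
  have e5 : 0 ≤ ∑ a, vecMulVec r r a a * vecMulVec r r a a := Finset.sum_nonneg fun _ _ => mul_self_nonneg _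
  simp only [e1, e2, e3] at h1
  have e6 : (fun σ => (r ⬝ᵥ vv n σ) ^ 4) = fun σ => (r ⬝ᵥ vv n σ) ^ 2 * (r ⬝ᵥ vv n σ) ^ 2 := by funext σ; ring
  rw [e6, h1]
  set R := (∑ b, r b ^ 2) with hR
  have hn2 : (0:ℝ) < (n:ℝ)^2 := by positivity
  have a1 : α * (R * R + 2 * R ^ 2) ≤ 100 / (n:ℝ)^2 * (R * R + 2 * R ^ 2) :=
    mul_le_mul_of_nonneg_right ((le_abs_self α).trans hα) (by nlinarith [sq_nonneg R])
  have a2 := mul_le_mul ((le_abs_self κ).trans hκ) e4 e5 (by positivity)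
  calc _ ≤ 100 / (n:ℝ)^2 * (R * R + 2 * R ^ 2) + 300 / (n:ℝ)^2 * R ^ 2 := add_le_add a1 a2
    _ = _ := by ring

lemma Rt_Qq (B : ℝ) (c : ℕ) : Rt B 2 (fun _ _ S σ => Qq c S σ) := by
  rcases Nat.eq_zero_or_pos c with rfl | hc
  · refine ⟨3, by norm_num, fun n hn j hj => ?_⟩
    have hN := N_pos hn
    have : EE n j (fun S σ => Qq 0 S σ) ≤ EE n j (fun _ _ => 3 / (n:ℝ)) := by
      refine EE_mono j fun S hS σ => ?_
      have : Qq 0 S σ ≤ ∑ a, 3 / (n:ℝ) * vv n σ a ^ 2 := by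
        simp only [Qq, pow_zero, one_mulVec]
        refine Finset.sum_le_sum fun a _ => ?_
        have := vv_sq_le (by omega) σ a
        nlinarith [sq_nonneg (vv n σ a)]
      rwa [← Finset.mul_sum, vv_sum_sq (by omega), mul_one] at this
    refine this.trans ?_
    rw [EE_const, ww_sq hn, div_eq_mul_inv]
    gcongr <;> linarith
  · have h0 := ((Rt_ss B (4 * c)).wmul 2).cmul (c := 600) (by norm_num)
    obtain ⟨C, hC, h0⟩ := h0
    refine ⟨C, hC, fun n hn j hj => ?_⟩
    refine le_trans ?_ (by simpa using h0 n hn j hj)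
    have hN := N_pos hn
    refine Ex_mono j fun S hS => ?_
    beta_reduce
    rw [av_const]
    have hSy := hS.sym0_pow hc
    have hSy2 := hS.sym0_pow (show 1 ≤ 2 * c by omega)
    have e1 : av (fun σ => Qq c S σ) ≤ ∑ a, 600 / (n:ℝ)^2 * (S ^ (2 * c)) a a ^ 2 := by
      simp only [Qq]
      rw [av_sum]
      refine Finset.sum_le_sum fun a _ => ?_
      refine (av_lin4 hn (fun b => (S ^ c) a b) (hSy.2 a)).trans (le_of_eq ?_)
      congr 2
      rw [two_mul, pow_add, mul_apply]
      exact Finset.sum_congr rfl fun b _ => by rw [hSy.symm b a, sq]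
    rw [← Finset.mul_sum] at e1
    have e2 := diag_sq_le hSy2
    rw [← pow_add, show 2 * c + 2 * c = 4 * c by ring] at e2
    have e3 := ss_eq (by omega) hS (show 1 ≤ 4 * c by omega)
    have e4 : (S ^ (4 * c)).trace = ((n:ℝ) - 1) * ss S (4 * c) := by rw [e3]; field_simp
    rw [e4] at e2
    have hs := ss_nonneg (by omega) hS (4 * c)
    refine e1.trans ((mul_le_mul_of_nonneg_left e2 (by positivity)).trans ?_)
    rw [ww_sq hn]
    have : 600 / (n:ℝ)^2 * (((n:ℝ) - 1) * ss S (4 * c)) = (600 * ((n:ℝ) - 1) / n ^ 2) * ss S (4 * c) := by ring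
    rw [this, ← mul_assoc]
    refine mul_le_mul_of_nonneg_right ?_ hs
    rw [div_le_iff₀ (by positivity), mul_assoc]
    refine mul_le_mul_of_nonneg_left ?_ (by norm_num)
    rw [inv_mul_eq_div, le_div_iff₀ (by linarith)]
    nlinarith

lemma Rt_LQ (B : ℝ) (K q c : ℕ) (hc : 2 * c ≤ K) : Rt B 1 (fun _ _ S σ => Lf K S σ ^ q * Qq c S σ) := by
  have := Rt.young (B := B) (a := 0) (b := 1) (X := fun _ _ S σ => Lf K S σ ^ q * √(Qq c S σ)) (Y := fun _ _ S σ => √(Qq c S σ))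
    (by
      refine (Rt_L B K (2 * q + 2)).mono fun n hn j hj S hS σ => ?_
      rw [mul_pow, Real.sq_sqrt (Qq_nonneg c S σ), pow_add, mul_comm 2 q, pow_mul]
      have h1 := Qq_le hS σ c
      have h2 := xx_le_Lf (by omega) hS σ hc
      have h3 := xx_nonneg (by omega) hS σ (2 * c)
      have h4 := pow_le_pow_left₀ h3 h2 2
      have h5 := Lf_ge_one (by omega) hS σ K
      exact mul_le_mul_of_nonneg_left (h1.trans h4) (by positivity))
    (by
      refine (Rt_Qq B c).mono fun n hn j hj S hS σ => ?_
      rw [Real.sq_sqrt (Qq_nonneg c S σ)])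
  refine this.mono fun n hn j hj S hS σ => le_of_eq ?_
  rw [mul_assoc, Real.mul_self_sqrt (Qq_nonneg c S σ)]

lemma pow_tele {n : ℕ} (S : Mat n) (σ : Pm n) (k : ℕ) : (upd S σ) ^ k - S ^ k
    = ∑ i ∈ range k, (upd S σ) ^ i * vecMulVec (vv n σ) (vv n σ) * S ^ (k - 1 - i) := by
  induction k with
  | zero => simp
  | succ k ih =>
    have : (upd S σ) ^ (k+1) - S ^ (k+1) = (upd S σ) ^ k * vecMulVec (vv n σ) (vv n σ) + ((upd S σ) ^ k - S ^ k) * S := by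
      rw [pow_succ, pow_succ]
      nth_rewrite 2 [upd]
      rw [mul_add, sub_mul]; abel
    rw [this, ih, Finset.sum_range_succ, Finset.sum_mul, add_comm]
    congr 1
    · refine Finset.sum_congr rfl fun i hi => ?_
      have := Finset.mem_range.1 hi
      rw [mul_assoc, ← pow_succ]; congr 2; omega
    · simp

lemma diag_incr {n : ℕ} (hn : 2 ≤ n) {S : Mat n} (hS : Good S) (σ : Pm n) (i : ℕ) (a : Fin n) :
    |((upd S σ) ^ i) a a - (S ^ i) a a| ≤ i * ((2 * i + 1) * Lf (2 * i) S σ) ^ (2 * i) *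
      (∑ c ∈ range i, |(S ^ c *ᵥ vv n σ) a|) ^ 2 := by
  set u : ℕ → ℝ := fun c => (S ^ c *ᵥ vv n σ) a with hu
  set U := ∑ c ∈ range i, |u c| with hU
  set H := ((2 * i + 1) * Lf (2 * i) S σ) ^ (2 * i) with hH
  have h5 := Lf_ge_one hn hS σ (2 * i)
  have hη : ∀ d < i, |PowerSeries.coeff d (HX (xser S σ))| ≤ H := by
    intro d hd
    refine (coeff_le_tn (show d < 2 * i + 1 by omega) _).trans ((tn_HX _ _).trans ?_)
    have := tn_xser hn hS σ (2 * i)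
    push_cast at this
    exact pow_le_pow_left₀ (by linarith [tn_nonneg (2*i) (xser S σ)]) this _
  have hH0 : 0 ≤ H := by positivity
  have hU0 : 0 ≤ U := Finset.sum_nonneg fun _ _ => abs_nonneg _
  have e1 : ((upd S σ) ^ i) a a - (S ^ i) a a = ∑ b ∈ range i, ((upd S σ) ^ b *ᵥ vv n σ) a * u (i - 1 - b) := by
    rw [← Matrix.sub_apply, pow_tele, Matrix.sum_apply]
    refine Finset.sum_congr rfl fun b _ => ?_
    rw [mul_vecMulVec, vecMulVec_mul, vecMulVec_apply, ← mulVec_transpose, transpose_pow, hS.symm]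
  rw [e1]
  have e2 : ∀ b ∈ range i, |((upd S σ) ^ b *ᵥ vv n σ) a * u (i - 1 - b)| ≤ H * U * U := by
    intro b hb
    have hb := Finset.mem_range.1 hb
    rw [abs_mul]
    refine mul_le_mul ?_ ?_ (abs_nonneg _) (by positivity)
    · rw [upd_pow_mulVec, Finset.sum_apply]
      refine (Finset.abs_sum_le_sum_abs _ _).trans ?_
      have : ∀ d ∈ range (b+1), |(PowerSeries.coeff d (HX (xser S σ)) • (S ^ (b - d) *ᵥ vv n σ)) a| ≤ H * |u (b - d)| := by
        intro d hd
        have hd := Finset.mem_range.1 hd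
        rw [Pi.smul_apply, smul_eq_mul, abs_mul]
        exact mul_le_mul_of_nonneg_right (hη d (by omega)) (abs_nonneg _)
      refine (Finset.sum_le_sum this).trans ?_
      have hr := Finset.sum_range_reflect (fun c => |u c|) (b + 1)
      rw [← Finset.mul_sum]
      refine mul_le_mul_of_nonneg_left ?_ hH0
      simp only [Nat.add_sub_cancel] at hr
      rw [hr]
      exact Finset.sum_le_sum_of_subset_of_nonneg (Finset.range_mono (by omega)) fun _ _ _ => abs_nonneg _
    · exact Finset.single_le_sum (f := fun c => |u c|) (fun _ _ => abs_nonneg _) (Finset.mem_range.2 (by omega))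
  refine (Finset.abs_sum_le_sum_abs _ _).trans ((Finset.sum_le_sum e2).trans (le_of_eq ?_))
  rw [Finset.sum_const, Finset.card_range, nsmul_eq_mul]; ring

noncomputable def KU {n : ℕ} (i : ℕ) (S : Mat n) : ℝ := ∑ a, ((S ^ i) a a - (S ^ i).trace / n) ^ 2

lemma Ex_diag {n : ℕ} (j i : ℕ) (a b : Fin n) :
    Ex j (fun S : Mat n => (S ^ i) a a) = Ex j (fun S : Mat n => (S ^ i) b b) := by
  rw [← Ex_conj j (Equiv.swap a b) (fun S : Mat n => (S ^ i) a a)]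
  refine congrArg _ (funext fun S => ?_)
  have : (S.submatrix (Equiv.swap a b) (Equiv.swap a b)) ^ i = (S ^ i).submatrix (Equiv.swap a b) (Equiv.swap a b) := by
    induction i with
    | zero => simp
    | succ i ih => rw [pow_succ, ih, pow_succ, submatrix_mul_equiv]
  rw [this]; simp

lemma KU_le {n : ℕ} (hn : 2 ≤ n) (i : ℕ) (S : Mat n) (m : ℝ) : KU i S ≤ ∑ a, ((S ^ i) a a - m) ^ 2 := by
  have hn' : (0:ℝ) < n := by positivity
  have e : (S ^ i).trace = ∑ a, (S ^ i) a a := rfl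
  set t := (S ^ i).trace
  have h1 : ∀ m : ℝ, ∑ a, ((S ^ i) a a - m) ^ 2 = ∑ a, (S ^ i) a a ^ 2 - 2 * m * t + n * m ^ 2 := by
    intro m
    simp only [sub_sq, Finset.sum_add_distrib, Finset.sum_sub_distrib, ← Finset.sum_mul, ← Finset.mul_sum, ← e]
    simp; ring
  rw [KU, h1, h1]
  have : (n:ℝ) * (m - t / n) ^ 2 = n * m ^ 2 - 2 * m * t + t ^ 2 / n := by field_simp; ring
  have h2 : 0 ≤ (n:ℝ) * (m - t / n) ^ 2 := by positivity
  have h3 : - 2 * (t / n) * t + n * (t / n) ^ 2 = - (t ^ 2 / n) := by field_simp; ring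
  linarith

lemma Rt_KU (B : ℝ) (i : ℕ) (hi : 1 ≤ i) : Rt B 3 (fun n _ S _ => ww n ^ 4 * KU i S) := by
  obtain ⟨C, hC, hQ⟩ := Rt.sum (B := B) (r := 1) (range i) (X := fun c _ _ S σ => Lf (2 * i) S σ ^ (2 * i * 2) * Qq c S σ)
    (fun c hc => Rt_LQ B (2 * i) _ c (by have := Finset.mem_range.1 hc; omega))
  set D : ℝ := i ^ 5 * (2 * i + 1) ^ (2 * i * 2) with hD
  refine ⟨2 * |B| * (D * C), by positivity, fun n hn j hj => ?_⟩
  have hw := ww_pos hn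
  have hN := N_pos hn
  rw [EE_mul, EE_S]
  rcases j with _ | j
  · have : KU i (0 : Mat n) = 0 := by simp [KU, zero_pow (by omega : i ≠ 0)]
    rw [Ex_zero, this, mul_zero]; positivity
  have hj' : (j : ℝ) ≤ B * n := by push_cast at hj; linarith
  set a0 : Fin n := ⟨0, by omega⟩
  set m := Ex (j+1) (fun S : Mat n => (S ^ i) a0 a0) with hm
  have h1 : Ex (j+1) (fun S : Mat n => KU i S) ≤ ∑ a, (Ex (j+1) (fun S : Mat n => ((S ^ i) a a) ^ 2)
      - (Ex (j+1) (fun S : Mat n => (S ^ i) a a)) ^ 2) := by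
    refine (Ex_mono (j+1) fun S hS => KU_le (by omega) i S m).trans (le_of_eq ?_)
    rw [Ex_sum]
    refine Finset.sum_congr rfl fun a _ => ?_
    have e : (fun S : Mat n => ((S ^ i) a a - m) ^ 2) = fun S => (((S ^ i) a a) ^ 2 - (2 * m) * (S ^ i) a a) + m ^ 2 := by
      funext S; ring
    rw [e, Ex_add, Ex_sub, Ex_mul, Ex_const, Ex_diag (j+1) i a a0, ← hm]; ring
  have h2 : Ex (j+1) (fun S : Mat n => KU i S) ≤ (j + 1) * (D * (C * ww n ^ 1)) := by
    refine h1.trans ((Finset.sum_le_sum fun a _ => efron_stein j (fun S : Mat n => (S ^ i) a a)).trans ?_)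
    rw [← Finset.mul_sum, ← Ex_sum]
    refine mul_le_mul_of_nonneg_left ?_ (by positivity)
    refine le_trans ?_ (mul_le_mul_of_nonneg_left (hQ n hn j hj') (by positivity))
    rw [← EE_mul]
    refine Ex_mono j fun S hS => ?_
    refine (Finset.sum_le_sum fun a _ => Var1_le (fun S : Mat n => (S ^ i) a a) S ((S ^ i) a a)).trans ?_
    rw [← av_sum]
    refine av_mono fun σ => ?_
    beta_reduce
    have h5 := Lf_ge_one (by omega) hS σ (2 * i)
    set L := Lf (2 * i) S σ
    have h3 : ∀ a ∈ Finset.univ, (((upd S σ) ^ i) a a - (S ^ i) a a) ^ 2 ≤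
        (i ^ 2 * ((2 * i + 1) * L) ^ (2 * i * 2)) * ((i:ℝ) ^ 3 * ∑ c ∈ range i, ((S ^ c *ᵥ vv n σ) a) ^ 4) := by
      intro a _
      have g1 := diag_incr (by omega) hS σ i a
      have g2 := pow_le_pow_left₀ (abs_nonneg _) g1 2
      rw [sq_abs] at g2
      refine g2.trans ?_
      have g3 := sum_pow_four_le (range i) (fun c => (S ^ c *ᵥ vv n σ) a)
      rw [Finset.card_range] at g3
      rw [mul_pow, mul_pow, ← pow_mul, ← pow_mul]
      exact mul_le_mul_of_nonneg_left g3 (by positivity)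
    refine (Finset.sum_le_sum h3).trans (le_of_eq ?_)
    rw [← Finset.mul_sum, ← Finset.mul_sum, Finset.sum_comm, ← Finset.mul_sum]
    simp only [Qq]
    rw [hD, mul_pow]; ring
  have h3 := jw_le hn hj
  calc ww n ^ 4 * Ex (j+1) (fun S : Mat n => KU i S) ≤ ww n ^ 4 * ((j + 1) * (D * (C * ww n ^ 1))) := by gcongr
    _ = ((j + 1 : ℕ) / ((n:ℝ) - 1)) * (D * C) * ww n ^ 3 := by
        rw [show ww n ^ 4 = ww n ^ 2 * ww n ^ 2 by ring, show ww n ^ 3 = ww n ^ 2 * ww n by ring]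
        rw [div_eq_mul_inv, ← ww_sq hn]; push_cast; ring
    _ ≤ _ := by gcongr
end Spear

open MeasureTheory Finset
namespace Spear
open Matrix

lemma alpha_eq {n : ℕ} (hn : 4 ≤ n) {α κ : ℝ} (h : ∀ A B : Mat n, Sym0 A → Sym0 B →
    av (fun σ => qf A (vv n σ) * qf B (vv n σ)) =
      α * (A.trace * B.trace + 2 * (A * B).trace) + κ * ∑ a, A a a * B a a) :
    α * (((n:ℝ) - 1) ^ 2 + 2 * ((n:ℝ) - 1)) + κ * (((n:ℝ) - 1) ^ 2 / n) = 1 := by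
  have hN := N_pos hn
  have hn0 : (n:ℝ) ≠ 0 := by linarith
  set P : Mat n := 1 - Matrix.of (fun _ _ => (1:ℝ) / n) with hP
  have hs : Sym0 P := by
    constructor
    · ext a b; simp [hP, Matrix.one_apply, eq_comm]
    · intro a; simp [hP, Matrix.one_apply, Finset.sum_sub_distrib, hn0]
  have hd : ∀ a, P a a = ((n:ℝ) - 1) / n := by
    intro a; simp [hP]; field_simp
  have ht : P.trace = (n:ℝ) - 1 := by
    simp [Matrix.trace, hd]; field_simp
  have hPP : P * P = P := by
    have e : (Matrix.of (fun _ _ => (1:ℝ) / n) : Mat n) * Matrix.of (fun _ _ => (1:ℝ) / n) = Matrix.of (fun _ _ => (1:ℝ) / n) := by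
      ext a b; simp [Matrix.mul_apply, hn0]
    rw [hP, sub_mul, mul_sub, mul_sub, e]; simp
  have hq : ∀ σ, qf P (vv n σ) = 1 := by
    intro σ
    have e : (Matrix.of (fun _ _ => (1:ℝ) / n) : Mat n) *ᵥ vv n σ = 0 := by
      funext a
      simp only [mulVec, dotProduct, of_apply, ← Finset.mul_sum, vv_sum, mul_zero, Pi.zero_apply]
    rw [qf, hP, sub_mulVec, e, one_mulVec, sub_zero, ← vv_sum_sq (by omega : 2 ≤ n) σ]
    simp [dotProduct, sq]
  have := h P P hs hs
  simp only [hq, mul_one, av_const, hPP, ht, hd] at this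
  refine Eq.trans ?_ this.symm
  rw [Finset.sum_const, Finset.card_univ, Fintype.card_fin, nsmul_eq_mul]
  field_simp

lemma cov_eq {n : ℕ} (hn : 4 ≤ n) : ∃ α κ : ℝ, |2 * ((n:ℝ) - 1) * α - 2 * ww n ^ 2| ≤ 604 * ww n ^ 4 ∧
    |κ| ≤ 300 * ww n ^ 4 ∧ ∀ S : Mat n, Good S → ∀ i l : ℕ, 1 ≤ i → 1 ≤ l →
    av (fun σ => (xx S σ i - ss S i) * (xx S σ l - ss S l)) = 2 * ((n:ℝ) - 1) * α * (ss S (i + l) - ss S i * ss S l)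
      + κ * ∑ a, ((S ^ i) a a - (S ^ i).trace / n) * ((S ^ l) a a - (S ^ l).trace / n) := by
  obtain ⟨α, κ, hκ, hα, h⟩ := av_qf_qf hn
  have h1 := alpha_eq hn h
  have hN := N_pos hn
  set N := (n:ℝ) - 1 with hNd
  have hn0 : (n:ℝ) = N + 1 := by rw [hNd]; ring
  have hκ' : |κ| ≤ 300 * ww n ^ 4 := by
    refine hκ.trans ?_
    rw [show ww n ^ 4 = (ww n ^ 2) ^ 2 by ring, ww_sq hn, hn0, div_eq_mul_inv, inv_pow, add_sub_cancel_right]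
    gcongr; linarith
  refine ⟨α, κ, ?_, hκ', ?_⟩
  · set x := κ * (N ^ 2 / n) with hx
    have hxb : |x| ≤ 300 / N := by
      rw [hx, abs_mul, abs_of_nonneg (by positivity : 0 ≤ N ^ 2 / (n:ℝ))]
      refine (mul_le_mul_of_nonneg_right hκ (by positivity)).trans ?_
      rw [hn0, div_mul_div_comm, div_le_div_iff₀ (by positivity) (by linarith)]
      nlinarith [pow_pos (by linarith : 0 < N) 2]
    have e : 2 * N * α - 2 * ww n ^ 2 = (- (2 * x) - 4 / N) / (N + 2) := by
      rw [ww_sq hn, ← hNd]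
      have : α = (1 - x) / (N ^ 2 + 2 * N) := by
        rw [eq_div_iff (by positivity)]; linarith
      rw [this]
      have : N ≠ 0 := by linarith
      have : N + 2 ≠ 0 := by linarith
      field_simp; ring
    rw [e, abs_div, abs_of_pos (by linarith : 0 < N + 2), show ww n ^ 4 = (ww n ^ 2) ^ 2 by ring, ww_sq hn, ← hNd]
    rw [div_le_iff₀ (by linarith)]
    have g1 : |-(2 * x) - 4 / N| ≤ 604 / N := by
      rw [abs_le] at hxb ⊢
      have : 300 / N = 300 * N⁻¹ := rfl
      have : 604 / N = 604 * N⁻¹ := rfl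
      have : 4 / N = 4 * N⁻¹ := rfl
      constructor <;> linarith [hxb.1, hxb.2]
    refine g1.trans ?_
    rw [inv_pow, ← div_eq_mul_inv, div_mul_eq_mul_div, div_le_div_iff₀ (by linarith) (by positivity)]
    nlinarith
  · intro S hS i l hi hl
    have e1 : av (fun σ => (xx S σ i - ss S i) * (xx S σ l - ss S l)) = av (fun σ => xx S σ i * xx S σ l) - ss S i * ss S l := by
      have : (fun σ => (xx S σ i - ss S i) * (xx S σ l - ss S l)) = fun σ => (xx S σ i * xx S σ l - ss S i * xx S σ l)
          - (ss S l * xx S σ i - ss S i * ss S l) := by funext σ; ring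
      rw [this, av_sub, av_sub, av_sub, av_mul, av_mul, av_const]
      show _ - ss S i * ss S l - (ss S l * ss S i - _) = _
      ring
    have e2 := h _ _ (hS.sym0_pow hi) (hS.sym0_pow hl)
    have t1 : ∀ a, 1 ≤ a → (S ^ a).trace = N * ss S a := by
      intro a ha; rw [ss_eq (by omega) hS ha, ← hNd]; field_simp
    rw [← pow_add, t1 i hi, t1 l hl, t1 (i+l) (by omega)] at e2
    have e3 : ∑ a, ((S ^ i) a a - (S ^ i).trace / n) * ((S ^ l) a a - (S ^ l).trace / n)
        = ∑ a, (S ^ i) a a * (S ^ l) a a - N ^ 2 * (ss S i * ss S l) / n := by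
      have d1 : ∑ a, (S ^ i) a a = N * ss S i := t1 i hi
      have d2 : ∑ a, (S ^ l) a a = N * ss S l := t1 l hl
      have : ∀ a, ((S ^ i) a a - (S ^ i).trace / n) * ((S ^ l) a a - (S ^ l).trace / n)
          = (S ^ i) a a * (S ^ l) a a - (S ^ i).trace / n * (S ^ l) a a - (S ^ l).trace / n * (S ^ i) a a
            + (S ^ i).trace / n * ((S ^ l).trace / n) := by intro a; ring
      simp only [this, Finset.sum_add_distrib, Finset.sum_sub_distrib, ← Finset.mul_sum, d1, d2]
      rw [t1 i hi, t1 l hl]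
      have : (n:ℝ) ≠ 0 := by linarith
      simp; field_simp; ring
    rw [e1, e3]
    change av (fun σ => xx S σ i * xx S σ l) = _ at e2
    rw [e2]
    linear_combination (ss S i * ss S l) * h1

lemma Rt_LZ (B : ℝ) (K q : ℕ) : Rt B 2 (fun n j S σ => Lf K S σ ^ q * Zf K n j S) :=
  Rt.young (B := B) (a := 0) (b := 2) (X := fun _ _ S σ => Lf K S σ ^ q) (Y := fun n j S _ => Zf K n j S)
    (by simp only [← pow_mul]; exact Rt_L B K _) (Rt_Z2 B K)

lemma Rt_KL (B : ℝ) (i l : ℕ) : Rt B 3 (fun n j S _ =>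
    |av (fun σ => (xx S σ i - ss S i) * (xx S σ l - ss S l)) - 2 * ww n ^ 2 * (Gam i l).eval (tt n j)|) := by
  rcases Nat.eq_zero_or_pos i with rfl | hi
  · refine (Rt.zero B 3).mono fun n hn j hj S hS σ => ?_
    simp only [xx_zero (by omega : 2 ≤ n), ss_zero (by omega : 2 ≤ n), Gam, mp_zero, zero_add]
    simp [av_const]
  rcases Nat.eq_zero_or_pos l with rfl | hl
  · refine (Rt.zero B 3).mono fun n hn j hj S hS σ => ?_
    simp only [xx_zero (by omega : 2 ≤ n), ss_zero (by omega : 2 ≤ n), Gam, mp_zero, add_zero]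
    simp [av_const]
  set K := i + l + 1 with hK
  obtain ⟨C, hC, hm⟩ := mps_bdd K (2 * |B|)
  have r1 := (((Rt_L B K 2).wmul 4).weaken (show 3 ≤ 0 + 4 by norm_num)).cmul (c := 2 * 604) (by norm_num)
  have r2 := (((Rt_LZ B K 1).wmul 2).weaken (show 3 ≤ 2 + 2 by norm_num)).cmul (c := 2 * (2 + C)) (by positivity)
  have r3 := ((Rt_KU B i hi).add (Rt_KU B l hl)).cmul (c := 300) (by norm_num)
  refine ((r1.add r2).add r3).mono fun n hn j hj S hS σ => ?_
  obtain ⟨α, κ, hα, hκ, h⟩ := cov_eq hn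
  rw [h S hS i l hi hl]
  set X := ∑ a, ((S ^ i) a a - (S ^ i).trace / n) * ((S ^ l) a a - (S ^ l).trace / n) with hX
  have hXb : |X| ≤ KU i S + KU l S := by
    rw [KU, KU, ← Finset.sum_add_distrib]
    refine (Finset.abs_sum_le_sum_abs _ _).trans (Finset.sum_le_sum fun a _ => ?_)
    rw [abs_mul]
    set x := (S ^ i) a a - (S ^ i).trace / n
    set y := (S ^ l) a a - (S ^ l).trace / n
    nlinarith [sq_nonneg (|x| - |y|), sq_abs x, sq_abs y]
  have hw := ww_pos hn
  have L1 := Lf_ge_one (by omega) hS σ K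
  set L := Lf K S σ
  have s1 := ss_le_Lf (by omega) hS σ (show i ≤ K by omega)
  have s2 := ss_le_Lf (by omega) hS σ (show l ≤ K by omega)
  have s3 := ss_le_Lf (by omega) hS σ (show i + l ≤ K by omega)
  have p1 := ss_nonneg (by omega) hS i
  have p2 := ss_nonneg (by omega) hS l
  have p3 := ss_nonneg (by omega) hS (i + l)
  have z : ∀ a < K, |zz n j S a| ≤ Zf K n j S := fun a ha =>
    Finset.single_le_sum (f := fun a => |zz n j S a|) (fun _ _ => abs_nonneg _) (Finset.mem_range.2 ha)
  have Z0 := Zf_nonneg K n j S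
  set Z := Zf K n j S
  set t := tt n j
  have q1 : |ss S (i+l) - ss S i * ss S l| ≤ 2 * L ^ 2 := by
    have : ss S i * ss S l ≤ L ^ 2 := by rw [sq]; exact mul_le_mul s1 s2 p2 (by linarith)
    have := mul_nonneg p1 p2
    rw [abs_le]; constructor <;> nlinarith
  have q2 : |ss S (i+l) - ss S i * ss S l - (Gam i l).eval t| ≤ (2 + C) * (L * Z) := by
    have e : ss S (i+l) - ss S i * ss S l - (Gam i l).eval t
        = zz n j S (i+l) - ss S i * zz n j S l - (mp l).eval t * zz n j S i := by
      simp only [Gam, zz, Polynomial.eval_sub, Polynomial.eval_mul]; ring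
    rw [e]
    have b1 := z (i+l) (by omega)
    have b2 := z l (by omega)
    have b3 := z i (by omega)
    have b4 : |ss S i * zz n j S l| ≤ L * Z := by
      rw [abs_mul, abs_of_nonneg p1]; exact mul_le_mul s1 b2 (abs_nonneg _) (by linarith)
    have b5 : |(mp l).eval t * zz n j S i| ≤ C * Z := by
      rw [abs_mul]; exact mul_le_mul (hm l (by omega) t (tt_nonneg hn j) (jw_le hn hj)) b3 (abs_nonneg _) hC
    have b6 : Z ≤ L * Z := le_mul_of_one_le_left Z0 L1
    have b7 := mul_le_mul_of_nonneg_left b6 hC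
    have b8 := abs_sub (zz n j S (i+l) - ss S i * zz n j S l) ((mp l).eval t * zz n j S i)
    have b9 := abs_sub (zz n j S (i+l)) (ss S i * zz n j S l)
    linarith
  have e : 2 * ((n:ℝ) - 1) * α * (ss S (i + l) - ss S i * ss S l) + κ * X - 2 * ww n ^ 2 * (Gam i l).eval t
      = (2 * ((n:ℝ) - 1) * α - 2 * ww n ^ 2) * (ss S (i + l) - ss S i * ss S l)
        + (2 * ww n ^ 2) * (ss S (i + l) - ss S i * ss S l - (Gam i l).eval t) + κ * X := by ring
  rw [e]
  have f1 := mul_le_mul hα q1 (abs_nonneg _) (by positivity)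
  have f2 := mul_le_mul_of_nonneg_left q2 (by positivity : 0 ≤ 2 * ww n ^ 2)
  have f3 := mul_le_mul hκ hXb (abs_nonneg _) (by positivity)
  rw [← abs_mul] at f1 f3
  rw [← abs_of_nonneg (by positivity : 0 ≤ 2 * ww n ^ 2), ← abs_mul, abs_of_nonneg (by positivity : 0 ≤ 2 * ww n ^ 2)] at f2
  refine (abs_add_le _ _).trans ?_
  refine (add_le_add ((abs_add_le _ _).trans (add_le_add f1 f2)) f3).trans (le_of_eq ?_)
  ring
end Spear

open MeasureTheory Finset
namespace Spear
open Matrix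

/-! ### The martingale-type increment -/
lemma Y_alg (K : ℕ) (c c1 cp u d e z ε : ℕ → ℝ) (Kk G : ℕ → ℕ → ℝ) (H : ℕ → ℕ → ℕ → ℝ) (w N : ℝ)
    (hNw : N * w ^ 2 = 1) (hu : ∀ a, u a = N * z a - e a)
    (hcp : ∀ i ∈ range K, cp i = - ∑ a ∈ range K, c a * Kk a i) :
    ∑ a ∈ range K, (c1 a * (u a + d a) - c a * u a)
      = - ∑ i ∈ range K, cp i * (ε i - z i)
        + 1/2 * ∑ i ∈ range K, ∑ l ∈ range K, (∑ a ∈ range K, c a * H a i l) * (ε i * ε l - 2 * w ^ 2 * G i l)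
        + (∑ a ∈ range K, c a * (d a - ∑ i ∈ range K, Kk a i * (ε i - w ^ 2 * e i)
            - 1/2 * ∑ i ∈ range K, ∑ l ∈ range K, H a i l * (ε i * ε l - 2 * w ^ 2 * G i l))
          + ∑ a ∈ range K, (c1 a - c a - cp a * w ^ 2) * u a
          + ∑ a ∈ range K, (c1 a - c a) * d a) := by
  have h1 : ∑ a ∈ range K, c a * ∑ i ∈ range K, Kk a i * (ε i - w ^ 2 * e i)
      = - ∑ i ∈ range K, cp i * (ε i - w ^ 2 * e i) := by
    simp only [Finset.mul_sum]
    rw [Finset.sum_comm, ← Finset.sum_neg_distrib]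
    refine Finset.sum_congr rfl fun i hi => ?_
    rw [hcp i hi, neg_mul, neg_neg, Finset.sum_mul]
    exact Finset.sum_congr rfl fun a _ => by ring
  have h2 : ∑ a ∈ range K, c a * ∑ i ∈ range K, ∑ l ∈ range K, H a i l * (ε i * ε l - 2 * w ^ 2 * G i l)
      = ∑ i ∈ range K, ∑ l ∈ range K, (∑ a ∈ range K, c a * H a i l) * (ε i * ε l - 2 * w ^ 2 * G i l) := by
    simp only [Finset.mul_sum]
    rw [Finset.sum_comm]
    refine Finset.sum_congr rfl fun i hi => ?_
    rw [Finset.sum_comm]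
    refine Finset.sum_congr rfl fun l hl => ?_
    rw [Finset.sum_mul]
    exact Finset.sum_congr rfl fun a _ => by ring
  have h3 : ∑ a ∈ range K, cp a * w ^ 2 * u a = ∑ i ∈ range K, cp i * (z i - w ^ 2 * e i) := by
    refine Finset.sum_congr rfl fun a _ => ?_
    rw [hu]; linear_combination cp a * z a * hNw
  have h4 : ∑ a ∈ range K, c a * (d a - ∑ i ∈ range K, Kk a i * (ε i - w ^ 2 * e i)
            - 1/2 * ∑ i ∈ range K, ∑ l ∈ range K, H a i l * (ε i * ε l - 2 * w ^ 2 * G i l))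
      = ∑ a ∈ range K, c a * d a - ∑ a ∈ range K, c a * ∑ i ∈ range K, Kk a i * (ε i - w ^ 2 * e i)
        - 1/2 * ∑ a ∈ range K, c a * ∑ i ∈ range K, ∑ l ∈ range K, H a i l * (ε i * ε l - 2 * w ^ 2 * G i l) := by
    rw [Finset.mul_sum (s := range K) (a := (1/2 : ℝ)), ← Finset.sum_sub_distrib, ← Finset.sum_sub_distrib]
    exact Finset.sum_congr rfl fun a _ => by ring
  have h5 : ∑ a ∈ range K, (c1 a - c a - cp a * w ^ 2) * u a
      = ∑ a ∈ range K, (c1 a * u a - c a * u a) - ∑ a ∈ range K, cp a * w ^ 2 * u a := by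
    rw [← Finset.sum_sub_distrib]
    exact Finset.sum_congr rfl fun a _ => by ring
  have h6 : ∑ a ∈ range K, (c1 a - c a) * d a = ∑ a ∈ range K, c1 a * d a - ∑ a ∈ range K, c a * d a := by
    rw [← Finset.sum_sub_distrib]
    exact Finset.sum_congr rfl fun a _ => by ring
  have h7 : ∑ a ∈ range K, (c1 a * (u a + d a) - c a * u a)
      = ∑ a ∈ range K, (c1 a * u a - c a * u a) + ∑ a ∈ range K, c1 a * d a := by
    rw [← Finset.sum_add_distrib]
    exact Finset.sum_congr rfl fun a _ => by ring
  have h8 : ∑ i ∈ range K, cp i * (ε i - w ^ 2 * e i) - ∑ i ∈ range K, cp i * (z i - w ^ 2 * e i)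
      = ∑ i ∈ range K, cp i * (ε i - z i) := by
    rw [← Finset.sum_sub_distrib]
    exact Finset.sum_congr rfl fun a _ => by ring
  rw [h4, h5, h6, h7, h1, h2, h3, ← h8]; ring

lemma sum_abs_le (K : ℕ) (f g : ℕ → ℝ) (C : ℝ) (hf : ∀ i ∈ range K, |f i| ≤ C) (hC : 0 ≤ C) :
    |∑ i ∈ range K, f i * g i| ≤ C * ∑ i ∈ range K, |g i| := by
  rw [Finset.mul_sum]
  refine (Finset.abs_sum_le_sum_abs _ _).trans (Finset.sum_le_sum fun i hi => ?_)
  rw [abs_mul]; exact mul_le_mul_of_nonneg_right (hf i hi) (abs_nonneg _)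

lemma sum_abs_le2 (K : ℕ) (f : ℕ → ℕ → ℝ) (ε : ℕ → ℝ) (G : ℕ → ℕ → ℝ) (w C : ℝ) (hC : 0 ≤ C)
    (hf : ∀ i ∈ range K, ∀ l ∈ range K, |f i l| ≤ C) (hG : ∀ i ∈ range K, ∀ l ∈ range K, |G i l| ≤ C) :
    |∑ i ∈ range K, ∑ l ∈ range K, f i l * (ε i * ε l - 2 * w ^ 2 * G i l)|
      ≤ C * (∑ i ∈ range K, |ε i|) ^ 2 + 2 * C ^ 2 * K ^ 2 * w ^ 2 := by
  have : ∀ i ∈ range K, ∀ l ∈ range K, |f i l * (ε i * ε l - 2 * w ^ 2 * G i l)|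
      ≤ C * (|ε i| * |ε l|) + 2 * C ^ 2 * w ^ 2 := by
    intro i hi l hl
    rw [abs_mul]
    have h1 : |ε i * ε l - 2 * w ^ 2 * G i l| ≤ |ε i| * |ε l| + 2 * w ^ 2 * C := by
      refine (abs_sub _ _).trans ?_
      rw [abs_mul, abs_mul (2 * w ^ 2), abs_of_nonneg (by positivity : 0 ≤ 2 * w ^ 2)]
      have := mul_le_mul_of_nonneg_left (hG i hi l hl) (by positivity : 0 ≤ 2 * w ^ 2)
      linarith
    calc _ ≤ C * (|ε i| * |ε l| + 2 * w ^ 2 * C) := mul_le_mul (hf i hi l hl) h1 (abs_nonneg _) hC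
      _ = _ := by ring
  refine (Finset.abs_sum_le_sum_abs _ _).trans ?_
  calc _ ≤ ∑ i ∈ range K, ∑ l ∈ range K, (C * (|ε i| * |ε l|) + 2 * C ^ 2 * w ^ 2) := by
        refine Finset.sum_le_sum fun i hi => ?_
        exact (Finset.abs_sum_le_sum_abs _ _).trans (Finset.sum_le_sum fun l hl => this i hi l hl)
    _ = _ := by
        simp only [Finset.sum_add_distrib, ← Finset.mul_sum, ← Finset.sum_mul_sum, Finset.sum_const, Finset.card_range, nsmul_eq_mul]
        simp only [← Finset.mul_sum, ← Finset.sum_mul]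
        ring

/-- `∃ q C` monomial bound helper -/
lemma pow_L_mono {L : ℝ} (hL : 1 ≤ L) {a b : ℕ} (h : a ≤ b) : L ^ a ≤ L ^ b := pow_le_pow_right₀ hL h
end Spear

open MeasureTheory Finset
namespace Spear
open Matrix

noncomputable def uu (n j : ℕ) (S : Mat n) (a : ℕ) : ℝ := ((n : ℝ) - 1) * zz n j S a - (ep a).eval (tt n j)
noncomputable def dd (n j : ℕ) (S : Mat n) (σ : Pm n) (a : ℕ) : ℝ := uu n (j+1) (upd S σ) a - uu n j S a
noncomputable def ee (n j : ℕ) (S : Mat n) (σ : Pm n) (a : ℕ) : ℝ := xx S σ a - (mp a).eval (tt n j)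

lemma dd_eq {n : ℕ} (hn : 4 ≤ n) (j : ℕ) {S : Mat n} (hS : Good S) (σ : Pm n) (a : ℕ) :
    dd n j S σ a = PowerSeries.coeff a (DD (xser S σ))
      - ((n : ℝ) - 1) * ((mp a).eval (tt n j + ww n ^ 2) - (mp a).eval (tt n j))
      - ((ep a).eval (tt n j + ww n ^ 2) - (ep a).eval (tt n j)) := by
  have hN := N_pos hn
  rw [dd, uu, uu, zz, zz, tt_succ hn]
  rcases Nat.eq_zero_or_pos a with rfl | ha
  · rw [← trace_incr, ss_zero (by omega), ss_zero (by omega)]; simp; ring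
  · rw [ss_upd (by omega) hS σ ha]
    field_simp; ring

lemma ep_ode_eval (K a : ℕ) (ha : a ≤ K) (t : ℝ) :
    (ep a).derivative.eval t + (mp a).derivative.derivative.eval t / 2
      = ∑ i ∈ range K, ∑ l ∈ range K, (H2 a i l).eval t * (Gam i l).eval t
        + ∑ i ∈ range K, (KK a i).eval t * (ep i).eval t := by
  have h := congrArg (Polynomial.eval t) (ep_ode K a ha)
  simp only [Polynomial.eval_add, Polynomial.eval_sub, Polynomial.eval_mul, Polynomial.eval_finset_sum,
    Polynomial.eval_ofNat] at h
  linarith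

lemma dd_expand (K : ℕ) (B : ℝ) : ∃ C : ℝ, 0 ≤ C ∧ ∀ n : ℕ, 4 ≤ n → ∀ j : ℕ, (j : ℝ) ≤ B * n →
    ∀ S : Mat n, Good S → ∀ σ, ∀ a ∈ range K,
    |dd n j S σ a - ∑ i ∈ range K, (KK a i).eval (tt n j) * (ee n j S σ i - ww n ^ 2 * (ep i).eval (tt n j))
      - 1/2 * ∑ i ∈ range K, ∑ l ∈ range K, (H2 a i l).eval (tt n j) *
        (ee n j S σ i * ee n j S σ l - 2 * ww n ^ 2 * (Gam i l).eval (tt n j))|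
      ≤ C * (Lf K S σ ^ K * (epsn K (tt n j) S σ ^ 3 + ww n ^ 3)) := by
  set T := 2 * |B| + 1 with hT
  have hT0 : 0 ≤ T := by positivity
  obtain ⟨C1, hC1, hD⟩ := DD_expand K T
  choose C2 hC2 hm using fun a => poly_taylor2 (mp a) T hT0
  choose C3 hC3 he using fun a => poly_taylor1 (ep a) T hT0
  refine ⟨C1 + ∑ a ∈ range K, (C2 a + C3 a), add_nonneg hC1 (Finset.sum_nonneg fun a _ => add_nonneg (hC2 a) (hC3 a)), ?_⟩
  intro n hn j hj S hS σ a ha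
  have hN := N_pos hn
  have hw := ww_pos hn
  have hw1 := ww_le_one hn
  have ht := tt_nonneg hn j
  have htB : tt n j ≤ 2 * |B| := jw_le hn hj
  have hw2 := ww_sq_le hn
  have hwN : ((n : ℝ) - 1) * ww n ^ 2 = 1 := by rw [ww_sq hn]; field_simp
  have ha' : a ≤ K := (Finset.mem_range.1 ha).le
  have b1 := hD n (by omega) S hS σ (tt n j) ht (by linarith) a ha'
  have b2 := hm a (tt n j) (ww n ^ 2) ht (by positivity) (by linarith)
  have b3 := he a (tt n j) (ww n ^ 2) ht (by positivity) hw2 (by linarith)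
  have hode := ep_ode_eval K a ha' (tt n j)
  have hL := Lf_ge_one (by omega) hS σ K
  have hLK : 1 ≤ Lf K S σ ^ K := one_le_pow₀ hL
  have he0 : 0 ≤ epsn K (tt n j) S σ := epsn_nonneg _ _ _ _
  have hCa : C2 a + C3 a ≤ ∑ a ∈ range K, (C2 a + C3 a) :=
    Finset.single_le_sum (f := fun a => C2 a + C3 a) (fun a _ => add_nonneg (hC2 a) (hC3 a)) ha
  set N := (n : ℝ) - 1
  set w := ww n
  set t := tt n j
  set x := PowerSeries.coeff a (DD (xser S σ))
  have e1 : ∑ i ∈ range K, (KK a i).eval t * (ee n j S σ i - w ^ 2 * (ep i).eval t)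
      = ∑ i ∈ range K, (KK a i).eval t * (xx S σ i - (mp i).eval t) - w ^ 2 * ∑ i ∈ range K, (KK a i).eval t * (ep i).eval t := by
    rw [Finset.mul_sum, ← Finset.sum_sub_distrib]
    exact Finset.sum_congr rfl fun i _ => by unfold ee; ring
  have e2 : ∑ i ∈ range K, ∑ l ∈ range K, (H2 a i l).eval t *
        (ee n j S σ i * ee n j S σ l - 2 * w ^ 2 * (Gam i l).eval t)
      = ∑ i ∈ range K, ∑ l ∈ range K, (H2 a i l).eval t * ((xx S σ i - (mp i).eval t) * (xx S σ l - (mp l).eval t))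
        - 2 * w ^ 2 * ∑ i ∈ range K, ∑ l ∈ range K, (H2 a i l).eval t * (Gam i l).eval t := by
    simp only [Finset.mul_sum, ← Finset.sum_sub_distrib]
    exact Finset.sum_congr rfl fun i _ => Finset.sum_congr rfl fun l _ => by unfold ee; ring
  rw [e1, e2, dd_eq hn j hS σ a]
  set A1 := ∑ i ∈ range K, (KK a i).eval t * (xx S σ i - (mp i).eval t)
  set A2 := ∑ i ∈ range K, ∑ l ∈ range K, (H2 a i l).eval t * ((xx S σ i - (mp i).eval t) * (xx S σ l - (mp l).eval t))
  set A3 := ∑ i ∈ range K, (KK a i).eval t * (ep i).eval t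
  set A4 := ∑ i ∈ range K, ∑ l ∈ range K, (H2 a i l).eval t * (Gam i l).eval t
  set M := (mp a).eval (t + w ^ 2)
  set M0 := (mp a).eval t
  set M1 := (mp a).derivative.eval t
  set M2 := (mp a).derivative.derivative.eval t
  set E := (ep a).eval (t + w ^ 2)
  set E0 := (ep a).eval t
  set E1 := (ep a).derivative.eval t
  have key : x - N * (M - M0) - (E - E0) - (A1 - w ^ 2 * A3) - 1/2 * (A2 - 2 * w ^ 2 * A4)
      = (x - M1 - A1 - 1/2 * A2) - N * (M - M0 - M1 * w ^ 2 - M2 / 2 * (w ^ 2) ^ 2) - (E - E0 - E1 * w ^ 2) := by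
    have : (N * w ^ 2 - 1) * (M1 + M2 / 2 * w ^ 2) = 0 := by rw [hwN]; ring
    linear_combination (-1) * w ^ 2 * hode - this
  rw [key]
  have f2 : |N * (M - M0 - M1 * w ^ 2 - M2 / 2 * (w ^ 2) ^ 2)| ≤ C2 a * w ^ 4 := by
    rw [abs_mul, abs_of_nonneg (by linarith : 0 ≤ N)]
    calc _ ≤ N * (C2 a * (w ^ 2) ^ 3) := mul_le_mul_of_nonneg_left b2 (by linarith)
      _ = C2 a * w ^ 4 * (N * w ^ 2) := by ring
      _ = _ := by rw [hwN, mul_one]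
  have f3 : w ^ 4 ≤ w ^ 3 := pow_le_pow_of_le_one hw.le hw1 (by norm_num)
  have f4 := mul_le_mul_of_nonneg_left f3 (add_nonneg (hC2 a) (hC3 a))
  have f5 := mul_le_mul_of_nonneg_right hCa (by positivity : 0 ≤ w ^ 3)
  set Cs := ∑ a ∈ range K, (C2 a + C3 a)
  have hCs : 0 ≤ Cs := le_trans (add_nonneg (hC2 a) (hC3 a)) hCa
  have f6 : Cs * w ^ 3 ≤ Cs * (Lf K S σ ^ K * w ^ 3) := by
    refine mul_le_mul_of_nonneg_left ?_ hCs
    exact le_mul_of_one_le_left (by positivity) hLK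
  have f7 : 0 ≤ C1 * (Lf K S σ ^ K * w ^ 3) := by positivity
  have f8 : 0 ≤ Cs * (Lf K S σ ^ K * epsn K t S σ ^ 3) := by positivity
  calc _ ≤ |x - M1 - A1 - 1/2 * A2| + |N * (M - M0 - M1 * w ^ 2 - M2 / 2 * (w ^ 2) ^ 2)| + |E - E0 - E1 * w ^ 2| :=
        (abs_sub _ _).trans (add_le_add_left (abs_sub _ _) _)
    _ ≤ C1 * (Lf K S σ ^ K * epsn K t S σ ^ 3) + C2 a * w ^ 4 + C3 a * w ^ 4 := by
        have : C3 a * (w ^ 2) ^ 2 = C3 a * w ^ 4 := by ring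
        linarith
    _ ≤ _ := by nlinarith
end Spear

open MeasureTheory Finset
namespace Spear
open Matrix

lemma rem_bound (K : ℕ) (D : ℝ) (hD : 0 ≤ D) : ∃ C : ℝ, 0 ≤ C ∧ ∀ (c c1 cp u d e z ε : ℕ → ℝ) (Kk G : ℕ → ℕ → ℝ)
    (H : ℕ → ℕ → ℕ → ℝ) (w N L ρ Z : ℝ), 0 ≤ w → w ≤ 1 → 0 ≤ N → N * w ^ 2 = 1 → 1 ≤ L →
    (∀ a, u a = N * z a - e a) → ρ = ∑ i ∈ range K, |ε i| + w → Z = ∑ i ∈ range K, |z i| → ρ ≤ D * L →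
    (∀ a ∈ range K, |c a| ≤ D) → (∀ a ∈ range K, |c1 a - c a - cp a * w ^ 2| ≤ D * w ^ 4) →
    (∀ a ∈ range K, |c1 a - c a| ≤ D * w ^ 2) → (∀ a ∈ range K, |e a| ≤ D) →
    (∀ a ∈ range K, ∀ i ∈ range K, |Kk a i| ≤ D) → (∀ a ∈ range K, ∀ i ∈ range K, |G a i| ≤ D) →
    (∀ a ∈ range K, ∀ i ∈ range K, ∀ l ∈ range K, |H a i l| ≤ D) →
    (∀ a ∈ range K, |d a - ∑ i ∈ range K, Kk a i * (ε i - w ^ 2 * e i)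
            - 1/2 * ∑ i ∈ range K, ∑ l ∈ range K, H a i l * (ε i * ε l - 2 * w ^ 2 * G i l)| ≤ D * (L ^ K * ρ ^ 3)) →
    |∑ a ∈ range K, c a * (d a - ∑ i ∈ range K, Kk a i * (ε i - w ^ 2 * e i)
            - 1/2 * ∑ i ∈ range K, ∑ l ∈ range K, H a i l * (ε i * ε l - 2 * w ^ 2 * G i l))
          + ∑ a ∈ range K, (c1 a - c a - cp a * w ^ 2) * u a
          + ∑ a ∈ range K, (c1 a - c a) * d a| ≤ C * (L ^ (K + 2) * (ρ ^ 3 + w ^ 2 * Z)) := by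
  refine ⟨K * D * D + (D + K * D ^ 2) + K * D * (D + K * D ^ 2 + D ^ 2 + D ^ 2 * K ^ 2 + D ^ 3), by positivity, ?_⟩
  intro c c1 cp u d e z ε Kk G H w N L ρ Z hw hw1 hN hNw hL hu hρ hZ hρL hc hc2 hc1 he hK hG hH hr
  have hs0 : 0 ≤ ∑ i ∈ range K, |ε i| := Finset.sum_nonneg fun _ _ => abs_nonneg _
  have hZ0 : 0 ≤ Z := hZ ▸ Finset.sum_nonneg fun _ _ => abs_nonneg _
  have hwρ : w ≤ ρ := by linarith
  have hρ0 : 0 ≤ ρ := by linarith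
  have hL0 : 0 ≤ L := by linarith
  have hw2 : w ^ 2 ≤ ρ := by nlinarith
  have hw2' : w ^ 2 ≤ ρ ^ 2 := pow_le_pow_left₀ hw hwρ 2
  have hw4 : w ^ 4 ≤ ρ ^ 3 := by
    calc w ^ 4 ≤ w ^ 3 := pow_le_pow_of_le_one hw hw1 (by norm_num)
      _ ≤ ρ ^ 3 := pow_le_pow_left₀ hw hwρ 3
  have hLK : 1 ≤ L ^ K := one_le_pow₀ hL
  have hLK2 : 1 ≤ L ^ (K+2) := one_le_pow₀ hL
  have hLKK : L ^ K ≤ L ^ (K+2) := pow_le_pow_right₀ hL (by omega)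
  have hLL : L ≤ L ^ (K+2) := by
    calc L = L ^ 1 := (pow_one L).symm
      _ ≤ _ := pow_le_pow_right₀ hL (by omega)
  -- bound of d
  have hd : ∀ a ∈ range K, |d a| ≤ (D + K * D ^ 2 + D ^ 2 + D ^ 2 * K ^ 2 + D ^ 3) * (L ^ (K+2) * ρ) := by
    intro a ha
    have h1 : |∑ i ∈ range K, Kk a i * (ε i - w ^ 2 * e i)| ≤ D * (ρ + K * D * ρ) := by
      refine (sum_abs_le K _ _ D (hK a ha) hD).trans (mul_le_mul_of_nonneg_left ?_ hD)
      calc _ ≤ ∑ i ∈ range K, (|ε i| + w ^ 2 * D) := by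
            refine Finset.sum_le_sum fun i hi => (abs_sub _ _).trans ?_
            rw [abs_mul, abs_of_nonneg (by positivity : 0 ≤ w ^ 2)]
            exact add_le_add_right (mul_le_mul_of_nonneg_left (he i hi) (by positivity)) _
        _ = ∑ i ∈ range K, |ε i| + K * D * w ^ 2 := by
            rw [Finset.sum_add_distrib]; simp; ring
        _ ≤ _ := by
            have := mul_le_mul_of_nonneg_left hw2 (by positivity : 0 ≤ (K:ℝ) * D)
            linarith
    have h2 := sum_abs_le2 K (H a) ε G w D hD (hH a ha) hG
    have h3 : (∑ i ∈ range K, |ε i|) ^ 2 ≤ D * L * ρ := by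
      calc _ ≤ ρ ^ 2 := pow_le_pow_left₀ hs0 (by linarith) 2
        _ = ρ * ρ := sq ρ
        _ ≤ _ := mul_le_mul_of_nonneg_right hρL hρ0
    have h4 : ρ ^ 3 ≤ (D ^ 2 * L ^ 2) * ρ := by
      calc ρ ^ 3 = ρ ^ 2 * ρ := by ring
        _ ≤ (D * L) ^ 2 * ρ := mul_le_mul_of_nonneg_right (pow_le_pow_left₀ hρ0 hρL 2) hρ0
        _ = _ := by ring
    have h5 : D * (L ^ K * ρ ^ 3) ≤ D ^ 3 * (L ^ (K+2) * ρ) := by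
      calc _ ≤ D * (L ^ K * ((D ^ 2 * L ^ 2) * ρ)) := by gcongr
        _ = _ := by ring
    have h6 := hr a ha
    have h7 : |d a| ≤ D * (ρ + K * D * ρ) + 1/2 * (D * (D * L * ρ) + 2 * D ^ 2 * K ^ 2 * ρ) + D ^ 3 * (L ^ (K+2) * ρ) := by
      set A1 := ∑ i ∈ range K, Kk a i * (ε i - w ^ 2 * e i)
      set A2 := ∑ i ∈ range K, ∑ l ∈ range K, H a i l * (ε i * ε l - 2 * w ^ 2 * G i l)
      have h8 : |A2| ≤ D * (D * L * ρ) + 2 * D ^ 2 * K ^ 2 * ρ := by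
        refine h2.trans ?_
        gcongr
      have h9 : d a = A1 + 1/2 * A2 + (d a - A1 - 1/2 * A2) := by ring
      rw [h9]
      refine (abs_add_le _ _).trans (add_le_add ((abs_add_le _ _).trans (add_le_add h1 ?_)) (h6.trans h5))
      rw [abs_mul, abs_of_nonneg (by norm_num : (0:ℝ) ≤ 1/2)]
      exact mul_le_mul_of_nonneg_left h8 (by norm_num)
    refine h7.trans ?_
    have i1 : ρ ≤ L ^ (K+2) * ρ := le_mul_of_one_le_left hρ0 hLK2
    have i2 : L * ρ ≤ L ^ (K+2) * ρ := mul_le_mul_of_nonneg_right hLL hρ0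
    have j1 := mul_le_mul_of_nonneg_left i1 (by positivity : 0 ≤ D + K * D ^ 2 + D ^ 2 * K ^ 2)
    have j2 := mul_le_mul_of_nonneg_left i2 (by positivity : 0 ≤ D ^ 2)
    have j3 : 0 ≤ D ^ 2 * (L * ρ) := by positivity
    nlinarith
  set C' := D + K * D ^ 2 + D ^ 2 + D ^ 2 * K ^ 2 + D ^ 3 with hC'
  have hC'0 : 0 ≤ C' := by positivity
  have hP0 : 0 ≤ L ^ (K+2) * (ρ ^ 3 + w ^ 2 * Z) := by positivity
  have g1 : |∑ a ∈ range K, c a * (d a - ∑ i ∈ range K, Kk a i * (ε i - w ^ 2 * e i)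
            - 1/2 * ∑ i ∈ range K, ∑ l ∈ range K, H a i l * (ε i * ε l - 2 * w ^ 2 * G i l))|
      ≤ K * D * D * (L ^ (K+2) * (ρ ^ 3 + w ^ 2 * Z)) := by
    refine (sum_abs_le K _ _ D hc hD).trans ?_
    calc _ ≤ D * ∑ a ∈ range K, D * (L ^ K * ρ ^ 3) := mul_le_mul_of_nonneg_left (Finset.sum_le_sum hr) hD
      _ = K * D * D * (L ^ K * ρ ^ 3) := by simp; ring
      _ ≤ _ := by
        have : 0 ≤ w ^ 2 * Z := by positivity
        gcongr
        linarith
  have g2 : |∑ a ∈ range K, (c1 a - c a - cp a * w ^ 2) * u a| ≤ (D + K * D ^ 2) * (L ^ (K+2) * (ρ ^ 3 + w ^ 2 * Z)) := by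
    refine (sum_abs_le K _ _ (D * w ^ 4) hc2 (by positivity)).trans ?_
    have h1 : ∑ a ∈ range K, |u a| ≤ N * Z + K * D := by
      rw [hZ, Finset.mul_sum]
      calc _ ≤ ∑ a ∈ range K, (N * |z a| + D) := by
            refine Finset.sum_le_sum fun a ha => ?_
            rw [hu]
            refine (abs_sub _ _).trans ?_
            rw [abs_mul, abs_of_nonneg hN]
            exact add_le_add_right (he a ha) _
        _ = _ := by rw [Finset.sum_add_distrib]; simp
    calc _ ≤ D * w ^ 4 * (N * Z + K * D) := mul_le_mul_of_nonneg_left h1 (by positivity)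
      _ = D * (w ^ 2 * Z) * (N * w ^ 2) + K * D ^ 2 * w ^ 4 := by ring
      _ = D * (w ^ 2 * Z) + K * D ^ 2 * w ^ 4 := by rw [hNw, mul_one]
      _ ≤ D * (ρ ^ 3 + w ^ 2 * Z) + K * D ^ 2 * (ρ ^ 3 + w ^ 2 * Z) := by
          have h0 : 0 ≤ w ^ 2 * Z := by positivity
          have h1 : 0 ≤ ρ ^ 3 := by positivity
          have := mul_le_mul_of_nonneg_left (show w ^ 4 ≤ ρ ^ 3 + w ^ 2 * Z by linarith) (by positivity : 0 ≤ K * D ^ 2)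
          have := mul_nonneg hD h1
          linarith
      _ = (D + K * D ^ 2) * (ρ ^ 3 + w ^ 2 * Z) := by ring
      _ ≤ _ := mul_le_mul_of_nonneg_left (le_mul_of_one_le_left (by positivity) hLK2) (by positivity)
  have g3 : |∑ a ∈ range K, (c1 a - c a) * d a| ≤ K * D * C' * (L ^ (K+2) * (ρ ^ 3 + w ^ 2 * Z)) := by
    refine (sum_abs_le K _ _ (D * w ^ 2) hc1 (by positivity)).trans ?_
    calc _ ≤ D * w ^ 2 * ∑ a ∈ range K, C' * (L ^ (K+2) * ρ) := mul_le_mul_of_nonneg_left (Finset.sum_le_sum hd) (by positivity)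
      _ = K * D * C' * (L ^ (K+2) * (w ^ 2 * ρ)) := by simp; ring
      _ ≤ K * D * C' * (L ^ (K+2) * (ρ ^ 2 * ρ)) := by gcongr
      _ ≤ _ := by
        have : 0 ≤ w ^ 2 * Z := by positivity
        gcongr
        nlinarith
  calc _ ≤ _ := (abs_add_le _ _).trans (add_le_add ((abs_add_le _ _).trans (add_le_add g1 g2)) g3)
    _ = _ := by ring

noncomputable def Psi (k : ℕ) (c : ℕ → Polynomial ℝ) (n j : ℕ) (S : Mat n) : ℝ :=
  ∑ a ∈ range (k+1), (c a).eval (tt n j) * uu n j S a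
noncomputable def YY (k : ℕ) (c : ℕ → Polynomial ℝ) (n j : ℕ) (S : Mat n) (σ : Pm n) : ℝ :=
  Psi k c n (j+1) (upd S σ) - Psi k c n j S
noncomputable def Aa (k : ℕ) (c : ℕ → Polynomial ℝ) (n j : ℕ) (S : Mat n) (σ : Pm n) : ℝ :=
  - ∑ i ∈ range (k+1), (c i).derivative.eval (tt n j) * (xx S σ i - ss S i)
noncomputable def gg (k : ℕ) (c : ℕ → Polynomial ℝ) (n j i l : ℕ) : ℝ :=
  ∑ a ∈ range (k+1), (c a).eval (tt n j) * (H2 a i l).eval (tt n j)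
noncomputable def Bb (k : ℕ) (c : ℕ → Polynomial ℝ) (n j : ℕ) (S : Mat n) (σ : Pm n) : ℝ :=
  1/2 * ∑ i ∈ range (k+1), ∑ l ∈ range (k+1), gg k c n j i l *
    (ee n j S σ i * ee n j S σ l - 2 * ww n ^ 2 * (Gam i l).eval (tt n j))

lemma Fin_of_range {K : ℕ} {p : ℕ → Polynomial ℝ} (T : ℝ) : ∃ C : ℝ, 0 ≤ C ∧ ∀ i ∈ range K, ∀ t, 0 ≤ t → t ≤ T →
    |(p i).eval t| ≤ C := by
  obtain ⟨C, hC, h⟩ := polys_bdd (fun i : Fin K => p i) T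
  exact ⟨C, hC, fun i hi => h ⟨i, Finset.mem_range.1 hi⟩⟩

lemma YY_expand0 (k : ℕ) (c : ℕ → Polynomial ℝ)
    (hc : ∀ i ≤ k, Polynomial.derivative (c i) = - ∑ a ∈ range (k + 1), c a * KK a i) (B : ℝ) :
    ∃ C : ℝ, 0 ≤ C ∧ ∀ n : ℕ, 4 ≤ n → ∀ j : ℕ, (j : ℝ) ≤ B * n → ∀ S : Mat n, Good S → ∀ σ,
    |YY k c n j S σ - Aa k c n j S σ - Bb k c n j S σ|
      ≤ C * (Lf (k+1) S σ ^ (k + 3) * ((epsn (k+1) (tt n j) S σ + ww n) ^ 3 + ww n ^ 2 * Zf (k+1) n j S)) := by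
  set K := k + 1 with hK
  set T := 2 * |B| + 1 with hT
  have hT0 : 0 ≤ T := by positivity
  obtain ⟨D1, hD1, b1⟩ := Fin_of_range (K := K) (p := c) T
  obtain ⟨D2, hD2, b2⟩ := Fin_of_range (K := K) (p := ep) T
  obtain ⟨D3, hD3, b3⟩ := polys_bdd (fun x : Fin K × Fin K => KK x.1 x.2) T
  obtain ⟨D4, hD4, b4⟩ := polys_bdd (fun x : Fin K × Fin K => Gam x.1 x.2) T
  obtain ⟨D5, hD5, b5⟩ := polys_bdd (fun x : Fin K × Fin K × Fin K => H2 x.1 x.2.1 x.2.2) T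
  obtain ⟨D6, hD6, b6⟩ := epsn_le_Lf K T
  obtain ⟨D7, hD7, b7⟩ := dd_expand K B
  choose e8 he8 b8 using fun a => poly_taylor1 (c a) T hT0
  choose e9 he9 b9 using fun a => poly_taylor0 (c a) T hT0
  have h8 : 0 ≤ ∑ a ∈ range K, e8 a := Finset.sum_nonneg fun a _ => he8 a
  have h9 : 0 ≤ ∑ a ∈ range K, e9 a := Finset.sum_nonneg fun a _ => he9 a
  set D8 := ∑ a ∈ range K, e8 a with hD8
  set D9 := ∑ a ∈ range K, e9 a with hD9
  set D := D1 + D2 + D3 + D4 + D5 + (D6 + 1) + D7 + D8 + D9 with hDdef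
  have hD : 0 ≤ D := by positivity
  obtain ⟨C, hC, h⟩ := rem_bound K D hD
  refine ⟨C, hC, fun n hn j hj S hS σ => ?_⟩
  have hN := N_pos hn
  have hw := ww_pos hn
  have hw1 := ww_le_one hn
  have ht := tt_nonneg hn j
  have htB : tt n j ≤ 2 * |B| := jw_le hn hj
  have hw2 := ww_sq_le hn
  have hwN : ((n : ℝ) - 1) * ww n ^ 2 = 1 := by rw [ww_sq hn]; field_simp
  have hL := Lf_ge_one (by omega) hS σ K
  have heps0 := epsn_nonneg K (tt n j) S σ
  have hcp : ∀ i ∈ range K, (c i).derivative.eval (tt n j)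
      = - ∑ a ∈ range K, (c a).eval (tt n j) * (KK a i).eval (tt n j) := by
    intro i hi
    rw [hc i (by have := Finset.mem_range.1 hi; omega)]
    simp [Polynomial.eval_finset_sum]
  have key := h (fun a => (c a).eval (tt n j)) (fun a => (c a).eval (tt n (j+1))) (fun a => (c a).derivative.eval (tt n j))
    (uu n j S) (dd n j S σ) (fun a => (ep a).eval (tt n j)) (zz n j S) (ee n j S σ)
    (fun a i => (KK a i).eval (tt n j)) (fun a i => (Gam a i).eval (tt n j)) (fun a i l => (H2 a i l).eval (tt n j))
    (ww n) ((n:ℝ) - 1) (Lf K S σ) (epsn K (tt n j) S σ + ww n) (Zf K n j S) hw.le hw1 (by linarith) hwN hL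
    (fun a => rfl) rfl rfl
    (by
      have := b6 n (by omega) S hS σ (tt n j) ht (by linarith)
      have : (D6 + 1) * Lf K S σ ≤ D * Lf K S σ := mul_le_mul_of_nonneg_right (by linarith) (by linarith)
      linarith)
    (fun a ha => (b1 a ha _ ht (by linarith)).trans (by linarith))
    (fun a ha => by
      rw [tt_succ hn]
      refine (b8 a (tt n j) (ww n ^ 2) ht (by positivity) hw2 (by linarith)).trans ?_
      rw [← pow_mul]
      refine mul_le_mul_of_nonneg_right ?_ (by positivity)
      have : e8 a ≤ D8 := Finset.single_le_sum (f := e8) (fun a _ => he8 a) ha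
      linarith)
    (fun a ha => by
      rw [tt_succ hn]
      refine (b9 a (tt n j) (ww n ^ 2) ht (by positivity) hw2 (by linarith)).trans ?_
      refine mul_le_mul_of_nonneg_right ?_ (by positivity)
      have : e9 a ≤ D9 := Finset.single_le_sum (f := e9) (fun a _ => he9 a) ha
      linarith)
    (fun a ha => (b2 a ha _ ht (by linarith)).trans (by linarith))
    (fun a ha i hi => (b3 (⟨a, Finset.mem_range.1 ha⟩, ⟨i, Finset.mem_range.1 hi⟩) _ ht (by linarith)).trans (by linarith))
    (fun a ha i hi => (b4 (⟨a, Finset.mem_range.1 ha⟩, ⟨i, Finset.mem_range.1 hi⟩) _ ht (by linarith)).trans (by linarith))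
    (fun a ha i hi l hl => (b5 (⟨a, Finset.mem_range.1 ha⟩, ⟨i, Finset.mem_range.1 hi⟩, ⟨l, Finset.mem_range.1 hl⟩) _ ht (by linarith)).trans (by linarith))
    (fun a ha => by
      refine (b7 n hn j hj S hS σ a ha).trans ?_
      have i1 : epsn K (tt n j) S σ ^ 3 + ww n ^ 3 ≤ (epsn K (tt n j) S σ + ww n) ^ 3 := by
        have := mul_nonneg heps0 hw.le
        have : (epsn K (tt n j) S σ + ww n) ^ 3 = epsn K (tt n j) S σ ^ 3 + ww n ^ 3
          + 3 * (epsn K (tt n j) S σ * ww n) * (epsn K (tt n j) S σ + ww n) := by ring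
        rw [this]
        have : 0 ≤ 3 * (epsn K (tt n j) S σ * ww n) * (epsn K (tt n j) S σ + ww n) := by positivity
        linarith
      have i2 : 0 ≤ Lf K S σ ^ K := by positivity
      have i3 : D7 ≤ D := by linarith
      gcongr)
  have alg := Y_alg K (fun a => (c a).eval (tt n j)) (fun a => (c a).eval (tt n (j+1))) (fun a => (c a).derivative.eval (tt n j))
    (uu n j S) (dd n j S σ) (fun a => (ep a).eval (tt n j)) (zz n j S) (ee n j S σ)
    (fun a i => (KK a i).eval (tt n j)) (fun a i => (Gam a i).eval (tt n j)) (fun a i l => (H2 a i l).eval (tt n j))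
    (ww n) ((n:ℝ) - 1) hwN (fun a => rfl) hcp
  have e1 : YY k c n j S σ = ∑ a ∈ range K, ((c a).eval (tt n (j+1)) * (uu n j S a + dd n j S σ a) - (c a).eval (tt n j) * uu n j S a) := by
    rw [YY, Psi, Psi, ← Finset.sum_sub_distrib]
    refine Finset.sum_congr rfl fun a _ => ?_
    rw [dd]; ring
  have e2 : Aa k c n j S σ = - ∑ i ∈ range K, (c i).derivative.eval (tt n j) * (ee n j S σ i - zz n j S i) := by
    rw [Aa]
    refine congrArg _ (Finset.sum_congr rfl fun i _ => ?_)
    rw [ee, zz]; ring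
  have e3 : Bb k c n j S σ = 1/2 * ∑ i ∈ range K, ∑ l ∈ range K, (∑ a ∈ range K, (c a).eval (tt n j) * (H2 a i l).eval (tt n j)) *
    (ee n j S σ i * ee n j S σ l - 2 * ww n ^ 2 * (Gam i l).eval (tt n j)) := rfl
  beta_reduce at alg key
  rw [← e1, ← e2, ← e3] at alg
  rw [alg]
  refine le_trans (le_of_eq ?_) key
  congr 1
  ring
end Spear

open MeasureTheory Finset
namespace Spear
open Matrix

noncomputable def Rr (K n : ℕ) (S : Mat n) (σ : Pm n) : ℝ := Dl K S σ + ww n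
noncomputable def Qf (K q n j : ℕ) (S : Mat n) (σ : Pm n) : ℝ :=
  Lf K S σ ^ q * (Rr K n S σ ^ 3 + Rr K n S σ * Zf K n j S + Zf K n j S ^ 2)

lemma Rt_Qf (B : ℝ) (K q : ℕ) : Rt B 3 (Qf K q) := by
  have h1 := (Rt_LD3 B K q).cmul (c := 4) (by norm_num)
  have h2 : Rt B 3 _ := ((Rt_L B K q).wmul 3).cmul (c := 4) (by norm_num)
  have h3 : Rt B 3 (fun n j S σ => Lf K S σ ^ q * Dl K S σ * Zf K n j S) :=
    Rt.young (B := B) (a := 1) (b := 2) (X := fun _ _ S σ => Lf K S σ ^ q * Dl K S σ) (Y := fun n j S _ => Zf K n j S)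
      (by simp only [mul_pow, ← pow_mul]; exact Rt_LD2 B K _) (Rt_Z2 B K)
  have h4 : Rt B 3 _ := (Rt_LZ B K q).wmul 1
  have h5 := Rt_LZ2 B K q
  refine ((((h1.add h2).add h3).add h4).add h5).mono fun n hn j hj S hS σ => ?_
  have hw := ww_pos hn
  have hD : 0 ≤ Dl K S σ := Dl_nonneg _ _ _
  have hL := Lf_ge_one (by omega) hS σ K
  have a1 : (Dl K S σ + ww n) ^ 3 ≤ 4 * Dl K S σ ^ 3 + 4 * ww n ^ 3 := by
    set d := Dl K S σ
    set w := ww n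
    nlinarith [mul_nonneg (add_nonneg hD hw.le) (sq_nonneg (d - w))]
  have a2 := mul_le_mul_of_nonneg_left a1 (by positivity : 0 ≤ Lf K S σ ^ q)
  unfold Qf Rr
  linarith

lemma real_Y (M C : ℝ) (hM : 0 ≤ M) (hC : 0 ≤ C) (q : ℕ) : ∃ C' : ℝ, 0 ≤ C' ∧ ∀ L R Z Y A : ℝ, 1 ≤ L → 0 ≤ R → 0 ≤ Z →
    R ≤ M * L → Z ≤ M * L → |A| ≤ C * R → |Y - A| ≤ C * (L ^ q * (R ^ 2 + Z)) →
    |Y ^ 2 - A ^ 2| ≤ C' * (L ^ (3 * q + 3) * (R ^ 3 + R * Z + Z ^ 2)) ∧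
    |Y| ^ 3 ≤ C' * (L ^ (3 * q + 3) * (R ^ 3 + R * Z + Z ^ 2)) := by
  refine ⟨2 * C ^ 2 * (1 + 2 * M) + 4 * C ^ 3 * (1 + M) ^ 3, by positivity, ?_⟩
  intro L R Z Y A hL hR hZ hRM hZM hA hY
  have hL0 : 0 ≤ L := by linarith
  have hΛ : 1 ≤ L ^ q := one_le_pow₀ hL
  set Λ := L ^ q with hΛdef
  have hQ0 : 0 ≤ R ^ 3 + R * Z + Z ^ 2 := by positivity
  have hp1 : Λ ^ 2 * L ≤ L ^ (3 * q + 3) := by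
    rw [hΛdef, ← pow_mul, ← pow_succ]; exact pow_le_pow_right₀ hL (by omega)
  have hp2 : Λ ^ 3 * L ^ 3 = L ^ (3 * q + 3) := by
    rw [hΛdef, ← pow_mul, ← pow_add]; congr 1; omega
  have hU : C * (Λ * (R ^ 2 + Z)) ≥ 0 := by positivity
  constructor
  · have e : Y ^ 2 - A ^ 2 = (Y - A) * (2 * A + (Y - A)) := by ring
    have h1 : |2 * A + (Y - A)| ≤ 2 * C * (Λ * (R + R ^ 2 + Z)) := by
      refine (abs_add_le _ _).trans ?_
      rw [abs_mul, abs_of_nonneg (by norm_num : (0:ℝ) ≤ 2)]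
      have : C * R ≤ C * (Λ * R) := mul_le_mul_of_nonneg_left (le_mul_of_one_le_left hR hΛ) hC
      have : 2 * C * (Λ * (R + R ^ 2 + Z)) = 2 * (C * (Λ * R)) + C * (Λ * (R ^ 2 + Z)) + C * (Λ * (R ^ 2 + Z)) := by ring
      linarith
    rw [e, abs_mul]
    have h2 : (R ^ 2 + Z) * (R + R ^ 2 + Z) ≤ (1 + 2 * M) * L * (R ^ 3 + R * Z + Z ^ 2) := by
      have i1 : R * R ^ 3 ≤ M * L * R ^ 3 := mul_le_mul_of_nonneg_right hRM (by positivity)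
      have i2 : R * (R * Z) ≤ M * L * (R * Z) := mul_le_mul_of_nonneg_right hRM (by positivity)
      have i3 : R ^ 3 + R * Z + Z ^ 2 ≤ L * (R ^ 3 + R * Z + Z ^ 2) := le_mul_of_one_le_left hQ0 hL
      have i4 : 0 ≤ M * L * R ^ 3 := by positivity
      have i5 : 0 ≤ M * L * Z ^ 2 := by positivity
      linarith
    calc _ ≤ (C * (Λ * (R ^ 2 + Z))) * (2 * C * (Λ * (R + R ^ 2 + Z))) := mul_le_mul hY h1 (abs_nonneg _) hU
      _ = 2 * C ^ 2 * Λ ^ 2 * ((R ^ 2 + Z) * (R + R ^ 2 + Z)) := by ring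
      _ ≤ 2 * C ^ 2 * Λ ^ 2 * ((1 + 2 * M) * L * (R ^ 3 + R * Z + Z ^ 2)) := mul_le_mul_of_nonneg_left h2 (by positivity)
      _ = 2 * C ^ 2 * (1 + 2 * M) * ((Λ ^ 2 * L) * (R ^ 3 + R * Z + Z ^ 2)) := by ring
      _ ≤ 2 * C ^ 2 * (1 + 2 * M) * (L ^ (3 * q + 3) * (R ^ 3 + R * Z + Z ^ 2)) := by gcongr
      _ ≤ _ := mul_le_mul_of_nonneg_right (le_add_of_nonneg_right (by positivity)) (by positivity)
  · have h1 : |Y| ≤ C * Λ * ((1 + M) * L * R + Z) := by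
      have : Y = A + (Y - A) := by ring
      rw [this]
      refine (abs_add_le _ _).trans ?_
      have i1 : C * R ≤ C * Λ * (L * R) := by
        calc C * R ≤ C * (Λ * (L * R)) := mul_le_mul_of_nonneg_left
              ((le_mul_of_one_le_left hR hL).trans (le_mul_of_one_le_left (by positivity) hΛ)) hC
          _ = _ := by ring
      have i2 : C * Λ * R ^ 2 ≤ C * Λ * (M * L * R) := by
        refine mul_le_mul_of_nonneg_left ?_ (by positivity)
        rw [sq]; exact mul_le_mul_of_nonneg_right hRM hR
      linarith
    have h2 : ((1 + M) * L * R + Z) ^ 3 ≤ 4 * (1 + M) ^ 3 * L ^ 3 * (R ^ 3 + R * Z + Z ^ 2) := by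
      have i0 : ∀ a b : ℝ, 0 ≤ a → 0 ≤ b → (a + b) ^ 3 ≤ 4 * a ^ 3 + 4 * b ^ 3 := fun a b ha hb => by
        nlinarith [mul_nonneg (add_nonneg ha hb) (sq_nonneg (a - b))]
      refine (i0 _ _ (by positivity) hZ).trans ?_
      have i1 : Z ^ 3 ≤ M * L * Z ^ 2 := by
        calc Z ^ 3 = Z * Z ^ 2 := by ring
          _ ≤ _ := mul_le_mul_of_nonneg_right hZM (by positivity)
      have i2 : M * L ≤ (1 + M) ^ 3 * L ^ 3 := by
        have : L ≤ L ^ 3 := by nlinarith [sq_nonneg L]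
        have : M ≤ (1 + M) ^ 3 := by nlinarith [sq_nonneg M, pow_nonneg hM 3]
        gcongr
      have i3 := mul_le_mul_of_nonneg_right i2 (by positivity : 0 ≤ Z ^ 2)
      have i4 : 0 ≤ (1 + M) ^ 3 * L ^ 3 * (R * Z) := by positivity
      have i5 : ((1 + M) * L * R) ^ 3 = (1 + M) ^ 3 * L ^ 3 * R ^ 3 := by ring
      rw [i5]
      linarith
    calc _ ≤ (C * Λ * ((1 + M) * L * R + Z)) ^ 3 := pow_le_pow_left₀ (abs_nonneg _) h1 3
      _ = C ^ 3 * Λ ^ 3 * ((1 + M) * L * R + Z) ^ 3 := by ring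
      _ ≤ C ^ 3 * Λ ^ 3 * (4 * (1 + M) ^ 3 * L ^ 3 * (R ^ 3 + R * Z + Z ^ 2)) := mul_le_mul_of_nonneg_left h2 (by positivity)
      _ = 4 * C ^ 3 * (1 + M) ^ 3 * ((Λ ^ 3 * L ^ 3) * (R ^ 3 + R * Z + Z ^ 2)) := by ring
      _ = 4 * C ^ 3 * (1 + M) ^ 3 * (L ^ (3 * q + 3) * (R ^ 3 + R * Z + Z ^ 2)) := by rw [hp2]
      _ ≤ _ := mul_le_mul_of_nonneg_right (le_add_of_nonneg_left (by positivity)) (by positivity)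

set_option maxHeartbeats 1000000 in
lemma real_S (k K : ℕ) (M C0 D D1 C1 C2 L R Z w ep' Y A Bv Dv : ℝ) (hMn : 0 ≤ M) (hC0 : 0 ≤ C0) (hDn : 0 ≤ D) (hD1 : 0 ≤ D1)
    (hC2 : 0 ≤ C2) (hC1n : 0 ≤ C1)
    (hC1 : C1 = D1 + 2 * (D * (2 + 2 * M) + 2 * D ^ 2 * K ^ 2) + C0 * (4 * (1 + M) + 1) * (2 * M + 1))
    (h2 : ∀ L R Z Y A : ℝ, 1 ≤ L → 0 ≤ R → 0 ≤ Z →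
    R ≤ M * L → Z ≤ M * L → |A| ≤ C1 * R → |Y - A| ≤ C1 * (L ^ (k+5) * (R ^ 2 + Z)) →
    |Y ^ 2 - A ^ 2| ≤ C2 * (L ^ (3 * (k+5) + 3) * (R ^ 3 + R * Z + Z ^ 2)) ∧
    |Y| ^ 3 ≤ C2 * (L ^ (3 * (k+5) + 3) * (R ^ 3 + R * Z + Z ^ 2)))
    (hw : 0 < w) (hw1 : w ≤ 1) (hL : 1 ≤ L) (heps0 : 0 ≤ ep') (hZ0 : 0 ≤ Z) (hDl0 : 0 ≤ Dv)
    (h0' : |Y - A - Bv| ≤ C0 * (L ^ (k + 3) * ((ep' + w) ^ 3 + w ^ 2 * Z)))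
    (hAb : |A| ≤ D1 * Dv) (hBb : |Bv| ≤ 1/2 * (D * ep' ^ 2 + 2 * D ^ 2 * K ^ 2 * w ^ 2))
    (hRL : R ≤ M * L) (hZL2 : Z ≤ M * L) (hwR : w ≤ R) (hDR : Dv ≤ R) (heR : ep' + w ≤ R + Z) :
    |Y - A - Bv| ≤ (C0 * (4 * (1 + M) + 1) + C2) * (L ^ (3 * (k+5) + 3) * (R ^ 3 + R * Z + Z ^ 2)) ∧
    |Y ^ 2 - A ^ 2| ≤ (C0 * (4 * (1 + M) + 1) + C2) * (L ^ (3 * (k+5) + 3) * (R ^ 3 + R * Z + Z ^ 2)) ∧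
    |Y| ^ 3 ≤ (C0 * (4 * (1 + M) + 1) + C2) * (L ^ (3 * (k+5) + 3) * (R ^ 3 + R * Z + Z ^ 2)) := by
  have hR0 : 0 ≤ R := by linarith
  have hQ0 : 0 ≤ R ^ 3 + R * Z + Z ^ 2 := by positivity
  have r1 : (ep' + w) ^ 3 + w ^ 2 * Z ≤ (4 * (1 + M) + 1) * (L * (R ^ 3 + R * Z + Z ^ 2)) := by
    have i1 : (ep' + w) ^ 3 ≤ (R + Z) ^ 3 := pow_le_pow_left₀ (by positivity) heR 3
    have i2 : (R + Z) ^ 3 ≤ 4 * R ^ 3 + 4 * Z ^ 3 := by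
      nlinarith [mul_nonneg (add_nonneg hR0 hZ0) (sq_nonneg (R - Z))]
    have i3 : Z ^ 3 ≤ M * L * Z ^ 2 := by
      calc Z ^ 3 = Z * Z ^ 2 := by ring
        _ ≤ _ := mul_le_mul_of_nonneg_right hZL2 (by positivity)
    have i4 : w ^ 2 * Z ≤ R * Z := by
      refine mul_le_mul_of_nonneg_right ?_ hZ0
      nlinarith
    have i5 : R ^ 3 + R * Z + Z ^ 2 ≤ L * (R ^ 3 + R * Z + Z ^ 2) := le_mul_of_one_le_left hQ0 hL
    have i6 : M * L * Z ^ 2 ≤ M * (L * (R ^ 3 + R * Z + Z ^ 2)) := by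
      rw [mul_assoc]
      refine mul_le_mul_of_nonneg_left (mul_le_mul_of_nonneg_left ?_ (by linarith)) hMn
      have : 0 ≤ R ^ 3 + R * Z := by positivity
      linarith
    have i7 : R ^ 3 ≤ R ^ 3 + R * Z + Z ^ 2 := by linarith [mul_nonneg hR0 hZ0, sq_nonneg Z]
    have i8 : R * Z ≤ R ^ 3 + R * Z + Z ^ 2 := by linarith [pow_nonneg hR0 3, sq_nonneg Z]
    have i9 : (4 * (1 + M) + 1) * (L * (R ^ 3 + R * Z + Z ^ 2)) = 5 * (L * (R ^ 3 + R * Z + Z ^ 2))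
      + 4 * (M * (L * (R ^ 3 + R * Z + Z ^ 2))) := by ring
    rw [i9]
    linarith
  have r2 : |Y - A - Bv| ≤ C0 * (4 * (1 + M) + 1) * (L ^ (k + 4) * (R ^ 3 + R * Z + Z ^ 2)) := by
    calc _ ≤ _ := h0'
      _ ≤ C0 * (L ^ (k + 3) * ((4 * (1 + M) + 1) * (L * (R ^ 3 + R * Z + Z ^ 2)))) := by gcongr
      _ = _ := by ring
  have r3 : |Y - A| ≤ C1 * (L ^ (k + 5) * (R ^ 2 + Z)) := by
    have i1 : |Y - A| ≤ |Y - A - Bv| + |Bv| := by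
      have : Y - A = (Y - A - Bv) + Bv := by ring
      calc |Y - A| = |(Y - A - Bv) + Bv| := by rw [← this]
        _ ≤ _ := abs_add_le _ _
    have i2 : R ^ 3 + R * Z + Z ^ 2 ≤ (2 * M + 1) * (L * (R ^ 2 + Z)) := by
      have j1 : R * R ^ 2 ≤ M * L * R ^ 2 := mul_le_mul_of_nonneg_right hRL (by positivity)
      have j2 : R * Z ≤ M * L * Z := mul_le_mul_of_nonneg_right hRL (by positivity)
      have j3 : Z * Z ≤ M * L * Z := mul_le_mul_of_nonneg_right hZL2 (by positivity)
      have j4 : 0 ≤ M * L * R ^ 2 := by positivity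
      have j5 : 0 ≤ L * (R ^ 2 + Z) := by positivity
      linarith
    have hLp : 1 ≤ L ^ (k+5) := one_le_pow₀ hL
    have hLp1 : L ≤ L ^ (k+5) := by
      calc L = L ^ 1 := (pow_one L).symm
        _ ≤ _ := pow_le_pow_right₀ hL (by omega)
    have i3 : |Bv| ≤ 2 * (D * (2 + 2 * M) + 2 * D ^ 2 * K ^ 2) * (L ^ (k+5) * (R ^ 2 + Z)) := by
      have j1 : ep' ^ 2 ≤ (2 + 2 * M) * (L * (R ^ 2 + Z)) := by
        have l1 : ep' ^ 2 ≤ (R + Z) ^ 2 := pow_le_pow_left₀ heps0 (by linarith) 2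
        have l2 : (R + Z) ^ 2 ≤ 2 * R ^ 2 + 2 * Z ^ 2 := by nlinarith [sq_nonneg (R - Z)]
        have l3 : Z * Z ≤ M * L * Z := mul_le_mul_of_nonneg_right hZL2 (by positivity)
        have l4 : R ^ 2 ≤ L * R ^ 2 := le_mul_of_one_le_left (by positivity) hL
        have l5 : 0 ≤ L * Z := by positivity
        have l6 : 0 ≤ M * L * R ^ 2 := by positivity
        linarith
      have j2 : w ^ 2 ≤ L ^ (k+5) * (R ^ 2 + Z) := by
        have l1 : w ^ 2 ≤ R ^ 2 := pow_le_pow_left₀ hw.le hwR 2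
        have l2 : R ^ 2 + Z ≤ L ^ (k+5) * (R ^ 2 + Z) := le_mul_of_one_le_left (by positivity) hLp
        linarith
      have j3 : ep' ^ 2 ≤ (2 + 2 * M) * (L ^ (k+5) * (R ^ 2 + Z)) := j1.trans (by gcongr)
      have j4 : 0 ≤ L ^ (k+5) * (R ^ 2 + Z) := by positivity
      set X := L ^ (k+5) * (R ^ 2 + Z)
      calc _ ≤ _ := hBb
        _ ≤ 1/2 * (D * ((2 + 2 * M) * X) + 2 * D ^ 2 * K ^ 2 * X) := by gcongr
        _ ≤ _ := by
          have : 0 ≤ D * ((2 + 2 * M) * X) := by positivity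
          have : 0 ≤ 2 * D ^ 2 * K ^ 2 * X := by positivity
          linarith
    have i4 : C0 * (4 * (1 + M) + 1) * (L ^ (k + 4) * (R ^ 3 + R * Z + Z ^ 2))
        ≤ C0 * (4 * (1 + M) + 1) * (2 * M + 1) * (L ^ (k+5) * (R ^ 2 + Z)) := by
      calc _ ≤ C0 * (4 * (1 + M) + 1) * (L ^ (k + 4) * ((2 * M + 1) * (L * (R ^ 2 + Z)))) := by gcongr
        _ = _ := by ring
    have j4 : 0 ≤ L ^ (k+5) * (R ^ 2 + Z) := by positivity
    have j5 : 0 ≤ D1 * (L ^ (k+5) * (R ^ 2 + Z)) := by positivity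
    rw [hC1]
    linarith
  have hA' : |A| ≤ C1 * R := by
    have : D1 ≤ C1 := by
      rw [hC1]
      have : 0 ≤ 2 * (D * (2 + 2 * M) + 2 * D ^ 2 * K ^ 2) + C0 * (4 * (1 + M) + 1) * (2 * M + 1) := by positivity
      linarith
    calc |A| ≤ D1 * Dv := hAb
      _ ≤ C1 * R := mul_le_mul this hDR hDl0 hC1n
  obtain ⟨s1, s2⟩ := h2 L R Z Y A hL hR0 hZ0 hRL hZL2 hA' r3
  have hLq : L ^ (k + 4) ≤ L ^ (3 * (k + 5) + 3) := pow_le_pow_right₀ hL (by omega)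
  have hX0 : 0 ≤ L ^ (3 * (k+5) + 3) * (R ^ 3 + R * Z + Z ^ 2) := by positivity
  have u1 : 0 ≤ C0 * (4 * (1 + M) + 1) := by positivity
  have u2 := mul_nonneg u1 hX0
  have u3 := mul_nonneg hC2 hX0
  rw [add_mul]
  refine ⟨?_, ?_, ?_⟩
  · have : C0 * (4 * (1 + M) + 1) * (L ^ (k + 4) * (R ^ 3 + R * Z + Z ^ 2))
      ≤ C0 * (4 * (1 + M) + 1) * (L ^ (3 * (k + 5) + 3) * (R ^ 3 + R * Z + Z ^ 2)) := by gcongr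
    linarith
  · linarith
  · linarith

set_option maxHeartbeats 2000000 in
/-- pointwise bounds on the increment -/
lemma YY_pointwise (k : ℕ) (c : ℕ → Polynomial ℝ)
    (hc : ∀ i ≤ k, Polynomial.derivative (c i) = - ∑ a ∈ range (k + 1), c a * KK a i) (B : ℝ) :
    ∃ (C : ℝ) (q : ℕ), 0 ≤ C ∧ ∀ n : ℕ, 4 ≤ n → ∀ j : ℕ, (j : ℝ) ≤ B * n → ∀ S : Mat n, Good S → ∀ σ,
    |YY k c n j S σ - Aa k c n j S σ - Bb k c n j S σ| ≤ C * Qf (k+1) q n j S σ ∧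
    |YY k c n j S σ ^ 2 - Aa k c n j S σ ^ 2| ≤ C * Qf (k+1) q n j S σ ∧
    |YY k c n j S σ| ^ 3 ≤ C * Qf (k+1) q n j S σ := by
  set K := k + 1 with hK
  set T := 2 * |B| + 1 with hT
  obtain ⟨C0, hC0, h0⟩ := YY_expand0 k c hc B
  obtain ⟨M0, hM0, hZL⟩ := Zf_le_Lf K B
  obtain ⟨D1, hD1, b1⟩ := Fin_of_range (K := K) (p := fun i => Polynomial.derivative (c i)) T
  obtain ⟨D2, hD2, b2⟩ := polys_bdd (fun x : Fin K × Fin K => ∑ a ∈ range K, c a * H2 a x.1 x.2) T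
  obtain ⟨D3, hD3, b3⟩ := polys_bdd (fun x : Fin K × Fin K => Gam x.1 x.2) T
  set M := M0 + K + 1 with hM
  have hMn : 0 ≤ M := by positivity
  set D := D2 + D3 with hD
  have hDn : 0 ≤ D := by positivity
  set C1 := D1 + 2 * (D * (2 + 2 * M) + 2 * D ^ 2 * K ^ 2) + C0 * (4 * (1 + M) + 1) * (2 * M + 1) with hC1
  have hC1n : 0 ≤ C1 := by positivity
  obtain ⟨C2, hC2, h2⟩ := real_Y M C1 hMn hC1n (k + 5)
  refine ⟨C0 * (4 * (1 + M) + 1) + C2, 3 * (k + 5) + 3, by positivity, fun n hn j hj S hS σ => ?_⟩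
  have hw := ww_pos hn
  have hw1 := ww_le_one hn
  have ht := tt_nonneg hn j
  have htB : tt n j ≤ 2 * |B| := jw_le hn hj
  have hL := Lf_ge_one (by omega) hS σ K
  have heps0 := epsn_nonneg K (tt n j) S σ
  have hZ0 := Zf_nonneg K n j S
  have hDl0 := Dl_nonneg K S σ
  have hDlL := Dl_le_Lf (by omega) hS σ K
  have heps := epsn_le K j S σ
  have hZL' := hZL n hn j hj S hS σ
  have h0' := h0 n hn j hj S hS σ
  have hAb : |Aa k c n j S σ| ≤ D1 * Dl K S σ := by
    rw [Aa, abs_neg]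
    exact sum_abs_le K _ _ D1 (fun i hi => b1 i hi _ ht (by linarith)) hD1
  have hBb : |Bb k c n j S σ| ≤ 1/2 * (D * epsn K (tt n j) S σ ^ 2 + 2 * D ^ 2 * K ^ 2 * ww n ^ 2) := by
    rw [Bb, abs_mul, abs_of_nonneg (by norm_num : (0:ℝ) ≤ 1/2)]
    refine mul_le_mul_of_nonneg_left ?_ (by norm_num)
    refine sum_abs_le2 K _ (ee n j S σ) (fun i l => (Gam i l).eval (tt n j)) (ww n) D hDn ?_ ?_
    · intro i hi l hl
      have := b2 (⟨i, Finset.mem_range.1 hi⟩, ⟨l, Finset.mem_range.1 hl⟩) _ ht (by linarith)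
      simp only [Polynomial.eval_finset_sum, Polynomial.eval_mul] at this
      exact this.trans (by linarith)
    · intro i hi l hl
      exact (b3 (⟨i, Finset.mem_range.1 hi⟩, ⟨l, Finset.mem_range.1 hl⟩) _ ht (by linarith)).trans (by linarith)
  have hRL : Rr K n S σ ≤ M * Lf K S σ := by
    have : 0 ≤ M0 * Lf K S σ := by positivity
    rw [Rr, hM]; linarith
  have hZL2 : Zf K n j S ≤ M * Lf K S σ := by
    have : 0 ≤ ((K:ℝ) + 1) * Lf K S σ := by positivity
    rw [hM]; linarith
  have hwR : ww n ≤ Rr K n S σ := by rw [Rr]; linarith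
  have hDR : Dl K S σ ≤ Rr K n S σ := by rw [Rr]; linarith
  have heR : epsn K (tt n j) S σ + ww n ≤ Rr K n S σ + Zf K n j S := by rw [Rr]; linarith
  exact real_S k K M C0 D D1 C1 C2 _ _ _ _ _ _ _ _ _ hMn hC0 hDn hD1 hC2 hC1n hC1 h2 hw hw1 hL heps0 hZ0 hDl0 h0' hAb hBb
    hRL hZL2 hwR hDR heR
end Spear

open MeasureTheory Finset
namespace Spear
open Matrix

noncomputable def kap (n j i l : ℕ) (S : Mat n) : ℝ :=
  av (fun σ => (xx S σ i - ss S i) * (xx S σ l - ss S l)) - 2 * ww n ^ 2 * (Gam i l).eval (tt n j)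
noncomputable def Kap (K n j : ℕ) (S : Mat n) : ℝ := ∑ i ∈ range K, ∑ l ∈ range K, |kap n j i l S|

lemma Rt_Kap (B : ℝ) (K : ℕ) : Rt B 3 (fun n j S _ => Kap K n j S) :=
  Rt.sum (range K) fun i _ => Rt.sum (range K) fun l _ => Rt_KL B i l

lemma av_del {n : ℕ} (S : Mat n) (i : ℕ) : av (fun σ => xx S σ i - ss S i) = 0 := by
  rw [av_sub, av_const, ss, sub_self]

lemma av_Aa (k : ℕ) (c : ℕ → Polynomial ℝ) (n j : ℕ) (S : Mat n) : av (Aa k c n j S) = 0 := by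
  have : Aa k c n j S = fun σ => (-1 : ℝ) * ∑ i ∈ range (k+1), (c i).derivative.eval (tt n j) * (xx S σ i - ss S i) := by
    funext σ; rw [Aa, neg_one_mul]
  rw [this, av_mul, av_sum, Finset.sum_eq_zero, mul_zero]
  intro i _
  rw [av_mul, av_del, mul_zero]

lemma av_Aa_sq (k : ℕ) (c : ℕ → Polynomial ℝ) (n j : ℕ) (S : Mat n) : av (fun σ => Aa k c n j S σ ^ 2)
    = ∑ i ∈ range (k+1), ∑ l ∈ range (k+1), (c i).derivative.eval (tt n j) * (c l).derivative.eval (tt n j) *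
      (kap n j i l S + 2 * ww n ^ 2 * (Gam i l).eval (tt n j)) := by
  have : (fun σ => Aa k c n j S σ ^ 2) = fun σ => ∑ i ∈ range (k+1), ∑ l ∈ range (k+1),
      ((c i).derivative.eval (tt n j) * (c l).derivative.eval (tt n j)) * ((xx S σ i - ss S i) * (xx S σ l - ss S l)) := by
    funext σ
    rw [Aa, neg_sq, sq, Finset.sum_mul_sum]
    exact Finset.sum_congr rfl fun i _ => Finset.sum_congr rfl fun l _ => by ring
  rw [this, av_sum]
  refine Finset.sum_congr rfl fun i _ => ?_
  rw [av_sum]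
  refine Finset.sum_congr rfl fun l _ => ?_
  rw [av_mul, kap, sub_add_cancel]

lemma av_Bb (k : ℕ) (c : ℕ → Polynomial ℝ) (n j : ℕ) (S : Mat n) : av (Bb k c n j S)
    = 1/2 * ∑ i ∈ range (k+1), ∑ l ∈ range (k+1), gg k c n j i l * (kap n j i l S + zz n j S i * zz n j S l) := by
  have : Bb k c n j S = fun σ => (1/2 : ℝ) * ∑ i ∈ range (k+1), ∑ l ∈ range (k+1), gg k c n j i l *
    (ee n j S σ i * ee n j S σ l - 2 * ww n ^ 2 * (Gam i l).eval (tt n j)) := rfl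
  rw [this, av_mul, av_sum]
  refine congrArg _ (Finset.sum_congr rfl fun i _ => ?_)
  rw [av_sum]
  refine Finset.sum_congr rfl fun l _ => ?_
  rw [av_mul]
  refine congrArg _ ?_
  have : (fun σ => ee n j S σ i * ee n j S σ l - 2 * ww n ^ 2 * (Gam i l).eval (tt n j))
      = fun σ => (((xx S σ i - ss S i) * (xx S σ l - ss S l) + zz n j S l * (xx S σ i - ss S i))
        + zz n j S i * (xx S σ l - ss S l)) + (zz n j S i * zz n j S l - 2 * ww n ^ 2 * (Gam i l).eval (tt n j)) := by
    funext σ; unfold ee zz; ring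
  rw [this, av_add, av_add, av_add, av_mul, av_mul, av_del, av_del, av_const, kap]; ring

lemma dsum_abs_le (K : ℕ) (f g : ℕ → ℕ → ℝ) (C : ℝ) (hf : ∀ i ∈ range K, ∀ l ∈ range K, |f i l| ≤ C) :
    |∑ i ∈ range K, ∑ l ∈ range K, f i l * g i l| ≤ C * ∑ i ∈ range K, ∑ l ∈ range K, |g i l| := by
  rw [Finset.mul_sum]
  refine (Finset.abs_sum_le_sum_abs _ _).trans (Finset.sum_le_sum fun i hi => ?_)
  rw [Finset.mul_sum]
  refine (Finset.abs_sum_le_sum_abs _ _).trans (Finset.sum_le_sum fun l hl => ?_)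
  rw [abs_mul]; exact mul_le_mul_of_nonneg_right (hf i hi l hl) (abs_nonneg _)

lemma WW_ode_eval (k : ℕ) (c : ℕ → Polynomial ℝ)
    (hc : ∀ i ≤ k, Polynomial.derivative (c i) = - ∑ a ∈ range (k + 1), c a * KK a i) (t : ℝ) :
    (WW k c).derivative.eval t = 2 * ∑ i ∈ range (k+1), ∑ l ∈ range (k+1),
      (c i).derivative.eval t * (c l).derivative.eval t * (Gam i l).eval t := by
  have hck : Polynomial.derivative (c k) = 0 := by
    rw [hc k le_rfl, Finset.sum_eq_zero, neg_zero]
    intro a ha; rw [KK_eq_zero k a (by simpa [Nat.lt_succ_iff] using ha), mul_zero]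
  rw [WW_ode k c hc]
  simp only [Finset.sum_range_succ, hck, Polynomial.eval_mul, Polynomial.eval_finset_sum, Polynomial.eval_ofNat,
    Polynomial.eval_zero, mul_zero, zero_mul, add_zero, Finset.sum_const_zero]

lemma step_bounds (k : ℕ) (c : ℕ → Polynomial ℝ)
    (hc : ∀ i ≤ k, Polynomial.derivative (c i) = - ∑ a ∈ range (k + 1), c a * KK a i) (B : ℝ) :
    ∃ X : Fam, Rt B 3 X ∧ ∀ n : ℕ, 4 ≤ n → ∀ j : ℕ, (j : ℝ) ≤ B * n → ∀ S : Mat n, Good S →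
    |av (YY k c n j S)| ≤ av (X n j S) ∧
    |av (fun σ => YY k c n j S σ ^ 2) - ((WW k c).eval (tt n (j+1)) - (WW k c).eval (tt n j))| ≤ av (X n j S) ∧
    av (fun σ => |YY k c n j S σ| ^ 3) ≤ av (X n j S) := by
  set K := k + 1 with hK
  set T := 2 * |B| + 1 with hT
  have hT0 : 0 ≤ T := by positivity
  obtain ⟨C, q, hC, h⟩ := YY_pointwise k c hc B
  obtain ⟨D1, hD1, b1⟩ := polys_bdd (fun x : Fin K × Fin K => Polynomial.derivative (c x.1) * Polynomial.derivative (c x.2)) T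
  obtain ⟨D2, hD2, b2⟩ := polys_bdd (fun x : Fin K × Fin K => ∑ a ∈ range K, c a * H2 a x.1 x.2) T
  obtain ⟨D3, hD3, b3⟩ := poly_taylor1 (WW k c) T hT0
  set C' := C + D1 + D2 + D3 with hC'
  have hC'0 : 0 ≤ C' := by positivity
  refine ⟨fun n j S σ => C' * (Kap K n j S + Qf K q n j S σ), ((Rt_Kap B K).add (Rt_Qf B K q)).cmul hC'0, ?_⟩
  intro n hn j hj S hS
  have hw := ww_pos hn
  have hw1 := ww_le_one hn
  have ht := tt_nonneg hn j
  have htB : tt n j ≤ 2 * |B| := jw_le hn hj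
  have hZ0 := Zf_nonneg K n j S
  have hQZ : Zf K n j S ^ 2 + ww n ^ 3 ≤ av (Qf K q n j S) := by
    have := av_mono (n := n) (f := fun _ => Zf K n j S ^ 2 + ww n ^ 3) (g := Qf K q n j S) (fun σ => by
      have hL : 1 ≤ Lf K S σ ^ q := one_le_pow₀ (Lf_ge_one (by omega) hS σ K)
      have hDl0 := Dl_nonneg K S σ
      have hR : ww n ≤ Rr K n S σ := by rw [Rr]; linarith
      have hR0 : 0 ≤ Rr K n S σ := hw.le.trans hR
      have h1 : ww n ^ 3 ≤ Rr K n S σ ^ 3 := pow_le_pow_left₀ hw.le hR 3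
      have h2 : 0 ≤ Rr K n S σ * Zf K n j S := by positivity
      unfold Qf
      calc _ ≤ Rr K n S σ ^ 3 + Rr K n S σ * Zf K n j S + Zf K n j S ^ 2 := by linarith
        _ ≤ _ := le_mul_of_one_le_left (by positivity) hL)
    rwa [av_const] at this
  have hQ0 : 0 ≤ av (Qf K q n j S) := le_trans (by positivity) hQZ
  have hKap0 : 0 ≤ Kap K n j S := Finset.sum_nonneg fun _ _ => Finset.sum_nonneg fun _ _ => abs_nonneg _
  have hX : av (fun σ => C' * (Kap K n j S + Qf K q n j S σ)) = C' * (Kap K n j S + av (Qf K q n j S)) := by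
    rw [av_mul, av_add, av_const]
  have hXX : av ((fun n j S σ => C' * (Kap K n j S + Qf K q n j S σ) : Fam) n j S) = C' * (Kap K n j S + av (Qf K q n j S)) := hX
  rw [hXX]
  set QA := av (Qf K q n j S) with hQA
  have hp := fun σ => h n hn j hj S hS σ
  have m1 : |av (YY k c n j S)| ≤ D2 * (Kap K n j S + Zf K n j S ^ 2) + C * QA := by
    have e1 : av (YY k c n j S) = av (Bb k c n j S) + av (fun σ => YY k c n j S σ - Aa k c n j S σ - Bb k c n j S σ) := by
      rw [av_sub, av_sub, av_Aa]; ring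
    have e2 : |av (fun σ => YY k c n j S σ - Aa k c n j S σ - Bb k c n j S σ)| ≤ C * QA := by
      refine (abs_av_le _).trans ?_
      rw [hQA, ← av_mul]
      exact av_mono fun σ => (hp σ).1
    have e3 : |av (Bb k c n j S)| ≤ D2 * (Kap K n j S + Zf K n j S ^ 2) := by
      rw [av_Bb, abs_mul, abs_of_nonneg (by norm_num : (0:ℝ) ≤ 1/2)]
      have i1 := dsum_abs_le K (gg k c n j) (fun i l => kap n j i l S + zz n j S i * zz n j S l) D2 (by
        intro i hi l hl
        have := b2 (⟨i, Finset.mem_range.1 hi⟩, ⟨l, Finset.mem_range.1 hl⟩) _ ht (by linarith)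
        simp only [Polynomial.eval_finset_sum, Polynomial.eval_mul] at this
        exact this)
      have i2 : ∑ i ∈ range K, ∑ l ∈ range K, |kap n j i l S + zz n j S i * zz n j S l| ≤ Kap K n j S + Zf K n j S ^ 2 := by
        rw [Kap, Zf, sq, Finset.sum_mul_sum, ← Finset.sum_add_distrib]
        refine Finset.sum_le_sum fun i _ => ?_
        rw [← Finset.sum_add_distrib]
        refine Finset.sum_le_sum fun l _ => (abs_add_le _ _).trans ?_
        rw [abs_mul]
      have i3 := i1.trans (mul_le_mul_of_nonneg_left i2 hD2)
      have i4 := abs_nonneg (∑ i ∈ range K, ∑ l ∈ range K, gg k c n j i l * (kap n j i l S + zz n j S i * zz n j S l))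
      linarith
    rw [e1]
    exact (abs_add_le _ _).trans (add_le_add e3 e2)
  have m2 : |av (fun σ => YY k c n j S σ ^ 2) - ((WW k c).eval (tt n (j+1)) - (WW k c).eval (tt n j))|
      ≤ C * QA + D1 * Kap K n j S + D3 * ww n ^ 3 := by
    have e1 : |av (fun σ => YY k c n j S σ ^ 2) - av (fun σ => Aa k c n j S σ ^ 2)| ≤ C * QA := by
      rw [← av_sub]
      refine (abs_av_le _).trans ?_
      rw [hQA, ← av_mul]
      exact av_mono fun σ => (hp σ).2.1
    have e2 : |(WW k c).eval (tt n (j+1)) - (WW k c).eval (tt n j) - (WW k c).derivative.eval (tt n j) * ww n ^ 2| ≤ D3 * ww n ^ 3 := by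
      rw [tt_succ hn]
      have hw2 := ww_sq_le hn
      refine (b3 (tt n j) (ww n ^ 2) ht (by positivity) hw2 (by linarith)).trans ?_
      refine mul_le_mul_of_nonneg_left ?_ hD3
      rw [← pow_mul]; exact pow_le_pow_of_le_one hw.le hw1 (by norm_num)
    have e3 : av (fun σ => Aa k c n j S σ ^ 2) - (WW k c).derivative.eval (tt n j) * ww n ^ 2
        = ∑ i ∈ range K, ∑ l ∈ range K, ((c i).derivative.eval (tt n j) * (c l).derivative.eval (tt n j)) * kap n j i l S := by
      rw [av_Aa_sq, WW_ode_eval k c hc, Finset.mul_sum, Finset.sum_mul, ← Finset.sum_sub_distrib]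
      refine Finset.sum_congr rfl fun i _ => ?_
      rw [Finset.mul_sum, Finset.sum_mul, ← Finset.sum_sub_distrib]
      exact Finset.sum_congr rfl fun l _ => by ring
    have e4 : |av (fun σ => Aa k c n j S σ ^ 2) - (WW k c).derivative.eval (tt n j) * ww n ^ 2| ≤ D1 * Kap K n j S := by
      rw [e3]
      refine dsum_abs_le K _ (fun i l => kap n j i l S) D1 ?_
      intro i hi l hl
      have := b1 (⟨i, Finset.mem_range.1 hi⟩, ⟨l, Finset.mem_range.1 hl⟩) _ ht (by linarith)
      simpa only [Polynomial.eval_mul] using this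
    rw [abs_le] at e1 e2 e4 ⊢
    constructor <;> linarith [e1.1, e1.2, e2.1, e2.2, e4.1, e4.2]
  have m3 : av (fun σ => |YY k c n j S σ| ^ 3) ≤ C * QA := by
    rw [hQA, ← av_mul]
    exact av_mono fun σ => (hp σ).2.2
  have w3 : 0 ≤ ww n ^ 3 := by positivity
  have z2 : 0 ≤ Zf K n j S ^ 2 := by positivity
  have s1 : C * QA ≤ C * (Kap K n j S + QA) := mul_le_mul_of_nonneg_left (by linarith) hC
  have s2 : D2 * (Kap K n j S + Zf K n j S ^ 2) ≤ D2 * (Kap K n j S + QA) := mul_le_mul_of_nonneg_left (by linarith) hD2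
  have s3 : D1 * Kap K n j S ≤ D1 * (Kap K n j S + QA) := mul_le_mul_of_nonneg_left (by linarith) hD1
  have s4 : D3 * ww n ^ 3 ≤ D3 * (Kap K n j S + QA) := mul_le_mul_of_nonneg_left (by linarith) hD3
  have t0 : 0 ≤ Kap K n j S + QA := by linarith
  have t1 := mul_nonneg hC t0
  have t2 := mul_nonneg hD1 t0
  have t3 := mul_nonneg hD2 t0
  have t4 := mul_nonneg hD3 t0
  have hsum : C' * (Kap K n j S + QA) = C * (Kap K n j S + QA) + D1 * (Kap K n j S + QA) + D2 * (Kap K n j S + QA)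
    + D3 * (Kap K n j S + QA) := by rw [hC']; ring
  rw [hsum]
  refine ⟨by linarith, by linarith, by linarith⟩
end Spear

open MeasureTheory Finset
namespace Spear
open Matrix

lemma cexp3 (x : ℝ) : ‖Complex.exp ((x:ℂ) * Complex.I) - 1 - (x:ℂ) * Complex.I + (x:ℂ) ^ 2 / 2‖ ≤ 4 * |x| ^ 3 := by
  have hx := abs_nonneg x
  rcases le_total |x| 1 with h | h
  · have h1 := Complex.norm_exp_sub_sum_le_norm_mul_exp ((x:ℂ) * Complex.I) 3
    have h2 : ∑ m ∈ range 3, ((x:ℂ) * Complex.I) ^ m / (m.factorial : ℂ)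
        = 1 + (x:ℂ) * Complex.I - (x:ℂ) ^ 2 / 2 := by
      simp [Finset.sum_range_succ, mul_pow, Nat.factorial]; ring
    have h3 : ‖(x:ℂ) * Complex.I‖ = |x| := by simp
    rw [h2, h3] at h1
    have h4 : Real.exp |x| ≤ 4 := by
      have := Real.exp_le_exp.2 h
      have := Real.exp_one_lt_d9
      linarith
    have e : Complex.exp ((x:ℂ) * Complex.I) - 1 - (x:ℂ) * Complex.I + (x:ℂ) ^ 2 / 2
      = Complex.exp ((x:ℂ) * Complex.I) - (1 + (x:ℂ) * Complex.I - (x:ℂ) ^ 2 / 2) := by ring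
    rw [e]
    have h5 : |x| ^ 3 * Real.exp |x| ≤ |x| ^ 3 * 4 := mul_le_mul_of_nonneg_left h4 (by positivity)
    linarith
  · have a1 : ‖Complex.exp ((x:ℂ) * Complex.I)‖ = 1 := Complex.norm_exp_ofReal_mul_I x
    have a2 : ‖(x:ℂ) * Complex.I‖ = |x| := by simp
    have a3 : ‖(x:ℂ) ^ 2 / 2‖ = |x| ^ 2 / 2 := by simp
    have a4 : ‖(1:ℂ)‖ = 1 := by simp
    have b1 := norm_add_le (Complex.exp ((x:ℂ) * Complex.I) - 1 - (x:ℂ) * Complex.I) ((x:ℂ) ^ 2 / 2)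
    have b2 := norm_sub_le (Complex.exp ((x:ℂ) * Complex.I) - 1) ((x:ℂ) * Complex.I)
    have b3 := norm_sub_le (Complex.exp ((x:ℂ) * Complex.I)) 1
    have c1 : 1 ≤ |x| ^ 3 := one_le_pow₀ h
    have c2 : |x| ≤ |x| ^ 3 := by simpa using pow_le_pow_right₀ h (show 1 ≤ 3 by norm_num)
    have c3 : |x| ^ 2 ≤ |x| ^ 3 := pow_le_pow_right₀ h (by norm_num)
    linarith

lemma exp_del {δ M : ℝ} (h : |δ| ≤ M) : |(1 - δ) * Real.exp δ - 1| ≤ δ ^ 2 * Real.exp M := by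
  have hM : 0 ≤ M := (abs_nonneg _).trans h
  have h0 : 1 ≤ Real.exp M := Real.one_le_exp hM
  have h1 : Real.exp δ ≤ Real.exp M := Real.exp_le_exp.2 (le_trans (le_abs_self _) h)
  have h2 := Real.add_one_le_exp δ
  have h3 := Real.add_one_le_exp (-δ)
  have h4 : Real.exp (-δ) * Real.exp δ = 1 := by rw [← Real.exp_add]; simp
  have h5 : (1 - δ) * Real.exp δ ≤ 1 := by
    rw [← h4]; exact mul_le_mul_of_nonneg_right (by linarith) (Real.exp_pos _).le
  rw [abs_of_nonpos (by linarith)]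
  rcases le_total δ 1 with hd | hd
  · have : (1 - δ) * (δ + 1) ≤ (1 - δ) * Real.exp δ := mul_le_mul_of_nonneg_left h2 (by linarith)
    have : δ ^ 2 * 1 ≤ δ ^ 2 * Real.exp M := mul_le_mul_of_nonneg_left h0 (sq_nonneg _)
    linarith
  · have i1 : (δ - 1) * Real.exp δ ≤ (δ - 1) * Real.exp M := mul_le_mul_of_nonneg_left h1 (by linarith)
    have i2 : δ * Real.exp M ≤ δ ^ 2 * Real.exp M := mul_le_mul_of_nonneg_right (by nlinarith) (by linarith)
    linarith

lemma av_cmul {n : ℕ} (z : ℂ) (f : Pm n → ℂ) : av (fun σ => z * f σ) = z * av f := by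
  simp only [av, ← Finset.mul_sum, mul_smul_comm]
lemma av_ofReal {n : ℕ} (f : Pm n → ℝ) : av (fun σ => (f σ : ℂ)) = ((av f : ℝ) : ℂ) := by
  simp [av]
lemma Ex_cmul {n : ℕ} (j : ℕ) (z : ℂ) (F : Mat n → ℂ) : Ex j (fun S => z * F S) = z * Ex j F := by
  induction j generalizing F with
  | zero => rfl
  | succ j ih =>
    simp only [Ex_succ, ← ih]; congr 1; funext S; exact av_cmul _ _

lemma av_exp_bound {n : ℕ} (τ : ℝ) (Y : Pm n → ℝ) (D x M : ℝ)
    (h1 : |av Y| ≤ x) (h2 : |av (fun σ => Y σ ^ 2) - D| ≤ x) (h3 : av (fun σ => |Y σ| ^ 3) ≤ x)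
    (hM : |τ ^ 2 / 2 * D| ≤ M) :
    ‖av (fun σ => Complex.exp ((τ * Y σ : ℝ) * Complex.I)) * (Real.exp (τ ^ 2 / 2 * D) : ℝ) - 1‖
      ≤ ((|τ| + τ ^ 2 / 2 + 4 * |τ| ^ 3) * x + (τ ^ 2 / 2 * D) ^ 2) * Real.exp M := by
  set A := av (fun σ => Complex.exp ((τ * Y σ : ℝ) * Complex.I)) with hA
  set δ := τ ^ 2 / 2 * D with hδ
  have e1 : A - 1 - ((τ * av Y : ℝ) : ℂ) * Complex.I + ((τ ^ 2 / 2 * av (fun σ => Y σ ^ 2) : ℝ) : ℂ)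
      = av (fun σ => Complex.exp ((τ * Y σ : ℝ) * Complex.I) - 1 - (τ * Y σ : ℝ) * Complex.I + ((τ * Y σ : ℝ) : ℂ) ^ 2 / 2) := by
    rw [av_add, av_sub, av_sub, av_const, ← av_mul, ← av_mul, ← av_ofReal, ← av_ofReal, mul_comm _ Complex.I, ← av_cmul]
    congr 1
    · congr 1
      congr 1; funext σ; rw [mul_comm]
    · congr 1; funext σ; push_cast; ring
  have b1 : ‖A - 1 - ((τ * av Y : ℝ) : ℂ) * Complex.I + ((τ ^ 2 / 2 * av (fun σ => Y σ ^ 2) : ℝ) : ℂ)‖ ≤ 4 * |τ| ^ 3 * x := by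
    rw [e1]
    refine (norm_av_le _).trans ((av_mono fun σ => cexp3 (τ * Y σ)).trans ?_)
    have : (fun σ => 4 * |τ * Y σ| ^ 3) = fun σ => (4 * |τ| ^ 3) * |Y σ| ^ 3 := by
      funext σ; rw [abs_mul, mul_pow]; ring
    rw [this, av_mul]
    exact mul_le_mul_of_nonneg_left h3 (by positivity)
  have b2 : ‖((τ * av Y : ℝ) : ℂ) * Complex.I‖ ≤ |τ| * x := by
    rw [norm_mul, Complex.norm_I, mul_one, Complex.norm_real, Real.norm_eq_abs, abs_mul]
    exact mul_le_mul_of_nonneg_left h1 (abs_nonneg _)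
  have b3 : ‖((τ ^ 2 / 2 * (av (fun σ => Y σ ^ 2) - D) : ℝ) : ℂ)‖ ≤ τ ^ 2 / 2 * x := by
    rw [Complex.norm_real, Real.norm_eq_abs, abs_mul, abs_of_nonneg (by positivity : 0 ≤ τ ^ 2 / 2)]
    exact mul_le_mul_of_nonneg_left h2 (by positivity)
  have b4 : ‖A - 1 + (δ : ℂ)‖ ≤ (|τ| + τ ^ 2 / 2 + 4 * |τ| ^ 3) * x := by
    have e : A - 1 + (δ : ℂ) = (A - 1 - ((τ * av Y : ℝ) : ℂ) * Complex.I + ((τ ^ 2 / 2 * av (fun σ => Y σ ^ 2) : ℝ) : ℂ))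
        + ((τ * av Y : ℝ) : ℂ) * Complex.I - ((τ ^ 2 / 2 * (av (fun σ => Y σ ^ 2) - D) : ℝ) : ℂ) := by
      rw [hδ]; push_cast; ring
    rw [e]
    refine (norm_sub_le _ _).trans ?_
    have := norm_add_le (A - 1 - ((τ * av Y : ℝ) : ℂ) * Complex.I + ((τ ^ 2 / 2 * av (fun σ => Y σ ^ 2) : ℝ) : ℂ)) (((τ * av Y : ℝ) : ℂ) * Complex.I)
    linarith
  have e2 : A * (Real.exp δ : ℝ) - 1 = (A - 1 + (δ : ℂ)) * (Real.exp δ : ℝ) + (((1 - δ) * Real.exp δ - 1 : ℝ) : ℂ) := by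
    push_cast; ring
  rw [e2]
  refine (norm_add_le _ _).trans ?_
  rw [norm_mul, Complex.norm_real, Complex.norm_real, Real.norm_eq_abs, Real.norm_eq_abs, Real.abs_exp, add_mul]
  refine add_le_add (mul_le_mul b4 (Real.exp_le_exp.2 (le_trans (le_abs_self _) hM)) (Real.exp_pos _).le ((norm_nonneg _).trans b4)) (exp_del hM)

noncomputable def FF (τ : ℝ) (k : ℕ) (c : ℕ → Polynomial ℝ) (n j : ℕ) (S : Mat n) : ℂ :=
  Complex.exp ((τ * Psi k c n j S : ℝ) * Complex.I) * (Real.exp (τ ^ 2 / 2 * (WW k c).eval (tt n j)) : ℝ)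

lemma FF_step (τ : ℝ) (k : ℕ) (c : ℕ → Polynomial ℝ) (n j : ℕ) (S : Mat n) :
    av (fun σ => FF τ k c n (j+1) (upd S σ)) - FF τ k c n j S = FF τ k c n j S *
      (av (fun σ => Complex.exp ((τ * YY k c n j S σ : ℝ) * Complex.I)) *
        (Real.exp (τ ^ 2 / 2 * ((WW k c).eval (tt n (j+1)) - (WW k c).eval (tt n j))) : ℝ) - 1) := by
  have : (fun σ => FF τ k c n (j+1) (upd S σ)) = fun σ => (FF τ k c n j S *
        (Real.exp (τ ^ 2 / 2 * ((WW k c).eval (tt n (j+1)) - (WW k c).eval (tt n j))) : ℝ)) *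
        Complex.exp ((τ * YY k c n j S σ : ℝ) * Complex.I) := by
    funext σ
    simp only [FF, YY, Complex.ofReal_exp, ← Complex.exp_add]
    congr 1
    push_cast; ring
  rw [this, av_cmul]; ring

lemma tele (τ : ℝ) (k : ℕ) (c : ℕ → Polynomial ℝ)
    (hc : ∀ i ≤ k, Polynomial.derivative (c i) = -∑ a ∈ range (k+1), c a * KK a i) (B : ℝ) :
    ∃ C : ℝ, 0 ≤ C ∧ ∀ n : ℕ, 4 ≤ n → ∀ j : ℕ, (j : ℝ) ≤ B * n →
      ‖Ex j (FF τ k c n j) - 1‖ ≤ j * (C * ww n ^ 3) := by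
  obtain ⟨X, ⟨C1, hC1, hX⟩, hst⟩ := step_bounds k c hc B
  obtain ⟨C2, hC2, hT⟩ := poly_taylor0 (WW k c) (2 * |B| + 1) (by positivity)
  obtain ⟨C3, hC3, hW⟩ := poly_bdd (WW k c) (2 * |B|)
  set a := |τ| + τ ^ 2 / 2 + 4 * |τ| ^ 3 with ha
  have ha0 : 0 ≤ a := by positivity
  set M := τ ^ 2 / 2 * C2 with hMd
  have hM0 : 0 ≤ M := by positivity
  set R := Real.exp (τ ^ 2 / 2 * C3) with hR
  refine ⟨R * ((a * C1 + M ^ 2) * Real.exp M), by positivity, fun n hn j => ?_⟩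
  have hN := N_pos hn
  have hw := ww_pos hn
  have hw1 := ww_le_one hn
  induction j with
  | zero =>
    intro _
    have : FF τ k c n 0 0 = 1 := by
      have ht : tt n 0 = 0 := by simp [tt]
      have hz : ∀ a, zz n 0 (0 : Mat n) a = 0 := by
        intro a
        rw [zz, ht]
        rcases Nat.eq_zero_or_pos a with rfl | h
        · rw [ss_zero (by omega), mp_zero]; simp
        · rw [ss_zero_mat h, mp_eval_zero a h]; simp
      have hP : Psi k c n 0 (0 : Mat n) = 0 := by
        rw [Psi]; refine Finset.sum_eq_zero fun a _ => ?_
        rw [uu, hz, ht, ep_eval_zero]; simp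
      rw [FF, hP, ht, WW_eval_zero]; simp
    rw [Ex_zero, this]; simp
  | succ j ih =>
    intro hj
    have hj' : (j : ℝ) ≤ B * n := by push_cast at hj; linarith
    have hX' := hX n hn j hj'
    have htb : tt n j ≤ 2 * |B| := by rw [tt]; exact jw_le hn hj'
    have ht0 : 0 ≤ tt n j := tt_nonneg hn j
    have hstep : ‖Ex (j+1) (FF τ k c n (j+1)) - Ex j (FF τ k c n j)‖ ≤ R * ((a * C1 + M ^ 2) * Real.exp M) * ww n ^ 3 := by
      rw [Ex_succ', ← Ex_sub]
      refine (norm_Ex_le _ _).trans ?_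
      have key : ∀ S : Mat n, Good S → ‖av (fun σ => FF τ k c n (j+1) (upd S σ)) - FF τ k c n j S‖
          ≤ (R * Real.exp M * a) * av (X n j S) + R * Real.exp M * M ^ 2 * ww n ^ 3 := by
        intro S hS
        obtain ⟨s1, s2, s3⟩ := hst n hn j hj' S hS
        rw [FF_step, norm_mul]
        set D := (WW k c).eval (tt n (j+1)) - (WW k c).eval (tt n j) with hD
        have hDb : |D| ≤ C2 * ww n ^ 2 := by
          rw [hD, tt_succ hn]
          exact hT _ _ ht0 (by positivity) (ww_sq_le hn) (by linarith [ww_sq_le hn])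
        have hw2 : ww n ^ 2 ≤ 1 := pow_le_one₀ hw.le hw1
        have hδ : |τ ^ 2 / 2 * D| ≤ M * ww n ^ 2 := by
          rw [abs_mul, abs_of_nonneg (by positivity : 0 ≤ τ ^ 2 / 2), hMd, mul_assoc]
          exact mul_le_mul_of_nonneg_left hDb (by positivity)
        have hδM : |τ ^ 2 / 2 * D| ≤ M := hδ.trans (mul_le_of_le_one_right hM0 hw2)
        have hb := av_exp_bound τ (YY k c n j S) D _ M s1 s2 s3 hδM
        have hδ2 : (τ ^ 2 / 2 * D) ^ 2 ≤ M ^ 2 * ww n ^ 3 := by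
          rw [← sq_abs]
          calc |τ ^ 2 / 2 * D| ^ 2 ≤ (M * ww n ^ 2) ^ 2 := pow_le_pow_left₀ (abs_nonneg _) hδ 2
            _ = M ^ 2 * ww n ^ 4 := by ring
            _ ≤ M ^ 2 * ww n ^ 3 := mul_le_mul_of_nonneg_left (pow_le_pow_of_le_one hw.le hw1 (by norm_num)) (by positivity)
        have hF : ‖FF τ k c n j S‖ ≤ R := by
          rw [FF, norm_mul, Complex.norm_exp_ofReal_mul_I, one_mul, Complex.norm_real, Real.norm_eq_abs, Real.abs_exp]
          exact Real.exp_le_exp.2 (mul_le_mul_of_nonneg_left ((le_abs_self _).trans (hW _ ht0 htb)) (by positivity))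
        calc ‖FF τ k c n j S‖ * _ ≤ R * ((a * av (X n j S) + M ^ 2 * ww n ^ 3) * Real.exp M) := by
              refine mul_le_mul hF (hb.trans ?_) (norm_nonneg _) (Real.exp_pos _).le
              exact mul_le_mul_of_nonneg_right (add_le_add le_rfl hδ2) (Real.exp_pos _).le
          _ = _ := by ring
      refine (Ex_mono j key).trans ?_
      rw [Ex_add, Ex_mul, Ex_const]
      have : (R * Real.exp M * a) * Ex j (fun S => av (X n j S)) ≤ (R * Real.exp M * a) * (C1 * ww n ^ 3) :=
        mul_le_mul_of_nonneg_left hX' (by positivity)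
      refine (add_le_add_left this _).trans (le_of_eq ?_)
      ring
    have e : Ex (j+1) (FF τ k c n (j+1)) - 1 = (Ex (j+1) (FF τ k c n (j+1)) - Ex j (FF τ k c n j)) + (Ex j (FF τ k c n j) - 1) := by ring
    rw [e]
    refine (norm_add_le _ _).trans ((add_le_add hstep (ih hj')).trans (le_of_eq ?_))
    push_cast; ring

/-- Characteristic function of the martingale-type statistic. -/
lemma charfun_Psi (τ : ℝ) (k : ℕ) (c : ℕ → Polynomial ℝ)
    (hc : ∀ i ≤ k, Polynomial.derivative (c i) = -∑ a ∈ range (k+1), c a * KK a i) (B : ℝ) :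
    ∃ C : ℝ, 0 ≤ C ∧ ∀ n : ℕ, 4 ≤ n → ∀ j : ℕ, (j : ℝ) ≤ B * n →
      ‖Ex j (fun S : Mat n => Complex.exp ((τ * Psi k c n j S : ℝ) * Complex.I))
        - (Real.exp (-(τ ^ 2 / 2 * (WW k c).eval (tt n j))) : ℝ)‖ ≤ C * ww n := by
  obtain ⟨C1, hC1, h1⟩ := tele τ k c hc B
  obtain ⟨C3, hC3, hW⟩ := poly_bdd (WW k c) (2 * |B|)
  refine ⟨Real.exp (τ ^ 2 / 2 * C3) * (2 * |B| * C1), by positivity, fun n hn j hj => ?_⟩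
  have hw := ww_pos hn
  have htb : tt n j ≤ 2 * |B| := by rw [tt]; exact jw_le hn hj
  have ht0 : 0 ≤ tt n j := tt_nonneg hn j
  set W := τ ^ 2 / 2 * (WW k c).eval (tt n j) with hWd
  have hWb : -W ≤ τ ^ 2 / 2 * C3 := by
    have := (abs_le.1 (hW _ ht0 htb)).1
    have := mul_le_mul_of_nonneg_left this (by positivity : 0 ≤ τ ^ 2 / 2)
    rw [hWd]; linarith
  have e : Ex j (fun S : Mat n => Complex.exp ((τ * Psi k c n j S : ℝ) * Complex.I)) - (Real.exp (-W) : ℝ)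
      = (Real.exp (-W) : ℝ) * (Ex j (FF τ k c n j) - 1) := by
    have : FF τ k c n j = fun S => ((Real.exp W : ℝ) : ℂ) * Complex.exp ((τ * Psi k c n j S : ℝ) * Complex.I) := by
      funext S; rw [FF, mul_comm]
    rw [this, Ex_cmul, mul_sub, ← mul_assoc, ← Complex.ofReal_mul, ← Real.exp_add]; simp
  rw [e, norm_mul, Complex.norm_real, Real.norm_eq_abs, Real.abs_exp, mul_assoc]
  refine mul_le_mul (Real.exp_le_exp.2 hWb) ((h1 n hn j hj).trans ?_) (norm_nonneg _) (Real.exp_pos _).le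
  have : (j:ℝ) * (C1 * ww n ^ 3) = tt n j * (C1 * ww n) := by
    rw [tt, div_eq_mul_inv, ← ww_sq hn]; ring
  rw [this]
  calc tt n j * (C1 * ww n) ≤ (2 * |B|) * (C1 * ww n) := mul_le_mul_of_nonneg_right htb (by positivity)
    _ = _ := by ring

end Spear

open MeasureTheory Finset
namespace Spear
open Matrix

section link
variable {n : ℕ} {E : Type*} [AddCommGroup E] [Module ℝ E]

lemma link (p : ℕ) (F : Mat n → E) : Ex p F =
    ((Fintype.card (Fin p → Pm n) : ℝ)⁻¹) • ∑ ω : Fin p → Pm n, F (∑ j, vecMulVec (vv n (ω j)) (vv n (ω j))) := by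
  induction p generalizing F with
  | zero => simp [Ex_zero]
  | succ p ih =>
    rw [Ex_succ, ih, ← Equiv.sum_comp (Fin.consEquiv (fun _ : Fin (p+1) => Pm n)), Fintype.sum_prod_type_right]
    have h1 : ∀ ω : Fin p → Pm n, LL F (∑ j, vecMulVec (vv n (ω j)) (vv n (ω j))) =
        ((Fintype.card (Pm n) : ℝ)⁻¹) • ∑ σ : Pm n, F (∑ j, vecMulVec (vv n ((Fin.consEquiv (fun _ : Fin (p+1) => Pm n)) (σ, ω) j))
          (vv n ((Fin.consEquiv (fun _ : Fin (p+1) => Pm n)) (σ, ω) j))) := by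
      intro ω
      rw [LL, av]; congr 1
      refine Finset.sum_congr rfl fun σ _ => ?_
      rw [Fin.sum_univ_succ, upd, add_comm]; rfl
    simp only [h1, ← Finset.smul_sum, smul_smul]
    congr 1
    rw [Fintype.card_fun, Fintype.card_fun, Fintype.card_fin, Fintype.card_fin, pow_succ]; push_cast
    rw [mul_inv]
end link

lemma trace_pow_comm {m n : Type*} [Fintype m] [Fintype n] [DecidableEq m] [DecidableEq n]
    (A : Matrix m n ℝ) (B : Matrix n m ℝ) (k : ℕ) (hk : 1 ≤ k) : ((A * B) ^ k).trace = ((B * A) ^ k).trace := by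
  obtain ⟨k, rfl⟩ : ∃ b, k = b + 1 := ⟨k - 1, by omega⟩
  have h : (A * B) ^ (k+1) = A * ((B * A) ^ k * B) := by
    induction k with
    | zero => simp
    | succ k ih => rw [pow_succ, ih (by omega), pow_succ]; simp only [Matrix.mul_assoc]
  rw [h, Matrix.trace_mul_comm, Matrix.mul_assoc, ← pow_succ]

lemma kap_lim (m : Polynomial ℝ) (y : ℝ) (p : ℕ → ℕ)
    (hpy : Filter.Tendsto (fun n => (p n : ℝ) / (n : ℝ)) Filter.atTop (nhds y)) :
    Filter.Tendsto (fun n : ℕ => ((n:ℝ) - 1) * m.eval (tt n (p n)) - n * m.eval ((p n : ℝ) / n)) Filter.atTop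
      (nhds (y * m.derivative.eval y - m.eval y)) ∧ Filter.Tendsto (fun n : ℕ => tt n (p n)) Filter.atTop (nhds y) := by
  have hN : Filter.Tendsto (fun n : ℕ => (n:ℝ) - 1) Filter.atTop Filter.atTop := by
    simpa [sub_eq_add_neg] using Filter.tendsto_atTop_add_const_right _ (-1:ℝ) tendsto_natCast_atTop_atTop
  have hh : Filter.Tendsto (fun n : ℕ => ((p n : ℝ) / n) / ((n:ℝ) - 1)) Filter.atTop (nhds 0) :=
    hpy.div_atTop hN
  have ht : ∀ᶠ n : ℕ in Filter.atTop, tt n (p n) = (p n : ℝ) / n + ((p n : ℝ) / n) / ((n:ℝ) - 1) := by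
    filter_upwards [Filter.eventually_ge_atTop 4] with n hn
    have := N_pos hn
    have h1 : (n:ℝ) - 1 ≠ 0 := by linarith
    have h2 : (n:ℝ) ≠ 0 := by linarith
    rw [tt]; field_simp; ring
  have htl : Filter.Tendsto (fun n : ℕ => tt n (p n)) Filter.atTop (nhds y) := by
    refine Filter.Tendsto.congr' (Filter.EventuallyEq.symm ht) ?_
    simpa using hpy.add hh
  refine ⟨?_, htl⟩
  have hy : 0 ≤ y := ge_of_tendsto' hpy fun n => by positivity
  obtain ⟨C, hC, hT⟩ := poly_taylor1 m (y + 2) (by linarith)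
  have hmain : Filter.Tendsto (fun n : ℕ => ((p n : ℝ) / n) * m.derivative.eval ((p n : ℝ) / n) - m.eval ((p n : ℝ) / n)) Filter.atTop
      (nhds (y * m.derivative.eval y - m.eval y)) :=
    (hpy.mul ((m.derivative.continuous.tendsto y).comp hpy)).sub ((m.continuous.tendsto y).comp hpy)
  have herr : Filter.Tendsto (fun n : ℕ => (((n:ℝ) - 1) * m.eval (tt n (p n)) - n * m.eval ((p n : ℝ) / n))
      - (((p n : ℝ) / n) * m.derivative.eval ((p n : ℝ) / n) - m.eval ((p n : ℝ) / n))) Filter.atTop (nhds 0) := by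
    have hz : Filter.Tendsto (fun n : ℕ => C * (((p n : ℝ) / n) * (((p n : ℝ) / n) / ((n:ℝ) - 1)))) Filter.atTop (nhds 0) := by
      simpa using (hpy.mul hh).const_mul C
    refine squeeze_zero_norm' ?_ hz
    filter_upwards [ht, Filter.eventually_ge_atTop 4, hh.eventually (ge_mem_nhds (show (0:ℝ) < 1 by norm_num)),
      hpy.eventually (ge_mem_nhds (show y < y + 1 by linarith))] with n e1 hn e2 e3
    have hn' := N_pos hn
    set s := (p n : ℝ) / n with hs
    have hs0 : 0 ≤ s := by positivity
    set N := (n:ℝ) - 1 with hNd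
    have hN0 : 0 < N := by linarith
    have h4 := hT s (s / N) hs0 (by positivity) e2 (by linarith)
    rw [e1, Real.norm_eq_abs]
    have e5 : N * m.eval (s + s / N) - n * m.eval s - (s * m.derivative.eval s - m.eval s)
        = N * (m.eval (s + s / N) - m.eval s - m.derivative.eval s * (s / N)) := by
      have : (n:ℝ) = N + 1 := by rw [hNd]; ring
      rw [this]; field_simp; ring
    rw [e5, abs_mul, abs_of_pos hN0]
    refine (mul_le_mul_of_nonneg_left h4 hN0.le).trans (le_of_eq ?_)
    field_simp
  simpa using herr.add hmain

lemma cexp_lip (a b : ℝ) : ‖Complex.exp ((a:ℂ) * Complex.I) - Complex.exp ((b:ℂ) * Complex.I)‖ ≤ |a - b| := by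
  have e : Complex.exp ((a:ℂ) * Complex.I) - Complex.exp ((b:ℂ) * Complex.I)
      = Complex.exp ((b:ℂ) * Complex.I) * (Complex.exp (Complex.I * ((a - b : ℝ) : ℂ)) - 1) := by
    rw [mul_sub, ← Complex.exp_add, mul_one]; congr 2; push_cast; ring
  rw [e, norm_mul, Complex.norm_exp_ofReal_mul_I, one_mul]
  exact Real.norm_exp_I_mul_ofReal_sub_one_le

lemma Ex_abs_uu (B : ℝ) (a : ℕ) : ∃ C : ℝ, 0 ≤ C ∧ ∀ n : ℕ, 4 ≤ n → ∀ j : ℕ, (j : ℝ) ≤ B * n →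
    Ex j (fun S : Mat n => |uu n j S a|) ≤ C := by
  obtain ⟨C, hC, h⟩ := Rt_abs_of B a (Rt_zz B a)
  obtain ⟨D, hD, h2⟩ := poly_bdd (ep a) (2 * |B|)
  refine ⟨C + D, by positivity, fun n hn j hj => ?_⟩
  have h1 := h n hn j hj
  have hN := N_pos hn
  rw [EE_S, ww_sq hn] at h1
  have htb : tt n j ≤ 2 * |B| := by rw [tt]; exact jw_le hn hj
  have h3 := h2 _ (tt_nonneg hn j) htb
  have : Ex j (fun S : Mat n => |uu n j S a|) ≤ Ex j (fun S : Mat n => ((n:ℝ) - 1) * |zz n j S a| + D) := by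
    refine Ex_mono j fun S _ => ?_
    rw [uu]
    refine (abs_sub _ _).trans ?_
    rw [abs_mul, abs_of_pos (by linarith : 0 < (n:ℝ) - 1)]
    linarith
  refine this.trans ?_
  rw [Ex_add, Ex_mul, Ex_const]
  have h5 := mul_le_mul_of_nonneg_left h1 (by linarith : 0 ≤ (n:ℝ) - 1)
  have h6 : ((n:ℝ) - 1) * (C * ((n:ℝ) - 1)⁻¹) = C := by
    have : (n:ℝ) - 1 ≠ 0 := by linarith
    field_simp
  rw [h6] at h5
  linarith

lemma Ex_lim (k : ℕ) (hk : 2 ≤ k) (y : ℝ) (hy : 0 < y) (p : ℕ → ℕ)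
    (hpy : Filter.Tendsto (fun n => (p n : ℝ) / (n : ℝ)) Filter.atTop (nhds y)) (τ : ℝ) :
    Filter.Tendsto (fun n : ℕ => Ex (p n) (fun S : Mat n =>
        Complex.exp ((τ * ((S ^ k).trace - n * (mp k).eval ((p n : ℝ) / n)) : ℝ) * Complex.I))) Filter.atTop
      (nhds (Complex.exp ((τ * ((ep k).eval y + (y * (mp k).derivative.eval y - (mp k).eval y)) : ℝ) * Complex.I)
        * (Real.exp (-(τ ^ 2 / 2 * (VV k k k).eval y)) : ℝ))) := by
  obtain ⟨c, hc, hcy⟩ := exists_cc k y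
  obtain ⟨hk1, htl⟩ := kap_lim (mp k) y p hpy
  set κ : ℕ → ℝ := fun n => (ep k).eval (tt n (p n)) + (((n:ℝ) - 1) * (mp k).eval (tt n (p n)) - n * (mp k).eval ((p n : ℝ) / n)) with hκ
  have hκl : Filter.Tendsto κ Filter.atTop (nhds ((ep k).eval y + (y * (mp k).derivative.eval y - (mp k).eval y))) :=
    (((ep k).continuous.tendsto y).comp htl).add hk1
  set B := y + 1 with hB
  have hev : ∀ᶠ n : ℕ in Filter.atTop, 4 ≤ n ∧ (p n : ℝ) ≤ B * n := by
    filter_upwards [Filter.eventually_ge_atTop 4, hpy.eventually (ge_mem_nhds (show y < y + 1 by linarith))] with n hn h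
    refine ⟨hn, ?_⟩
    have : (0:ℝ) < n := by have := N_pos hn; linarith
    rwa [div_le_iff₀ this] at h
  have hw0 : Filter.Tendsto ww Filter.atTop (nhds 0) := by
    have hN : Filter.Tendsto (fun n : ℕ => (n:ℝ) - 1) Filter.atTop Filter.atTop := by
      simpa [sub_eq_add_neg] using Filter.tendsto_atTop_add_const_right _ (-1:ℝ) tendsto_natCast_atTop_atTop
    exact tendsto_inv_atTop_zero.comp (Real.tendsto_sqrt_atTop.comp hN)
  -- char. function of Psi
  obtain ⟨C1, hC1, h1⟩ := charfun_Psi τ k c hc B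
  have hPsi : Filter.Tendsto (fun n : ℕ => Ex (p n) (fun S : Mat n => Complex.exp ((τ * Psi k c n (p n) S : ℝ) * Complex.I)))
      Filter.atTop (nhds ((Real.exp (-(τ ^ 2 / 2 * (VV k k k).eval y)) : ℝ) : ℂ)) := by
    have ha : Filter.Tendsto (fun n : ℕ => Ex (p n) (fun S : Mat n => Complex.exp ((τ * Psi k c n (p n) S : ℝ) * Complex.I))
        - (Real.exp (-(τ ^ 2 / 2 * (WW k c).eval (tt n (p n)))) : ℝ)) Filter.atTop (nhds 0) := by
      refine squeeze_zero_norm' (a := fun n => C1 * ww n) ?_ (by simpa using hw0.const_mul C1)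
      filter_upwards [hev] with n hn
      exact h1 n hn.1 _ hn.2
    have hb : Filter.Tendsto (fun n : ℕ => ((Real.exp (-(τ ^ 2 / 2 * (WW k c).eval (tt n (p n)))) : ℝ) : ℂ)) Filter.atTop
        (nhds ((Real.exp (-(τ ^ 2 / 2 * (VV k k k).eval y)) : ℝ) : ℂ)) := by
      rw [← WW_eval_y k y c hcy]
      have hcont : Continuous fun t : ℝ => ((Real.exp (-(τ ^ 2 / 2 * (WW k c).eval t)) : ℝ) : ℂ) := by
        have := (WW k c).continuous
        fun_prop
      exact (hcont.tendsto y).comp htl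
    simpa using ha.add hb
  have hmain : Filter.Tendsto (fun n : ℕ => Complex.exp ((τ * κ n : ℝ) * Complex.I) *
      Ex (p n) (fun S : Mat n => Complex.exp ((τ * Psi k c n (p n) S : ℝ) * Complex.I))) Filter.atTop
      (nhds (Complex.exp ((τ * ((ep k).eval y + (y * (mp k).derivative.eval y - (mp k).eval y)) : ℝ) * Complex.I)
        * (Real.exp (-(τ ^ 2 / 2 * (VV k k k).eval y)) : ℝ))) := by
    refine Filter.Tendsto.mul ?_ hPsi
    have hcont : Continuous fun t : ℝ => Complex.exp ((τ * t : ℝ) * Complex.I) := by fun_prop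
    exact (hcont.tendsto _).comp hκl
  -- error
  choose Cu hCu hu using fun a => Ex_abs_uu B a
  have hd : ∀ a ∈ range (k+1), Filter.Tendsto (fun n => |(if a = k then 1 else 0) - (c a).eval (tt n (p n))| * Cu a) Filter.atTop (nhds 0) := by
    intro a ha
    have h2 : Filter.Tendsto (fun n => (c a).eval (tt n (p n))) Filter.atTop (nhds (if a = k then 1 else 0)) := by
      rw [← hcy a (by rw [Finset.mem_range] at ha; omega)]
      exact ((c a).continuous.tendsto y).comp htl
    have h3 := ((tendsto_const_nhds (x := (if a = k then (1:ℝ) else 0))).sub h2).abs.mul_const (Cu a)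
    simpa using h3
  have hds : Filter.Tendsto (fun n => |τ| * ∑ a ∈ range (k+1), |(if a = k then 1 else 0) - (c a).eval (tt n (p n))| * Cu a) Filter.atTop (nhds 0) := by
    simpa using (tendsto_finsetSum _ hd).const_mul |τ|
  have herr : Filter.Tendsto (fun n : ℕ => Ex (p n) (fun S : Mat n =>
        Complex.exp ((τ * ((S ^ k).trace - n * (mp k).eval ((p n : ℝ) / n)) : ℝ) * Complex.I)) -
        Complex.exp ((τ * κ n : ℝ) * Complex.I) *
      Ex (p n) (fun S : Mat n => Complex.exp ((τ * Psi k c n (p n) S : ℝ) * Complex.I))) Filter.atTop (nhds 0) := by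
    refine squeeze_zero_norm' ?_ hds
    filter_upwards [hev] with n hn
    obtain ⟨hn, hpn⟩ := hn
    have hN := N_pos hn
    rw [← Ex_cmul, ← Ex_sub]
    refine (norm_Ex_le _ _).trans ?_
    have key : ∀ S : Mat n, Good S →
        ‖Complex.exp ((τ * ((S ^ k).trace - n * (mp k).eval ((p n : ℝ) / n)) : ℝ) * Complex.I) -
          Complex.exp ((τ * κ n : ℝ) * Complex.I) * Complex.exp ((τ * Psi k c n (p n) S : ℝ) * Complex.I)‖
        ≤ |τ| * ∑ a ∈ range (k+1), |(if a = k then 1 else 0) - (c a).eval (tt n (p n))| * |uu n (p n) S a| := by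
      intro S hS
      have e1 : Complex.exp ((τ * κ n : ℝ) * Complex.I) * Complex.exp ((τ * Psi k c n (p n) S : ℝ) * Complex.I)
          = Complex.exp ((τ * (κ n + Psi k c n (p n) S) : ℝ) * Complex.I) := by
        rw [← Complex.exp_add]; congr 1; push_cast; ring
      rw [e1]
      refine (cexp_lip _ _).trans ?_
      rw [← mul_sub, abs_mul]
      refine mul_le_mul_of_nonneg_left ?_ (abs_nonneg _)
      have e2 : (S ^ k).trace = ((n:ℝ) - 1) * ss S k := by
        rw [ss_eq (by omega) hS (by omega)]
        have : (n:ℝ) - 1 ≠ 0 := by linarith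
        field_simp
      have e3 : (S ^ k).trace - n * (mp k).eval ((p n : ℝ) / n) - (κ n + Psi k c n (p n) S)
          = ∑ a ∈ range (k+1), ((if a = k then 1 else 0) - (c a).eval (tt n (p n))) * uu n (p n) S a := by
        have e4 : ∑ a ∈ range (k+1), (if a = k then (1:ℝ) else 0) * uu n (p n) S a = uu n (p n) S k := by
          rw [Finset.sum_eq_single k]
          · simp
          · intro b _ hb; simp [hb]
          · intro h; simp at h
        simp only [sub_mul, Finset.sum_sub_distrib]
        rw [e4, e2, hκ, Psi, uu, zz]
        ring
      rw [e3]
      refine (Finset.abs_sum_le_sum_abs _ _).trans (le_of_eq ?_)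
      exact Finset.sum_congr rfl fun a _ => abs_mul _ _
    refine (Ex_mono _ key).trans ?_
    rw [Ex_mul, Ex_sum]
    refine mul_le_mul_of_nonneg_left (Finset.sum_le_sum fun a _ => ?_) (abs_nonneg _)
    rw [Ex_mul]
    exact mul_le_mul_of_nonneg_left (hu a n hn _ hpn) (abs_nonneg _)
  simpa using herr.add hmain

end Spear

namespace Spear
open Matrix

lemma VV_nonneg (k : ℕ) (y : ℝ) (hy : 0 < y) : 0 ≤ (VV k k k).eval y := by
  rw [VV, Polynomial.eval_finset_sum]
  refine Finset.sum_nonneg fun r _ => ?_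
  have h : (2 * ((r + 2 : ℕ) : Polynomial ℝ) * Polynomial.X ^ (r + 2) * (bb k (r + 2) * bb k (r + 2))).eval y
      = 2 * ((r + 2 : ℕ) : ℝ) * y ^ (r + 2) * ((bb k (r + 2)).eval y * (bb k (r + 2)).eval y) := by
    simp [Polynomial.eval_mul, Polynomial.eval_pow]
  rw [h]
  have := mul_self_nonneg ((bb k (r + 2)).eval y)
  positivity

lemma spearman_trace (n p : ℕ) (hn : 2 ≤ n) (k : ℕ) (hk : 1 ≤ k) (ω : Fin p → Equiv.Perm (Fin n)) :
    ((spearmanRho n p ω) ^ k).trace = ((∑ j, vecMulVec (vv n (ω j)) (vv n (ω j))) ^ k).trace := by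
  set V : Matrix (Fin n) (Fin p) ℝ := Matrix.of fun a j => vv n (ω j) a with hV
  have h1 : spearmanRho n p ω = Vᵀ * V := by
    ext i j
    simp only [spearmanRho, Matrix.smul_apply, Matrix.sum_apply, vecMulVec_apply, Matrix.mul_apply, transpose_apply, hV,
      Matrix.of_apply, vv, smul_eq_mul, Finset.mul_sum]
    refine Finset.sum_congr rfl fun a _ => ?_
    have := Real.mul_self_sqrt (cst_nonneg hn)
    calc _ = (Real.sqrt (12 / ((n : ℝ) * ((n : ℝ) ^ 2 - 1))) * Real.sqrt (12 / ((n : ℝ) * ((n : ℝ) ^ 2 - 1)))) *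
          ((((ω i a : ℕ) : ℝ) + 1 - ((n : ℝ) + 1) / 2) * (((ω j a : ℕ) : ℝ) + 1 - ((n : ℝ) + 1) / 2)) := by rw [this]
      _ = _ := by ring
  have h2 : ∑ j, vecMulVec (vv n (ω j)) (vv n (ω j)) = V * Vᵀ := by
    ext a b
    simp only [Matrix.sum_apply, vecMulVec_apply, Matrix.mul_apply, transpose_apply, hV, Matrix.of_apply]
  rw [h1, h2, trace_pow_comm _ _ k hk]

instance permVec_discrete (n p : ℕ) : DiscreteMeasurableSpace (Fin p → Equiv.Perm (Fin n)) := ⟨fun _ => trivial⟩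

instance permVec_prob (n p : ℕ) : IsProbabilityMeasure (permVecUniform n p) := by
  unfold permVecUniform; infer_instance

lemma integral_perm (n p : ℕ) (f : (Fin p → Equiv.Perm (Fin n)) → ℂ) :
    ∫ ω, f ω ∂(permVecUniform n p) = ((Fintype.card (Fin p → Pm n) : ℝ)⁻¹) • ∑ ω, f ω := by
  rw [permVecUniform, PMF.integral_eq_sum, Finset.smul_sum]
  refine Finset.sum_congr rfl fun ω _ => ?_
  rw [PMF.uniformOfFintype_apply, ENNReal.toReal_inv, ENNReal.toReal_natCast]

lemma centering (n p k : ℕ) (hn : 1 ≤ n) (hk : 1 ≤ k) :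
    ∑ j ∈ Finset.range k, (p : ℝ) * ((p : ℝ) / (n : ℝ)) ^ j / ((j : ℝ) + 1)
                  * (Nat.choose k j : ℝ) * (Nat.choose (k - 1) j : ℝ) = n * (mp k).eval ((p:ℝ) / n) := by
  rw [eval_mp k hk, Finset.mul_sum]
  refine Finset.sum_congr rfl fun j _ => ?_
  have h : (n:ℝ) * ((p:ℝ) / n) = p := by
    have : (n:ℝ) ≠ 0 := by positivity
    field_simp
  calc _ = ((n:ℝ) * ((p:ℝ) / n)) * ((p : ℝ) / (n : ℝ)) ^ j / ((j : ℝ) + 1)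
                  * (Nat.choose k j : ℝ) * (Nat.choose (k - 1) j : ℝ) := by rw [h]
    _ = _ := by rw [pow_succ]; ring

end Spear

/-- (CLT for `tr(ρₙᵏ)`, `k ≥ 2`.)  If `p(n)/n → y ∈ (0,∞)`, then
`tr(ρₙᵏ) − Σ_{j=0}^{k−1} (p·(p/n)ʲ/(j+1))·C(k,j)·C(k−1,j)` converges in distribution to
`N(μ_{xᵏ}, σ_{xᵏ}²)` with the explicit mean and variance below; convergence in
distribution is expressed by testing against all bounded continuous functions. -/
theorem spearman_trace_power_clt (k : ℕ) (hk : 2 ≤ k) (y : ℝ) (hy0 : 0 < y)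
    (p : ℕ → ℕ) (hp : ∀ n, 1 ≤ p n)
    (hpy : Filter.Tendsto (fun n => (p n : ℝ) / (n : ℝ)) Filter.atTop (nhds y)) :
    ∀ g : BoundedContinuousFunction ℝ ℝ,
      Filter.Tendsto
        (fun n => ∫ x, g x ∂(Measure.map
          (fun ω => ((spearmanRho n (p n) ω) ^ k).trace
            - ∑ j ∈ Finset.range k,
                (p n : ℝ) * ((p n : ℝ) / (n : ℝ)) ^ j / ((j : ℝ) + 1)
                  * (Nat.choose k j : ℝ) * (Nat.choose (k - 1) j : ℝ))
          (permVecUniform n (p n))))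
        Filter.atTop
        (nhds (∫ x, g x ∂(ProbabilityTheory.gaussianReal
          ((1 / 4) * ((1 - Real.sqrt y) ^ (2 * k) + (1 + Real.sqrt y) ^ (2 * k))
            - (1 / 2) * ∑ j ∈ Finset.range (k + 1),
                (Nat.choose k j : ℝ) ^ 2 * y ^ (k - j)
            - (2 / y) * ∑ j ∈ Finset.range (k + 1),
                (Nat.choose k j : ℝ) * (y - 1) ^ j * (Nat.choose (2 * k - j) (k - 2) : ℝ)
            + ∑ j ∈ Finset.range (k + 1),
                (Nat.choose k j : ℝ) * (y - 1) ^ j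
                  * (Nat.choose (2 * k - j - 1) (k - 2) : ℝ))
          (Real.toNNReal
            (2 * ∑ j1 ∈ Finset.range k, ∑ j2 ∈ Finset.range (k + 1),
                (Nat.choose k j1 : ℝ) * (Nat.choose k j2 : ℝ) * (y - 1) ^ (j1 + j2)
                  * ∑ l ∈ Finset.Icc 1 (k - j1),
                      (l : ℝ) * (Nat.choose (2 * k - 1 - (j1 + l)) (k - 1) : ℝ)
                        * (Nat.choose (2 * k - 1 - j2 + l) (k - 1) : ℝ)
              - (2 / y) * ∑ j1 ∈ Finset.range (k + 1), ∑ j2 ∈ Finset.range (k + 1),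
                  (Nat.choose k j1 : ℝ) * (Nat.choose k j2 : ℝ) * (y - 1) ^ (j1 + j2)
                    * (Nat.choose (2 * k - j1) (k - 1) : ℝ)
                    * (Nat.choose (2 * k - j2) (k - 1) : ℝ)))))) := by
  intro g
  rw [Spear.mean_formula k hk y hy0, Spear.var_formula k hk y hy0]
  set m := (Spear.ep k).eval y + (y * (Polynomial.derivative (Spear.mp k)).eval y - (Spear.mp k).eval y) with hm
  set v := Real.toNNReal ((Spear.VV k k k).eval y) with hv
  set T : ∀ n : ℕ, (Fin (p n) → Equiv.Perm (Fin n)) → ℝ := fun n ω =>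
    ((spearmanRho n (p n) ω) ^ k).trace
            - ∑ j ∈ Finset.range k,
                (p n : ℝ) * ((p n : ℝ) / (n : ℝ)) ^ j / ((j : ℝ) + 1)
                  * (Nat.choose k j : ℝ) * (Nat.choose (k - 1) j : ℝ) with hT
  have hTm : ∀ n, Measurable (T n) := fun n => Measurable.of_discrete
  let μ : ℕ → ProbabilityMeasure ℝ := fun n =>
    ⟨Measure.map (T n) (permVecUniform n (p n)), Measure.isProbabilityMeasure_map (hTm n).aemeasurable⟩
  let μ₀ : ProbabilityMeasure ℝ := ⟨ProbabilityTheory.gaussianReal m v, inferInstance⟩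
  have hlim : Filter.Tendsto μ Filter.atTop (nhds μ₀) := by
    refine ProbabilityMeasure.tendsto_of_tendsto_charFun fun τ => ?_
    have hE := Spear.Ex_lim k hk y hy0 p hpy τ
    have e0 : charFun (μ₀ : Measure ℝ) τ = Complex.exp ((τ * m : ℝ) * Complex.I)
        * (Real.exp (-(τ ^ 2 / 2 * (Spear.VV k k k).eval y)) : ℝ) := by
      show charFun (ProbabilityTheory.gaussianReal m v) τ = _
      rw [ProbabilityTheory.charFun_gaussianReal, Complex.ofReal_exp, ← Complex.exp_add]
      congr 1
      have : ((v : NNReal) : ℝ) = (Spear.VV k k k).eval y := Real.coe_toNNReal _ (Spear.VV_nonneg k y hy0)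
      rw [← this]
      push_cast; ring
    rw [e0]
    refine Filter.Tendsto.congr' ?_ hE
    filter_upwards [Filter.eventually_ge_atTop 2] with n hn
    show _ = charFun (Measure.map (T n) (permVecUniform n (p n))) τ
    rw [charFun_apply_real, integral_map (hTm n).aemeasurable (by fun_prop), Spear.integral_perm, Spear.link]
    congr 1
    refine Finset.sum_congr rfl fun ω _ => ?_
    rw [hT]
    beta_reduce
    rw [Spear.centering n (p n) k (by omega) (by omega), Spear.spearman_trace n (p n) hn k (by omega)]
    congr 1
    push_cast; ring
  exact (ProbabilityMeasure.tendsto_iff_forall_integral_tendsto.1 hlim) g
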